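/- Let 1 < p < ∞, m ∈ ℝ and α < 2. Let A = [[Q, qᵗ],[q, γ]] be a real symmetric positive definite (N+1)×(N+1) matrix (Q ∈ ℝ^{N×N}, q ∈ ℝ^N, γ > 0), and let v = (d,c) ∈ ℝ^{N+1} with c ≠ 0. Assume max(−α,0) < (m+1)/p < c/γ + 1 − α. Then there exists a constant C > 0 such that for every u ∈ C_c^∞((0,∞) × ℝ^N × [0,∞)) satisfying d·∇_x u(t,x,y) + c ∂_y u(t,x,y) = 0 whenever y ≤ δ, for some δ > 0, one has ‖∂_t u‖ + ‖ℒu‖ ≤ C ‖∂_t u − ℒu‖, where ℒu(t,·) := y^{α} Tr(A D²_{(x,y)}u(t,·)) + y^{α−1} v·∇_{(x,y)}u(t,·) acts in the space variables for each fixed t, and all norms are taken in L^p of (0,∞) × ℝ^{N+1}_+ with respect to the measure y^m dt dx dy. -/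

import Mathlib

open MeasureTheory Real

noncomputable section

/-- Points of `ℝ^{N+1} = ℝ^N × ℝ`. -/
abbrev Pt (N : ℕ) := (Fin N → ℝ) × ℝ

/-- Space-time points `(t, x, y)`. -/
abbrev PtT (N : ℕ) := ℝ × Pt N

/-- Directional (partial) derivative of `u` at `w` in the direction `v`. -/
def pdT {N : ℕ} (v : PtT N) (u : PtT N → ℝ) (w : PtT N) : ℝ := fderiv ℝ u w v

/-- The time direction. -/
def et (N : ℕ) : PtT N := (1, 0)

/-- The unit vector in the `i`-th `x`-direction. -/
def exT {N : ℕ} (i : Fin N) : PtT N := (0, (Pi.single i 1, 0))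

/-- The unit vector in the `y`-direction. -/
def eyT (N : ℕ) : PtT N := (0, (0, 1))

/-- The `i`-th spatial coordinate direction among `(x_1, …, x_N, y)`. -/
def bvecT {N : ℕ} (i : Fin (N + 1)) : PtT N :=
  if h : (i : ℕ) < N then exT ⟨i, h⟩ else eyT N

/-- The block matrix `[[Q, qᵗ], [q, γ]]`. -/
def blockA {N : ℕ} (Q : Matrix (Fin N) (Fin N) ℝ) (q : Fin N → ℝ) (γ : ℝ) :
    Matrix (Fin (N + 1)) (Fin (N + 1)) ℝ := Matrix.of fun i j =>
  if hi : (i : ℕ) < N then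
    if hj : (j : ℕ) < N then Q ⟨i, hi⟩ ⟨j, hj⟩ else q ⟨i, hi⟩
  else if hj : (j : ℕ) < N then q ⟨j, hj⟩ else γ

/-- `Tr (A D²_{(x,y)} u)` at the space-time point `w` (spatial Hessian only). -/
def trHessT {N : ℕ} (A : Matrix (Fin (N + 1)) (Fin (N + 1)) ℝ) (u : PtT N → ℝ) (w : PtT N) : ℝ :=
  ∑ i, ∑ j, A i j * pdT (bvecT i) (pdT (bvecT j) u) w

/-- The norm of `L^p((0,∞) × ℝ^{N+1}_+ ; y^m dt dx dy)`. -/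
def LpmNormT (N : ℕ) (p m : ℝ) (f : PtT N → ℝ) : ℝ :=
  (∫ w in {w : PtT N | 0 < w.1 ∧ 0 < w.2.2}, |f w| ^ p * w.2.2 ^ m) ^ (1 / p)


open scoped Topology
/-- causal convolution -/
def cvl (a f : ℕ → ℂ) (n : ℕ) : ℂ := ∑ j ∈ Finset.range (n + 1), a (n - j) * f j

lemma cvl_add (a f g : ℕ → ℂ) (n : ℕ) :
    cvl a (fun j => f j + g j) n = cvl a f n + cvl a g n := by
  simp [cvl, mul_add, Finset.sum_add_distrib]

lemma cvl_congr (a f g : ℕ → ℂ) (n : ℕ) (h : ∀ j ≤ n, f j = g j) : cvl a f n = cvl a g n := by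
  apply Finset.sum_congr rfl
  intro j hj
  rw [h j (by simpa [Nat.lt_succ_iff] using hj)]

/-- Calderon-Zygmund decomposition on an interval -/
def CZd (a f : ℕ → ℂ) (lam : ℝ) (s l : ℕ) : Prop :=
  ∃ (b : ℕ → ℂ) (E : Finset ℕ),
    (∀ n, n ∉ Finset.Ico s (s + l) → b n = 0) ∧
    (∀ n ∈ Finset.Ico s (s + l), ‖f n - b n‖ ≤ 2 * lam) ∧
    (∑ n ∈ Finset.Ico s (s + l), ‖f n - b n‖ ≤ ∑ n ∈ Finset.Ico s (s + l), ‖f n‖) ∧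
    (lam * (E.card : ℝ) ≤ 2 * ∑ n ∈ Finset.Ico s (s + l), ‖f n‖) ∧
    (∀ L : ℕ, ∑ n ∈ (Finset.range L).filter (fun n => n ∉ E), ‖cvl a b n‖
      ≤ 2 * ∑ n ∈ Finset.Ico s (s + l), ‖f n‖)

lemma CZd_small (a f : ℕ → ℂ) (lam : ℝ) (hl : 0 < lam) (s : ℕ) (h : ‖f s‖ ≤ lam) :
    CZd a f lam s 1 := by
  refine ⟨0, ∅, ?_, ?_, ?_, ?_, ?_⟩
  · simp
  · intro n hn
    have : n = s := by simp at hn; omega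
    subst this
    simp; linarith
  · simp
  · simp
  · intro L
    simp [cvl]

lemma CZd_merge (a f : ℕ → ℂ) (lam : ℝ) (hlam : 0 < lam) (s l l' : ℕ) (h1 : CZd a f lam s l)
    (h2 : CZd a f lam (s + l) l') : CZd a f lam s (l + l') := by
  obtain ⟨b, E, hb, hg, hgs, hE, hc⟩ := h1
  obtain ⟨b', E', hb', hg', hgs', hE', hc'⟩ := h2
  have hsplit : ∀ F : ℕ → ℝ, ∑ n ∈ Finset.Ico s (s + (l + l')), F n =
      ∑ n ∈ Finset.Ico s (s + l), F n + ∑ n ∈ Finset.Ico (s + l) (s + l + l'), F n := by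
    intro F
    rw [Finset.sum_Ico_consecutive F (by omega) (by omega)]
    congr 2; omega
  have e1 : ∀ n ∈ Finset.Ico s (s + l), f n - (b n + b' n) = f n - b n := by
    intro n hn
    rw [hb' n (by simp at hn ⊢; omega), add_zero]
  have e2 : ∀ n ∈ Finset.Ico (s + l) (s + l + l'), f n - (b n + b' n) = f n - b' n := by
    intro n hn
    rw [hb n (by simp at hn ⊢; omega), zero_add]
  refine ⟨fun n => b n + b' n, E ∪ E', ?_, ?_, ?_, ?_, ?_⟩
  · intro n hn
    simp only [Finset.mem_Ico] at hn hb hb'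
    show b n + b' n = 0
    rw [hb n (by omega), hb' n (by omega), add_zero]
  · intro n hn
    by_cases h : n < s + l
    · have : n ∈ Finset.Ico s (s + l) := by simp at hn ⊢; omega
      simp only [e1 n this]; exact hg n this
    · have : n ∈ Finset.Ico (s + l) (s + l + l') := by simp at hn ⊢; omega
      simp only [e2 n this]; exact hg' n this
  · rw [hsplit, hsplit]
    rw [Finset.sum_congr rfl fun n hn => by rw [e1 n hn], 
      Finset.sum_congr (s₁ := Finset.Ico (s + l) (s + l + l')) rfl fun n hn => by rw [e2 n hn]]
    exact add_le_add hgs hgs'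
  · rw [hsplit]
    have : ((E ∪ E').card : ℝ) ≤ E.card + E'.card := by exact_mod_cast Finset.card_union_le _ _
    nlinarith
  · intro L
    rw [hsplit, mul_add]
    refine le_trans ?_ (add_le_add (hc L) (hc' L))
    calc _ ≤ ∑ n ∈ (Finset.range L).filter (fun n => n ∉ E ∪ E'), (‖cvl a b n‖ + ‖cvl a b' n‖) := by
          apply Finset.sum_le_sum
          intro n _
          rw [cvl_add]; exact norm_add_le _ _
      _ ≤ _ := by
          rw [Finset.sum_add_distrib]
          apply add_le_add
          · apply Finset.sum_le_sum_of_subset_of_nonneg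
            · intro n; simp; tauto
            · intros; positivity
          · apply Finset.sum_le_sum_of_subset_of_nonneg
            · intro n; simp; tauto
            · intros; positivity

/-- smoothness of the kernel, normalised -/
def KSm (a : ℕ → ℂ) : Prop := ∀ k : ℕ, 1 ≤ k → ‖a (k + 1) - a k‖ ≤ 1 / ((k : ℝ) * (k + 1))

lemma tele_sum (k0 L : ℕ) (hk : 1 ≤ k0) : 
    ∑ k ∈ Finset.Ico k0 L, 1 / ((k : ℝ) * (k + 1)) ≤ 1 / (k0 : ℝ) := by
  rcases le_or_gt L k0 with h | h
  · rw [Finset.Ico_eq_empty (by omega)]; simp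
  have : ∑ k ∈ Finset.Ico k0 L, 1 / ((k : ℝ) * (k + 1)) = 1 / (k0 : ℝ) - 1 / (L : ℝ) := by
    induction L, h using Nat.le_induction with
    | base => 
      have : (0:ℝ) < k0 := by exact_mod_cast hk
      simp; field_simp; ring
    | succ n hn ih =>
      have h0 : (0:ℝ) < n := by exact_mod_cast (by omega : 0 < n)
      rw [Finset.sum_Ico_succ_top (by omega), ih]
      push_cast
      field_simp; ring
  rw [this]
  have : 0 ≤ 1 / (L : ℝ) := by positivity
  linarith

lemma horm (a : ℕ → ℂ) (ha : KSm a) (s l : ℕ) (i : ℕ) (hi : i ∈ Finset.Ico s (s + l)) (L : ℕ) :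
    ∑ n ∈ Finset.Ico (s + 2 * l) L, ‖a (n - i) - a (n - s)‖ ≤ 1 := by
  simp only [Finset.mem_Ico] at hi
  have key : ∀ n ∈ Finset.Ico (s + 2 * l) L, ‖a (n - i) - a (n - s)‖ ≤
      ∑ j ∈ Finset.Ico s i, 1 / (((n - j - 1 : ℕ) : ℝ) * ((n - j - 1 : ℕ) + 1)) := by
    intro n hn
    simp only [Finset.mem_Ico] at hn
    have : a (n - i) - a (n - s) = ∑ j ∈ Finset.Ico s i, (a (n - (j + 1)) - a (n - j)) := by
      rw [Finset.sum_Ico_sub (fun j => a (n - j)) hi.1]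
    rw [this]
    refine (norm_sum_le _ _).trans (Finset.sum_le_sum ?_)
    intro j hj
    simp only [Finset.mem_Ico] at hj
    have := ha (n - j - 1) (by omega)
    rw [show n - j - 1 + 1 = n - j by omega, norm_sub_rev] at this
    exact this
  refine (Finset.sum_le_sum key).trans ?_
  rw [Finset.sum_comm]
  have key2 : ∀ j ∈ Finset.Ico s i, ∑ n ∈ Finset.Ico (s + 2 * l) L, 
      1 / (((n - j - 1 : ℕ) : ℝ) * ((n - j - 1 : ℕ) + 1)) ≤ 1 / (l : ℝ) := by
    intro j hj
    simp only [Finset.mem_Ico] at hj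
    have : ∑ n ∈ Finset.Ico (s + 2 * l) L, 
      1 / (((n - j - 1 : ℕ) : ℝ) * ((n - j - 1 : ℕ) + 1)) = 
      ∑ k ∈ Finset.Ico (s + 2 * l - (j + 1)) (L - (j + 1)), 1 / ((k : ℝ) * (k + 1)) := by
      refine Finset.sum_bij (fun n _ => n - j - 1) ?_ ?_ ?_ ?_
      · intro n hn; simp only [Finset.mem_Ico] at hn ⊢; omega
      · intro n hn n' hn'; simp only [Finset.mem_Ico] at hn hn'; omega
      · intro n hn; simp only [Finset.mem_Ico] at hn; exact ⟨n + j + 1, by simp; omega, by omega⟩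
      · intro n hn; rfl
    rw [this]
    refine (tele_sum _ _ (by omega)).trans ?_
    have : (0:ℝ) < l := by exact_mod_cast (by omega : 0 < l)
    apply one_div_le_one_div_of_le this
    exact_mod_cast (by omega)
  refine (Finset.sum_le_sum key2).trans ?_
  simp only [Finset.sum_const, Nat.card_Ico, nsmul_eq_mul]
  have : (0:ℝ) < l := by exact_mod_cast (by omega : 0 < l)
  rw [mul_one_div, div_le_one this]
  exact_mod_cast (by omega)

lemma CZd_leaf (a f : ℕ → ℂ) (ha : KSm a) (lam : ℝ) (hlam : 0 < lam) (s l : ℕ) (hl : 1 ≤ l)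
    (h1 : lam * l < ∑ n ∈ Finset.Ico s (s + l), ‖f n‖) 
    (h2 : ∑ n ∈ Finset.Ico s (s + l), ‖f n‖ ≤ 2 * lam * l) : CZd a f lam s l := by
  have hl0 : (0:ℝ) < l := by exact_mod_cast hl
  set av : ℂ := (∑ n ∈ Finset.Ico s (s + l), f n) / l with hav
  set S := ∑ n ∈ Finset.Ico s (s + l), ‖f n‖ with hS
  have havS : ‖av‖ * l ≤ S := by
    rw [hav, norm_div, Complex.norm_natCast, div_mul_cancel₀ _ hl0.ne']
    exact norm_sum_le _ _
  have hav2 : ‖av‖ ≤ 2 * lam := by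
    have := havS.trans h2
    exact le_of_mul_le_mul_right this hl0
  set b : ℕ → ℂ := fun n => if n ∈ Finset.Ico s (s + l) then f n - av else 0 with hb
  have hbI : ∀ n ∈ Finset.Ico s (s + l), b n = f n - av := fun n hn => by simp only [hb, if_pos hn]
  have hb0 : ∀ n, n ∉ Finset.Ico s (s + l) → b n = 0 := fun n hn => by simp only [hb, if_neg hn]
  have hg : ∀ n ∈ Finset.Ico s (s + l), f n - b n = av := by
    intro n hn; rw [hbI n hn]; ring
  have hbsum : ∑ n ∈ Finset.Ico s (s + l), b n = 0 := by
    rw [Finset.sum_congr rfl hbI, Finset.sum_sub_distrib]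
    simp only [Finset.sum_const, Nat.card_Ico, nsmul_eq_mul, hav]
    rw [show s + l - s = l by omega, mul_div_cancel₀]
    · simp
    · exact_mod_cast hl0.ne'
  have hbnorm : ∑ n ∈ Finset.Ico s (s + l), ‖b n‖ ≤ 2 * S := by
    calc _ ≤ ∑ n ∈ Finset.Ico s (s + l), (‖f n‖ + ‖av‖) := by
          apply Finset.sum_le_sum; intro n hn; rw [hbI n hn]; exact norm_sub_le _ _
      _ = S + l * ‖av‖ := by
          rw [Finset.sum_add_distrib]; simp [hS]
      _ ≤ _ := by linarith
  refine ⟨b, Finset.Ico s (s + 2 * l), hb0, ?_, ?_, ?_, ?_⟩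
  · intro n hn; rw [hg n hn]; exact hav2
  · rw [Finset.sum_congr rfl fun n hn => by rw [hg n hn]]
    simp only [Finset.sum_const, Nat.card_Ico, nsmul_eq_mul]
    rw [show s + l - s = l by omega]; linarith
  · simp only [Nat.card_Ico]
    rw [show s + 2 * l - s = 2 * l by omega]; push_cast; linarith
  · intro L
    -- zero before s
    have hz : ∀ n < s, cvl a b n = 0 := by
      intro n hn
      apply Finset.sum_eq_zero
      intro j hj
      simp only [Finset.mem_range] at hj
      rw [hb0 j (by simp; omega), mul_zero]
    have hrep : ∀ n, s + 2 * l ≤ n → cvl a b n = ∑ i ∈ Finset.Ico s (s + l), (a (n - i) - a (n - s)) * b i := by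
      intro n hn
      simp only [sub_mul, Finset.sum_sub_distrib]
      rw [← Finset.mul_sum, hbsum, mul_zero, sub_zero, cvl]
      symm
      apply Finset.sum_subset
      · intro i hi; simp only [Finset.mem_Ico, Finset.mem_range] at hi ⊢; omega
      · intro i _ hi; rw [hb0 i hi, mul_zero]
    calc ∑ n ∈ (Finset.range L).filter (fun n => n ∉ Finset.Ico s (s + 2 * l)), ‖cvl a b n‖
        ≤ ∑ n ∈ Finset.range s ∪ Finset.Ico (s + 2 * l) L, ‖cvl a b n‖ := by
          apply Finset.sum_le_sum_of_subset_of_nonneg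
          · intro n; simp; omega
          · intros; positivity
      _ ≤ ∑ n ∈ Finset.range s, ‖cvl a b n‖ + ∑ n ∈ Finset.Ico (s + 2 * l) L, ‖cvl a b n‖ := by
          rw [← Finset.sum_union_inter]
          simp only [le_add_iff_nonneg_right]
          positivity
      _ = ∑ n ∈ Finset.Ico (s + 2 * l) L, ‖cvl a b n‖ := by
          rw [Finset.sum_eq_zero, zero_add]
          intro n hn; rw [hz n (by simpa using hn), norm_zero]
      _ ≤ ∑ n ∈ Finset.Ico (s + 2 * l) L, ∑ i ∈ Finset.Ico s (s + l), ‖a (n - i) - a (n - s)‖ * ‖b i‖ := by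
          apply Finset.sum_le_sum
          intro n hn
          rw [hrep n (by simp at hn; omega)]
          refine (norm_sum_le _ _).trans (le_of_eq ?_)
          simp only [norm_mul]
      _ = ∑ i ∈ Finset.Ico s (s + l), (∑ n ∈ Finset.Ico (s + 2 * l) L, ‖a (n - i) - a (n - s)‖) * ‖b i‖ := by
          rw [Finset.sum_comm]; simp only [Finset.sum_mul]
      _ ≤ ∑ i ∈ Finset.Ico s (s + l), 1 * ‖b i‖ := by
          apply Finset.sum_le_sum
          intro i hi
          exact mul_le_mul_of_nonneg_right (horm a ha s l i hi L) (norm_nonneg _)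
      _ ≤ _ := by simpa using hbnorm

lemma CZd_all (a f : ℕ → ℂ) (ha : KSm a) (lam : ℝ) (hlam : 0 < lam) (J : ℕ) : ∀ s : ℕ,
    (∑ n ∈ Finset.Ico s (s + 2 ^ J), ‖f n‖ ≤ lam * (2 : ℝ) ^ J) → CZd a f lam s (2 ^ J) := by
  induction J with
  | zero => 
    intro s h
    simp at h
    exact CZd_small a f lam hlam s h
  | succ J ih =>
    intro s h
    rw [pow_succ, mul_two]
    have hsp : ∑ n ∈ Finset.Ico s (s + 2 ^ (J + 1)), ‖f n‖ =
        ∑ n ∈ Finset.Ico s (s + 2 ^ J), ‖f n‖ + ∑ n ∈ Finset.Ico (s + 2 ^ J) (s + 2 ^ J + 2 ^ J), ‖f n‖ := by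
      rw [Finset.sum_Ico_consecutive _ (Nat.le_add_right _ _) (Nat.le_add_right _ _)]
      congr 2; ring
    rw [hsp, pow_succ] at h
    have n1 : 0 ≤ ∑ n ∈ Finset.Ico s (s + 2 ^ J), ‖f n‖ := by positivity
    have n2 : 0 ≤ ∑ n ∈ Finset.Ico (s + 2 ^ J) (s + 2 ^ J + 2 ^ J), ‖f n‖ := by positivity
    apply CZd_merge a f lam hlam
    · by_cases hc : ∑ n ∈ Finset.Ico s (s + 2 ^ J), ‖f n‖ ≤ lam * (2 : ℝ) ^ J
      · exact ih s hc
      · apply CZd_leaf a f ha lam hlam _ _ Nat.one_le_two_pow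
        · push_cast; linarith
        · push_cast; linarith
    · by_cases hc : ∑ n ∈ Finset.Ico (s + 2 ^ J) (s + 2 ^ J + 2 ^ J), ‖f n‖ ≤ lam * (2 : ℝ) ^ J
      · exact ih _ hc
      · apply CZd_leaf a f ha lam hlam _ _ Nat.one_le_two_pow
        · push_cast; linarith
        · push_cast; linarith

/-- normalised l2 bound -/
def KL2 (a : ℕ → ℂ) : Prop := ∀ (L : ℕ) (f : ℕ → ℂ), 
  ∑ n ∈ Finset.range L, ‖cvl a f n‖ ^ 2 ≤ ∑ n ∈ Finset.range L, ‖f n‖ ^ 2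

lemma cheb_card (s : Finset ℕ) (F : ℕ → ℝ) (lam : ℝ) (hF : ∀ n ∈ s, 0 ≤ F n) :
    lam * ((s.filter (fun n => lam < F n)).card : ℝ) ≤ ∑ n ∈ s, F n := by
  calc lam * ((s.filter (fun n => lam < F n)).card : ℝ) 
      = ∑ n ∈ s.filter (fun n => lam < F n), lam := by simp; ring
    _ ≤ ∑ n ∈ s.filter (fun n => lam < F n), F n := by
        apply Finset.sum_le_sum; intro n hn; simp at hn; exact hn.2.le
    _ ≤ _ := by
        apply Finset.sum_le_sum_of_subset_of_nonneg (Finset.filter_subset _ _)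
        intro n hn _; exact hF n hn

lemma weak_pow (a f : ℕ → ℂ) (ha : KSm a) (h2 : KL2 a) (lam : ℝ) (hlam : 0 < lam) (J : ℕ) :
    lam * (((Finset.range (2 ^ J)).filter (fun n => 2 * lam < ‖cvl a f n‖)).card : ℝ) ≤ 
      6 * ∑ n ∈ Finset.range (2 ^ J), ‖f n‖ := by
  set S := ∑ n ∈ Finset.range (2 ^ J), ‖f n‖ with hS
  have S0 : 0 ≤ S := by positivity
  by_cases hc : S ≤ lam * (2 : ℝ) ^ J
  swap
  · have : (((Finset.range (2 ^ J)).filter (fun n => 2 * lam < ‖cvl a f n‖)).card : ℝ) ≤ 2 ^ J := by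
      have := Finset.card_filter_le (Finset.range (2 ^ J)) (fun n => 2 * lam < ‖cvl a f n‖)
      rw [Finset.card_range] at this
      exact_mod_cast this
    nlinarith
  have hI : Finset.Ico 0 (0 + 2 ^ J) = Finset.range (2 ^ J) := by ext; simp
  obtain ⟨b, E, hb, hg, hgs, hE, hcb⟩ := CZd_all a f ha lam hlam J 0 (by rw [hI]; exact hc)
  rw [hI] at hb hg hgs hE 
  simp only [hI] at hcb
  rw [← hS] at hgs hE
  have hdec : ∀ n, cvl a f n = cvl a (fun j => f j - b j) n + cvl a b n := by
    intro n; rw [← cvl_add]; simp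
  set g : ℕ → ℂ := fun j => f j - b j with hgdef
  have hsub : (Finset.range (2 ^ J)).filter (fun n => 2 * lam < ‖cvl a f n‖) ⊆
      E ∪ ((Finset.range (2 ^ J)).filter (fun n => n ∉ E)).filter (fun n => lam < ‖cvl a b n‖) ∪ 
      (Finset.range (2 ^ J)).filter (fun n => lam ^ 2 < ‖cvl a g n‖ ^ 2) := by
    intro n hn
    simp only [Finset.mem_filter, Finset.mem_union] at hn ⊢
    by_contra hcon
    push Not at hcon
    obtain ⟨⟨h1, h3⟩, h4⟩ := hcon
    have h3' := h3 ⟨hn.1, h1⟩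
    have h4' : ‖cvl a g n‖ ≤ lam := by
      have := h4 hn.1
      exact le_of_sq_le_sq this hlam.le
    have := norm_add_le (cvl a g n) (cvl a b n)
    rw [← hdec] at this
    linarith [hn.2]
  have hcard := Finset.card_le_card hsub
  have hc2 := hcard.trans (Finset.card_union_le _ _)
  have hc3 := hc2.trans (Nat.add_le_add_right (Finset.card_union_le _ _) _)
  have hc4 : (((Finset.range (2 ^ J)).filter (fun n => 2 * lam < ‖cvl a f n‖)).card : ℝ) ≤ 
    E.card + (((Finset.range (2 ^ J)).filter (fun n => n ∉ E)).filter (fun n => lam < ‖cvl a b n‖)).card +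
    ((Finset.range (2 ^ J)).filter (fun n => lam ^ 2 < ‖cvl a g n‖ ^ 2)).card := by exact_mod_cast hc3
  have e1 := cheb_card ((Finset.range (2 ^ J)).filter (fun n => n ∉ E)) (fun n => ‖cvl a b n‖) lam 
    (fun _ _ => norm_nonneg _)
  have e2 := cheb_card (Finset.range (2 ^ J)) (fun n => ‖cvl a g n‖ ^ 2) (lam ^ 2) 
    (fun _ _ => by positivity)
  have e3 : ∑ n ∈ Finset.range (2 ^ J), ‖g n‖ ^ 2 ≤ 2 * lam * S := by
    calc _ ≤ ∑ n ∈ Finset.range (2 ^ J), 2 * lam * ‖g n‖ := by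
          apply Finset.sum_le_sum
          intro n hn
          rw [pow_two]
          exact mul_le_mul_of_nonneg_right (hg n hn) (norm_nonneg _)
      _ ≤ _ := by
          rw [← Finset.mul_sum]
          exact mul_le_mul_of_nonneg_left hgs (by linarith)
  have e4 := (e2.trans (h2 (2 ^ J) g)).trans e3
  have e5 := e1.trans (hcb (2 ^ J))
  have e6 : lam * (((Finset.range (2 ^ J)).filter (fun n => lam ^ 2 < ‖cvl a g n‖ ^ 2)).card : ℝ) ≤ 2 * S := by
    have : lam * (lam * (((Finset.range (2 ^ J)).filter (fun n => lam ^ 2 < ‖cvl a g n‖ ^ 2)).card : ℝ)) ≤ lam * (2 * S) := by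
      nlinarith
    exact le_of_mul_le_mul_left this hlam
  calc _ ≤ lam * (_) := mul_le_mul_of_nonneg_left hc4 hlam.le
    _ ≤ _ := by rw [mul_add, mul_add]; linarith

lemma lint_low (A e : ℝ) (hA : 0 ≤ A) (he : -1 < e) :
    ∫⁻ x in Set.Ioo 0 A, ENNReal.ofReal (x ^ e) = ENNReal.ofReal (A ^ (e + 1) / (e + 1)) := by
  rw [← ofReal_integral_eq_lintegral_ofReal]
  · rw [← integral_Ioc_eq_integral_Ioo, ← intervalIntegral.integral_of_le hA, integral_rpow (Or.inl he),
      Real.zero_rpow (by linarith), sub_zero]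
  · have := (intervalIntegral.intervalIntegrable_rpow' (a := 0) (b := A) he)
    rw [intervalIntegrable_iff_integrableOn_Ioo_of_le hA] at this
    exact this
  · rw [Filter.EventuallyLE, ae_restrict_iff' measurableSet_Ioo]
    filter_upwards with x hx
    exact Real.rpow_nonneg hx.1.le _

lemma lint_high (A e : ℝ) (hA : 0 < A) (he : e < -1) :
    ∫⁻ x in Set.Ioi A, ENNReal.ofReal (x ^ e) = ENNReal.ofReal (-A ^ (e + 1) / (e + 1)) := by
  rw [← ofReal_integral_eq_lintegral_ofReal]
  · rw [integral_Ioi_rpow_of_lt he hA]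
  · exact integrableOn_Ioi_rpow_of_lt he hA
  · rw [Filter.EventuallyLE, ae_restrict_iff' measurableSet_Ioi]
    filter_upwards with x hx
    exact Real.rpow_nonneg (hA.le.trans (le_of_lt hx)) _

/-- distributional estimate -/
lemma dist_est (a f : ℕ → ℂ) (ha : KSm a) (h2 : KL2 a) (lam : ℝ) (hlam : 0 < lam) (J : ℕ) :
    (((Finset.range (2 ^ J)).filter (fun n => lam < ‖cvl a f n‖ / 4)).card : ℝ) ≤ 
      ∑ n ∈ Finset.range (2 ^ J), (if lam < ‖f n‖ then 6 * lam⁻¹ * ‖f n‖ else lam⁻¹ ^ 2 * ‖f n‖ ^ 2) := by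
  set f1 : ℕ → ℂ := fun n => if lam < ‖f n‖ then f n else 0 with hf1
  set f2 : ℕ → ℂ := fun n => if lam < ‖f n‖ then 0 else f n with hf2
  have hdec : ∀ n, cvl a f n = cvl a f1 n + cvl a f2 n := by
    intro n; rw [← cvl_add]; congr 1; ext j; simp only [hf1, hf2]; split_ifs <;> simp
  have hsub : (Finset.range (2 ^ J)).filter (fun n => lam < ‖cvl a f n‖ / 4) ⊆
      (Finset.range (2 ^ J)).filter (fun n => 2 * lam < ‖cvl a f1 n‖) ∪ 
      (Finset.range (2 ^ J)).filter (fun n => lam ^ 2 < ‖cvl a f2 n‖ ^ 2) := by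
    intro n hn
    simp only [Finset.mem_filter, Finset.mem_union] at hn ⊢
    by_contra hcon
    push Not at hcon
    obtain ⟨h3, h4⟩ := hcon
    have h3' := h3 hn.1
    have h4' : ‖cvl a f2 n‖ ≤ lam := le_of_sq_le_sq (h4 hn.1) hlam.le
    have := norm_add_le (cvl a f1 n) (cvl a f2 n)
    rw [← hdec] at this
    linarith [hn.2]
  have hc : (((Finset.range (2 ^ J)).filter (fun n => lam < ‖cvl a f n‖ / 4)).card : ℝ) ≤ 
    ((Finset.range (2 ^ J)).filter (fun n => 2 * lam < ‖cvl a f1 n‖)).card +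
    ((Finset.range (2 ^ J)).filter (fun n => lam ^ 2 < ‖cvl a f2 n‖ ^ 2)).card := by
    exact_mod_cast (Finset.card_le_card hsub).trans (Finset.card_union_le _ _)
  have e1 := weak_pow a f1 ha h2 lam hlam J
  have e2 := (cheb_card (Finset.range (2 ^ J)) (fun n => ‖cvl a f2 n‖ ^ 2) (lam ^ 2) 
    (fun _ _ => by positivity)).trans (h2 (2 ^ J) f2)
  have e1' : (((Finset.range (2 ^ J)).filter (fun n => 2 * lam < ‖cvl a f1 n‖)).card : ℝ) ≤ 
      lam⁻¹ * (6 * ∑ n ∈ Finset.range (2 ^ J), ‖f1 n‖) := by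
    rw [le_inv_mul_iff₀ hlam]; exact e1
  have e2' : (((Finset.range (2 ^ J)).filter (fun n => lam ^ 2 < ‖cvl a f2 n‖ ^ 2)).card : ℝ) ≤ 
      (lam ^ 2)⁻¹ * (∑ n ∈ Finset.range (2 ^ J), ‖f2 n‖ ^ 2) := by
    rw [le_inv_mul_iff₀ (by positivity)]; exact e2
  refine (hc.trans (add_le_add e1' e2')).trans (le_of_eq ?_)
  rw [Finset.mul_sum, Finset.mul_sum, Finset.mul_sum, ← Finset.sum_add_distrib]
  apply Finset.sum_congr rfl
  intro n _
  simp only [hf1, hf2]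
  split_ifs <;> simp <;> ring

lemma strong_pow (q : ℝ) (hq : 1 < q) (hq2 : q < 2) (a f : ℕ → ℂ) (ha : KSm a) (h2 : KL2 a) (J : ℕ) :
    ∑ n ∈ Finset.range (2 ^ J), (‖cvl a f n‖ / 4) ^ q ≤ 
      (6 * q / (q - 1) + q / (2 - q)) * ∑ n ∈ Finset.range (2 ^ J), ‖f n‖ ^ q := by
  have q0 : 0 < q := by linarith
  have q1 : 0 < q - 1 := by linarith
  have q2 : 0 < 2 - q := by linarith
  have hlay : ∀ t : ℝ, 0 ≤ t → ENNReal.ofReal (t ^ q) = 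
      ∫⁻ x in Set.Ioi (0:ℝ), (if x < t then ENNReal.ofReal (q * x ^ (q - 1)) else 0) := by
    intro t ht
    have e : (fun x : ℝ => if x < t then ENNReal.ofReal (q * x ^ (q - 1)) else 0) = 
      (Set.Iio t).indicator (fun x => ENNReal.ofReal q * ENNReal.ofReal (x ^ (q - 1))) := by
      ext x
      simp only [Set.indicator, Set.mem_Iio, ENNReal.ofReal_mul q0.le]
    rw [e, setLIntegral_indicator measurableSet_Iio, Set.inter_comm, Set.Ioi_inter_Iio, lintegral_const_mul' _ _ ENNReal.ofReal_ne_top,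
      lint_low _ _ ht (by linarith), ← ENNReal.ofReal_mul q0.le]
    congr 1
    rw [sub_add_cancel]; field_simp
  have hterm : ∀ t : ℝ, 0 ≤ t → 
      ∫⁻ x in Set.Ioi (0:ℝ), ENNReal.ofReal (q * x ^ (q - 1) * (if x < t then 6 * x⁻¹ * t else x⁻¹ ^ 2 * t ^ 2)) 
       ≤ ENNReal.ofReal ((6 * q / (q - 1) + q / (2 - q)) * t ^ q) := by
    intro t ht
    rcases ht.eq_or_lt with h0 | h0
    · subst h0
      refine le_of_eq_of_le ?_ (zero_le)
      rw [setLIntegral_congr_fun (g := fun _ => 0) measurableSet_Ioi]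
      · simp
      · intro x hx
        have : ¬ (x < 0) := not_lt.2 (le_of_lt hx)
        simp [this]
    have e : Set.Ioi (0:ℝ) = Set.Ioo 0 t ∪ Set.Ici t := by
      ext x; simp only [Set.mem_Ioi, Set.mem_union, Set.mem_Ioo, Set.mem_Ici]
      constructor
      · intro h; rcases lt_or_ge x t with h' | h'
        · exact Or.inl ⟨h, h'⟩
        · exact Or.inr h'
      · rintro (h | h)
        · exact h.1
        · linarith
    rw [e]
    refine (lintegral_union_le _ _ _).trans ?_
    rw [add_mul, ENNReal.ofReal_add (by positivity) (by positivity)]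
    apply add_le_add
    · rw [setLIntegral_congr_fun (g := fun x => ENNReal.ofReal (6 * q * t) * ENNReal.ofReal (x ^ (q - 2))) measurableSet_Ioo]
      · rw [lintegral_const_mul' _ _ ENNReal.ofReal_ne_top, lint_low _ _ ht (by linarith), ← ENNReal.ofReal_mul (by positivity)]
        apply ENNReal.ofReal_le_ofReal
        apply le_of_eq
        have : t ^ q = t ^ (q - 1) * t := by
          rw [← Real.rpow_add_one h0.ne', sub_add_cancel]
        rw [this, show q - 2 + 1 = q - 1 by ring]
        ring
      · intro x hx
        simp only [hx.2, if_true]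
        rw [← ENNReal.ofReal_mul (by positivity)]
        congr 1
        rw [show q - 1 = (q - 2) + 1 by ring, Real.rpow_add_one hx.1.ne']
        have := hx.1.ne'
        field_simp
    · rw [setLIntegral_congr_fun (g := fun x => ENNReal.ofReal (q * t ^ 2) * ENNReal.ofReal (x ^ (q - 3))) measurableSet_Ici]
      · rw [lintegral_const_mul' _ _ ENNReal.ofReal_ne_top, setLIntegral_congr Ioi_ae_eq_Ici.symm, lint_high _ _ h0 (by linarith), ← ENNReal.ofReal_mul (by positivity)]
        apply ENNReal.ofReal_le_ofReal
        apply le_of_eq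
        have : t ^ q = t ^ (q - 3 + 1) * t ^ 2 := by
          rw [← Real.rpow_natCast, ← Real.rpow_add h0]; congr 1; push_cast; ring
        rw [this, show q - 3 + 1 = - (2 - q) by ring, neg_div_neg_eq]
        field_simp
      · intro x hx
        have hx0 : 0 < x := lt_of_lt_of_le h0 hx
        have : ¬ (x < t) := not_lt.2 hx
        simp only [this, if_false]
        rw [← ENNReal.ofReal_mul (by positivity)]
        congr 1
        have : x ^ (q - 1) = x ^ (q - 3) * x ^ 2 := by
          rw [← Real.rpow_natCast, ← Real.rpow_add hx0]; congr 1; push_cast; ring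
        rw [this]
        field_simp
  have R0 : 0 ≤ (6 * q / (q - 1) + q / (2 - q)) * ∑ n ∈ Finset.range (2 ^ J), ‖f n‖ ^ q := by
    have : 0 ≤ 6 * q / (q - 1) + q / (2 - q) := by positivity
    exact mul_nonneg this (by positivity)
  rw [← ENNReal.ofReal_le_ofReal_iff R0, ENNReal.ofReal_sum_of_nonneg (fun _ _ => by positivity)]
  rw [Finset.sum_congr rfl fun n _ => hlay _ (by positivity)]
  have m1 : ∀ t : ℝ, Measurable (fun x : ℝ => if x < t then ENNReal.ofReal (q * x ^ (q - 1)) else 0) := by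
    intro t
    refine Measurable.ite measurableSet_Iio ?_ measurable_const
    fun_prop
  have m2 : ∀ t : ℝ, Measurable (fun x : ℝ => ENNReal.ofReal (q * x ^ (q - 1) * (if x < t then 6 * x⁻¹ * t else x⁻¹ ^ 2 * t ^ 2))) := by
    intro t
    apply Measurable.ennreal_ofReal
    apply Measurable.mul (by fun_prop)
    refine Measurable.ite measurableSet_Iio ?_ ?_ <;> fun_prop
  rw [← lintegral_finsetSum _ (fun n _ => m1 _)]
  calc _ ≤ ∫⁻ x in Set.Ioi (0:ℝ), ∑ n ∈ Finset.range (2 ^ J), ENNReal.ofReal (q * x ^ (q - 1) * (if x < ‖f n‖ then 6 * x⁻¹ * ‖f n‖ else x⁻¹ ^ 2 * ‖f n‖ ^ 2)) := by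
        apply setLIntegral_mono_ae' measurableSet_Ioi
        filter_upwards with x hx
        have hx0 : 0 < x := hx
        rw [← ENNReal.ofReal_sum_of_nonneg]
        · rw [← Finset.mul_sum, ← Finset.sum_filter, Finset.sum_const, nsmul_eq_mul,
            ← ENNReal.ofReal_natCast, ← ENNReal.ofReal_mul (by positivity)]
          apply ENNReal.ofReal_le_ofReal
          rw [mul_comm]
          exact mul_le_mul_of_nonneg_left (dist_est a f ha h2 x hx0 J) (by positivity)
        · intro n _
          split_ifs <;> positivity
    _ = ∑ n ∈ Finset.range (2 ^ J), ∫⁻ x in Set.Ioi (0:ℝ), ENNReal.ofReal (q * x ^ (q - 1) * (if x < ‖f n‖ then 6 * x⁻¹ * ‖f n‖ else x⁻¹ ^ 2 * ‖f n‖ ^ 2)) := by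
        rw [lintegral_finsetSum _ (fun n _ => m2 _)]
    _ ≤ ∑ n ∈ Finset.range (2 ^ J), ENNReal.ofReal ((6 * q / (q - 1) + q / (2 - q)) * ‖f n‖ ^ q) := 
        Finset.sum_le_sum fun n _ => hterm _ (norm_nonneg _)
    _ = _ := by
        rw [← ENNReal.ofReal_sum_of_nonneg, Finset.mul_sum]
        intro n _
        have : 0 ≤ 6 * q / (q - 1) + q / (2 - q) := by positivity
        exact mul_nonneg this (by positivity)

lemma strong_lt2 (q : ℝ) (hq : 1 < q) (hq2 : q < 2) : ∃ C : ℝ, 0 < C ∧ ∀ (a f : ℕ → ℂ), KSm a → KL2 a → 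
    ∀ L, (∑ n ∈ Finset.range L, ‖cvl a f n‖ ^ q) ^ (1 / q) ≤ 
      C * (∑ n ∈ Finset.range L, ‖f n‖ ^ q) ^ (1 / q) := by
  have q0 : 0 < q := by linarith
  have q1 : 0 < q - 1 := by linarith
  have q2 : 0 < 2 - q := by linarith
  have hK : 0 < (6 * q / (q - 1) + q / (2 - q)) := by positivity
  refine ⟨4 * (6 * q / (q - 1) + q / (2 - q)) ^ (1 / q), by positivity, ?_⟩
  intro a f ha h2 L
  set f' : ℕ → ℂ := fun n => if n < L then f n else 0 with hf'
  have hL : L ≤ 2 ^ L := Nat.lt_two_pow_self.le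
  have h := strong_pow q hq hq2 a f' ha h2 L
  have e1 : ∑ n ∈ Finset.range (2 ^ L), ‖f' n‖ ^ q = ∑ n ∈ Finset.range L, ‖f n‖ ^ q := by
    symm
    rw [← Finset.sum_subset (Finset.range_mono hL)]
    · apply Finset.sum_congr rfl
      intro n hn
      simp only [hf', Finset.mem_range.1 hn, if_true]
    · intro n _ hn
      simp only [Finset.mem_range] at hn
      simp only [hf', hn, if_false, norm_zero, Real.zero_rpow q0.ne']
  have e2 : ∑ n ∈ Finset.range L, (‖cvl a f n‖ / 4) ^ q ≤ ∑ n ∈ Finset.range (2 ^ L), (‖cvl a f' n‖ / 4) ^ q := by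
    calc _ = ∑ n ∈ Finset.range L, (‖cvl a f' n‖ / 4) ^ q := by
          apply Finset.sum_congr rfl
          intro n hn
          rw [cvl_congr a f f' n]
          intro j hj
          have : j < L := lt_of_le_of_lt hj (Finset.mem_range.1 hn)
          simp only [hf', this, if_true]
      _ ≤ _ := by
          apply Finset.sum_le_sum_of_subset_of_nonneg (Finset.range_mono hL)
          intros; positivity
  rw [e1] at h
  have h3 := e2.trans h
  have e4 : ∑ n ∈ Finset.range L, (‖cvl a f n‖ / 4) ^ q = (∑ n ∈ Finset.range L, ‖cvl a f n‖ ^ q) / 4 ^ q := by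
    rw [Finset.sum_div]
    apply Finset.sum_congr rfl
    intro n _
    rw [Real.div_rpow (norm_nonneg _) (by norm_num)]
  rw [e4, div_le_iff₀ (by positivity)] at h3
  calc _ ≤ ((6 * q / (q - 1) + q / (2 - q)) * (∑ n ∈ Finset.range L, ‖f n‖ ^ q) * 4 ^ q) ^ (1 / q) := 
        Real.rpow_le_rpow (by positivity) h3 (by positivity)
    _ = _ := by
        rw [Real.mul_rpow (by positivity) (by positivity), Real.mul_rpow hK.le (by positivity),
          ← Real.rpow_mul (by norm_num), mul_one_div_cancel q0.ne', Real.rpow_one]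
        ring

/-- bilinear estimate, all exponents -/
lemma bil_all (q q' : ℝ) (hq : q.HolderConjugate q') : ∃ C : ℝ, 0 < C ∧ ∀ (a : ℕ → ℂ), KSm a → KL2 a → 
    ∀ L (g F : ℕ → ℂ), ‖∑ n ∈ Finset.range L, cvl a g n * F n‖ ≤ 
      C * (∑ n ∈ Finset.range L, ‖g n‖ ^ q) ^ (1 / q) * (∑ n ∈ Finset.range L, ‖F n‖ ^ q') ^ (1 / q') := by
  have main : ∀ q q' : ℝ, q.HolderConjugate q' → q < 2 → ∃ C : ℝ, 0 < C ∧ ∀ (a : ℕ → ℂ), KSm a → KL2 a → 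
    ∀ L (g F : ℕ → ℂ), ‖∑ n ∈ Finset.range L, cvl a g n * F n‖ ≤ 
      C * (∑ n ∈ Finset.range L, ‖g n‖ ^ q) ^ (1 / q) * (∑ n ∈ Finset.range L, ‖F n‖ ^ q') ^ (1 / q') := by
    intro q q' hq hq2
    obtain ⟨C, hC, h⟩ := strong_lt2 q hq.lt hq2
    refine ⟨C, hC, ?_⟩
    intro a ha h2 L g F
    have := h a g ha h2 L
    calc _ ≤ ∑ n ∈ Finset.range L, ‖cvl a g n‖ * ‖F n‖ := by
          refine (norm_sum_le _ _).trans (le_of_eq ?_)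
          simp only [norm_mul]
      _ ≤ _ := Real.inner_le_Lp_mul_Lq_of_nonneg _ hq (fun _ _ => norm_nonneg _) (fun _ _ => norm_nonneg _)
      _ ≤ _ := mul_le_mul_of_nonneg_right this (by positivity)
  rcases lt_trichotomy q 2 with h | h | h
  · exact main q q' hq h
  · subst h
    have : q' = 2 := by
      have := hq.inv_add_inv_eq_one
      have h3 : q'⁻¹ = 2⁻¹ := by linarith
      exact inv_injective h3
    subst this
    refine ⟨1, one_pos, ?_⟩
    intro a ha h2 L g F
    calc _ ≤ ∑ n ∈ Finset.range L, ‖cvl a g n‖ * ‖F n‖ := by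
          refine (norm_sum_le _ _).trans (le_of_eq ?_)
          simp only [norm_mul]
      _ ≤ _ := Real.inner_le_Lp_mul_Lq_of_nonneg _ hq (fun _ _ => norm_nonneg _) (fun _ _ => norm_nonneg _)
      _ ≤ _ := by
        refine mul_le_mul_of_nonneg_right ?_ (by positivity)
        rw [one_mul]
        apply Real.rpow_le_rpow (by positivity) _ (by norm_num)
        have := h2 L g
        simpa using this
  · have hq'2 : q' < 2 := by
      have e := hq.inv_add_inv_eq_one
      have : q⁻¹ < 2⁻¹ := by 
        apply inv_strictAnti₀ (by norm_num) h
      have h3 : 2⁻¹ < q'⁻¹ := by linarith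
      exact (inv_lt_inv₀ (by norm_num) hq.symm.pos).1 h3
    obtain ⟨C, hC, hh⟩ := main q' q hq.symm hq'2
    refine ⟨C, hC, ?_⟩
    intro a ha h2 L g F
    have := hh a ha h2 L (fun n => F (L - 1 - n)) (fun n => g (L - 1 - n))
    rw [Finset.sum_range_reflect (fun n => ‖F n‖ ^ q') L, Finset.sum_range_reflect (fun n => ‖g n‖ ^ q) L] at this
    have e : ∑ n ∈ Finset.range L, cvl a (fun n => F (L - 1 - n)) n * g (L - 1 - n) = 
        ∑ n ∈ Finset.range L, cvl a g n * F n := by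
      simp only [cvl, Finset.sum_mul]
      rw [Finset.sum_sigma', Finset.sum_sigma']
      refine Finset.sum_bij' (fun x _ => ⟨L - 1 - x.2, L - 1 - x.1⟩) (fun x _ => ⟨L - 1 - x.2, L - 1 - x.1⟩) ?_ ?_ ?_ ?_ ?_
      · rintro ⟨i, j⟩ h; simp at h ⊢; omega
      · rintro ⟨i, j⟩ h; simp at h ⊢; omega
      · rintro ⟨i, j⟩ h; simp at h ⊢; omega
      · rintro ⟨i, j⟩ h; simp at h ⊢; omega
      · rintro ⟨i, j⟩ h
        simp at h ⊢
        rw [show L - 1 - j - (L - 1 - i) = i - j by omega]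
        ring
    rw [e] at this
    linarith

/-- coefficients of `(1-w)^z` -/
def bc (z : ℂ) : ℕ → ℂ
  | 0 => 1
  | k + 1 => bc z k * (((k : ℂ) - z) / ((k : ℂ) + 1))

lemma bc_zero (z : ℂ) : bc z 0 = 1 := rfl
lemma bc_succ (z : ℂ) (k : ℕ) : bc z (k + 1) = bc z k * (((k : ℂ) - z) / ((k : ℂ) + 1)) := rfl

lemma bc_choose (z : ℂ) (k : ℕ) : bc z k = (-1) ^ k * Ring.choose z k := by
  induction k with
  | zero => simp [bc_zero]
  | succ k ih =>
    rw [bc_succ, ih, Ring.choose_eq_smul, Ring.choose_eq_smul, descPochhammer_succ_right,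
      Polynomial.smeval_mul, Nat.factorial_succ]
    have h1 : ((k : ℂ) + 1) ≠ 0 := by exact_mod_cast Nat.succ_ne_zero k
    have h2 : ((k.factorial : ℕ) : ℂ) ≠ 0 := by exact_mod_cast Nat.factorial_ne_zero k
    simp only [Polynomial.smeval_sub, Polynomial.smeval_X, Polynomial.smeval_natCast, smul_eq_mul]
    push_cast
    field_simp
    simp
    ring

lemma bc_add (z w : ℂ) (n : ℕ) : 
    ∑ x ∈ Finset.HasAntidiagonal.antidiagonal n, bc z x.1 * bc w x.2 = bc (z + w) n := by
  rw [bc_choose, Ring.add_choose_eq n (Commute.all z w), Finset.mul_sum]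
  apply Finset.sum_congr rfl
  intro x hx
  rw [bc_choose, bc_choose, ← Finset.HasAntidiagonal.mem_antidiagonal.1 hx, pow_add]
  ring

lemma bc_growth (z : ℂ) (n : ℕ) (hz : ‖z‖ ≤ n) (k : ℕ) : ‖bc z k‖ ≤ ((k : ℝ) + 1) ^ n := by
  induction k with
  | zero => simp [bc_zero]
  | succ k ih =>
    rw [bc_succ, norm_mul, norm_div]
    have hk : (0:ℝ) < (k:ℝ) + 1 := by positivity
    have e1 : ‖(k : ℂ) + 1‖ = (k : ℝ) + 1 := by
      have : ((k : ℂ) + 1) = ((k + 1 : ℕ) : ℂ) := by push_cast; rfl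
      rw [this, Complex.norm_natCast]; push_cast; rfl
    have e2 : ‖(k : ℂ) - z‖ ≤ k + n := by
      refine (norm_sub_le _ _).trans ?_
      rw [Complex.norm_natCast]; linarith
    rw [e1]
    have e3 : ((k : ℝ) + n) / (k + 1) ≤ (1 + 1 / ((k:ℝ) + 1)) ^ n := by
      have := one_add_mul_le_pow (a := 1 / ((k:ℝ) + 1)) (by have : 0 ≤ 1 / ((k:ℝ) + 1) := by positivity
                                                            linarith) n
      refine le_trans ?_ this
      rw [div_le_iff₀ hk]
      field_simp
      linarith
    calc _ ≤ ((k : ℝ) + 1) ^ n * (1 + 1 / ((k:ℝ) + 1)) ^ n := by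
          apply mul_le_mul ih _ (by positivity) (by positivity)
          refine le_trans ?_ e3
          gcongr
      _ = _ := by
          rw [← mul_pow]; congr 1; push_cast; field_simp; try ring

lemma bc_im (y : ℝ) (k : ℕ) (hk : 1 ≤ k) : 
    ‖bc (y * Complex.I) k‖ ≤ |y| / k * Real.exp (y ^ 2 * (1 - 1 / k)) := by
  induction k, hk using Nat.le_induction with
  | base => simp [bc_succ, bc_zero]
  | succ k hk ih =>
    have hk0 : (0:ℝ) < k := by exact_mod_cast hk
    rw [bc_succ, norm_mul, norm_div]
    have e1 : ‖(k : ℂ) + 1‖ = (k : ℝ) + 1 := by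
      have : ((k : ℂ) + 1) = ((k + 1 : ℕ) : ℂ) := by push_cast; rfl
      rw [this, Complex.norm_natCast]; push_cast; rfl
    have e2 : ‖(k : ℂ) - y * Complex.I‖ ≤ k * Real.exp (y ^ 2 * (1 / k - 1 / (k + 1))) := by
      apply le_of_sq_le_sq _ (by positivity)
      rw [← Complex.normSq_eq_norm_sq, Complex.normSq_apply, mul_pow, ← Real.exp_nat_mul]
      have h1 : y ^ 2 / k ^ 2 ≤ (2 : ℕ) * (y ^ 2 * (1 / k - 1 / (k + 1))) := by
        have : (2:ℝ) * (y ^ 2 * (1 / k - 1 / (k + 1))) = y ^ 2 * (2 / (k * (k + 1))) := by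
          field_simp; ring
        push_cast
        rw [this, div_eq_mul_one_div]
        apply mul_le_mul_of_nonneg_left _ (sq_nonneg _)
        rw [div_le_div_iff₀ (by positivity) (by positivity)]
        have : (1:ℝ) ≤ k := by exact_mod_cast hk
        nlinarith
      have h2 := Real.add_one_le_exp (y ^ 2 / (k:ℝ) ^ 2)
      have h3 := Real.exp_le_exp.2 h1
      have h4 : (k : ℝ) ^ 2 * (y ^ 2 / k ^ 2 + 1) ≤ k ^ 2 * Real.exp ((2 : ℕ) * (y ^ 2 * (1 / k - 1 / (k + 1)))) := by
        apply mul_le_mul_of_nonneg_left _ (by positivity)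
        linarith
      refine le_trans (le_of_eq ?_) h4
      simp
      field_simp
      ring
    rw [e1]
    calc _ ≤ (|y| / k * Real.exp (y ^ 2 * (1 - 1 / k))) * ((k * Real.exp (y ^ 2 * (1 / k - 1 / (k + 1)))) / (k + 1)) := by
          apply mul_le_mul ih _ (by positivity) (by positivity)
          gcongr
      _ = _ := by
          push_cast
          have : Real.exp (y ^ 2 * (1 - 1 / ((k:ℝ) + 1))) = Real.exp (y ^ 2 * (1 - 1 / k)) * Real.exp (y ^ 2 * (1 / k - 1 / (k + 1))) := by
            rw [← Real.exp_add]; congr 1; ring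
          rw [this]
          field_simp

lemma ker_diff (y r : ℝ) (hr : 0 ≤ r) (hr1 : r < 1) (k : ℕ) (hk : 1 ≤ k) : 
    ‖(r : ℂ) ^ (k + 1) * bc (y * Complex.I) (k + 1) - (r : ℂ) ^ k * bc (y * Complex.I) k‖ ≤ 
      2 * Real.exp (2 * y ^ 2) * (1 / ((k : ℝ) * (k + 1))) := by
  have hk0 : (0:ℝ) < k := by exact_mod_cast hk
  have h1 : ((k : ℂ) + 1) ≠ 0 := by exact_mod_cast Nat.succ_ne_zero k
  have e1 : ‖(k : ℂ) + 1‖ = (k : ℝ) + 1 := by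
    have : ((k : ℂ) + 1) = ((k + 1 : ℕ) : ℂ) := by push_cast; rfl
    rw [this, Complex.norm_natCast]; push_cast; rfl
  have e : (r : ℂ) ^ (k + 1) * bc (y * Complex.I) (k + 1) - (r : ℂ) ^ k * bc (y * Complex.I) k = 
     - (bc (y * Complex.I) k * ((r : ℂ) ^ k * (1 - r) + (r : ℂ) ^ (k + 1) * ((1 + y * Complex.I) / (k + 1)))) := by
    rw [bc_succ]; field_simp; ring
  rw [e, norm_neg, norm_mul]
  have b1 := bc_im y k hk
  have b2 : ‖bc (y * Complex.I) k‖ ≤ |y| / k * Real.exp (y ^ 2) := by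
    refine b1.trans ?_
    apply mul_le_mul_of_nonneg_left _ (by positivity)
    apply Real.exp_le_exp.2
    have : 0 ≤ 1 / (k:ℝ) := by positivity
    nlinarith [sq_nonneg y]
  have geo : ((k:ℝ) + 1) * (r ^ k * (1 - r)) ≤ 1 := by
    have hg : (∑ j ∈ Finset.range (k + 1), r ^ j) * (1 - r) = 1 - r ^ (k + 1) := by
      have := geom_sum_mul_neg r (k + 1); exact this
    have : ((k:ℝ) + 1) * r ^ k ≤ ∑ j ∈ Finset.range (k + 1), r ^ j := by
      calc ((k:ℝ) + 1) * r ^ k = ∑ j ∈ Finset.range (k + 1), r ^ k := by simp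
        _ ≤ _ := by
          apply Finset.sum_le_sum
          intro j hj
          apply pow_le_pow_of_le_one hr hr1.le
          simp at hj; omega
    have h3 : 0 ≤ r ^ (k + 1) := by positivity
    nlinarith
  have b3 : ‖(r : ℂ) ^ k * (1 - r) + (r : ℂ) ^ (k + 1) * ((1 + y * Complex.I) / (k + 1))‖ ≤ (|y| + 2) / (k + 1) := by
    refine (norm_add_le _ _).trans ?_
    have t1 : ‖(r : ℂ) ^ k * (1 - r)‖ ≤ 1 / (k + 1) := by
      have : (r : ℂ) ^ k * (1 - r) = ((r ^ k * (1 - r) : ℝ) : ℂ) := by push_cast; rfl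
      rw [this, Complex.norm_real, Real.norm_eq_abs, abs_of_nonneg (mul_nonneg (by positivity) (by linarith)), le_div_iff₀ (by positivity)]
      linarith
    have t2 : ‖(r : ℂ) ^ (k + 1) * ((1 + y * Complex.I) / (k + 1))‖ ≤ (1 + |y|) / (k + 1) := by
      rw [norm_mul, norm_div, e1, norm_pow, Complex.norm_real, Real.norm_eq_abs, abs_of_nonneg hr]
      have : ‖1 + (y:ℂ) * Complex.I‖ ≤ 1 + |y| := by
        refine (norm_add_le _ _).trans ?_
        simp
      calc _ ≤ 1 * ((1 + |y|) / ((k:ℝ) + 1)) := by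
            apply mul_le_mul (pow_le_one₀ hr hr1.le) _ (by positivity) (by norm_num)
            gcongr
        _ = _ := by ring
    refine (add_le_add t1 t2).trans (le_of_eq ?_)
    ring
  calc _ ≤ (|y| / k * Real.exp (y ^ 2)) * ((|y| + 2) / (k + 1)) := 
        mul_le_mul b2 b3 (by positivity) (by positivity)
    _ = (|y| * (|y| + 2)) * Real.exp (y ^ 2) * (1 / ((k : ℝ) * (k + 1))) := by field_simp
    _ ≤ _ := by
      apply mul_le_mul_of_nonneg_right _ (by positivity)
      have : Real.exp (2 * y ^ 2) = Real.exp (y ^ 2) * Real.exp (y ^ 2) := by rw [← Real.exp_add]; congr 1; ring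
      rw [this, ← mul_assoc]
      apply mul_le_mul_of_nonneg_right _ (by positivity)
      have := Real.add_one_le_exp (y ^ 2)
      rw [← sq_abs] at this ⊢
      nlinarith [sq_nonneg (|y| - 1)]

lemma bc_hasSum (z x : ℂ) (hx : ‖x‖ < 1) : HasSum (fun k => bc z k * x ^ k) ((1 - x) ^ z) := by
  have := (Complex.one_add_cpow_hasFPowerSeriesOnBall_zero (a := z)).hasSum (y := -x) (by
    simp only [Metric.mem_eball, edist_zero_right, enorm_neg]
    rw [← ENNReal.ofReal_one, ← ofReal_norm]
    exact (ENNReal.ofReal_lt_ofReal_iff one_pos).2 hx)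
  simp only [zero_add, binomialSeries_apply, List.ofFn_const, List.prod_replicate, smul_eq_mul] at this
  rw [← sub_eq_add_neg] at this
  have e : (fun k => bc z k * x ^ k) = fun n => Ring.choose z n * (-x) ^ n := by
    ext k
    rw [bc_choose, neg_pow]; ring
  rw [e]
  exact this

lemma sup_bound (y r : ℝ) (hr : 0 ≤ r) (hr1 : r < 1) (w : ℂ) (hw : ‖w‖ = 1) :
    ‖(1 - (r:ℂ) * w) ^ (y * Complex.I)‖ ≤ Real.exp (4 + y ^ 2) := by
  have hn : ‖(r:ℂ) * w‖ < 1 := by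
    rw [norm_mul, hw, Complex.norm_real, Real.norm_eq_abs, abs_of_nonneg hr]; linarith
  have h0 : (1 - (r:ℂ) * w) ≠ 0 := by
    intro h
    have : (r:ℂ) * w = 1 := by linear_combination -h
    rw [this] at hn; simp at hn
  rw [Complex.norm_cpow_of_ne_zero h0]
  simp only [Complex.mul_re, Complex.ofReal_re, Complex.I_re, mul_zero, Complex.ofReal_im, Complex.I_im, mul_one, sub_self, Real.rpow_zero, Complex.mul_im, zero_add, add_zero]
  rw [one_div, ← Real.exp_neg]
  apply Real.exp_le_exp.2
  have h1 := Complex.abs_arg_le_pi (1 - (r:ℂ) * w)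
  have h2 : -(Complex.arg (1 - (r:ℂ) * w) * y) ≤ |Complex.arg (1 - (r:ℂ) * w)| * |y| := by
    rw [← abs_mul]; exact neg_le_abs _
  have h3 := Real.pi_le_four
  have h4 : |Complex.arg (1 - (r:ℂ) * w)| * |y| ≤ 4 * |y| := by
    apply mul_le_mul_of_nonneg_right (h1.trans h3) (abs_nonneg _)
  rw [← sq_abs y]
  nlinarith [sq_nonneg (|y| - 2)]

lemma ker_l2 (y r : ℝ) (hr : 0 ≤ r) (hr1 : r < 1) (L : ℕ) (f : ℕ → ℂ) :
    ∑ n ∈ Finset.range L, ‖cvl (fun k => (r : ℂ) ^ k * bc (y * Complex.I) k) f n‖ ^ 2 ≤ 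
      (2 * Real.exp (4 + y ^ 2)) ^ 2 * ∑ n ∈ Finset.range L, ‖f n‖ ^ 2 := by
  -- tail
  set z : ℂ := y * Complex.I with hz
  have hsum : Summable (fun k => ‖bc z k * (r:ℂ) ^ k‖) := by
    have : Summable (fun k => bc z k * (r:ℂ) ^ k) := (bc_hasSum z r (by 
      rw [Complex.norm_real, Real.norm_eq_abs, abs_of_nonneg hr]; exact hr1)).summable
    exact this.norm
  obtain ⟨M, hML, hM⟩ : ∃ M, L ≤ M ∧ ∑' k, ‖bc z (k + M) * (r:ℂ) ^ (k + M)‖ ≤ 1 := by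
    have h1 := tendsto_sum_nat_add (fun k => ‖bc z k * (r:ℂ) ^ k‖)
    have h2 := (h1.eventually (ge_mem_nhds (show (0:ℝ) < 1 by norm_num))).and (Filter.eventually_ge_atTop L)
    obtain ⟨M, h3, h4⟩ := h2.exists
    exact ⟨M, h4, h3⟩
  set A : Polynomial ℂ := ∑ k ∈ Finset.range M, Polynomial.monomial k ((r : ℂ) ^ k * bc z k) with hA
  set F : Polynomial ℂ := ∑ k ∈ Finset.range L, Polynomial.monomial k (f k) with hF
  have hAc : ∀ k, A.coeff k = if k < M then (r : ℂ) ^ k * bc z k else 0 := by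
    intro k
    rw [hA, Polynomial.finsetSum_coeff]
    simp [Polynomial.coeff_monomial]
  have hFc : ∀ k, F.coeff k = if k < L then f k else 0 := by
    intro k
    rw [hF, Polynomial.finsetSum_coeff]
    simp [Polynomial.coeff_monomial]
  have hsup : ∀ w : ℂ, ‖w‖ = 1 → ‖A.eval w‖ ≤ 2 * Real.exp (4 + y ^ 2) := by
    intro w hw
    have hs := bc_hasSum z (r * w) (by
      rw [norm_mul, hw, Complex.norm_real, Real.norm_eq_abs, abs_of_nonneg hr]; linarith)
    have h1 := hs.summable.sum_add_tsum_nat_add M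
    rw [hs.tsum_eq] at h1
    have e1 : A.eval w = ∑ k ∈ Finset.range M, bc z k * (r * w) ^ k := by
      rw [hA, Polynomial.eval_finsetSum]
      apply Finset.sum_congr rfl
      intro k _
      rw [Polynomial.eval_monomial, mul_pow]; ring
    have e2 : A.eval w = (1 - (r:ℂ) * w) ^ z - ∑' k, bc z (k + M) * (r * w) ^ (k + M) := by
      rw [e1, ← h1]; ring
    have e3 : ‖∑' k, bc z (k + M) * (r * w) ^ (k + M)‖ ≤ 1 := by
      have he : ∀ k, ‖bc z (k + M) * (r * w) ^ (k + M)‖ = ‖bc z (k + M) * (r:ℂ) ^ (k + M)‖ := by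
        intro k
        simp only [norm_mul, norm_pow, hw, mul_one]
      refine (norm_tsum_le_tsum_norm ?_).trans ?_
      · simp only [he]
        exact (summable_nat_add_iff M).2 hsum
      · simp only [he]; exact hM
    rw [e2]
    have h2 := sup_bound y r hr hr1 w hw
    have h3 : 1 ≤ Real.exp (4 + y ^ 2) := Real.one_le_exp (by positivity)
    refine (norm_sub_le _ _).trans ?_
    linarith
  have parsF := Polynomial.sum_sq_norm_coeff_eq_circleAverage (p := F)
  have parsAF := Polynomial.sum_sq_norm_coeff_eq_circleAverage (p := A * F)
  have e1 : ∑ i ∈ F.support, ‖F.coeff i‖ ^ 2 = ∑ n ∈ Finset.range L, ‖f n‖ ^ 2 := by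
    rw [Finset.sum_subset (s₂ := Finset.range L)]
    · apply Finset.sum_congr rfl
      intro n hn
      rw [hFc, if_pos (Finset.mem_range.1 hn)]
    · intro n hn
      rw [Polynomial.mem_support_iff, hFc] at hn
      by_contra hcon
      simp only [Finset.mem_range] at hcon
      rw [if_neg hcon] at hn; exact hn rfl
    · intro n _ hn
      rw [Polynomial.notMem_support_iff.1 hn]; simp
  have e2 : ∑ n ∈ Finset.range L, ‖cvl (fun k => (r : ℂ) ^ k * bc z k) f n‖ ^ 2 ≤ ∑ i ∈ (A * F).support, ‖(A * F).coeff i‖ ^ 2 := by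
    calc _ = ∑ n ∈ Finset.range L, ‖(A * F).coeff n‖ ^ 2 := by
          apply Finset.sum_congr rfl
          intro n hn
          have hn := Finset.mem_range.1 hn
          congr 2
          rw [mul_comm A F, Polynomial.coeff_mul, Finset.Nat.sum_antidiagonal_eq_sum_range_succ_mk, cvl]
          apply Finset.sum_congr rfl
          intro j hj
          have hj := Finset.mem_range.1 hj
          simp only
          rw [hFc, hAc, if_pos (by omega), if_pos (by omega)]; ring
      _ = ∑ n ∈ (Finset.range L).filter (fun n => n ∈ (A * F).support), ‖(A * F).coeff n‖ ^ 2 := by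
          rw [Finset.sum_filter]
          apply Finset.sum_congr rfl
          intro n _
          split_ifs with h
          · rfl
          · rw [Polynomial.notMem_support_iff.1 h]; simp
      _ ≤ _ := by
          apply Finset.sum_le_sum_of_subset_of_nonneg
          · intro n hn; exact (Finset.mem_filter.1 hn).2
          · intros; positivity
  refine e2.trans ?_
  rw [← e1, parsF, parsAF, ← smul_eq_mul (a := (2 * rexp (4 + y ^ 2)) ^ 2), ← circleAverage_smul]
  apply circleAverage_mono
  · apply ContinuousOn.circleIntegrable'
    exact ((A * F).continuous.norm.pow 2).continuousOn
  · apply ContinuousOn.circleIntegrable'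
    exact ((F.continuous.norm.pow 2).const_smul _).continuousOn
  · intro w hw
    have hw1 : ‖w‖ = 1 := by simpa using hw
    simp only [Polynomial.eval_mul, norm_mul, mul_pow, Pi.smul_apply, smul_eq_mul]
    apply mul_le_mul_of_nonneg_right _ (by positivity)
    have := pow_le_pow_left₀ (norm_nonneg _) (hsup w hw1) 2
    rw [mul_pow] at this
    exact this

lemma bil_kernel (q q' : ℝ) (hq : q.HolderConjugate q') : ∃ C : ℝ, 0 < C ∧ ∀ (r y : ℝ), 0 ≤ r → r < 1 →  
    ∀ L (g F : ℕ → ℂ), ‖∑ n ∈ Finset.range L, cvl (fun k => (r : ℂ) ^ k * bc (y * Complex.I) k) g n * F n‖ ≤ 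
      C * Real.exp (2 * y ^ 2) * (∑ n ∈ Finset.range L, ‖g n‖ ^ q) ^ (1 / q) * (∑ n ∈ Finset.range L, ‖F n‖ ^ q') ^ (1 / q') := by
  obtain ⟨C, hC, h⟩ := bil_all q q' hq
  refine ⟨C * (2 * Real.exp 4), by positivity, ?_⟩
  intro r y hr hr1 L g F
  set K : ℝ := 2 * Real.exp 4 * Real.exp (2 * y ^ 2) with hK
  have hK0 : 0 < K := by positivity
  have hK1 : 2 * Real.exp (2 * y ^ 2) ≤ K := by
    rw [hK]
    have := Real.one_le_exp (show (0:ℝ) ≤ 4 by norm_num)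
    have h2 := Real.exp_pos (2 * y ^ 2)
    nlinarith
  have hK2 : 2 * Real.exp (4 + y ^ 2) ≤ K := by
    rw [hK, mul_assoc, ← Real.exp_add]
    have : Real.exp (4 + y ^ 2) ≤ Real.exp (4 + 2 * y ^ 2) := by
      apply Real.exp_le_exp.2; nlinarith [sq_nonneg y]
    linarith
  set a : ℕ → ℂ := fun k => (r : ℂ) ^ k * bc (y * Complex.I) k with ha
  have hcv : ∀ f n, cvl (fun k => a k / K) f n = cvl a f n / K := by
    intro f n
    simp only [cvl, Finset.sum_div]
    apply Finset.sum_congr rfl; intro j _; ring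
  have hKn : ‖(K:ℂ)‖ = K := by rw [Complex.norm_real, Real.norm_eq_abs, abs_of_pos hK0]
  have ks : KSm (fun k => a k / K) := by
    intro k hk
    rw [← sub_div, norm_div, hKn, div_le_iff₀ hK0]
    refine (ker_diff y r hr hr1 k hk).trans ?_
    rw [mul_comm]
    exact mul_le_mul_of_nonneg_left hK1 (by positivity)
  have kl : KL2 (fun k => a k / K) := by
    intro L f
    have := ker_l2 y r hr hr1 L f
    simp only [hcv, norm_div, hKn, div_pow, ← Finset.sum_div]
    rw [div_le_iff₀ (by positivity), mul_comm]
    refine this.trans ?_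
    apply mul_le_mul_of_nonneg_right _ (by positivity)
    exact pow_le_pow_left₀ (by positivity) hK2 2
  have := h _ ks kl L g F
  simp only [hcv] at this
  have e : ∑ n ∈ Finset.range L, cvl a g n / K * F n = (∑ n ∈ Finset.range L, cvl a g n * F n) / K := by
    rw [Finset.sum_div]; apply Finset.sum_congr rfl; intro n _; ring
  rw [e, norm_div, hKn, div_le_iff₀ hK0] at this
  refine this.trans (le_of_eq ?_)
  rw [hK]; ring

/-- weighted l^q norm on a finite type -/
def nL {X : Type*} [Fintype X] (q : ℝ) (μ : X → ℝ) (f : X → ℂ) : ℝ := (∑ x, μ x * ‖f x‖ ^ q) ^ (1 / q)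

lemma nL_nonneg {X : Type*} [Fintype X] (q : ℝ) (μ : X → ℝ) (hμ : ∀ x, 0 ≤ μ x) (f : X → ℂ) : 0 ≤ nL q μ f := by
  apply Real.rpow_nonneg
  apply Finset.sum_nonneg
  intro x _
  exact mul_nonneg (hμ x) (by positivity)

lemma nL_pow {X : Type*} [Fintype X] (q : ℝ) (hq : 0 < q) (μ : X → ℝ) (hμ : ∀ x, 0 ≤ μ x) (f : X → ℂ) : 
    nL q μ f ^ q = ∑ x, μ x * ‖f x‖ ^ q := by
  rw [nL, ← Real.rpow_mul, one_div_mul_cancel hq.ne', Real.rpow_one]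
  apply Finset.sum_nonneg
  intro x _
  exact mul_nonneg (hμ x) (by positivity)

/-- weighted Holder inequality -/
lemma wholder {ι : Type*} (s : Finset ι) (q q' : ℝ) (hq : q.HolderConjugate q') (w a b : ι → ℝ)
    (hw : ∀ i ∈ s, 0 ≤ w i) (ha : ∀ i ∈ s, 0 ≤ a i) (hb : ∀ i ∈ s, 0 ≤ b i) :
    ∑ i ∈ s, w i * (a i * b i) ≤ (∑ i ∈ s, w i * a i ^ q) ^ (1 / q) * (∑ i ∈ s, w i * b i ^ q') ^ (1 / q') := by
  have q0 := hq.pos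
  have q0' := hq.symm.pos
  have := Real.inner_le_Lp_mul_Lq_of_nonneg s (f := fun i => w i ^ (1 / q) * a i) (g := fun i => w i ^ (1 / q') * b i) hq
    (fun i hi => mul_nonneg (Real.rpow_nonneg (hw i hi) _) (ha i hi)) (fun i hi => mul_nonneg (Real.rpow_nonneg (hw i hi) _) (hb i hi))
  have e1 : ∑ i ∈ s, (w i ^ (1 / q) * a i) ^ q = ∑ i ∈ s, w i * a i ^ q := by
    apply Finset.sum_congr rfl
    intro i hi
    rw [Real.mul_rpow (Real.rpow_nonneg (hw i hi) _) (ha i hi), ← Real.rpow_mul (hw i hi), one_div_mul_cancel q0.ne', Real.rpow_one]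
  have e2 : ∑ i ∈ s, (w i ^ (1 / q') * b i) ^ q' = ∑ i ∈ s, w i * b i ^ q' := by
    apply Finset.sum_congr rfl
    intro i hi
    rw [Real.mul_rpow (Real.rpow_nonneg (hw i hi) _) (hb i hi), ← Real.rpow_mul (hw i hi), one_div_mul_cancel q0'.ne', Real.rpow_one]
  rw [e1, e2] at this
  refine le_trans (le_of_eq ?_) this
  apply Finset.sum_congr rfl
  intro i hi
  have : w i = w i ^ (1 / q) * w i ^ (1 / q') := by
    rw [← Real.rpow_add' (hw i hi)]
    · rw [one_div, one_div, hq.inv_add_inv_eq_one, Real.rpow_one]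
    · rw [one_div, one_div, hq.inv_add_inv_eq_one]; norm_num
  calc w i * (a i * b i) = (w i ^ (1 / q) * w i ^ (1 / q')) * (a i * b i) := by rw [← this]
    _ = _ := by ring

lemma nL_holder {X : Type*} [Fintype X] (q q' : ℝ) (hq : q.HolderConjugate q') (μ : X → ℝ) (hμ : ∀ x, 0 ≤ μ x) (g f : X → ℂ) :
    ‖∑ x, (μ x : ℂ) * (g x * f x)‖ ≤ nL q μ g * nL q' μ f := by
  refine (norm_sum_le _ _).trans ?_
  have := wholder Finset.univ q q' hq μ (fun x => ‖g x‖) (fun x => ‖f x‖) (fun x _ => hμ x) (fun _ _ => norm_nonneg _) (fun _ _ => norm_nonneg _)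
  refine le_trans (le_of_eq ?_) this
  apply Finset.sum_congr rfl
  intro x _
  rw [norm_mul, norm_mul, Complex.norm_real, Real.norm_eq_abs, abs_of_nonneg (hμ x)]

/-- operator of a real matrix -/
def mop {X : Type*} [Fintype X] (R : X → X → ℝ) : (X → ℂ) →L[ℂ] (X → ℂ) :=
  LinearMap.toContinuousLinearMap 
    { toFun := fun f x => ∑ y, (R x y : ℂ) * f y
      map_add' := by intro f g; ext x; simp [mul_add, Finset.sum_add_distrib]
      map_smul' := by intro c f; ext x; simp [Finset.mul_sum]; apply Finset.sum_congr rfl; intro y _; ring }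

lemma mop_apply {X : Type*} [Fintype X] (R : X → X → ℝ) (f : X → ℂ) (x : X) : mop R f x = ∑ y, (R x y : ℂ) * f y := rfl

/-- stochastic with invariant weight -/
structure Sto {X : Type*} [Fintype X] (μ : X → ℝ) (R : X → X → ℝ) : Prop where
  mu : ∀ x, 0 ≤ μ x
  nn : ∀ x y, 0 ≤ R x y
  row : ∀ x, ∑ y, R x y = 1
  inv : ∀ y, ∑ x, μ x * R x y = μ y

lemma mop_norm {X : Type*} [Fintype X] {μ : X → ℝ} {R : X → X → ℝ} (h : Sto μ R) : ‖mop R‖ ≤ 1 := by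
  apply ContinuousLinearMap.opNorm_le_bound _ zero_le_one
  intro f
  rw [one_mul, pi_norm_le_iff_of_nonneg (norm_nonneg _)]
  intro x
  rw [mop_apply]
  refine (norm_sum_le _ _).trans ?_
  calc _ ≤ ∑ y, R x y * ‖f‖ := by
        apply Finset.sum_le_sum
        intro y _
        rw [norm_mul, Complex.norm_real, Real.norm_eq_abs, abs_of_nonneg (h.nn x y)]
        exact mul_le_mul_of_nonneg_left (norm_le_pi_norm f y) (h.nn x y)
    _ = _ := by rw [← Finset.sum_mul, h.row, one_mul]

lemma mop_inv {X : Type*} [Fintype X] {μ : X → ℝ} {R : X → X → ℝ} (h : Sto μ R) (f : X → ℂ) : 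
    ∑ x, (μ x : ℂ) * mop R f x = ∑ x, (μ x : ℂ) * f x := by
  simp only [mop_apply, Finset.mul_sum]
  rw [Finset.sum_comm]
  apply Finset.sum_congr rfl
  intro y _
  rw [← h.inv y]
  push_cast
  rw [Finset.sum_mul]
  apply Finset.sum_congr rfl; intro x _; ring

/-- path space representation -/
lemma paths {X : Type} [Fintype X] {μ : X → ℝ} {R : X → X → ℝ} (h : Sto μ R) (n : ℕ) : 
    ∃ (ι : Type) (_ : Fintype ι) (W : ι → ℝ) (P : ι → ℕ → X), (∀ i, 0 ≤ W i) ∧ 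
      ∀ j m : ℕ, j ≤ m → m ≤ n → ∀ g f : X → ℂ, 
        ∑ i, (W i : ℂ) * (g (P i j) * f (P i m)) = ∑ x, (μ x : ℂ) * (g x * ((mop R) ^ (m - j)) f x) := by
  classical
  induction n with
  | zero => 
    refine ⟨X, inferInstance, μ, fun x _ => x, h.mu, ?_⟩
    intro j m hjm hm g f
    obtain rfl : m = 0 := by omega
    obtain rfl : j = 0 := by omega
    simp
  | succ n ih =>
    obtain ⟨ι, _, W, P, hW, hP⟩ := ih
    refine ⟨ι × X, inferInstance, fun i => W i.1 * R (P i.1 n) i.2, fun i => Function.update (P i.1) (n + 1) i.2, ?_, ?_⟩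
    · intro i; exact mul_nonneg (hW _) (h.nn _ _)
    · intro j m hjm hm g f
      rw [Fintype.sum_prod_type]
      rcases Nat.lt_or_ge m (n + 1) with hm' | hm'
      · have e : ∀ i : ι, ∑ y, ((W i * R (P i n) y : ℝ) : ℂ) * (g (Function.update (P i) (n + 1) y j) * f (Function.update (P i) (n + 1) y m)) = 
            (W i : ℂ) * (g (P i j) * f (P i m)) := by
          intro i
          have : ∀ y, g (Function.update (P i) (n + 1) y j) * f (Function.update (P i) (n + 1) y m) = g (P i j) * f (P i m) := by
            intro y
            rw [Function.update_of_ne (by omega), Function.update_of_ne (by omega)]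
          simp only [this]
          rw [← Finset.sum_mul]
          congr 1
          push_cast
          rw [← Finset.mul_sum]
          have := h.row (P i n)
          have h2 : ∑ y, (R (P i n) y : ℂ) = 1 := by exact_mod_cast this
          rw [h2, mul_one]
        simp only [e]
        exact hP j m hjm (by omega) g f
      · obtain rfl : m = n + 1 := by omega
        rcases Nat.lt_or_ge j (n + 1) with hj | hj
        · have e : ∀ i : ι, ∑ y, ((W i * R (P i n) y : ℝ) : ℂ) * (g (Function.update (P i) (n + 1) y j) * f (Function.update (P i) (n + 1) y (n + 1))) = 
            (W i : ℂ) * (g (P i j) * (mop R f) (P i n)) := by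
            intro i
            simp only [Function.update_self, mop_apply, Finset.mul_sum]
            apply Finset.sum_congr rfl
            intro y _
            rw [Function.update_of_ne (by omega)]
            push_cast; ring
          simp only [e]
          rw [hP j n (by omega) le_rfl g (mop R f)]
          rw [show n + 1 - j = (n - j) + 1 by omega, pow_succ]
          rfl
        · obtain rfl : j = n + 1 := by omega
          have e : ∀ i : ι, ∑ y, ((W i * R (P i n) y : ℝ) : ℂ) * (g (Function.update (P i) (n + 1) y (n + 1)) * f (Function.update (P i) (n + 1) y (n + 1))) = 
            (W i : ℂ) * ((fun _ => (1:ℂ)) (P i n) * (mop R (fun x => g x * f x)) (P i n)) := by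
            intro i
            simp only [Function.update_self, mop_apply, Finset.mul_sum]
            apply Finset.sum_congr rfl
            intro y _
            push_cast; ring
          simp only [e]
          rw [hP n n le_rfl le_rfl (fun _ => 1) (mop R (fun x => g x * f x))]
          simp only [Nat.sub_self, pow_zero, one_mul, ContinuousLinearMap.one_apply]
          rw [mop_inv h]

/-- power of an operator of the form `(1 - r R)^z` -/
def FR {X : Type*} [Fintype X] (R : X → X → ℝ) (r : ℝ) (z : ℂ) : (X → ℂ) →L[ℂ] (X → ℂ) := 
  ∑' k : ℕ, ((r : ℂ) ^ k * bc z k) • (mop R) ^ k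

lemma coef_summable (r : ℝ) (hr : 0 ≤ r) (hr1 : r < 1) (n : ℕ) : Summable (fun k : ℕ => r ^ k * ((k : ℝ) + 1) ^ n) := by
  have h := summable_pow_mul_geometric_of_norm_lt_one (R := ℝ) n (r := r) (by rw [Real.norm_eq_abs, abs_of_nonneg hr]; exact hr1)
  rcases hr.eq_or_lt with h0 | h0
  · subst h0
    apply summable_of_finite_support
    apply (Set.finite_singleton 0).subset
    intro k hk
    simp only [Function.mem_support] at hk
    by_contra hcon
    simp only [Set.mem_singleton_iff] at hcon
    apply hk
    rw [zero_pow hcon, zero_mul]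
  have h2 := ((summable_nat_add_iff 1).2 h).mul_left (r⁻¹)
  have e : (fun k : ℕ => r ^ k * ((k : ℝ) + 1) ^ n) = fun k : ℕ => r⁻¹ * (((k + 1 : ℕ) : ℝ) ^ n * r ^ (k + 1)) := by
    ext k
    push_cast
    rw [pow_succ]
    field_simp
  rw [e]
  exact h2

lemma mop_pow_norm {X : Type*} [Fintype X] {μ : X → ℝ} {R : X → X → ℝ} (h : Sto μ R) (k : ℕ) : ‖(mop R) ^ k‖ ≤ 1 := by
  rcases Nat.eq_zero_or_pos k with h0 | h0
  · subst h0; rw [pow_zero]; exact ContinuousLinearMap.norm_id_le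
  · exact (norm_pow_le' _ h0).trans (pow_le_one₀ (norm_nonneg _) (mop_norm h))

lemma FR_term_bound {X : Type*} [Fintype X] {μ : X → ℝ} {R : X → X → ℝ} (h : Sto μ R) (r : ℝ) (hr : 0 ≤ r) (z : ℂ) (n : ℕ) (hz : ‖z‖ ≤ n) (k : ℕ) :
    ‖((r : ℂ) ^ k * bc z k) • (mop R) ^ k‖ ≤ r ^ k * ((k : ℝ) + 1) ^ n := by
  rw [norm_smul, norm_mul, norm_pow, Complex.norm_real, Real.norm_eq_abs, abs_of_nonneg hr]
  calc _ ≤ (r ^ k * ((k : ℝ) + 1) ^ n) * 1 := by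
        apply mul_le_mul _ (mop_pow_norm h k) (norm_nonneg _) (by positivity)
        exact mul_le_mul_of_nonneg_left (bc_growth z n hz k) (by positivity)
    _ = _ := mul_one _

lemma FR_summable {X : Type*} [Fintype X] {μ : X → ℝ} {R : X → X → ℝ} (h : Sto μ R) (r : ℝ) (hr : 0 ≤ r) (hr1 : r < 1) (z : ℂ) :
    Summable (fun k : ℕ => ‖((r : ℂ) ^ k * bc z k) • (mop R) ^ k‖) := by
  obtain ⟨n, hn⟩ := exists_nat_ge ‖z‖
  exact Summable.of_nonneg_of_le (fun _ => norm_nonneg _) (FR_term_bound h r hr z n hn) (coef_summable r hr hr1 n)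

/-- transference -/
lemma transf (q q' : ℝ) (hq : q.HolderConjugate q') : ∃ C : ℝ, 0 < C ∧ ∀ (X : Type) [Fintype X] (μ : X → ℝ) (R : X → X → ℝ), Sto μ R → 
    ∀ (r y : ℝ), 0 ≤ r → r < 1 → ∀ g f : X → ℂ, 
    ‖∑ x, (μ x : ℂ) * (g x * FR R r (y * Complex.I) f x)‖ ≤ C * Real.exp (2 * y ^ 2) * nL q μ g * nL q' μ f := by
  obtain ⟨C, hC, hker⟩ := bil_kernel q q' hq
  refine ⟨C, hC, ?_⟩
  intro X _ μ R h r y hr hr1 g f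
  have q0 := hq.pos
  have q0' := hq.symm.pos
  set z : ℂ := y * Complex.I with hz
  set a : ℕ → ℂ := fun k => (r : ℂ) ^ k * bc z k with ha
  set b : ℕ → ℂ := fun k => ∑ x, (μ x : ℂ) * (g x * ((mop R) ^ k) f x) with hb
  set B := C * Real.exp (2 * y ^ 2) * nL q μ g * nL q' μ f with hB
  -- finite estimate
  have fin : ∀ L : ℕ, 0 < L → ‖∑ m ∈ Finset.range L, ∑ k ∈ Finset.range (m + 1), a k * b k‖ ≤ L * B := by
    intro L hL
    obtain ⟨ι, _, W, P, hW, hP⟩ := paths h (L - 1)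
    have marg : ∀ (φ : X → ℝ) (j : ℕ), j < L → ∑ i, W i * φ (P i j) = ∑ x, μ x * φ x := by
      intro φ j hj
      have := hP j j le_rfl (by omega) (fun x => (φ x : ℂ)) (fun _ => 1)
      simp only [Nat.sub_self, pow_zero, mul_one, ContinuousLinearMap.one_apply] at this
      exact_mod_cast this
    have e : ∑ m ∈ Finset.range L, ∑ k ∈ Finset.range (m + 1), a k * b k = 
        ∑ i, (W i : ℂ) * ∑ m ∈ Finset.range L, cvl a (fun j => g (P i j)) m * f (P i m) := by
      simp only [cvl, Finset.sum_mul, Finset.mul_sum]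
      rw [Finset.sum_comm]
      apply Finset.sum_congr rfl
      intro m hm
      have hm := Finset.mem_range.1 hm
      rw [Finset.sum_comm, ← Finset.sum_range_reflect]
      apply Finset.sum_congr rfl
      intro j hj
      have hj := Finset.mem_range.1 hj
      have := hP j m (by omega) (by omega) g f
      rw [show m + 1 - 1 - j = m - j by omega]
      rw [hb]
      simp only
      rw [← this, Finset.mul_sum]
      apply Finset.sum_congr rfl
      intro i _
      ring
    rw [e]
    refine (norm_sum_le _ _).trans ?_
    calc _ ≤ ∑ i, W i * ((C * Real.exp (2 * y ^ 2)) * ((∑ n ∈ Finset.range L, ‖g (P i n)‖ ^ q) ^ (1 / q) * (∑ n ∈ Finset.range L, ‖f (P i n)‖ ^ q') ^ (1 / q'))) := by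
          apply Finset.sum_le_sum
          intro i _
          rw [norm_mul, Complex.norm_real, Real.norm_eq_abs, abs_of_nonneg (hW i)]
          apply mul_le_mul_of_nonneg_left _ (hW i)
          have := hker r y hr hr1 L (fun j => g (P i j)) (fun m => f (P i m))
          rw [← mul_assoc]
          exact this
      _ = (C * Real.exp (2 * y ^ 2)) * ∑ i, W i * ((∑ n ∈ Finset.range L, ‖g (P i n)‖ ^ q) ^ (1 / q) * (∑ n ∈ Finset.range L, ‖f (P i n)‖ ^ q') ^ (1 / q')) := by
          rw [Finset.mul_sum]; apply Finset.sum_congr rfl; intro i _; ring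
      _ ≤ (C * Real.exp (2 * y ^ 2)) * ((∑ i, W i * ((∑ n ∈ Finset.range L, ‖g (P i n)‖ ^ q) ^ (1 / q)) ^ q) ^ (1 / q) * (∑ i, W i * ((∑ n ∈ Finset.range L, ‖f (P i n)‖ ^ q') ^ (1 / q')) ^ q') ^ (1 / q')) := by
          apply mul_le_mul_of_nonneg_left _ (by positivity)
          apply wholder _ q q' hq
          · intro i _; exact hW i
          · intro i _; positivity
          · intro i _; positivity
      _ = (C * Real.exp (2 * y ^ 2)) * (((L : ℝ) * ∑ x, μ x * ‖g x‖ ^ q) ^ (1 / q) * ((L : ℝ) * ∑ x, μ x * ‖f x‖ ^ q') ^ (1 / q')) := by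
          congr 3
          · congr 1
            calc _ = ∑ i, W i * ∑ n ∈ Finset.range L, ‖g (P i n)‖ ^ q := by
                  apply Finset.sum_congr rfl
                  intro i _
                  rw [← Real.rpow_mul (by positivity), one_div_mul_cancel q0.ne', Real.rpow_one]
              _ = ∑ n ∈ Finset.range L, ∑ i, W i * ‖g (P i n)‖ ^ q := by
                  simp only [Finset.mul_sum]; rw [Finset.sum_comm]
              _ = ∑ n ∈ Finset.range L, ∑ x, μ x * ‖g x‖ ^ q := by
                  apply Finset.sum_congr rfl
                  intro n hn
                  exact marg (fun x => ‖g x‖ ^ q) n (Finset.mem_range.1 hn)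
              _ = _ := by simp
          · congr 1
            calc _ = ∑ i, W i * ∑ n ∈ Finset.range L, ‖f (P i n)‖ ^ q' := by
                  apply Finset.sum_congr rfl
                  intro i _
                  rw [← Real.rpow_mul (by positivity), one_div_mul_cancel q0'.ne', Real.rpow_one]
              _ = ∑ n ∈ Finset.range L, ∑ i, W i * ‖f (P i n)‖ ^ q' := by
                  simp only [Finset.mul_sum]; rw [Finset.sum_comm]
              _ = ∑ n ∈ Finset.range L, ∑ x, μ x * ‖f x‖ ^ q' := by
                  apply Finset.sum_congr rfl
                  intro n hn
                  exact marg (fun x => ‖f x‖ ^ q') n (Finset.mem_range.1 hn)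
              _ = _ := by simp
      _ = _ := by
          have n1 : 0 ≤ ∑ x, μ x * ‖g x‖ ^ q := Finset.sum_nonneg fun x _ => mul_nonneg (h.mu x) (by positivity)
          have n2 : 0 ≤ ∑ x, μ x * ‖f x‖ ^ q' := Finset.sum_nonneg fun x _ => mul_nonneg (h.mu x) (by positivity)
          rw [Real.mul_rpow (by positivity) n1, Real.mul_rpow (by positivity) n2, hB, nL, nL]
          have : (L : ℝ) = (L : ℝ) ^ (1 / q) * (L : ℝ) ^ (1 / q') := by
            rw [← Real.rpow_add (by exact_mod_cast hL), one_div, one_div, hq.inv_add_inv_eq_one, Real.rpow_one]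
          conv_rhs => rw [this]
          ring
  -- limit
  have hsum : HasSum (fun k => a k * b k) (∑ x, (μ x : ℂ) * (g x * FR R r z f x)) := by
    have h1 : HasSum (fun k => ((r : ℂ) ^ k * bc z k) • (mop R) ^ k) (FR R r z) := (FR_summable h r hr hr1 z).of_norm.hasSum
    have h2 : ∀ x, HasSum (fun k => ((r : ℂ) ^ k * bc z k) * ((mop R) ^ k) f x) (FR R r z f x) := by
      intro x
      have h3 := h1.mapL ((ContinuousLinearMap.proj (R := ℂ) (φ := fun _ : X => ℂ) x).comp (ContinuousLinearMap.apply ℂ (X → ℂ) f))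
      simpa using h3
    have h4 := hasSum_sum (s := Finset.univ) (fun x _ => ((h2 x).mul_left (g x)).mul_left (μ x : ℂ))
    convert! h4 using 2 with k
    rw [hb, ha]
    simp only [Finset.mul_sum]
    apply Finset.sum_congr rfl; intro x _; ring
  have lim := hsum.tendsto_sum_nat
  have lim2 := (Filter.tendsto_add_atTop_iff_nat 1).2 lim
  have ces := lim2.cesaro_smul
  have hle : ∀ᶠ L : ℕ in Filter.atTop, ‖(L⁻¹ : ℝ) • ∑ i ∈ Finset.range L, ∑ k ∈ Finset.range (i + 1), a k * b k‖ ≤ B := by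
    filter_upwards [Filter.eventually_gt_atTop 0] with L hL
    have hL0 : (0:ℝ) < L := by exact_mod_cast hL
    rw [norm_smul, Real.norm_eq_abs, abs_of_nonneg (by positivity), inv_mul_le_iff₀ hL0]
    exact fin L hL
  exact le_of_tendsto ces.norm hle

section generic
variable {E : Type*} [NormedAddCommGroup E] [NormedSpace ℂ E]

/-- generic version -/
def FRo (A : E →L[ℂ] E) (r : ℝ) (z : ℂ) : E →L[ℂ] E := ∑' k : ℕ, ((r : ℂ) ^ k * bc z k) • A ^ k

lemma FRo_add [CompleteSpace E] (A : E →L[ℂ] E) (r : ℝ) (z w : ℂ) (h1 : Summable (fun k : ℕ => ‖((r : ℂ) ^ k * bc z k) • A ^ k‖))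
    (h2 : Summable (fun k : ℕ => ‖((r : ℂ) ^ k * bc w k) • A ^ k‖)) :
    FRo A r (z + w) = FRo A r z * FRo A r w := by
  rw [FRo, FRo, FRo, tsum_mul_tsum_eq_tsum_sum_antidiagonal_of_summable_norm h1 h2]
  congr 1
  ext1 n
  rw [← bc_add, Finset.mul_sum, Finset.sum_smul]
  apply Finset.sum_congr rfl
  intro x hx
  have hx : x.1 + x.2 = n := by simpa using hx
  rw [smul_mul_smul_comm, ← pow_add, hx, ← hx, pow_add]
  congr 1
  ring

lemma FRo_zero (A : E →L[ℂ] E) (r : ℝ) : FRo A r 0 = 1 := by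
  have hb : ∀ k : ℕ, bc 0 (k + 1) = 0 := by
    intro k
    induction k with
    | zero => simp [bc_succ]
    | succ k ih => rw [bc_succ, ih, zero_mul]
  rw [FRo, tsum_eq_single 0]
  · simp [bc_zero]
  · intro k hk
    obtain ⟨j, rfl⟩ := Nat.exists_eq_succ_of_ne_zero hk
    simp [hb]

lemma FRo_one (A : E →L[ℂ] E) (r : ℝ) : FRo A r 1 = 1 - (r : ℂ) • A := by
  have hb : ∀ k : ℕ, bc 1 (k + 2) = 0 := by
    intro k
    induction k with
    | zero => simp [bc_succ]
    | succ k ih => rw [bc_succ, ih, zero_mul]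
  rw [FRo, tsum_eq_sum (s := {0, 1})]
  · rw [Finset.sum_pair (by norm_num)]
    simp [bc_zero, bc_succ, sub_eq_add_neg]
  · intro k hk
    simp only [Finset.mem_insert, Finset.mem_singleton, not_or] at hk
    obtain ⟨j, rfl⟩ : ∃ j, k = j + 2 := ⟨k - 2, by omega⟩
    simp [hb]

lemma FRo_commute (A B : E →L[ℂ] E) (hc : Commute A B) (r : ℝ) (z w : ℂ) :
    Commute (FRo A r z) (FRo B r w) := by
  rw [FRo, FRo]
  apply Commute.tsum_right
  intro i
  apply Commute.tsum_left
  intro j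
  exact ((hc.pow_pow j i).smul_left _).smul_right _
end generic

lemma FR_add {X : Type*} [Fintype X] {μ : X → ℝ} {R : X → X → ℝ} (h : Sto μ R) (r : ℝ) (hr : 0 ≤ r) (hr1 : r < 1) (z w : ℂ) :
    FR R r (z + w) = FR R r z * FR R r w := 
  FRo_add (mop R) r z w (FR_summable h r hr hr1 z) (FR_summable h r hr hr1 w)

lemma FR_zero {X : Type*} [Fintype X] (R : X → X → ℝ) (r : ℝ) : FR R r 0 = 1 := FRo_zero _ _

lemma FR_one {X : Type*} [Fintype X] (R : X → X → ℝ) (r : ℝ) (f : X → ℂ) (x : X) : FR R r 1 f x = f x - r * mop R f x := by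
  have : FR R r 1 = FRo (mop R) r 1 := rfl
  rw [this, FRo_one]; rfl

lemma FR_commute {X : Type*} [Fintype X] (S R : X → X → ℝ) (hc : Commute (mop S) (mop R)) (r : ℝ) (z w : ℂ) :
    Commute (FR S r z) (FR R r w) := FRo_commute _ _ hc _ _ _

lemma bc_differentiable (k : ℕ) : Differentiable ℂ (fun z => bc z k) := by
  induction k with
  | zero => simp only [bc_zero]; fun_prop
  | succ k ih => simp only [bc_succ]; fun_prop

lemma FR_differentiable {X : Type*} [Fintype X] {μ : X → ℝ} {R : X → X → ℝ} (h : Sto μ R) (r : ℝ) (hr : 0 ≤ r) (hr1 : r < 1) :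
    Differentiable ℂ (FR R r) := by
  intro z
  obtain ⟨n, hn⟩ := exists_nat_gt ‖z‖
  have := Complex.differentiableOn_tsum_of_summable_norm (U := Metric.ball (0:ℂ) n) (coef_summable r hr hr1 n)
    (F := fun k z => ((r : ℂ) ^ k * bc z k) • (mop R) ^ k) ?_ Metric.isOpen_ball ?_
  · exact (this z (by simpa using hn)).differentiableAt (Metric.isOpen_ball.mem_nhds (by simpa using hn))
  · intro k
    have := bc_differentiable k
    apply Differentiable.differentiableOn
    fun_prop
  · intro k w hw
    apply FR_term_bound h r hr
    exact (by simpa using hw : ‖w‖ < n).le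

lemma FR_bound {X : Type*} [Fintype X] {μ : X → ℝ} {R : X → X → ℝ} (h : Sto μ R) (r : ℝ) (hr : 0 ≤ r) (hr1 : r < 1) :
    ∃ β : ℝ, 0 ≤ β ∧ ∀ z, ‖FR R r z‖ ≤ Real.exp (β * (‖z‖ + 1)) := by
  set B := ∑' k : ℕ, r ^ k * ((k : ℝ) + 1) ^ 1 with hB
  have B0 : 0 ≤ B := tsum_nonneg fun k => by positivity
  have h1 : ∀ z : ℂ, ‖z‖ ≤ 1 → ‖FR R r z‖ ≤ B := by
    intro z hz
    exact tsum_of_norm_bounded (coef_summable r hr hr1 1).hasSum (FR_term_bound h r hr z 1 (by simpa using hz))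
  have B1 : B ≤ Real.exp B := by linarith [Real.add_one_le_exp B]
  refine ⟨B, B0, ?_⟩
  intro z
  have key : ∀ (n : ℕ) (w : ℂ), ‖w‖ ≤ 1 → ‖FR R r ((n + 1) * w)‖ ≤ Real.exp B ^ (n + 1) := by
    intro n w hw
    induction n with
    | zero => simp; exact (h1 w hw).trans B1
    | succ n ih =>
      have : (((n + 1 : ℕ) : ℂ) + 1) * w = (n + 1) * w + w := by push_cast; ring
      rw [this, FR_add h r hr hr1, pow_succ]
      exact (norm_mul_le _ _).trans (mul_le_mul ih ((h1 w hw).trans B1) (norm_nonneg _) (by positivity))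
  set n := ⌊‖z‖⌋₊ with hn
  have n1 : ((n : ℂ) + 1) ≠ 0 := by exact_mod_cast Nat.succ_ne_zero n
  have := key n (z / (n + 1)) (by
    rw [norm_div]
    have : ‖(n : ℂ) + 1‖ = (n : ℝ) + 1 := by exact_mod_cast Complex.norm_natCast (n + 1)
    rw [this, div_le_one (by positivity)]
    exact (Nat.lt_floor_add_one _).le)
  rw [mul_div_cancel₀ _ n1] at this
  refine this.trans ?_
  rw [← Real.exp_nat_mul]
  apply Real.exp_le_exp.2
  push_cast
  have : (n : ℝ) ≤ ‖z‖ := Nat.floor_le (norm_nonneg _)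
  nlinarith

/-- norm from bilinear bounds -/
lemma nL_dual {X : Type*} [Fintype X] (q q' : ℝ) (hq : q.HolderConjugate q') (μ : X → ℝ) (hμ : ∀ x, 0 ≤ μ x) (h : X → ℂ) (A : ℝ)
    (hA : ∀ g : X → ℂ, ‖∑ x, (μ x : ℂ) * (g x * h x)‖ ≤ A * nL q μ g) (A0 : 0 ≤ A) : nL q' μ h ≤ A := by
  have q0 := hq.pos
  have q0' := hq.symm.pos
  set g : X → ℂ := fun x => (starRingEnd ℂ (h x)) * ((‖h x‖ ^ (q' - 2) : ℝ) : ℂ) with hg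
  have e1 : ∀ x, g x * h x = ((‖h x‖ ^ q' : ℝ) : ℂ) := by
    intro x
    rcases eq_or_ne (h x) 0 with h0 | h0
    · simp [hg, h0, Real.zero_rpow q0'.ne']
    · have hn : 0 < ‖h x‖ := norm_pos_iff.2 h0
      calc g x * h x = ((h x) * (starRingEnd ℂ (h x))) * ((‖h x‖ ^ (q' - 2) : ℝ) : ℂ) := by rw [hg]; ring
        _ = ((‖h x‖ ^ 2 * ‖h x‖ ^ (q' - 2) : ℝ) : ℂ) := by rw [Complex.mul_conj, Complex.normSq_eq_norm_sq]; push_cast; ring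
        _ = _ := by
          rw [← Real.rpow_natCast, ← Real.rpow_add hn]; congr 2; push_cast; ring
  have e2 : ∀ x, ‖g x‖ ^ q = ‖h x‖ ^ q' := by
    intro x
    rcases eq_or_ne (h x) 0 with h0 | h0
    · simp [hg, h0, Real.zero_rpow q0'.ne', Real.zero_rpow q0.ne']
    · have hn : 0 < ‖h x‖ := norm_pos_iff.2 h0
      rw [hg]
      simp only [norm_mul, RCLike.norm_conj, Complex.norm_real, Real.norm_eq_abs]
      rw [abs_of_nonneg (by positivity)]
      have : ‖h x‖ * ‖h x‖ ^ (q' - 2) = ‖h x‖ ^ (q' - 1) := by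
        nth_rewrite 1 [← Real.rpow_one ‖h x‖]
        rw [← Real.rpow_add hn]; congr 1; ring
      rw [this, ← Real.rpow_mul hn.le]
      congr 1
      have := hq.symm.sub_one_mul_conj
      linarith
  have := hA g
  simp only [e1] at this
  set s := ∑ x, μ x * ‖h x‖ ^ q' with hs
  have s0 : 0 ≤ s := Finset.sum_nonneg fun x _ => mul_nonneg (hμ x) (by positivity)
  have e3 : ‖∑ x, (μ x : ℂ) * ((‖h x‖ ^ q' : ℝ) : ℂ)‖ = s := by
    have : ∑ x, (μ x : ℂ) * ((‖h x‖ ^ q' : ℝ) : ℂ) = (s : ℂ) := by rw [hs]; push_cast; rfl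
    rw [this, Complex.norm_real, Real.norm_eq_abs, abs_of_nonneg s0]
  rw [e3, nL] at this
  simp only [e2] at this
  rw [← hs] at this
  rw [nL, ← hs]
  rcases s0.eq_or_lt with h0 | h0
  · rw [← h0, Real.zero_rpow (by positivity)]; exact A0
  · have e : s = s ^ (1 / q') * s ^ (1 / q) := by
      rw [← Real.rpow_add h0, one_div, one_div, add_comm, hq.inv_add_inv_eq_one, Real.rpow_one]
    have hpos : 0 < s ^ (1 / q) := by positivity
    exact le_of_mul_le_mul_right (by rw [← e]; exact this) hpos

lemma FR_im_bound (q : ℝ) (hq : 1 < q) : ∃ C : ℝ, 0 < C ∧ ∀ (X : Type) [Fintype X] (μ : X → ℝ) (R : X → X → ℝ), Sto μ R → 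
    ∀ (r y : ℝ), 0 ≤ r → r < 1 → ∀ f : X → ℂ, nL q μ (FR R r (y * Complex.I) f) ≤ C * Real.exp (2 * y ^ 2) * nL q μ f := by
  have hc := (Real.HolderConjugate.conjExponent hq).symm
  obtain ⟨C, C0, hC⟩ := transf _ _ hc
  refine ⟨C, C0, ?_⟩
  intro X _ μ R h r y hr hr1 f
  apply nL_dual _ _ hc μ h.mu
  · intro g
    have := hC X μ R h r y hr hr1 g f
    refine this.trans (le_of_eq ?_)
    ring
  · have := nL_nonneg q μ h.mu f
    positivity

/-- complex powers of a function -/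
def pw {X : Type*} (f : X → ℂ) (w : ℂ) (x : X) : ℂ := if f x = 0 then 0 else (f x / ‖f x‖) * (‖f x‖ : ℂ) ^ w

lemma pw_norm {X : Type*} (f : X → ℂ) (w : ℂ) (hw : 0 < w.re) (x : X) : ‖pw f w x‖ = ‖f x‖ ^ w.re := by
  unfold pw
  split_ifs with h
  · simp [h, Real.zero_rpow hw.ne']
  · have hn : 0 < ‖f x‖ := norm_pos_iff.2 h
    rw [norm_mul, Complex.norm_cpow_eq_rpow_re_of_pos hn, norm_div, Complex.norm_real, norm_norm, div_self hn.ne', one_mul]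

lemma pw_one {X : Type*} (f : X → ℂ) : pw f 1 = f := by
  ext x
  unfold pw
  split_ifs with h
  · exact h.symm
  · have hn : (‖f x‖ : ℂ) ≠ 0 := by exact_mod_cast norm_ne_zero_iff.2 h
    rw [Complex.cpow_one, div_mul_cancel₀ _ hn]

lemma pw_diff {X : Type*} (f : X → ℂ) (x : X) : Differentiable ℂ (fun w => pw f w x) := by
  unfold pw
  split_ifs with h
  · fun_prop
  · have hn : (‖f x‖ : ℂ) ≠ 0 := by exact_mod_cast norm_ne_zero_iff.2 h
    apply Differentiable.const_mul
    intro w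
    exact DifferentiableAt.const_cpow differentiableAt_id (Or.inl hn)

lemma pw_nL {X : Type*} [Fintype X] (μ : X → ℝ) (hμ : ∀ x, 0 ≤ μ x) (f : X → ℂ) (w : ℂ) (p q : ℝ) (hp : 0 < p) (hq : 0 < q) (hw : w.re = p / q)
    (hf : nL p μ f ≤ 1) : nL q μ (pw f w) ≤ 1 := by
  have e : ∀ x, ‖pw f w x‖ ^ q = ‖f x‖ ^ p := by
    intro x
    rw [pw_norm f w (by rw [hw]; positivity), hw, ← Real.rpow_mul (norm_nonneg _), div_mul_cancel₀ _ hq.ne']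
  rw [nL]
  simp only [e]
  have h1 := nL_pow p hp μ hμ f
  have h2 : nL p μ f ^ p ≤ 1 := Real.rpow_le_one (nL_nonneg _ _ hμ _) hf hp.le
  rw [h1] at h2
  apply Real.rpow_le_one _ h2 (by positivity)
  apply Finset.sum_nonneg
  intro x _
  exact mul_nonneg (hμ x) (by positivity)

lemma interp_exp (p : ℝ) (hp : 1 < p) : ∃ k : ℕ, 2 ≤ k ∧ ∃ q : ℝ, 1 < q ∧ 1 / p = (1 - 1 / (k : ℝ)) / q + (1 / (k : ℝ)) / 2 := by
  have e0 : 0 < min (1 / p) (1 - 1 / p) := by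
    apply lt_min (by positivity)
    rw [sub_pos, div_lt_one (by linarith)]; exact hp
  obtain ⟨k, hk⟩ := exists_nat_gt (1 / min (1 / p) (1 - 1 / p))
  set e := min (1 / p) (1 - 1 / p)
  have he1 : e ≤ 1 / p := min_le_left _ _
  have he2 : e ≤ 1 - 1 / p := min_le_right _ _
  have k0 : (0:ℝ) < k := lt_trans (by positivity) hk
  have hk1 : 1 / (k : ℝ) < e := by
    rw [div_lt_iff₀ e0] at hk
    rw [div_lt_iff₀ k0]; linarith
  have k2 : 2 ≤ k := by
    by_contra hcon
    have : k ≤ 1 := by omega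
    have : (k : ℝ) ≤ 1 := by exact_mod_cast this
    have : 1 ≤ 1 / (k : ℝ) := by rw [le_div_iff₀ k0]; linarith
    linarith
  refine ⟨k, k2, (1 - 1 / (k : ℝ)) / (1 / p - (1 / (k : ℝ)) / 2), ?_, ?_⟩
  · have : (0:ℝ) < 1 / k := by positivity
    rw [lt_div_iff₀ (by linarith)]
    linarith
  · have : (0:ℝ) < 1 / k := by positivity
    rw [div_div_eq_mul_div, mul_div_cancel_left₀]
    · ring
    · linarith

set_option maxHeartbeats 2000000 in
/-- Stein interpolation for a pair of commuting Markov operators -/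
theorem stein (p : ℝ) (hp : 1 < p) (C2 : ℝ) (hC2 : 0 < C2) : ∃ C : ℝ, 0 < C ∧ ∀ (X : Type) [Fintype X] (μ : X → ℝ) (S R : X → X → ℝ), 
    (∀ x, 0 < μ x) → Sto μ S → Sto μ R → Commute (mop S) (mop R) → ∀ r : ℝ, 0 ≤ r → r < 1 → 
    (∀ f : X → ℂ, nL 2 μ (fun x => f x - r * mop S f x) ≤ C2 * nL 2 μ (fun x => f x - r * mop R f x)) → 
    ∀ f : X → ℂ, nL p μ (fun x => f x - r * mop S f x) ≤ C * nL p μ (fun x => f x - r * mop R f x) := by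
  obtain ⟨k, hk, q, hq, hpq⟩ := interp_exp p hp
  obtain ⟨Cq, Cq0, hCq⟩ := FR_im_bound q hq
  obtain ⟨Ct, Ct0, hCt⟩ := FR_im_bound 2 (by norm_num)
  have cp := Real.HolderConjugate.conjExponent hp
  have cq := Real.HolderConjugate.conjExponent hq
  set p' := Real.conjExponent p with hp'
  set q' := Real.conjExponent q with hq'
  set K : ℝ := 4 * (k : ℝ) ^ 2 with hK
  have k0 : (0:ℝ) < k := by exact_mod_cast (by omega : 0 < k)
  have K0 : 0 < K := by positivity
  set A : ℝ := Cq ^ 2 with hA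
  set B : ℝ := Real.exp K * (C2 ^ k * Ct ^ 2) with hB
  have A0 : 0 < A := by positivity
  have B0 : 0 < B := by positivity
  refine ⟨A ^ (1 - 1 / (k : ℝ)) * B ^ (1 / (k : ℝ)), by positivity, ?_⟩
  intro X _ μ S R hμ hS hR hc r hr hr1 h2
  have μ0 : ∀ x, 0 ≤ μ x := fun x => (hμ x).le
  set G : ℂ → ((X → ℂ) →L[ℂ] (X → ℂ)) := fun z => FR S r z * FR R r (-z) with hG
  have Gadd : ∀ z w, G (z + w) = G z * G w := by
    intro z w
    simp only [hG]
    rw [neg_add, FR_add hS r hr hr1, FR_add hR r hr hr1]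
    have := (FR_commute S R hc r w (-z)).eq
    calc _ = FR S r z * (FR S r w * FR R r (-z)) * FR R r (-w) := by simp only [mul_assoc]
      _ = _ := by rw [this]; simp only [mul_assoc]
  have Rinv : ∀ f, FR R r 1 (FR R r (-1) f) = f := by
    intro f
    have : FR R r 1 * FR R r (-1) = 1 := by rw [← FR_add hR r hr hr1, add_neg_cancel, FR_zero]
    calc _ = (FR R r 1 * FR R r (-1)) f := rfl
      _ = _ := by rw [this]; rfl
  have Rinv2 : ∀ f, FR R r (-1) (FR R r 1 f) = f := by
    intro f
    have : FR R r (-1) * FR R r 1 = 1 := by rw [← FR_add hR r hr hr1, neg_add_cancel, FR_zero]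
    calc _ = (FR R r (-1) * FR R r 1) f := rfl
      _ = _ := by rw [this]; rfl
  have G1 : ∀ f, nL 2 μ (G 1 f) ≤ C2 * nL 2 μ f := by
    intro f
    have := h2 (FR R r (-1) f)
    have e1 : (fun x => FR R r (-1) f x - r * mop R (FR R r (-1) f) x) = f := by
      ext x
      rw [← FR_one, Rinv]
    have e2 : (fun x => FR R r (-1) f x - r * mop S (FR R r (-1) f) x) = G 1 f := by
      ext x
      rw [← FR_one]; rfl
    rw [e1, e2] at this
    exact this
  have Gn : ∀ (n : ℕ) (w : ℂ) f, nL 2 μ (G (n + w) f) ≤ C2 ^ n * nL 2 μ (G w f) := by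
    intro n w f
    induction n with
    | zero => simp
    | succ n ih =>
      have : ((n + 1 : ℕ) : ℂ) + w = 1 + (n + w) := by push_cast; ring
      rw [this, Gadd]
      calc _ ≤ C2 * nL 2 μ (G (n + w) f) := G1 _
        _ ≤ C2 * (C2 ^ n * nL 2 μ (G w f)) := mul_le_mul_of_nonneg_left ih hC2.le
        _ = _ := by ring
  have Gim : ∀ (q C : ℝ), (∀ R : X → X → ℝ, Sto μ R → ∀ y f, nL q μ (FR R r ((y : ℝ) * Complex.I) f) ≤ C * Real.exp (2 * y ^ 2) * nL q μ f) → 0 < C → 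
      ∀ (y : ℝ) f, nL q μ (G (y * Complex.I) f) ≤ C ^ 2 * Real.exp (4 * y ^ 2) * nL q μ f := by
    intro q C hC C0 y f
    have h1 := hC S hS y (FR R r (-(y * Complex.I)) f)
    have h2 := hC R hR (-y) f
    rw [Complex.ofReal_neg, neg_mul] at h2
    calc _ ≤ _ := h1
      _ ≤ C * Real.exp (2 * y ^ 2) * (C * Real.exp (2 * (-y) ^ 2) * nL q μ f) := mul_le_mul_of_nonneg_left h2 (by positivity)
      _ = _ := by
        rw [show 4 * y ^ 2 = 2 * y ^ 2 + 2 * y ^ 2 by ring, Real.exp_add, neg_sq]; ring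
  have Gq := Gim q Cq (fun R hR y f => hCq X μ R hR r y hr hr1 f) Cq0
  have Gt := Gim 2 Ct (fun R hR y f => hCt X μ R hR r y hr hr1 f) Ct0
  have Gd : Differentiable ℂ G := by
    intro z
    have d1 := FR_differentiable hS r hr hr1
    have d2 := FR_differentiable hR r hr hr1
    have d3 : Differentiable ℂ (fun z : ℂ => FR R r (-z)) := d2.comp differentiable_neg
    exact (d1 z).mul (d3 z)
  obtain ⟨β1, β10, hβ1⟩ := FR_bound hS r hr hr1
  obtain ⟨β2, β20, hβ2⟩ := FR_bound hR r hr hr1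
  have Gb : ∀ z, ‖G z‖ ≤ Real.exp ((β1 + β2) * (‖z‖ + 1)) := by
    intro z
    calc _ ≤ ‖FR S r z‖ * ‖FR R r (-z)‖ := norm_mul_le _ _
      _ ≤ Real.exp (β1 * (‖z‖ + 1)) * Real.exp (β2 * (‖-z‖ + 1)) := mul_le_mul (hβ1 _) (hβ2 _) (norm_nonneg _) (by positivity)
      _ = _ := by rw [← Real.exp_add, norm_neg]; congr 1; ring
  -- exponents
  have p0 : 0 < p := by linarith
  have q0 : 0 < q := by linarith
  have p0' : 0 < p' := cp.symm.pos
  have q0' : 0 < q' := cq.symm.pos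
  have ip : 1 / p + 1 / p' = 1 := by rw [one_div, one_div]; exact cp.inv_add_inv_eq_one
  have iq : 1 / q + 1 / q' = 1 := by rw [one_div, one_div]; exact cq.inv_add_inv_eq_one
  have hpq' : 1 / p' = (1 - 1 / (k : ℝ)) / q' + (1 / (k : ℝ)) / 2 := by
    have : (1 - 1 / (k : ℝ)) / q' = (1 - 1 / (k : ℝ)) * (1 - 1 / q) := by
      rw [show 1 - 1 / q = 1 / q' by linarith]; ring
    rw [this]
    have h3 : (1 - 1 / (k : ℝ)) / q = (1 - 1 / (k : ℝ)) * (1 / q) := by ring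
    rw [h3] at hpq
    linarith
  set ex : ℝ → ℝ → ℂ → ℂ := fun p q z => (p : ℂ) * ((1 - z) / q + z / 2) with hex
  have ex_re : ∀ p q z, (ex p q z).re = p * ((1 - z.re) / q + z.re / 2) := by
    intro p q z
    simp only [hex]
    rw [Complex.re_ofReal_mul]
    congr 1
    rw [Complex.add_re, Complex.div_ofReal_re]
    congr 1
    have : (2:ℂ) = ((2:ℝ):ℂ) := by norm_num
    rw [this, Complex.div_ofReal_re]
  have ex_th : ∀ p q : ℝ, 0 < p → 1 / p = (1 - 1 / (k : ℝ)) / q + (1 / (k : ℝ)) / 2 → ex p q ((1 / (k : ℝ) : ℝ) : ℂ) = 1 := by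
    intro p q p0 h
    have : ((p * ((1 - 1 / (k : ℝ)) / q + (1 / (k : ℝ)) / 2) : ℝ) : ℂ) = 1 := by
      rw [← h, mul_one_div_cancel p0.ne', Complex.ofReal_one]
    rw [← this]
    simp only [hex]
    push_cast
    ring
  have ex_d : ∀ p q, Differentiable ℂ (ex p q) := by
    intro p q
    simp only [hex]
    fun_prop
  -- the key bilinear bound for normalised functions
  have key : ∀ f g : X → ℂ, nL p μ f ≤ 1 → nL p' μ g ≤ 1 → ‖∑ x, (μ x : ℂ) * (g x * G 1 f x)‖ ≤ A ^ (1 - 1 / (k : ℝ)) * B ^ (1 / (k : ℝ)) := by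
    intro f g hf hg
    set φ : ℂ → ℂ := fun z => Complex.exp (K * z ^ 2) * ∑ x, (μ x : ℂ) * (pw g (ex p' q' z) x * G (k * z) (pw f (ex p q z)) x) with hφ
    have φd : Differentiable ℂ φ := by
      simp only [hφ]
      apply Differentiable.mul
      · fun_prop
      · apply Differentiable.fun_sum
        intro x _
        apply Differentiable.const_mul
        apply Differentiable.mul
        · exact (pw_diff g x).comp (ex_d p' q')
        · have h1 : Differentiable ℂ (fun z : ℂ => G (k * z)) := Gd.comp (by fun_prop)
          have h2 : Differentiable ℂ (fun z : ℂ => pw f (ex p q z)) := by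
            apply differentiable_pi.2
            intro x
            exact (pw_diff f x).comp (ex_d p q)
          exact differentiable_pi.1 (h1.clm_apply h2) x
    have nexp : ∀ z : ℂ, ‖Complex.exp (K * z ^ 2)‖ = Real.exp (K * (z.re ^ 2 - z.im ^ 2)) := by
      intro z
      rw [Complex.norm_exp]
      congr 1
      simp [pow_two]
    have φb : BddAbove ((norm ∘ φ) '' Complex.HadamardThreeLines.verticalClosedStrip 0 1) := by
      have exb : ∀ (p q : ℝ) (h : X → ℂ), 0 < p → 0 < q → ∀ z : ℂ, 0 ≤ z.re → z.re ≤ 1 → ∀ x, ‖pw h (ex p q z) x‖ ≤ (1 + ‖h‖) ^ (p * (1 / q + 1 / 2)) := by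
        intro p q h p0 q0 z z0 z1 x
        have hre : 0 < (1 - z.re) / q + z.re / 2 := by
          rcases z0.eq_or_lt with h0 | h0
          · rw [← h0]; simp [q0]
          · have : 0 ≤ (1 - z.re) / q := div_nonneg (by linarith) q0.le
            linarith
        rw [pw_norm _ _ (by rw [ex_re]; positivity), ex_re]
        calc _ ≤ (1 + ‖h‖) ^ (p * ((1 - z.re) / q + z.re / 2)) := by
              apply Real.rpow_le_rpow (norm_nonneg _) _ (by positivity)
              linarith [norm_le_pi_norm h x]
          _ ≤ _ := by
              apply Real.rpow_le_rpow_of_exponent_le (by linarith [norm_nonneg h])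
              apply mul_le_mul_of_nonneg_left _ p0.le
              have h1 : (1 - z.re) / q ≤ 1 / q := div_le_div_of_nonneg_right (by linarith) q0.le
              linarith
      set Mf := (1 + ‖f‖) ^ (p * (1 / q + 1 / 2)) with hMf
      set Mg := (1 + ‖g‖) ^ (p' * (1 / q' + 1 / 2)) with hMg
      have Mf0 : 0 ≤ Mf := by positivity
      have Mg0 : 0 ≤ Mg := by positivity
      set β := β1 + β2 with hβ
      have β0 : 0 ≤ β := by positivity
      set c := Real.exp (K + β * (k + 1) + (β * k) ^ 2 / (4 * K)) with hcc
      refine ⟨c * ∑ x, μ x * (Mg * Mf), ?_⟩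
      rintro _ ⟨z, ⟨hz0, hz1⟩, rfl⟩
      simp only [Function.comp, hφ]
      rw [norm_mul, nexp]
      have s1 : ‖∑ x, (μ x : ℂ) * (pw g (ex p' q' z) x * G (k * z) (pw f (ex p q z)) x)‖ ≤ ∑ x, μ x * (Mg * (Real.exp (β * (‖(k : ℂ) * z‖ + 1)) * Mf)) := by
        refine (norm_sum_le _ _).trans (Finset.sum_le_sum ?_)
        intro x _
        rw [norm_mul, norm_mul, Complex.norm_real, Real.norm_eq_abs, abs_of_nonneg (μ0 x)]
        apply mul_le_mul_of_nonneg_left _ (μ0 x)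
        apply mul_le_mul (exb p' q' g p0' q0' z hz0 hz1 x) _ (norm_nonneg _) Mg0
        calc _ ≤ ‖G (k * z) (pw f (ex p q z))‖ := norm_le_pi_norm _ x
          _ ≤ ‖G (k * z)‖ * ‖pw f (ex p q z)‖ := ContinuousLinearMap.le_opNorm _ _
          _ ≤ _ := by
            apply mul_le_mul (Gb _) _ (norm_nonneg _) (by positivity)
            rw [pi_norm_le_iff_of_nonneg Mf0]
            exact exb p q f p0 q0 z hz0 hz1
      have nz : ‖(k : ℂ) * z‖ ≤ k * (1 + |z.im|) := by
        rw [norm_mul, Complex.norm_natCast]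
        apply mul_le_mul_of_nonneg_left _ k0.le
        have := Complex.norm_le_abs_re_add_abs_im z
        rw [abs_of_nonneg hz0] at this
        linarith
      calc _ ≤ Real.exp (K * (z.re ^ 2 - z.im ^ 2)) * ∑ x, μ x * (Mg * (Real.exp (β * (‖(k : ℂ) * z‖ + 1)) * Mf)) := 
            mul_le_mul_of_nonneg_left s1 (by positivity)
        _ = Real.exp (K * (z.re ^ 2 - z.im ^ 2) + β * (‖(k : ℂ) * z‖ + 1)) * ∑ x, μ x * (Mg * Mf) := by
            rw [Real.exp_add, Finset.mul_sum, Finset.mul_sum]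
            apply Finset.sum_congr rfl
            intro x _
            ring
        _ ≤ _ := by
            apply mul_le_mul_of_nonneg_right _ (Finset.sum_nonneg fun x _ => mul_nonneg (μ0 x) (by positivity))
            apply Real.exp_le_exp.2
            have h1 : z.re ^ 2 ≤ 1 := by nlinarith
            have h2 : β * (‖(k : ℂ) * z‖ + 1) ≤ β * (k * (1 + |z.im|) + 1) := by
              apply mul_le_mul_of_nonneg_left _ β0; linarith
            have h3 : β * k * |z.im| ≤ K * z.im ^ 2 + (β * k) ^ 2 / (4 * K) := by
              rw [← sq_abs z.im]
              have : 0 ≤ (2 * K * |z.im| - β * k) ^ 2 / (4 * K) := by positivity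
              have e : (2 * K * |z.im| - β * k) ^ 2 / (4 * K) = K * |z.im| ^ 2 + (β * k) ^ 2 / (4 * K) - β * k * |z.im| := by
                field_simp; ring
              linarith
            nlinarith
    have ha : ∀ z ∈ Complex.re ⁻¹' {(0:ℝ)}, ‖φ z‖ ≤ A := by
      intro z hz
      have hz : z.re = 0 := hz
      have hkz : (k : ℂ) * z = ((k * z.im : ℝ) : ℂ) * Complex.I := by
        apply Complex.ext <;> simp [hz]
      have n1 := pw_nL μ μ0 f (ex p q z) p q p0 q0 (by rw [ex_re, hz]; ring) hf
      have n2 := pw_nL μ μ0 g (ex p' q' z) p' q' p0' q0' (by rw [ex_re, hz]; ring) hg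
      have n3 := nL_holder q' q cq.symm μ μ0 (pw g (ex p' q' z)) (G (k * z) (pw f (ex p q z)))
      have n4 := Gq (k * z.im) (pw f (ex p q z))
      rw [← hkz] at n4
      rw [hφ]
      simp only
      rw [norm_mul, nexp, hz]
      calc _ ≤ Real.exp (K * (0 ^ 2 - z.im ^ 2)) * (1 * (Cq ^ 2 * Real.exp (4 * (k * z.im) ^ 2) * 1)) := by
            apply mul_le_mul_of_nonneg_left _ (by positivity)
            refine n3.trans (mul_le_mul n2 (n4.trans (mul_le_mul_of_nonneg_left n1 (by positivity))) (nL_nonneg _ _ μ0 _) zero_le_one)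
        _ = A * Real.exp (K * (0 ^ 2 - z.im ^ 2) + 4 * (k * z.im) ^ 2) := by rw [Real.exp_add, hA]; ring
        _ = A := by
            rw [hK, show 4 * (k : ℝ) ^ 2 * (0 ^ 2 - z.im ^ 2) + 4 * (k * z.im) ^ 2 = 0 by ring, Real.exp_zero, mul_one]
    have hb : ∀ z ∈ Complex.re ⁻¹' {(1:ℝ)}, ‖φ z‖ ≤ B := by
      intro z hz
      have hz : z.re = 1 := hz
      have hkz : (k : ℂ) * z = (k : ℂ) + ((k * z.im : ℝ) : ℂ) * Complex.I := by
        apply Complex.ext <;> simp [hz]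
      have n1 := pw_nL μ μ0 f (ex p q z) p 2 p0 two_pos (by rw [ex_re, hz]; ring) hf
      have n2 := pw_nL μ μ0 g (ex p' q' z) p' 2 p0' two_pos (by rw [ex_re, hz]; ring) hg
      have n3 := nL_holder 2 2 Real.HolderConjugate.two_two μ μ0 (pw g (ex p' q' z)) (G (k * z) (pw f (ex p q z)))
      have n4 := Gt (k * z.im) (pw f (ex p q z))
      have n5 := Gn k (((k * z.im : ℝ) : ℂ) * Complex.I) (pw f (ex p q z))
      rw [← hkz] at n5
      rw [hφ]
      simp only
      rw [norm_mul, nexp, hz]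
      calc _ ≤ Real.exp (K * (1 ^ 2 - z.im ^ 2)) * (1 * (C2 ^ k * (Ct ^ 2 * Real.exp (4 * (k * z.im) ^ 2) * 1))) := by
            apply mul_le_mul_of_nonneg_left _ (by positivity)
            refine n3.trans (mul_le_mul n2 (n5.trans (mul_le_mul_of_nonneg_left (n4.trans (mul_le_mul_of_nonneg_left n1 (by positivity))) (by positivity))) (nL_nonneg _ _ μ0 _) zero_le_one)
        _ = (C2 ^ k * Ct ^ 2) * Real.exp (K * (1 ^ 2 - z.im ^ 2) + 4 * (k * z.im) ^ 2) := by rw [Real.exp_add]; ring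
        _ = B := by
            rw [hB, hK, show 4 * (k : ℝ) ^ 2 * (1 ^ 2 - z.im ^ 2) + 4 * (k * z.im) ^ 2 = 4 * (k : ℝ) ^ 2 by ring]; ring
    have kk : 1 / (k : ℝ) ≤ 1 := by rw [div_le_one k0]; exact_mod_cast (by omega : 1 ≤ k)
    have := Complex.HadamardThreeLines.norm_le_interp_of_mem_verticalClosedStrip₀₁' φ (z := ((1 / (k : ℝ) : ℝ) : ℂ)) (a := A) (b := B) 
      ⟨by rw [Complex.ofReal_re]; positivity, by rw [Complex.ofReal_re]; exact kk⟩ φd.diffContOnCl φb ha hb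
    rw [Complex.ofReal_re] at this
    refine le_trans ?_ this
    rw [hφ]
    simp only
    rw [norm_mul, ex_th p q p0 hpq, ex_th p' q' p0' hpq', pw_one, pw_one, nexp]
    have e1 : (k : ℂ) * ((1 / (k : ℝ) : ℝ) : ℂ) = 1 := by
      have : (k : ℂ) ≠ 0 := by exact_mod_cast k0.ne'
      push_cast; field_simp
    rw [e1]
    have : 1 ≤ Real.exp (K * ((((1 / (k : ℝ) : ℝ) : ℂ)).re ^ 2 - (((1 / (k : ℝ) : ℝ) : ℂ)).im ^ 2)) := by
      apply Real.one_le_exp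
      rw [Complex.ofReal_re, Complex.ofReal_im, zero_pow two_ne_zero, sub_zero]
      positivity
    exact le_mul_of_one_le_left (norm_nonneg _) this
  set C := A ^ (1 - 1 / (k : ℝ)) * B ^ (1 / (k : ℝ)) with hC
  have C0 : 0 < C := by positivity
  have nsm : ∀ (p : ℝ) (c : ℝ) (f : X → ℂ), 0 < p → 0 ≤ c → nL p μ (fun x => (c : ℂ) * f x) = c * nL p μ f := by
    intro p c f p0 c0
    have s0 : 0 ≤ ∑ x, μ x * ‖f x‖ ^ p := Finset.sum_nonneg fun x _ => mul_nonneg (μ0 x) (by positivity)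
    have e : ∑ x, μ x * ‖(c : ℂ) * f x‖ ^ p = c ^ p * ∑ x, μ x * ‖f x‖ ^ p := by
      rw [Finset.mul_sum]
      apply Finset.sum_congr rfl
      intro x _
      rw [norm_mul, Complex.norm_real, Real.norm_eq_abs, abs_of_nonneg c0, Real.mul_rpow c0 (norm_nonneg _)]
      ring
    rw [nL, nL, e, Real.mul_rpow (by positivity) s0, ← Real.rpow_mul c0, mul_one_div_cancel p0.ne', Real.rpow_one]
  have nzero : ∀ (p : ℝ) (f : X → ℂ), 0 < p → nL p μ f = 0 → f = 0 := by
    intro p f p0 h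
    have h1 := nL_pow p p0 μ μ0 f
    rw [h, Real.zero_rpow p0.ne'] at h1
    have h3 := (Finset.sum_eq_zero_iff_of_nonneg (fun x _ => mul_nonneg (μ0 x) (Real.rpow_nonneg (norm_nonneg (f x)) p))).1 h1.symm
    ext x
    have := h3 x (Finset.mem_univ _)
    rcases mul_eq_zero.1 this with h4 | h4
    · exact absurd h4 (hμ x).ne'
    · rw [Real.rpow_eq_zero (norm_nonneg _) p0.ne'] at h4
      simpa using h4
  have full : ∀ f : X → ℂ, nL p μ (G 1 f) ≤ C * nL p μ f := by
    intro f
    apply nL_dual p' p cp.symm μ μ0 _ _ _ (mul_nonneg C0.le (nL_nonneg _ _ μ0 _))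
    intro g
    rcases (nL_nonneg p μ μ0 f).eq_or_lt with h0 | h0
    · have := nzero p f p0 h0.symm
      subst this
      simp only [map_zero, Pi.zero_apply, mul_zero, Finset.sum_const_zero, norm_zero]
      exact mul_nonneg (mul_nonneg C0.le (nL_nonneg _ _ μ0 _)) (nL_nonneg _ _ μ0 _)
    rcases (nL_nonneg p' μ μ0 g).eq_or_lt with h1 | h1
    · have := nzero p' g p0' h1.symm
      subst this
      simp only [Pi.zero_apply, zero_mul, mul_zero, Finset.sum_const_zero, norm_zero]
      exact mul_nonneg (mul_nonneg C0.le (nL_nonneg _ _ μ0 _)) (nL_nonneg _ _ μ0 _)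
    set a := nL p μ f
    set b := nL p' μ g
    have h3 := key ((a⁻¹ : ℝ) • f) ((b⁻¹ : ℝ) • g) (le_of_eq (by
      have := nsm p a⁻¹ f p0 (by positivity)
      rw [inv_mul_cancel₀ h0.ne'] at this
      rw [← this]; rfl)) (le_of_eq (by
      have := nsm p' b⁻¹ g p0' (by positivity)
      rw [inv_mul_cancel₀ h1.ne'] at this
      rw [← this]; rfl))
    have e : ∑ x, (μ x : ℂ) * (((b⁻¹ : ℝ) • g) x * G 1 ((a⁻¹ : ℝ) • f) x) = ((a⁻¹ * b⁻¹ : ℝ) : ℂ) * ∑ x, (μ x : ℂ) * (g x * G 1 f x) := by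
      rw [Finset.mul_sum]
      apply Finset.sum_congr rfl
      intro x _
      have : G 1 ((a⁻¹ : ℝ) • f) = (a⁻¹ : ℝ) • G 1 f := by
        have h5 := (G 1).map_smul ((a⁻¹ : ℝ) : ℂ) f
        exact h5
      rw [this]
      simp only [Pi.smul_apply, Complex.real_smul]
      push_cast
      ring
    rw [e, norm_mul, Complex.norm_real, Real.norm_eq_abs, abs_of_nonneg (by positivity)] at h3
    calc _ = a * b * (a⁻¹ * b⁻¹ * ‖∑ x, (μ x : ℂ) * (g x * G 1 f x)‖) := by field_simp
      _ ≤ a * b * C := mul_le_mul_of_nonneg_left h3 (by positivity)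
      _ = _ := by ring
  intro f
  have := full (FR R r 1 f)
  have e1 : G 1 (FR R r 1 f) = fun x => f x - r * mop S f x := by
    have : G 1 (FR R r 1 f) = FR S r 1 (FR R r (-1) (FR R r 1 f)) := rfl
    rw [this, Rinv2]
    ext x
    rw [FR_one]
  have e2 : FR R r 1 f = fun x => f x - r * mop R f x := by
    ext x
    rw [FR_one]
  rw [e1] at this
  rw [e2] at this
  exact this

/-- numerical form of `1 - P` -/
def Dform {Ω : Type*} [Fintype Ω] (ν : Ω → ℝ) (P : Ω → Ω → ℝ) (u : Ω → ℂ) : ℂ := 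
  ∑ x, (ν x : ℂ) * (starRingEnd ℂ (u x) * (u x - mop P u x))

/-- sector condition -/
structure Sect {Ω : Type*} [Fintype Ω] (ν : Ω → ℝ) (P : Ω → Ω → ℝ) (κ : ℝ) : Prop where
  sec : ∀ u, |(Dform ν P u).im| ≤ κ * (Dform ν P u).re
  small : ∀ u, (1 + κ ^ 2) * (Dform ν P u).re ≤ ∑ x, ν x * ‖u x‖ ^ 2

lemma sect_scalar (κ : ℝ) (hκ : 0 < κ) (D ω : ℂ) (n r : ℝ) (hr : 0 ≤ r) (hr1 : r < 1) (hω : ‖ω‖ = 1)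
    (h1 : |D.im| ≤ κ * D.re) (h2 : (1 + κ ^ 2) * D.re ≤ n) : 
    ‖1 - r * ω‖ * n ≤ (1 + 2 * (1 + κ)) * ‖n - r * ω * (n - D)‖ := by
  have a0 : 0 ≤ D.re := nonneg_of_mul_nonneg_right (le_trans (abs_nonneg D.im) h1) hκ
  have an : D.re ≤ n := by nlinarith [sq_nonneg κ]
  have n0 : 0 ≤ n := by linarith
  have b2 : D.im ^ 2 ≤ (κ * D.re) ^ 2 := by
    rw [← sq_abs D.im]; exact pow_le_pow_left₀ (abs_nonneg _) h1 2
  have e1 : ‖(n : ℂ) - D‖ ≤ n - D.re / 2 := by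
    rw [Complex.norm_eq_sqrt_sq_add_sq]
    apply Real.sqrt_le_iff.2 ⟨by linarith, ?_⟩
    simp only [Complex.sub_re, Complex.ofReal_re, Complex.sub_im, Complex.ofReal_im]
    nlinarith [mul_le_mul_of_nonneg_right h2 a0]
  have nr : ‖(r : ℂ) * ω‖ = r := by rw [norm_mul, hω, mul_one, Complex.norm_real, Real.norm_eq_abs, abs_of_nonneg hr]
  set Z := ‖(n : ℂ) - r * ω * (n - D)‖ with hZ
  have e2 : D.re / 2 ≤ Z := by
    have : ‖(n : ℂ)‖ - ‖(r : ℂ) * ω * (n - D)‖ ≤ Z := norm_sub_norm_le _ _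
    rw [norm_mul, nr, Complex.norm_real, Real.norm_eq_abs, abs_of_nonneg n0] at this
    have : r * ‖(n : ℂ) - D‖ ≤ 1 * (n - D.re / 2) := mul_le_mul hr1.le e1 (norm_nonneg _) zero_le_one
    linarith
  have e3 : ‖D‖ ≤ (1 + κ) * D.re := by
    have := Complex.norm_le_abs_re_add_abs_im D
    rw [abs_of_nonneg a0] at this
    linarith
  have e4 : ‖1 - r * ω‖ * n ≤ Z + ‖D‖ := by
    calc ‖1 - r * ω‖ * n = ‖(1 - r * ω) * (n : ℂ)‖ := by rw [norm_mul, Complex.norm_real, Real.norm_eq_abs, abs_of_nonneg n0]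
      _ = ‖((n : ℂ) - r * ω * (n - D)) - r * ω * D‖ := by congr 1; ring
      _ ≤ Z + ‖(r : ℂ) * ω * D‖ := norm_sub_le _ _
      _ ≤ Z + ‖D‖ := by
        rw [norm_mul, nr]; nlinarith [norm_nonneg D]
  nlinarith

lemma nL_two_sq {X : Type*} [Fintype X] (μ : X → ℝ) (hμ : ∀ x, 0 ≤ μ x) (f : X → ℂ) : nL 2 μ f ^ 2 = ∑ x, μ x * ‖f x‖ ^ 2 := by
  have := nL_pow 2 two_pos μ hμ f
  exact_mod_cast this

lemma l2_point {Ω : Type*} [Fintype Ω] (ν : Ω → ℝ) (hν : ∀ x, 0 ≤ ν x) (P : Ω → Ω → ℝ) (κ : ℝ) (hκ : 0 < κ) (h : Sect ν P κ) (r : ℝ) (hr : 0 ≤ r) (hr1 : r < 1)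
    (ω : ℂ) (hω : ‖ω‖ = 1) (u : Ω → ℂ) : 
    ‖1 - r * ω‖ ^ 2 * ∑ x, ν x * ‖u x‖ ^ 2 ≤ (1 + 2 * (1 + κ)) ^ 2 * ∑ x, ν x * ‖u x - r * ω * mop P u x‖ ^ 2 := by
  have h1 := sect_scalar κ hκ (Dform ν P u) ω _ r hr hr1 hω (h.sec u) (h.small u)
  set g : Ω → ℂ := fun x => u x - r * ω * mop P u x with hg
  set n := ∑ x, ν x * ‖u x‖ ^ 2 with hn
  have e : (n : ℂ) - r * ω * (n - Dform ν P u) = ∑ x, (ν x : ℂ) * (starRingEnd ℂ (u x) * g x) := by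
    have hn' : (n : ℂ) = ∑ x, (ν x : ℂ) * (starRingEnd ℂ (u x) * u x) := by
      rw [hn]; push_cast
      apply Finset.sum_congr rfl; intro x _
      rw [mul_comm (starRingEnd ℂ (u x)), Complex.mul_conj, Complex.normSq_eq_norm_sq]; push_cast; ring
    rw [hn', Dform, ← Finset.sum_sub_distrib, Finset.mul_sum, ← Finset.sum_sub_distrib]
    apply Finset.sum_congr rfl; intro x _
    rw [hg]; ring
  have cs := nL_holder 2 2 Real.HolderConjugate.two_two ν hν (fun x => starRingEnd ℂ (u x)) g
  have eu : nL 2 ν (fun x => starRingEnd ℂ (u x)) = nL 2 ν u := by simp [nL]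
  rw [e] at h1
  rw [eu] at cs
  have su := nL_two_sq ν hν u
  have sg := nL_two_sq ν hν g
  have u0 := nL_nonneg 2 ν hν u
  have g0 := nL_nonneg 2 ν hν g
  change _ ≤ (1 + 2 * (1 + κ)) ^ 2 * ∑ x, ν x * ‖g x‖ ^ 2
  rw [← hn] at su
  rw [← sg, ← su]
  rw [← su] at h1
  set U := nL 2 ν u
  set V := nL 2 ν g
  rcases u0.eq_or_lt with h0 | h0
  · rw [← h0]; simp; positivity
  have h2 : ‖1 - r * ω‖ * U ≤ (1 + 2 * (1 + κ)) * V := by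
    have : (‖1 - r * ω‖ * U) * U ≤ ((1 + 2 * (1 + κ)) * V) * U := by
      calc _ = ‖1 - r * ω‖ * U ^ 2 := by ring
        _ ≤ _ := h1
        _ ≤ (1 + 2 * (1 + κ)) * (U * V) := mul_le_mul_of_nonneg_left cs (by positivity)
        _ = _ := by ring
    exact le_of_mul_le_mul_right this h0
  rw [← mul_pow, ← mul_pow]
  exact pow_le_pow_left₀ (by positivity) h2 2

/-- Fourier transform on ZMod M -/
def hatz {M : ℕ} [NeZero M] (f : ZMod M → ℂ) (k : ZMod M) : ℂ := ∑ n, ZMod.stdAddChar (N := M) (k * n) * f n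

lemma hatz_shift {M : ℕ} [NeZero M] (f : ZMod M → ℂ) (a k : ZMod M) : 
    hatz (fun n => f (n - a)) k = ZMod.stdAddChar (N := M) (k * a) * hatz f k := by
  unfold hatz
  rw [← Equiv.sum_comp (Equiv.addRight a), Finset.mul_sum]
  apply Finset.sum_congr rfl
  intro n _
  simp only [Equiv.coe_addRight, add_sub_cancel_right]
  rw [mul_add, AddChar.map_add_eq_mul]
  ring

lemma hatz_parseval {M : ℕ} [NeZero M] (f : ZMod M → ℂ) : ∑ k, ‖hatz f k‖ ^ 2 = M * ∑ n, ‖f n‖ ^ 2 := by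
  have key : ((∑ k, ‖hatz f k‖ ^ 2 : ℝ) : ℂ) = ((M * ∑ n, ‖f n‖ ^ 2 : ℝ) : ℂ) := by
    have e : ∀ k, ((‖hatz f k‖ ^ 2 : ℝ) : ℂ) = ∑ n, ∑ m, (f n * starRingEnd ℂ (f m)) * ZMod.stdAddChar (N := M) (k * (n - m)) := by
      intro k
      rw [← Complex.normSq_eq_norm_sq, ← Complex.mul_conj]
      unfold hatz
      rw [map_sum, Finset.sum_mul_sum]
      apply Finset.sum_congr rfl; intro n _
      apply Finset.sum_congr rfl; intro m _
      rw [map_mul (starRingEnd ℂ), mul_sub, AddChar.map_sub_eq_div]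
      have h1 : ‖ZMod.stdAddChar (N := M) (k * m)‖ = 1 := AddChar.norm_apply _ _
      have h2 := Complex.inv_eq_conj h1
      rw [← h2, div_eq_mul_inv]
      ring
    push_cast at e ⊢
    simp only [e]
    rw [Finset.sum_comm, Finset.mul_sum]
    apply Finset.sum_congr rfl; intro n _
    rw [Finset.sum_comm]
    simp only [← Finset.mul_sum, AddChar.sum_mulShift _ (ZMod.isPrimitive_stdAddChar M), ZMod.card]
    rw [Finset.sum_eq_single n]
    · rw [sub_self, if_pos rfl, Complex.mul_conj, Complex.normSq_eq_norm_sq]; push_cast; ring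
    · intro m _ hm
      rw [if_neg (by intro h; exact hm (sub_eq_zero.1 h).symm)]; simp
    · simp
  exact_mod_cast key

/-- the shift matrix -/
def shM {M : ℕ} {Ω : Type*} [DecidableEq Ω] (a : ZMod M) (x y : ZMod M × Ω) : ℝ := if y.1 = x.1 - a ∧ y.2 = x.2 then 1 else 0
/-- shift composed with P -/
def shP {M : ℕ} {Ω : Type*} (P : Ω → Ω → ℝ) (a : ZMod M) (x y : ZMod M × Ω) : ℝ := if y.1 = x.1 - a then P x.2 y.2 else 0

lemma shP_apply {M : ℕ} [NeZero M] {Ω : Type*} [Fintype Ω] (P : Ω → Ω → ℝ) (a : ZMod M) (f : ZMod M × Ω → ℂ) (x : ZMod M × Ω) : 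
    mop (shP P a) f x = ∑ y, (P x.2 y : ℂ) * f (x.1 - a, y) := by
  rw [mop_apply, Fintype.sum_prod_type, Finset.sum_eq_single (x.1 - a)]
  · simp [shP]
  · intro b _ hb; simp [shP, hb]
  · simp

lemma shM_eq {M : ℕ} {Ω : Type*} [DecidableEq Ω] (a : ZMod M) : (shM a : ZMod M × Ω → ZMod M × Ω → ℝ) = shP (fun x y => if y = x then 1 else 0) a := by
  ext x y
  simp only [shM, shP]
  split_ifs <;> simp_all

lemma shM_apply {M : ℕ} [NeZero M] {Ω : Type*} [Fintype Ω] [DecidableEq Ω] (a : ZMod M) (f : ZMod M × Ω → ℂ) (x : ZMod M × Ω) : 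
    mop (shM a) f x = f (x.1 - a, x.2) := by
  rw [shM_eq, shP_apply]
  rw [Finset.sum_eq_single x.2 (fun b _ hb => by rw [if_neg hb]; push_cast; ring) (fun h => absurd (Finset.mem_univ _) h), if_pos rfl]; push_cast; ring

lemma shP_sto {M : ℕ} [NeZero M] {Ω : Type*} [Fintype Ω] {ν : Ω → ℝ} {P : Ω → Ω → ℝ} (h : Sto ν P) (a : ZMod M) : 
    Sto (fun x : ZMod M × Ω => ν x.2) (shP P a) where
  mu x := h.mu _
  nn x y := by unfold shP; split_ifs; exacts [h.nn _ _, le_rfl]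
  row x := by
    rw [Fintype.sum_prod_type, Finset.sum_eq_single (x.1 - a)]
    · simp [shP, h.row]
    · intro b _ hb; simp [shP, hb]
    · simp
  inv y := by
    rw [Fintype.sum_prod_type, Finset.sum_eq_single (y.1 + a)]
    · simp [shP, h.inv]
    · intro b _ hb
      have : ¬ (y.1 = b - a) := by rintro h; apply hb; rw [h]; ring
      simp [shP, this]
    · simp

lemma id_sto {Ω : Type*} [Fintype Ω] [DecidableEq Ω] {ν : Ω → ℝ} (h : ∀ x, 0 ≤ ν x) : Sto ν (fun x y : Ω => if y = x then 1 else 0) where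
  mu := h
  nn x y := by split_ifs <;> norm_num
  row x := by simp
  inv y := by simp

lemma sh_commute {M : ℕ} [NeZero M] {Ω : Type*} [Fintype Ω] [DecidableEq Ω] (P : Ω → Ω → ℝ) (a b : ZMod M) : 
    Commute (mop (shM (Ω := Ω) a)) (mop (shP P b)) := by
  apply ContinuousLinearMap.ext
  intro f
  ext x
  change mop (shM a) (mop (shP P b) f) x = mop (shP P b) (mop (shM a) f) x
  rw [shM_apply, shP_apply, shP_apply]
  apply Finset.sum_congr rfl; intro y _
  rw [shM_apply]
  simp only
  rw [sub_right_comm]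

lemma l2_bound {M : ℕ} [NeZero M] {Ω : Type*} [Fintype Ω] [DecidableEq Ω] (ν : Ω → ℝ) (P : Ω → Ω → ℝ) (hν : ∀ x, 0 ≤ ν x) (κ : ℝ) (hκ : 0 < κ) (h : Sect ν P κ) 
    (r : ℝ) (hr : 0 ≤ r) (hr1 : r < 1) (a : ZMod M) (f : ZMod M × Ω → ℂ) :
    nL 2 (fun x : ZMod M × Ω => ν x.2) (fun x => f x - r * mop (shM a) f x) ≤ (1 + 2 * (1 + κ)) * nL 2 (fun x : ZMod M × Ω => ν x.2) (fun x => f x - r * mop (shP P a) f x) := by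
  have hν' : ∀ x : ZMod M × Ω, 0 ≤ ν x.2 := fun x => hν _
  apply le_of_sq_le_sq _ (mul_nonneg (by positivity) (nL_nonneg _ _ hν' _))
  rw [mul_pow, nL_two_sq _ hν', nL_two_sq _ hν', Fintype.sum_prod_type_right, Fintype.sum_prod_type_right]
  have M0 : (0:ℝ) < M := by exact_mod_cast NeZero.pos M
  have par : ∀ g : ZMod M × Ω → ℂ, (M : ℝ) * ∑ ω, ∑ n, ν ω * ‖g (n, ω)‖ ^ 2 = ∑ k, ∑ ω, ν ω * ‖hatz (fun n => g (n, ω)) k‖ ^ 2 := by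
    intro g
    rw [Finset.sum_comm (s := Finset.univ (α := ZMod M)), Finset.mul_sum]
    apply Finset.sum_congr rfl; intro ω _
    rw [← Finset.mul_sum, ← Finset.mul_sum, hatz_parseval]
    ring
  apply le_of_mul_le_mul_left _ M0
  rw [mul_left_comm]
  rw [par (fun x => f x - r * mop (shM a) f x), par (fun x => f x - r * mop (shP P a) f x), Finset.mul_sum]
  apply Finset.sum_le_sum
  intro k _
  set χ := ZMod.stdAddChar (N := M) (k * a) with hχ
  have := l2_point ν hν P κ hκ h r hr hr1 χ (AddChar.norm_apply _ _) (fun ω => hatz (fun n => f (n, ω)) k)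
  rw [Finset.mul_sum] at this
  have hlin : ∀ (g h : ZMod M → ℂ) (c : ℂ), hatz (fun n => g n - c * h n) k = hatz g k - c * hatz h k := by
    intro g h c
    unfold hatz
    rw [Finset.mul_sum, ← Finset.sum_sub_distrib]
    apply Finset.sum_congr rfl; intro n _; ring
  convert! this using 1
  · apply Finset.sum_congr rfl; intro ω _
    simp only [shM_apply]
    rw [hlin, hatz_shift (fun n => f (n, ω)), ← hχ]
    rw [show hatz (fun n => f (n, ω)) k - r * (χ * hatz (fun n => f (n, ω)) k) = (1 - r * χ) * hatz (fun n => f (n, ω)) k by ring, norm_mul]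
    ring
  · congr 1
    apply Finset.sum_congr rfl; intro ω _
    simp only [shP_apply]
    rw [hlin, mop_apply]
    have : hatz (fun n => ∑ y, (P ω y : ℂ) * f (n - a, y)) k = χ * ∑ y, (P ω y : ℂ) * hatz (fun n => f (n, y)) k := by
      rw [Finset.mul_sum]
      calc _ = ∑ y, (P ω y : ℂ) * hatz (fun n => f (n - a, y)) k := by
            unfold hatz
            simp only [Finset.mul_sum]
            rw [Finset.sum_comm]
            apply Finset.sum_congr rfl; intro y _
            apply Finset.sum_congr rfl; intro n _
            ring
        _ = _ := by
            apply Finset.sum_congr rfl; intro y _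
            rw [hatz_shift (fun n => f (n, y))]; ring
    rw [this, mul_assoc]

/-- discrete maximal regularity in `l^p(ν)` -/
theorem lp_main (p : ℝ) (hp : 1 < p) (κ : ℝ) (hκ : 0 < κ) : ∃ C : ℝ, 0 < C ∧ ∀ (M : ℕ) [NeZero M] (Ω : Type) [Fintype Ω] (ν : Ω → ℝ) (P : Ω → Ω → ℝ), 
    (∀ x, 0 < ν x) → Sto ν P → Sect ν P κ → ∀ (a : ZMod M) (r : ℝ), 0 ≤ r → r < 1 → ∀ f : ZMod M × Ω → ℂ, 
    nL p (fun x : ZMod M × Ω => ν x.2) (fun x => f x - r * f (x.1 - a, x.2)) ≤ C * nL p (fun x : ZMod M × Ω => ν x.2) (fun x => f x - r * ∑ y, (P x.2 y : ℂ) * f (x.1 - a, y)) := by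
  obtain ⟨C, C0, hC⟩ := stein p hp (1 + 2 * (1 + κ)) (by positivity)
  refine ⟨C, C0, ?_⟩
  intro M _ Ω _ ν P hν hP hs a r hr hr1 f
  classical
  have hS : Sto (fun x : ZMod M × Ω => ν x.2) (shM a) := by
    rw [shM_eq]; exact shP_sto (id_sto fun x => (hν x).le) a
  have := hC (ZMod M × Ω) (fun x => ν x.2) (shM a) (shP P a) (fun x => hν _) hS (shP_sto hP a) (sh_commute P a a) r hr hr1 
    (l2_bound ν P (fun x => (hν x).le) κ hκ hs r hr hr1 a) f
  simp only [shM_apply, shP_apply] at this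
  exact this

/-- `1 - r S P` -/
def Aop {M : ℕ} {Ω : Type*} [Fintype Ω] (P : Ω → Ω → ℝ) (a : ZMod M) (r : ℝ) (f : ZMod M × Ω → ℂ) (x : ZMod M × Ω) : ℂ :=
  f x - r * ∑ y, (P x.2 y : ℂ) * f (x.1 - a, y)
/-- `1 - r S` -/
def Bop {M : ℕ} {Ω : Type*} (a : ZMod M) (r : ℝ) (f : ZMod M × Ω → ℂ) (x : ZMod M × Ω) : ℂ :=
  f x - r * f (x.1 - a, x.2)

/-- `Aop` as a linear map -/
def AopL {M : ℕ} {Ω : Type*} [Fintype Ω] (P : Ω → Ω → ℝ) (a : ZMod M) (r : ℝ) : (ZMod M × Ω → ℂ) →ₗ[ℂ] (ZMod M × Ω → ℂ) :=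
    { toFun := Aop P a r
      map_add' := by
        intro f g; ext x; simp only [Aop, Pi.add_apply, mul_add, Finset.sum_add_distrib]; ring
      map_smul' := by
        intro c f; ext x
        simp only [Aop, Pi.smul_apply, smul_eq_mul, RingHom.id_apply]
        rw [mul_sub, mul_left_comm c, Finset.mul_sum (a := c)]
        congr 2
        apply Finset.sum_congr rfl; intro y _; ring }

lemma Aop_inj {M : ℕ} [NeZero M] {Ω : Type*} [Fintype Ω] {ν : Ω → ℝ} {P : Ω → Ω → ℝ} (hP : Sto ν P) (a : ZMod M) (r : ℝ)
    (hr : 0 ≤ r) (hr1 : r < 1) : Function.Injective (AopL P a r) := by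
  rw [← LinearMap.ker_eq_bot, LinearMap.ker_eq_bot']
  intro U hU
  have h1 : ‖U‖ ≤ r * ‖U‖ := by
    rw [pi_norm_le_iff_of_nonneg (by positivity)]
    intro x
    have := congrFun hU x
    change Aop P a r U x = 0 at this
    rw [Aop, sub_eq_zero] at this
    rw [this, norm_mul, Complex.norm_real, Real.norm_of_nonneg hr]
    apply mul_le_mul_of_nonneg_left _ hr
    refine (norm_sum_le _ _).trans ?_
    calc _ ≤ ∑ y, P x.2 y * ‖U‖ := by
          apply Finset.sum_le_sum; intro y _
          rw [norm_mul, Complex.norm_real, Real.norm_of_nonneg (hP.nn _ _)]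
          exact mul_le_mul_of_nonneg_left (norm_le_pi_norm U _) (hP.nn _ _)
      _ = _ := by rw [← Finset.sum_mul, hP.row, one_mul]
  have h2 : ‖U‖ = 0 := by nlinarith [norm_nonneg U]
  exact norm_eq_zero.1 h2

lemma Aop_surj {M : ℕ} [NeZero M] {Ω : Type*} [Fintype Ω] {ν : Ω → ℝ} {P : Ω → Ω → ℝ} (hP : Sto ν P) (a : ZMod M) (r : ℝ)
    (hr : 0 ≤ r) (hr1 : r < 1) (f : ZMod M × Ω → ℂ) : ∃ U, Aop P a r U = f := 
  (LinearMap.injective_iff_surjective.1 (Aop_inj hP a r hr hr1)) f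

lemma AB_comm {M : ℕ} {Ω : Type*} [Fintype Ω] (P : Ω → Ω → ℝ) (a : ZMod M) (r : ℝ) (f : ZMod M × Ω → ℂ) :
    Aop P a r (Bop a r f) = Bop a r (Aop P a r f) := by
  ext x
  simp only [Aop, Bop, mul_sub, Finset.sum_sub_distrib]
  have : ∑ y, (P x.2 y : ℂ) * (r * f (x.1 - a - a, y)) = r * ∑ y, (P x.2 y : ℂ) * f (x.1 - a - a, y) := by
    rw [Finset.mul_sum]; apply Finset.sum_congr rfl; intro y _; ring
  rw [this]; ring

/-- adjoint -/
def Pst {Ω : Type*} (ν : Ω → ℝ) (P : Ω → Ω → ℝ) (x y : Ω) : ℝ := ν y * P y x / ν x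

lemma Pst_sto {Ω : Type*} [Fintype Ω] {ν : Ω → ℝ} {P : Ω → Ω → ℝ} (hν : ∀ x, 0 < ν x) (h : Sto ν P) : Sto ν (Pst ν P) where
  mu := h.mu
  nn x y := div_nonneg (mul_nonneg (h.mu _) (h.nn _ _)) (h.mu _)
  row x := by
    simp only [Pst]
    rw [← Finset.sum_div, h.inv, div_self (hν x).ne']
  inv y := by
    have : ∀ x, ν x * Pst ν P x y = ν y * P y x := by intro x; rw [Pst, mul_div_cancel₀ _ (hν x).ne']
    simp only [this]
    rw [← Finset.mul_sum, h.row, mul_one]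

lemma Dform_eq {Ω : Type*} [Fintype Ω] (ν : Ω → ℝ) (P : Ω → Ω → ℝ) (u : Ω → ℂ) :
    Dform ν P u = ((∑ x, ν x * ‖u x‖ ^ 2 : ℝ) : ℂ) - ∑ x, ∑ y, ((ν x * P x y : ℝ) : ℂ) * (starRingEnd ℂ (u x) * u y) := by
  rw [Dform]
  push_cast
  rw [← Finset.sum_sub_distrib]
  apply Finset.sum_congr rfl; intro x _
  rw [mop_apply, mul_sub, mul_sub, ← Complex.normSq_eq_conj_mul_self, Complex.normSq_eq_norm_sq, Finset.mul_sum, Finset.mul_sum]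
  push_cast
  congr 1
  apply Finset.sum_congr rfl; intro y _; ring

lemma Pst_D {Ω : Type*} [Fintype Ω] {ν : Ω → ℝ} {P : Ω → Ω → ℝ} (hν : ∀ x, 0 < ν x) (u : Ω → ℂ) :
    Dform ν (Pst ν P) u = starRingEnd ℂ (Dform ν P u) := by
  rw [Dform_eq, Dform_eq, map_sub, Complex.conj_ofReal, map_sum]
  congr 1
  rw [Finset.sum_comm]
  apply Finset.sum_congr rfl; intro x _
  rw [map_sum]
  apply Finset.sum_congr rfl; intro y _
  rw [Pst, mul_div_cancel₀ _ (hν y).ne', map_mul, Complex.conj_ofReal, map_mul, Complex.conj_conj]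
  ring

lemma Pst_sect {Ω : Type*} [Fintype Ω] {ν : Ω → ℝ} {P : Ω → Ω → ℝ} {κ : ℝ} (hν : ∀ x, 0 < ν x) (h : Sect ν P κ) : Sect ν (Pst ν P) κ where
  sec u := by rw [Pst_D hν, Complex.conj_im, Complex.conj_re, abs_neg]; exact h.sec u
  small u := by rw [Pst_D hν, Complex.conj_re]; exact h.small u

lemma A_adj {M : ℕ} [NeZero M] {Ω : Type*} [Fintype Ω] {ν : Ω → ℝ} {P : Ω → Ω → ℝ} (hν : ∀ x, 0 < ν x) (a : ZMod M) (r : ℝ)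
    (f g : ZMod M × Ω → ℂ) : ∑ x : ZMod M × Ω, (ν x.2 : ℂ) * (Aop P a r f x * g x) = ∑ x : ZMod M × Ω, (ν x.2 : ℂ) * (f x * Aop (Pst ν P) (-a) r g x) := by
  simp only [Aop, sub_mul, mul_sub, Finset.sum_sub_distrib]
  congr 1
  simp only [Fintype.sum_prod_type, Finset.mul_sum, Finset.sum_mul]
  rw [← Equiv.sum_comp (Equiv.addRight a)]
  apply Finset.sum_congr rfl; intro n _
  rw [Finset.sum_comm]
  apply Finset.sum_congr rfl; intro x _
  apply Finset.sum_congr rfl; intro y _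
  have : ((Pst ν P x y : ℝ) : ℂ) * ν x = ν y * P y x := by
    have : Pst ν P x y * ν x = ν y * P y x := by rw [Pst, div_mul_cancel₀ _ (hν x).ne']
    exact_mod_cast this
  simp only [Equiv.coe_addRight, add_sub_cancel_right, sub_neg_eq_add]
  linear_combination (-(r : ℂ) * f (n, x) * g (n + a, y)) * this

lemma B_adj {M : ℕ} [NeZero M] {Ω : Type*} [Fintype Ω] {ν : Ω → ℝ} (a : ZMod M) (r : ℝ)
    (f g : ZMod M × Ω → ℂ) : ∑ x : ZMod M × Ω, (ν x.2 : ℂ) * (Bop a r f x * g x) = ∑ x : ZMod M × Ω, (ν x.2 : ℂ) * (f x * Bop (-a) r g x) := by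
  simp only [Bop, sub_mul, mul_sub, Finset.sum_sub_distrib]
  congr 1
  simp only [Fintype.sum_prod_type]
  rw [← Equiv.sum_comp (Equiv.addRight a)]
  apply Finset.sum_congr rfl; intro n _
  apply Finset.sum_congr rfl; intro x _
  simp only [Equiv.coe_addRight, add_sub_cancel_right, sub_neg_eq_add]
  ring

/-- duality between the two systems -/
lemma T_adj {M : ℕ} [NeZero M] {Ω : Type*} [Fintype Ω] {ν : Ω → ℝ} {P : Ω → Ω → ℝ} (hν : ∀ x, 0 < ν x) (a : ZMod M) (r : ℝ)
    (U V : ZMod M × Ω → ℂ) : ∑ x : ZMod M × Ω, (ν x.2 : ℂ) * (Bop a r U x * Aop (Pst ν P) (-a) r V x) = 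
      ∑ x : ZMod M × Ω, (ν x.2 : ℂ) * (Aop P a r U x * Bop (-a) r V x) := by
  rw [← A_adj hν, AB_comm, B_adj]

/-- minimal row structure -/
structure Rows {G : Type*} [Fintype G] {K : ℕ} (ν : Fin K → ℝ) (P : G × Fin K → G × Fin K → ℝ) (pp : Fin K → Fin K → ℝ) : Prop where
  col : ∀ j x' j', ∑ x, P (x, j) (x', j') = pp j j'
  col2 : ∀ x j j', ∑ x', P (x, j) (x', j') = pp j j'
  rev : ∀ j j', ν j * pp j j' = ν j' * pp j' j
  tri : ∀ j j' : Fin K, (j : ℕ) + 1 < j' → pp j j' = 0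
  pos : ∀ j j' : Fin K, (j : ℕ) + 1 = j' → 0 < pp j j'

lemma Pst_rows {G : Type*} [Fintype G] {K : ℕ} {ν : Fin K → ℝ} {P : G × Fin K → G × Fin K → ℝ} {pp : Fin K → Fin K → ℝ} (hν : ∀ x, 0 < ν x)
    (h : Rows ν P pp) : Rows ν (Pst (fun x => ν x.2) P) pp where
  col j x' j' := by
    simp only [Pst]
    rw [← Finset.sum_div, ← Finset.mul_sum, h.col2, h.rev, mul_div_cancel_left₀ _ (hν j).ne']
  col2 x j j' := by
    simp only [Pst]
    rw [← Finset.sum_div, ← Finset.mul_sum, h.col, h.rev, mul_div_cancel_left₀ _ (hν j).ne']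
  rev := h.rev
  tri := h.tri
  pos := h.pos

lemma rows_mono {K : ℕ} (pp : Fin K → Fin K → ℝ) (φ : Fin K → ℝ) (blk : Fin K → ℕ) (hb : Monotone blk) (k : ℕ)
    (nn : ∀ i j, 0 ≤ pp i j) (row : ∀ j, ∑ j', pp j j' = 1) (tri : ∀ j j' : Fin K, (j : ℕ) + 1 < j' → pp j j' = 0) (pos : ∀ j j' : Fin K, (j : ℕ) + 1 = j' → 0 < pp j j')
    (sub : ∀ j, blk j < k → φ j ≤ ∑ j', pp j j' * φ j') (n : ℕ) : ∀ j : Fin K, (j : ℕ) = n → blk j < k → ∀ i ≤ j, φ i ≤ φ j := by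
  induction n with
  | zero =>
    intro j hj _ i hi
    have : i = j := by apply Fin.ext; have : (i:ℕ) ≤ j := hi; omega
    rw [this]
  | succ n ih =>
    intro j hj hk i hi
    have hjK := j.2
    set j0 : Fin K := ⟨n, by omega⟩ with hj0
    have l0 : j0 ≤ j := by change n ≤ (j:ℕ); omega
    have hk0 : blk j0 < k := (hb l0).trans_lt hk
    have ih0 := ih j0 rfl hk0
    have key : φ j0 ≤ φ j := by
      have s := sub j0 hk0
      have p1 := pos j0 j (by rw [hj])
      have : ∑ j', pp j0 j' * (φ j' - φ j0) ≤ pp j0 j * (φ j - φ j0) := by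
        rw [← Finset.add_sum_erase _ _ (Finset.mem_univ j)]
        have : ∑ x ∈ Finset.univ.erase j, pp j0 x * (φ x - φ j0) ≤ 0 := by
          apply Finset.sum_nonpos
          intro x hx
          have hx1 := Finset.ne_of_mem_erase hx
          have hx2 : (x : ℕ) ≠ j := fun h => hx1 (Fin.ext h)
          by_cases h : (x:ℕ) ≤ n
          · exact mul_nonpos_of_nonneg_of_nonpos (nn _ _) (sub_nonpos.2 (ih0 x h))
          · rw [tri j0 x (by change n + 1 < (x:ℕ); omega), zero_mul]
        linarith
      have e : ∑ j', pp j0 j' * (φ j' - φ j0) = ∑ j', pp j0 j' * φ j' - φ j0 := by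
        simp only [mul_sub, Finset.sum_sub_distrib]
        rw [← Finset.sum_mul, row, one_mul]
      rw [e] at this
      by_contra hlt
      push Not at hlt
      nlinarith
    by_cases h : (i:ℕ) ≤ n
    · exact (ih0 i h).trans key
    · have : i = j := by apply Fin.ext; have : (i:ℕ) ≤ j := hi; omega
      rw [this]

/-- restriction to a block -/
def res {M : ℕ} {G : Type*} {K : ℕ} (blk : Fin K → ℕ) (k : ℕ) (f : ZMod M × (G × Fin K) → ℂ) (x : ZMod M × (G × Fin K)) : ℂ :=
  if blk x.2.2 = k then f x else 0

lemma res_nL {M : ℕ} [NeZero M] {G : Type*} [Fintype G] {K : ℕ} (ν : Fin K → ℝ) (hν : ∀ x, 0 < ν x) (blk : Fin K → ℕ) (k : ℕ) (f : ZMod M × (G × Fin K) → ℂ) (q : ℝ) (hq : 0 < q) :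
    nL q (fun x => ν x.2.2) (res blk k f) ^ q = ∑ j, if blk j = k then ν j * ∑ n, ∑ x, ‖f (n, x, j)‖ ^ q else 0 := by
  rw [nL_pow q hq _ (fun x => (hν _).le), Fintype.sum_prod_type]
  simp only [Fintype.sum_prod_type_right]
  rw [Finset.sum_comm]
  apply Finset.sum_congr rfl; intro j _
  simp only [res]
  split_ifs with h
  · simp only [Finset.mul_sum]
  · simp [Real.zero_rpow hq.ne']

/-- sub-harmonicity of row sums -/
lemma rows_sub {M : ℕ} [NeZero M] {G : Type*} [Fintype G] {K : ℕ} {ν : Fin K → ℝ} {P : G × Fin K → G × Fin K → ℝ} {pp : Fin K → Fin K → ℝ}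
    (hP : Sto (fun x : G × Fin K => ν x.2) P) (h : Rows ν P pp) (q : ℝ) (hq : 1 < q) (r : ℝ) (hr : 0 ≤ r) (hr1 : r < 1) (a : ZMod M) (v : ZMod M × (G × Fin K) → ℂ) (j : Fin K)
    (hv : ∀ n x, Aop P a r v (n, x, j) = 0) : ∑ n, ∑ x, ‖v (n, x, j)‖ ^ q ≤ ∑ j', pp j j' * ∑ n, ∑ x, ‖v (n, x, j')‖ ^ q := by
  have pt : ∀ n x, ‖v (n, x, j)‖ ^ q ≤ ∑ y, P (x, j) y * ‖v (n - a, y)‖ ^ q := by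
    intro n x
    have := hv n x
    rw [Aop, sub_eq_zero] at this
    have h1 : ‖v (n, x, j)‖ ≤ ∑ y, P (x, j) y * ‖v (n - a, y)‖ := by
      rw [this, norm_mul, Complex.norm_real, Real.norm_of_nonneg hr]
      calc _ ≤ 1 * ‖∑ y, (P (x, j) y : ℂ) * v (n - a, y)‖ := mul_le_mul_of_nonneg_right hr1.le (norm_nonneg _)
        _ ≤ _ := by
          rw [one_mul]
          refine (norm_sum_le _ _).trans (le_of_eq ?_)
          apply Finset.sum_congr rfl; intro y _
          rw [norm_mul, Complex.norm_real, Real.norm_of_nonneg (hP.nn _ _)]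
    refine (Real.rpow_le_rpow (norm_nonneg _) h1 (by linarith)).trans ?_
    exact Real.rpow_arith_mean_le_arith_mean_rpow _ _ _ (fun y _ => hP.nn _ _) (hP.row _) (fun y _ => norm_nonneg _) hq.le
  calc _ ≤ ∑ n, ∑ x, ∑ y, P (x, j) y * ‖v (n - a, y)‖ ^ q := Finset.sum_le_sum fun n _ => Finset.sum_le_sum fun x _ => pt n x
    _ = ∑ n, ∑ y : G × Fin K, pp j y.2 * ‖v (n - a, y)‖ ^ q := by
        apply Finset.sum_congr rfl; intro n _
        rw [Finset.sum_comm]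
        apply Finset.sum_congr rfl; intro y _
        rw [← Finset.sum_mul, ← h.col j y.1 y.2]
    _ = ∑ n, ∑ y : G × Fin K, pp j y.2 * ‖v (n, y)‖ ^ q := by
        rw [← Equiv.sum_comp (Equiv.addRight a)]
        simp only [Equiv.coe_addRight, add_sub_cancel_right]
    _ = _ := by
        simp only [Fintype.sum_prod_type_right]
        rw [Finset.sum_comm]
        apply Finset.sum_congr rfl; intro j' _
        rw [Finset.mul_sum]
        apply Finset.sum_congr rfl; intro n _
        rw [Finset.mul_sum]

/-- mass of a block -/
def mass {K : ℕ} (ν : Fin K → ℝ) (blk : Fin K → ℕ) (i : ℕ) : ℝ := ∑ j, if blk j = i then ν j else 0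

lemma mass_nonneg {K : ℕ} (ν : Fin K → ℝ) (hν : ∀ x, 0 < ν x) (blk : Fin K → ℕ) (i : ℕ) : 0 ≤ mass ν blk i := by
  apply Finset.sum_nonneg; intro j _; split_ifs; exacts [(hν _).le, le_rfl]

lemma res_le {M : ℕ} [NeZero M] {G : Type*} [Fintype G] {K : ℕ} (ν : Fin K → ℝ) (hν : ∀ x, 0 < ν x) (blk : Fin K → ℕ) (k : ℕ) (f : ZMod M × (G × Fin K) → ℂ) (q : ℝ) (hq : 0 < q) :
    nL q (fun x => ν x.2.2) (res blk k f) ≤ nL q (fun x => ν x.2.2) f := by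
  apply Real.rpow_le_rpow _ _ (by positivity)
  · apply Finset.sum_nonneg; intro x _; exact mul_nonneg (hν _).le (by positivity)
  · apply Finset.sum_le_sum; intro x _
    apply mul_le_mul_of_nonneg_left _ (hν _).le
    rw [res]; split_ifs
    · exact le_rfl
    · simp [Real.zero_rpow hq.ne']; positivity

lemma block_est {M : ℕ} [NeZero M] {G : Type*} [Fintype G] {K : ℕ} {ν : Fin K → ℝ} {P : G × Fin K → G × Fin K → ℝ} {pp : Fin K → Fin K → ℝ}
    (hν : ∀ x, 0 < ν x)
    (hP : Sto (fun x : G × Fin K => ν x.2) P) (h : Rows ν P pp) (q : ℝ) (hq : 1 < q) (r : ℝ) (hr : 0 ≤ r) (hr1 : r < 1) (a : ZMod M)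
    (blk : Fin K → ℕ) (hb : Monotone blk) (U : ZMod M × (G × Fin K) → ℂ) (k i : ℕ) (hi : i < k) (hU : ∀ x, blk x.2.2 < k → Aop P a r U x = 0) :
    mass ν blk (k - 1) * nL q (fun x => ν x.2.2) (res blk i (Bop a r U)) ^ q ≤ mass ν blk i * nL q (fun x => ν x.2.2) (Bop a r U) ^ q := by
  have q0 : 0 < q := by linarith
  set v := Bop a r U with hv
  set φ : Fin K → ℝ := fun j => ∑ n, ∑ x, ‖v (n, x, j)‖ ^ q with hφ
  rcases isEmpty_or_nonempty G with hG | hG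
  · have : ∀ j, φ j = 0 := by intro j; simp [hφ]
    rw [res_nL ν hν _ _ _ _ q0]
    change mass ν blk (k - 1) * (∑ j, if blk j = i then ν j * φ j else 0) ≤ _
    simp only [this]
    simp
    exact mul_nonneg (mass_nonneg ν hν _ _) (Real.rpow_nonneg (nL_nonneg _ _ (fun x => (hν _).le) _) _)
  have sub : ∀ j, blk j < k → φ j ≤ ∑ j', pp j j' * φ j' := by
    intro j hj
    apply rows_sub hP h q hq r hr hr1 a v j
    intro n x
    rw [hv, AB_comm, Bop, hU _ hj, hU (n - a, x, j) hj]; simp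
  have nn : ∀ i j, 0 ≤ pp i j := by
    intro i j
    obtain ⟨g⟩ := hG
    rw [← h.col i g j]
    exact Finset.sum_nonneg fun _ _ => hP.nn _ _
  have row : ∀ j, ∑ j', pp j j' = 1 := by
    intro j
    obtain ⟨g⟩ := hG
    rw [← hP.row (g, j), Fintype.sum_prod_type_right]
    apply Finset.sum_congr rfl; intro j' _
    rw [h.col2]
  have mono := rows_mono pp φ blk hb k nn row h.tri h.pos sub
  have h1 : mass ν blk (k - 1) * nL q (fun x => ν x.2.2) (res blk i v) ^ q ≤ mass ν blk i * nL q (fun x => ν x.2.2) (res blk (k - 1) v) ^ q := by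
    rw [res_nL ν hν _ _ _ _ q0, res_nL ν hν _ _ _ _ q0]
    change mass ν blk (k - 1) * (∑ j, if blk j = i then ν j * φ j else 0) ≤ mass ν blk i * ∑ j, if blk j = k - 1 then ν j * φ j else 0
    rcases eq_or_ne i (k - 1) with e | e
    · rw [e]
    rw [mass, mass, Finset.sum_mul_sum, Finset.sum_mul_sum, Finset.sum_comm]
    apply Finset.sum_le_sum; intro j _
    apply Finset.sum_le_sum; intro j' _
    split_ifs with h1 h2
    · have : j ≤ j' := by
        by_contra hlt
        push Not at hlt
        have := hb hlt.le
        omega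
      have := mono j' j' rfl (by omega) j this
      calc _ = ν j * ν j' * φ j := by ring
        _ ≤ ν j * ν j' * φ j' := mul_le_mul_of_nonneg_left this (mul_nonneg (hν _).le (hν _).le)
        _ = _ := by ring
    all_goals simp
  refine h1.trans ?_
  apply mul_le_mul_of_nonneg_left _ (mass_nonneg ν hν _ _)
  apply Real.rpow_le_rpow (nL_nonneg _ _ (fun x => (hν _).le) _) (res_le ν hν _ _ _ _ q0) q0.le

lemma nL_add {X : Type*} [Fintype X] (p : ℝ) (hp : 1 ≤ p) (μ : X → ℝ) (hμ : ∀ x, 0 ≤ μ x) (f g : X → ℂ) :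
    nL p μ (fun x => f x + g x) ≤ nL p μ f + nL p μ g := by
  have p0 : 0 < p := by linarith
  have e : ∀ h : X → ℂ, nL p μ h = (∑ x, ‖μ x ^ (1/p) * ‖h x‖‖ ^ p) ^ (1 / p) := by
    intro h
    rw [nL]; congr 1
    apply Finset.sum_congr rfl; intro x _
    rw [Real.norm_of_nonneg (mul_nonneg (Real.rpow_nonneg (hμ x) _) (norm_nonneg _)), Real.mul_rpow (Real.rpow_nonneg (hμ x) _) (norm_nonneg _), ← Real.rpow_mul (hμ x), one_div_mul_cancel p0.ne', Real.rpow_one]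
  have := Real.Lp_add_le Finset.univ (fun x => μ x ^ (1/p) * ‖f x‖) (fun x => μ x ^ (1/p) * ‖g x‖) hp
  rw [e f, e g]
  refine le_trans ?_ this
  rw [e]
  apply Real.rpow_le_rpow (Finset.sum_nonneg fun _ _ => by positivity) _ (by positivity)
  apply Finset.sum_le_sum; intro x _
  apply Real.rpow_le_rpow (norm_nonneg _) _ p0.le
  have m0 := Real.rpow_nonneg (hμ x) (1/p)
  rw [Real.norm_of_nonneg (mul_nonneg m0 (norm_nonneg _)), abs_of_nonneg (by positivity), ← mul_add]
  exact mul_le_mul_of_nonneg_left (norm_add_le _ _) m0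

lemma nL_sum {X : Type*} [Fintype X] (p : ℝ) (hp : 1 ≤ p) (μ : X → ℝ) (hμ : ∀ x, 0 ≤ μ x) (s : Finset ℕ) (f : ℕ → X → ℂ) :
    nL p μ (fun x => ∑ k ∈ s, f k x) ≤ ∑ k ∈ s, nL p μ (f k) := by
  induction s using Finset.induction_on with
  | empty => 
    have : (1:ℝ)/p ≠ 0 := by positivity
    have p0 : p ≠ 0 := by positivity
    simp [nL, Real.zero_rpow p0]
    rw [Real.zero_rpow (by positivity)]
  | insert a s ha ih =>
    simp only [Finset.sum_insert ha]
    exact (nL_add p hp μ hμ _ _).trans (add_le_add le_rfl ih)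

lemma schur (p θ : ℝ) (hp : 1 < p) (h0 : 0 < θ) (h1 : θ < 1) : ∃ A : ℝ, 0 < A ∧ ∀ (n : ℕ) (b : ℕ → ℝ), (∀ k, 0 ≤ b k) → 
    ∑ i ∈ Finset.range n, (∑ k ∈ Finset.range n, θ ^ ((i : ℤ) - k).natAbs * b k) ^ p ≤ A * ∑ k ∈ Finset.range n, b k ^ p := by
  have sm : Summable (fun n : ℤ => θ ^ n.natAbs) := by
    rw [summable_int_iff_summable_nat_and_neg]
    constructor <;> simp [summable_geometric_of_lt_one h0.le h1]
  set S := ∑' n : ℤ, θ ^ n.natAbs with hS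
  have S0 : 0 < S := lt_of_lt_of_le (by positivity : 0 < θ ^ (0:ℤ).natAbs) (sm.le_tsum 0 (fun _ _ => by positivity))
  have b1 : ∀ (i n : ℕ), ∑ k ∈ Finset.range n, θ ^ ((i : ℤ) - k).natAbs ≤ S := by
    intro i n
    have inj : Function.Injective (fun k : ℕ => (i : ℤ) - k) := by intro a b h; simp at h; exact h
    calc _ = ∑ z ∈ (Finset.range n).map ⟨_, inj⟩, θ ^ z.natAbs := by rw [Finset.sum_map]; rfl
      _ ≤ S := sm.sum_le_tsum _ (fun _ _ => by positivity)
  have b2 : ∀ (k n : ℕ), ∑ i ∈ Finset.range n, θ ^ ((i : ℤ) - k).natAbs ≤ S := by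
    intro k n
    convert! b1 k n using 3 with i
    rw [← Int.natAbs_neg]; congr 1; ring
  have hc := Real.HolderConjugate.conjExponent hp
  set q := p.conjExponent
  have p0 : 0 < p := by linarith
  refine ⟨S ^ (1 / q * p) * S, by positivity, ?_⟩
  intro n b hb
  have st : ∀ i : ℕ, (∑ k ∈ Finset.range n, θ ^ ((i : ℤ) - k).natAbs * b k) ^ p ≤ S ^ (1 / q * p) * ∑ k ∈ Finset.range n, θ ^ ((i : ℤ) - k).natAbs * b k ^ p := by
    intro i
    have := wholder (Finset.range n) q p hc.symm (fun k => θ ^ ((i : ℤ) - k).natAbs) (fun _ => 1) b (fun _ _ => by positivity) (fun _ _ => zero_le_one) (fun k _ => hb k)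
    simp only [one_mul, Real.one_rpow, mul_one] at this
    have i0 : 0 ≤ ∑ k ∈ Finset.range n, θ ^ ((i : ℤ) - k).natAbs * b k ^ p := Finset.sum_nonneg fun k _ => mul_nonneg (by positivity) (Real.rpow_nonneg (hb k) _)
    have j0 : 0 ≤ ∑ k ∈ Finset.range n, θ ^ ((i : ℤ) - k).natAbs := Finset.sum_nonneg fun k _ => (by positivity)
    refine (Real.rpow_le_rpow (Finset.sum_nonneg fun k _ => mul_nonneg (by positivity) (hb k)) this p0.le).trans ?_
    rw [Real.mul_rpow (by positivity) (by positivity), ← Real.rpow_mul j0, ← Real.rpow_mul i0, one_div_mul_cancel p0.ne', Real.rpow_one]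
    apply mul_le_mul_of_nonneg_right _ i0
    apply Real.rpow_le_rpow j0 (b1 i n)
    have := hc.symm.pos
    positivity
  calc _ ≤ ∑ i ∈ Finset.range n, S ^ (1 / q * p) * ∑ k ∈ Finset.range n, θ ^ ((i : ℤ) - k).natAbs * b k ^ p := Finset.sum_le_sum fun i _ => st i
    _ = S ^ (1 / q * p) * ∑ k ∈ Finset.range n, (∑ i ∈ Finset.range n, θ ^ ((i : ℤ) - k).natAbs) * b k ^ p := by
        rw [← Finset.mul_sum, Finset.sum_comm]; simp only [Finset.sum_mul]
    _ ≤ S ^ (1 / q * p) * ∑ k ∈ Finset.range n, S * b k ^ p := by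
        apply mul_le_mul_of_nonneg_left _ (by positivity)
        apply Finset.sum_le_sum; intro k _
        exact mul_le_mul_of_nonneg_right (b2 k n) (Real.rpow_nonneg (hb k) _)
    _ = _ := by rw [← Finset.mul_sum]; ring

lemma res_sum {M : ℕ} [NeZero M] {G : Type*} [Fintype G] {K : ℕ} (ν : Fin K → ℝ) (hν : ∀ x, 0 < ν x) (blk : Fin K → ℕ) (n : ℕ) (hn : ∀ j, blk j < n)
    (lam : ℕ → ℝ) (f : ZMod M × (G × Fin K) → ℂ) (p : ℝ) (hp : 0 < p) :
    ∑ i ∈ Finset.range n, lam i ^ p * nL p (fun x => ν x.2.2) (res blk i f) ^ p = ∑ x : ZMod M × (G × Fin K), lam (blk x.2.2) ^ p * ν x.2.2 * ‖f x‖ ^ p := by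
  simp only [nL_pow p hp _ (fun x : ZMod M × (G × Fin K) => (hν x.2.2).le), Finset.mul_sum]
  rw [Finset.sum_comm]
  apply Finset.sum_congr rfl; intro x _
  rw [Finset.sum_eq_single (blk x.2.2)]
  · simp [res]; ring
  · intro b _ hb; simp [res, hb.symm, Real.zero_rpow hp.ne']
  · intro h; exact absurd (Finset.mem_range.2 (hn _)) h

lemma off_diag {M : ℕ} [NeZero M] {G : Type*} [Fintype G] {K : ℕ} {ν : Fin K → ℝ} {P : G × Fin K → G × Fin K → ℝ} {pp : Fin K → Fin K → ℝ}
    (hν : ∀ x, 0 < ν x)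
    (hP : Sto (fun x : G × Fin K => ν x.2) P) (h : Rows ν P pp) (q : ℝ) (hq : 1 < q) (r : ℝ) (hr : 0 ≤ r) (hr1 : r < 1) (a : ZMod M)
    (blk : Fin K → ℕ) (hb : Monotone blk) (C : ℝ) (C0 : 0 < C)
    (hC : ∀ f : ZMod M × (G × Fin K) → ℂ, nL q (fun x => ν x.2.2) (Bop a r f) ≤ C * nL q (fun x => ν x.2.2) (Aop P a r f))
    (U F : ZMod M × (G × Fin K) → ℂ) (k i : ℕ) (hi : i < k) (hm : 0 < mass ν blk (k - 1)) (hU : Aop P a r U = res blk k F) :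
    nL q (fun x => ν x.2.2) (res blk i (Bop a r U)) ≤ (mass ν blk i / mass ν blk (k - 1)) ^ (1 / q) * (C * nL q (fun x => ν x.2.2) (res blk k F)) := by
  have q0 : 0 < q := by linarith
  have nn : ∀ f : ZMod M × (G × Fin K) → ℂ, 0 ≤ nL q (fun x => ν x.2.2) f := fun f => nL_nonneg _ _ (fun x => (hν _).le) _
  have m0 := mass_nonneg ν hν blk i
  have h1 := block_est hν hP h q hq r hr hr1 a blk hb U k i hi (by intro x hx; rw [hU, res, if_neg hx.ne])
  have h2 := hC U
  rw [hU] at h2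
  have h3 := Real.rpow_le_rpow (nn _) h2 q0.le
  have : nL q (fun x => ν x.2.2) (res blk i (Bop a r U)) ^ q ≤ ((mass ν blk i / mass ν blk (k - 1)) ^ (1 / q) * (C * nL q (fun x => ν x.2.2) (res blk k F))) ^ q := by
    rw [Real.mul_rpow (by positivity) (mul_nonneg C0.le (nn _)), ← Real.rpow_mul (by positivity), one_div_mul_cancel q0.ne', Real.rpow_one, div_mul_eq_mul_div, le_div_iff₀ hm, mul_comm]
    exact h1.trans (mul_le_mul_of_nonneg_left h3 m0)
  exact (Real.rpow_le_rpow_iff (nn _) (mul_nonneg (by positivity) (mul_nonneg C0.le (nn _))) q0).1 this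

lemma off_diag2 {M : ℕ} [NeZero M] {G : Type*} [Fintype G] {K : ℕ} {ν : Fin K → ℝ} {P : G × Fin K → G × Fin K → ℝ} {pp : Fin K → Fin K → ℝ}
    (hν : ∀ x, 0 < ν x)
    (hP : Sto (fun x : G × Fin K => ν x.2) P) (h : Rows ν P pp) (p q : ℝ) (hp : 1 < p) (hq : p.HolderConjugate q) (r : ℝ) (hr : 0 ≤ r) (hr1 : r < 1) (a : ZMod M)
    (blk : Fin K → ℕ) (hb : Monotone blk) (C : ℝ) (C0 : 0 < C)
    (hC : ∀ f : ZMod M × (G × Fin K) → ℂ, nL q (fun x => ν x.2.2) (Bop (-a) r f) ≤ C * nL q (fun x => ν x.2.2) (Aop (Pst (fun x => ν x.2) P) (-a) r f))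
    (U F : ZMod M × (G × Fin K) → ℂ) (k i : ℕ) (hi : k < i) (hm : 0 < mass ν blk (i - 1)) (hU : Aop P a r U = res blk k F) :
    nL p (fun x => ν x.2.2) (res blk i (Bop a r U)) ≤ (mass ν blk k / mass ν blk (i - 1)) ^ (1 / q) * (C * nL p (fun x => ν x.2.2) (res blk k F)) := by
  have q0 : 0 < q := hq.symm.pos
  have hq1 : 1 < q := hq.symm.lt
  have hν' : ∀ x : G × Fin K, 0 < ν x.2 := fun x => hν _
  have m0 := mass_nonneg ν hν blk k
  have nn : ∀ q, ∀ f : ZMod M × (G × Fin K) → ℂ, 0 ≤ nL q (fun x => ν x.2.2) f := fun q f => nL_nonneg _ _ (fun x => (hν _).le) _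
  apply nL_dual q p hq.symm (fun x : ZMod M × (G × Fin K) => ν x.2.2) (fun x => (hν _).le)
  · intro g
    obtain ⟨V, hV⟩ := Aop_surj (Pst_sto hν' hP) (-a) r hr hr1 (res blk i g)
    have e1 : ∑ x : ZMod M × (G × Fin K), (ν x.2.2 : ℂ) * (g x * res blk i (Bop a r U) x) = ∑ x : ZMod M × (G × Fin K), (ν x.2.2 : ℂ) * (res blk k F x * res blk k (Bop (-a) r V) x) := by
      have := T_adj (P := P) hν' a r U V
      rw [hV, hU] at this
      calc _ = ∑ x : ZMod M × (G × Fin K), (ν x.2.2 : ℂ) * (Bop a r U x * res blk i g x) := by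
            apply Finset.sum_congr rfl; intro x _
            simp only [res]; split_ifs <;> ring
        _ = _ := this
        _ = _ := by
            apply Finset.sum_congr rfl; intro x _
            simp only [res]; split_ifs <;> ring
    rw [e1]
    refine (nL_holder p q hq (fun x : ZMod M × (G × Fin K) => ν x.2.2) (fun x => (hν _).le) _ _).trans ?_
    have h1 := off_diag hν (Pst_sto hν' hP) (Pst_rows hν h) q hq1 r hr hr1 (-a) blk hb C C0 hC V g i k hi hm hV
    have h2 := res_le ν hν blk i g q q0
    calc _ ≤ nL p (fun x => ν x.2.2) (res blk k F) * ((mass ν blk k / mass ν blk (i - 1)) ^ (1 / q) * (C * nL q (fun x => ν x.2.2) g)) := by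
          apply mul_le_mul_of_nonneg_left _ (nn _ _)
          refine h1.trans ?_
          apply mul_le_mul_of_nonneg_left _ (by positivity)
          exact mul_le_mul_of_nonneg_left h2 C0.le
      _ = _ := by ring
  · have := nn p (res blk k F)
    positivity

/-- weighted estimate, abstract form -/
lemma wt_abs (p q : ℝ) (hp : 1 < p) (hq : p.HolderConjugate q) (C A B θ : ℝ) (C0 : 0 < C) (A0 : 0 < A) (B0 : 0 < B) (h0 : 0 < θ) (h1 : θ < 1) :
    ∃ C' : ℝ, 0 < C' ∧ ∀ (M : ℕ) [NeZero M] (G : Type) [Fintype G] (K : ℕ) (ν : Fin K → ℝ) (P : G × Fin K → G × Fin K → ℝ) (pp : Fin K → Fin K → ℝ)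
    (a : ZMod M) (r : ℝ) (blk : Fin K → ℕ) (n : ℕ) (lam : ℕ → ℝ) (w : Fin K → ℝ),
    (∀ x, 0 < ν x) → Sto (fun x : G × Fin K => ν x.2) P → Rows ν P pp → 0 ≤ r → r < 1 → Monotone blk → (∀ j, blk j < n) →
    (∀ f : ZMod M × (G × Fin K) → ℂ, nL p (fun x => ν x.2.2) (Bop a r f) ≤ C * nL p (fun x => ν x.2.2) (Aop P a r f)) → 
    (∀ f : ZMod M × (G × Fin K) → ℂ, nL q (fun x => ν x.2.2) (Bop (-a) r f) ≤ C * nL q (fun x => ν x.2.2) (Aop (Pst (fun x => ν x.2) P) (-a) r f)) → 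
    (∀ i < n, 0 < mass ν blk i) → (∀ i, 0 < lam i) →
    (∀ i k, i < k → k < n → lam i * (mass ν blk i / mass ν blk (k - 1)) ^ (1 / p) ≤ A * θ ^ ((i : ℤ) - k).natAbs * lam k) → 
    (∀ i k, k < i → i < n → lam i * (mass ν blk k / mass ν blk (i - 1)) ^ (1 / q) ≤ A * θ ^ ((i : ℤ) - k).natAbs * lam k) → 
    (∀ j, w j ≤ B * (lam (blk j) ^ p * ν j)) → (∀ j, lam (blk j) ^ p * ν j ≤ B * w j) → 
    ∀ f : ZMod M × (G × Fin K) → ℂ, ∑ x : ZMod M × (G × Fin K), w x.2.2 * ‖Bop a r f x‖ ^ p ≤ C' * ∑ x : ZMod M × (G × Fin K), w x.2.2 * ‖Aop P a r f x‖ ^ p := by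
  have p0 : 0 < p := by linarith
  obtain ⟨S, S0, hS⟩ := schur p θ hp h0 h1
  refine ⟨B * (((A + 1) * C) ^ p * (S * B)), by positivity, ?_⟩
  intro M _ G _ K ν P pp a r blk n lam w hν hP hR hr hr1 hb hn hC hC' hm hl W1 W2 w1 w2 f
  set F := Aop P a r f with hF
  have nn : ∀ f : ZMod M × (G × Fin K) → ℂ, 0 ≤ nL p (fun x => ν x.2.2) f := fun f => nL_nonneg _ _ (fun x => (hν _).le) _
  choose U hU using fun k => Aop_surj hP a r hr hr1 (res blk k F)
  have sumU : f = ∑ k ∈ Finset.range n, U k := by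
    apply Aop_inj hP a r hr hr1
    rw [map_sum]
    change Aop P a r f = ∑ k ∈ Finset.range n, Aop P a r (U k)
    simp only [hU]
    ext x
    rw [Finset.sum_apply, Finset.sum_eq_single (blk x.2.2)]
    · simp [res, hF]
    · intro b _ hb; simp [res, hb.symm]
    · intro h; exact absurd (Finset.mem_range.2 (hn _)) h
  have sumB : ∀ x, Bop a r f x = ∑ k ∈ Finset.range n, Bop a r (U k) x := by
    intro x
    conv_lhs => rw [sumU]
    simp only [Bop, Finset.sum_apply, Finset.sum_sub_distrib, Finset.mul_sum]
  have sumR : ∀ i, res blk i (Bop a r f) = fun x => ∑ k ∈ Finset.range n, res blk i (Bop a r (U k)) x := by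
    intro i; ext x
    simp only [res, sumB]; split_ifs <;> simp
  have est : ∀ i < n, ∀ k < n, lam i * nL p (fun x => ν x.2.2) (res blk i (Bop a r (U k))) ≤ (A + 1) * C * (θ ^ ((i : ℤ) - k).natAbs * (lam k * nL p (fun x => ν x.2.2) (res blk k F))) := by
    intro i hi k hk
    have l0 := hl i
    have l1 := hl k
    have n1 := nn (res blk k F)
    have t0 : 0 ≤ C * (θ ^ ((i : ℤ) - k).natAbs * (lam k * nL p (fun x => ν x.2.2) (res blk k F))) := by positivity
    rcases lt_trichotomy i k with h | h | h
    · have := off_diag hν hP hR p hp r hr hr1 a blk hb C C0 hC (U k) F k i h (hm _ (by omega)) (hU k)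
      calc _ ≤ lam i * ((mass ν blk i / mass ν blk (k - 1)) ^ (1 / p) * (C * nL p (fun x => ν x.2.2) (res blk k F))) := mul_le_mul_of_nonneg_left this l0.le
        _ = (lam i * (mass ν blk i / mass ν blk (k - 1)) ^ (1 / p)) * (C * nL p (fun x => ν x.2.2) (res blk k F)) := by ring
        _ ≤ (A * θ ^ ((i : ℤ) - k).natAbs * lam k) * (C * nL p (fun x => ν x.2.2) (res blk k F)) := mul_le_mul_of_nonneg_right (W1 i k h hk) (by positivity)
        _ = A * (C * (θ ^ ((i : ℤ) - k).natAbs * (lam k * nL p (fun x => ν x.2.2) (res blk k F)))) := by ring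
        _ ≤ _ := by linarith
    · subst h
      have h1 := res_le ν hν blk i (Bop a r (U i)) p p0
      have h2 := hC (U i)
      rw [hU] at h2
      have h3 := mul_le_mul_of_nonneg_left (h1.trans h2) l0.le
      simp only [sub_self, Int.natAbs_zero, pow_zero, one_mul] at t0 ⊢
      have : 0 ≤ A * (C * (lam i * nL p (fun x => ν x.2.2) (res blk i F))) := by positivity
      linarith
    · have := off_diag2 hν hP hR p q hp hq r hr hr1 a blk hb C C0 hC' (U k) F k i h (hm _ (by omega)) (hU k)
      calc _ ≤ lam i * ((mass ν blk k / mass ν blk (i - 1)) ^ (1 / q) * (C * nL p (fun x => ν x.2.2) (res blk k F))) := mul_le_mul_of_nonneg_left this l0.le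
        _ = (lam i * (mass ν blk k / mass ν blk (i - 1)) ^ (1 / q)) * (C * nL p (fun x => ν x.2.2) (res blk k F)) := by ring
        _ ≤ (A * θ ^ ((i : ℤ) - k).natAbs * lam k) * (C * nL p (fun x => ν x.2.2) (res blk k F)) := mul_le_mul_of_nonneg_right (W2 i k h hi) (by positivity)
        _ = A * (C * (θ ^ ((i : ℤ) - k).natAbs * (lam k * nL p (fun x => ν x.2.2) (res blk k F)))) := by ring
        _ ≤ _ := by linarith
  set b : ℕ → ℝ := fun k => lam k * nL p (fun x => ν x.2.2) (res blk k F) with hbdef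
  have b0 : ∀ k, 0 ≤ b k := fun k => mul_nonneg (hl k).le (nn _)
  have est2 : ∀ i ∈ Finset.range n, lam i ^ p * nL p (fun x => ν x.2.2) (res blk i (Bop a r f)) ^ p ≤ ((A + 1) * C) ^ p * (∑ k ∈ Finset.range n, θ ^ ((i : ℤ) - k).natAbs * b k) ^ p := by
    intro i hi
    rw [← Real.mul_rpow (hl i).le (nn _), ← Real.mul_rpow (by positivity) (Finset.sum_nonneg fun k _ => mul_nonneg (by positivity) (b0 k))]
    apply Real.rpow_le_rpow (mul_nonneg (hl i).le (nn _)) _ p0.le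
    rw [sumR, Finset.mul_sum]
    refine (mul_le_mul_of_nonneg_left (nL_sum p hp.le _ (fun x => (hν _).le) _ _) (hl i).le).trans ?_
    rw [Finset.mul_sum]
    apply Finset.sum_le_sum; intro k hk
    exact est i (Finset.mem_range.1 hi) k (Finset.mem_range.1 hk)
  have hL := res_sum ν hν blk n hn lam (Bop a r f) p p0
  have hRr := res_sum ν hν blk n hn lam F p p0
  calc _ ≤ ∑ x : ZMod M × (G × Fin K), B * (lam (blk x.2.2) ^ p * ν x.2.2 * ‖Bop a r f x‖ ^ p) := by
        apply Finset.sum_le_sum; intro x _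
        calc _ ≤ (B * (lam (blk x.2.2) ^ p * ν x.2.2)) * ‖Bop a r f x‖ ^ p := mul_le_mul_of_nonneg_right (w1 _) (by positivity)
          _ = _ := by ring
    _ = B * ∑ i ∈ Finset.range n, lam i ^ p * nL p (fun x => ν x.2.2) (res blk i (Bop a r f)) ^ p := by rw [hL, Finset.mul_sum]
    _ ≤ B * ∑ i ∈ Finset.range n, ((A + 1) * C) ^ p * (∑ k ∈ Finset.range n, θ ^ ((i : ℤ) - k).natAbs * b k) ^ p := 
        mul_le_mul_of_nonneg_left (Finset.sum_le_sum est2) B0.le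
    _ ≤ B * (((A + 1) * C) ^ p * (S * ∑ k ∈ Finset.range n, b k ^ p)) := by
        rw [← Finset.mul_sum]
        apply mul_le_mul_of_nonneg_left _ B0.le
        exact mul_le_mul_of_nonneg_left (hS n b b0) (by positivity)
    _ = B * (((A + 1) * C) ^ p * (S * ∑ x : ZMod M × (G × Fin K), lam (blk x.2.2) ^ p * ν x.2.2 * ‖F x‖ ^ p)) := by
        rw [← hRr]
        congr 3
        apply Finset.sum_congr rfl; intro k _
        rw [← Real.mul_rpow (hl k).le (nn _)]
    _ ≤ B * (((A + 1) * C) ^ p * (S * (B * ∑ x : ZMod M × (G × Fin K), w x.2.2 * ‖F x‖ ^ p))) := by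
        apply mul_le_mul_of_nonneg_left _ B0.le
        apply mul_le_mul_of_nonneg_left _ (by positivity)
        apply mul_le_mul_of_nonneg_left _ S0.le
        rw [Finset.mul_sum]
        apply Finset.sum_le_sum; intro x _
        rw [← mul_assoc B]
        exact mul_le_mul_of_nonneg_right (w2 _) (by positivity)
    _ = _ := by ring

lemma zb (a T z : ℝ) (hT : 0 < T) (h1 : T ≤ z) (h2 : z ≤ 2 * T) : z ^ a ≤ 2 ^ |a| * T ^ a ∧ T ^ a ≤ 2 ^ |a| * z ^ a := by
  have z0 : 0 < z := by linarith
  have hx : 1 ≤ z / T := by rw [le_div_iff₀ hT]; linarith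
  have hx2 : z / T ≤ 2 := by rw [div_le_iff₀ hT]; linarith
  have b : ∀ b : ℝ, (z / T) ^ b ≤ 2 ^ |b| := fun b => 
    (Real.rpow_le_rpow_of_exponent_le hx (le_abs_self b)).trans (Real.rpow_le_rpow (by positivity) hx2 (abs_nonneg b))
  constructor
  · have := b a
    rw [Real.div_rpow z0.le hT.le, div_le_iff₀ (by positivity)] at this
    exact this
  · have := b (-a)
    rw [abs_neg, Real.rpow_neg (by positivity), Real.div_rpow z0.le hT.le, inv_div, div_le_iff₀ (by positivity)] at this
    exact this

/-- dyadic block -/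
def dblk {K : ℕ} (j : Fin K) : ℕ := Nat.log 2 ((j : ℕ) + 1)
/-- power weight -/
def pwt {K : ℕ} (ω a : ℝ) (j : Fin K) : ℝ := ((j : ℕ) + 1 + ω : ℝ) ^ a

lemma dblk_mono {K : ℕ} : Monotone (dblk (K := K)) := by
  intro i j h
  have : (i : ℕ) ≤ j := h
  exact Nat.log_mono_right (by omega)

lemma dblk_iff {j i : ℕ} : Nat.log 2 (j + 1) = i ↔ 2 ^ i ≤ j + 1 ∧ j + 1 < 2 ^ (i + 1) := by
  rw [Nat.log_eq_iff]; right; exact ⟨by norm_num, by omega⟩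

lemma z_bd {i j : ℕ} {ω : ℝ} (h0 : 0 ≤ ω) (h1 : ω < 1) (h : Nat.log 2 (j + 1) = i) : (2:ℝ) ^ i ≤ j + 1 + ω ∧ (j:ℝ) + 1 + ω ≤ 2 * 2 ^ i := by
  obtain ⟨a, b⟩ := dblk_iff.1 h
  have a' : (2:ℝ) ^ i ≤ j + 1 := by exact_mod_cast a
  have b' : (j:ℝ) + 1 + 1 ≤ 2 ^ (i + 1) := by exact_mod_cast b
  rw [pow_succ] at b'
  constructor <;> linarith

lemma mass_le {K : ℕ} (ω a : ℝ) (h0 : 0 ≤ ω) (h1 : ω < 1) (i : ℕ) : mass (pwt (K := K) ω a) dblk i ≤ 2 ^ |a| * ((2:ℝ) ^ i) ^ (a + 1) := by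
  have T0 : (0:ℝ) < 2 ^ i := by positivity
  have e0 : mass (pwt (K := K) ω a) dblk i = ∑ j ∈ Finset.range K, (if Nat.log 2 (j + 1) = i then ((j:ℝ) + 1 + ω) ^ a else 0) :=
    Fin.sum_univ_eq_sum_range (fun j : ℕ => if Nat.log 2 (j + 1) = i then ((j:ℝ) + 1 + ω) ^ a else 0) K
  rw [e0, ← Finset.sum_filter]
  calc _ ≤ ∑ j ∈ Finset.range K with Nat.log 2 (j + 1) = i, 2 ^ |a| * ((2:ℝ) ^ i) ^ a := by
        apply Finset.sum_le_sum; intro j hj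
        have hz := z_bd h0 h1 (Finset.mem_filter.1 hj).2
        exact (zb a _ _ T0 hz.1 hz.2).1
    _ = (Finset.card {j ∈ Finset.range K | Nat.log 2 (j + 1) = i} : ℝ) * (2 ^ |a| * ((2:ℝ) ^ i) ^ a) := by rw [Finset.sum_const, nsmul_eq_mul]
    _ ≤ 2 ^ i * (2 ^ |a| * ((2:ℝ) ^ i) ^ a) := by
        apply mul_le_mul_of_nonneg_right _ (by positivity)
        have : Finset.card {j ∈ Finset.range K | Nat.log 2 (j + 1) = i} ≤ Finset.card (Finset.Ico (2 ^ i - 1) (2 ^ (i + 1) - 1)) := by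
          apply Finset.card_le_card
          intro j hj
          obtain ⟨u, v⟩ := dblk_iff.1 (Finset.mem_filter.1 hj).2
          rw [Finset.mem_Ico]; omega
        rw [Nat.card_Ico] at this
        have h3 : 2 ^ (i + 1) - 1 - (2 ^ i - 1) = 2 ^ i := by rw [pow_succ]; have := Nat.one_le_two_pow (n := i); omega
        rw [h3] at this
        exact_mod_cast this
    _ = _ := by rw [Real.rpow_add T0, Real.rpow_one]; ring

lemma le_mass {K : ℕ} (ω a : ℝ) (h0 : 0 ≤ ω) (h1 : ω < 1) (i : ℕ) (hi : 2 ^ (i + 1) ≤ K) : ((2:ℝ) ^ i) ^ (a + 1) ≤ 2 ^ |a| * mass (pwt (K := K) ω a) dblk i := by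
  have T0 : (0:ℝ) < 2 ^ i := by positivity
  have e0 : mass (pwt (K := K) ω a) dblk i = ∑ j ∈ Finset.range K, (if Nat.log 2 (j + 1) = i then ((j:ℝ) + 1 + ω) ^ a else 0) :=
    Fin.sum_univ_eq_sum_range (fun j : ℕ => if Nat.log 2 (j + 1) = i then ((j:ℝ) + 1 + ω) ^ a else 0) K
  rw [e0, ← Finset.sum_filter, Finset.mul_sum]
  calc _ = 2 ^ i * ((2:ℝ) ^ i) ^ a := by rw [Real.rpow_add T0, Real.rpow_one]; ring
    _ ≤ (Finset.card {j ∈ Finset.range K | Nat.log 2 (j + 1) = i} : ℝ) * ((2:ℝ) ^ i) ^ a := by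
        apply mul_le_mul_of_nonneg_right _ (by positivity)
        have : Finset.card (Finset.Ico (2 ^ i - 1) (2 ^ (i + 1) - 1)) ≤ Finset.card {j ∈ Finset.range K | Nat.log 2 (j + 1) = i} := by
          apply Finset.card_le_card
          intro j hj
          rw [Finset.mem_Ico] at hj
          rw [Finset.mem_filter, Finset.mem_range, dblk_iff]
          have := Nat.one_le_two_pow (n := i)
          have := Nat.one_le_two_pow (n := i + 1)
          omega
        rw [Nat.card_Ico] at this
        have h3 : 2 ^ (i + 1) - 1 - (2 ^ i - 1) = 2 ^ i := by rw [pow_succ]; have := Nat.one_le_two_pow (n := i); omega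
        rw [h3] at this
        exact_mod_cast this
    _ = ∑ j ∈ Finset.range K with Nat.log 2 (j + 1) = i, ((2:ℝ) ^ i) ^ a := by rw [Finset.sum_const, nsmul_eq_mul]
    _ ≤ _ := by
        apply Finset.sum_le_sum; intro j hj
        have hz := z_bd h0 h1 (Finset.mem_filter.1 hj).2
        exact (zb a _ _ T0 hz.1 hz.2).2

lemma mass_pos {K : ℕ} (ω a : ℝ) (h0 : 0 ≤ ω) (i : ℕ) (hi : 2 ^ i ≤ K) : 0 < mass (pwt (K := K) ω a) dblk i := by
  have := Nat.one_le_two_pow (n := i)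
  apply Finset.sum_pos'
  · intro j _; split_ifs
    · unfold pwt; positivity
    · exact le_rfl
  · refine ⟨⟨2 ^ i - 1, by omega⟩, Finset.mem_univ _, ?_⟩
    have : dblk (⟨2 ^ i - 1, by omega⟩ : Fin K) = i := by
      unfold dblk; simp only
      rw [Nat.sub_add_cancel this, Nat.log_pow (by norm_num)]
    rw [if_pos this]; unfold pwt; positivity

lemma mass_ratio {K : ℕ} (ω a : ℝ) (h0 : 0 ≤ ω) (h1 : ω < 1) (ha : 0 < a + 1) (i k : ℕ) (hik : i < k) (hk : 2 ^ k ≤ K) (q : ℝ) (hq : 0 < q) : 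
    (mass (pwt (K := K) ω a) dblk i / mass (pwt (K := K) ω a) dblk (k - 1)) ^ (1 / q) ≤ ((2:ℝ) ^ |a| * 2 ^ |a| * 2 ^ (a + 1)) ^ (1 / q) * (2:ℝ) ^ (-((k:ℝ) - i) * ((a + 1) / q)) := by
  obtain ⟨l, rfl⟩ : ∃ l, k = l + 1 := ⟨k - 1, by omega⟩
  have mp := mass_pos (K := K) ω a h0 l (le_trans (Nat.pow_le_pow_right (by norm_num) (by omega)) hk)
  have e : (2:ℝ) ^ (-(((l + 1 : ℕ):ℝ) - i) * ((a + 1) / q)) = (((2:ℝ) ^ i) ^ (a + 1) / ((2:ℝ) ^ (l + 1)) ^ (a + 1)) ^ (1 / q) := by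
    rw [← Real.div_rpow (by positivity) (by positivity), ← Real.rpow_natCast, ← Real.rpow_natCast, ← Real.rpow_sub (by norm_num), ← Real.rpow_mul (by positivity), ← Real.rpow_mul (by positivity)]
    congr 1; field_simp; ring
  rw [e, ← Real.mul_rpow (by positivity) (by positivity), Nat.add_sub_cancel]
  apply Real.rpow_le_rpow (div_nonneg (mass_nonneg _ (fun x => by unfold pwt; positivity) _ _) mp.le) _ (by positivity)
  have m1 := mass_le (K := K) ω a h0 h1 i
  have m2 := le_mass (K := K) ω a h0 h1 l hk
  rw [div_le_iff₀ mp]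
  have e2 : ((2:ℝ) ^ (l + 1)) ^ (a + 1) = 2 ^ (a + 1) * ((2:ℝ) ^ l) ^ (a + 1) := by
    rw [pow_succ, Real.mul_rpow (by positivity) (by positivity)]; ring
  rw [e2]
  have p1 : (0:ℝ) < ((2:ℝ) ^ l) ^ (a + 1) := by positivity
  have p2 : (0:ℝ) < (2:ℝ) ^ (a + 1) := by positivity
  have p3 : (0:ℝ) < (2:ℝ) ^ |a| := by positivity
  calc _ ≤ (2:ℝ) ^ |a| * ((2:ℝ) ^ i) ^ (a + 1) * 1 := by linarith
    _ ≤ (2:ℝ) ^ |a| * ((2:ℝ) ^ i) ^ (a + 1) * ((2 ^ |a| * mass (pwt (K := K) ω a) dblk l) / ((2:ℝ) ^ l) ^ (a + 1)) := by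
        apply mul_le_mul_of_nonneg_left _ (by positivity)
        rw [le_div_iff₀ p1]; linarith
    _ = _ := by field_simp

/-- weighted discrete maximal regularity with power weights -/
theorem wt_pow (p a m κ : ℝ) (hp : 1 < p) (hκ : 0 < κ) (hs : 0 < (m + 1) / p) (hD : (m + 1) / p < a + 1) : 
    ∃ C' : ℝ, 0 < C' ∧ ∀ (M : ℕ) [NeZero M] (G : Type) [Fintype G] (K : ℕ) (ω : ℝ) (P : G × Fin K → G × Fin K → ℝ) (pp : Fin K → Fin K → ℝ),
    0 ≤ ω → ω < 1 → Sto (fun x : G × Fin K => pwt ω a x.2) P → Sect (fun x : G × Fin K => pwt ω a x.2) P κ → Rows (pwt ω a) P pp → 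
    ∀ (b : ZMod M) (r : ℝ), 0 ≤ r → r < 1 → 
    ∀ f : ZMod M × (G × Fin K) → ℂ, ∑ x : ZMod M × (G × Fin K), pwt ω m x.2.2 * ‖Bop b r f x‖ ^ p ≤ C' * ∑ x : ZMod M × (G × Fin K), pwt ω m x.2.2 * ‖Aop P b r f x‖ ^ p := by
  have p0 : 0 < p := by linarith
  have hq := Real.HolderConjugate.conjExponent hp
  set q := p.conjExponent
  have q0 : 0 < q := hq.symm.pos
  have hpq : 1 / p + 1 / q = 1 := by have := hq.inv_add_inv_eq_one; simpa [one_div] using this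
  obtain ⟨C1, C10, hC1⟩ := lp_main p hp κ hκ
  obtain ⟨C2, C20, hC2⟩ := lp_main q hq.symm.lt κ hκ
  set D := a + 1 with hDd
  set s := (m + 1) / p with hsd
  set e := s - D / p with he
  have D0 : 0 < D := by linarith
  set η := min s (D - s) with hη
  have η0 : 0 < η := lt_min hs (by linarith)
  set E : ℝ := (2:ℝ) ^ |a| * 2 ^ |a| * 2 ^ D with hE
  have E0 : 0 < E := by positivity
  set A : ℝ := E ^ (1 / p) + E ^ (1 / q) with hA
  have θ1 : (2:ℝ) ^ (-η) < 1 := Real.rpow_lt_one_of_one_lt_of_neg (by norm_num) (by linarith)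
  obtain ⟨C', C'0, hC'⟩ := wt_abs p q hp hq (C1 + C2) A (2 ^ |p * e|) (2 ^ (-η)) (by positivity) (by positivity) (by positivity) (by positivity) θ1
  refine ⟨C', C'0, ?_⟩
  intro M _ G _ K ω P pp h0 h1 hP hS hR b r hr hr1 f
  rcases Nat.eq_zero_or_pos K with hK | hK
  · subst hK; simp
  have hν : ∀ x : Fin K, 0 < pwt ω a x := fun x => by unfold pwt; positivity
  have hν' : ∀ x : G × Fin K, 0 < pwt ω a x.2 := fun x => hν _
  have nn : ∀ (q : ℝ) (f : ZMod M × (G × Fin K) → ℂ), 0 ≤ nL q (fun x => pwt ω a x.2.2) f := fun q f => nL_nonneg _ _ (fun x => (hν _).le) _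
  have ln : ∀ i : ℕ, i < Nat.log 2 K + 1 → 2 ^ i ≤ K := by
    intro i hi
    exact (Nat.pow_le_pow_right (by norm_num) (Nat.lt_succ_iff.1 hi)).trans (Nat.pow_log_le_self 2 hK.ne')
  have lamr : ∀ i k : ℕ, ((2:ℝ) ^ i) ^ e = 2 ^ (((i:ℝ) - k) * e) * ((2:ℝ) ^ k) ^ e := by
    intro i k
    rw [← Real.rpow_natCast, ← Real.rpow_natCast, ← Real.rpow_mul (by norm_num), ← Real.rpow_mul (by norm_num), ← Real.rpow_add (by norm_num)]
    congr 1; ring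
  have thr : ∀ (i k : ℕ) (x : ℝ), (((i:ℤ) - k).natAbs : ℝ) = x → ((2:ℝ) ^ (-η)) ^ ((i:ℤ) - k).natAbs = 2 ^ (-η * x) := by
    intro i k x hx
    rw [← hx, ← Real.rpow_natCast, ← Real.rpow_mul (by norm_num)]
  refine hC' M G K (pwt ω a) P pp b r dblk (Nat.log 2 K + 1) (fun i => ((2:ℝ) ^ i) ^ e) (pwt ω m) hν hP hR hr hr1 dblk_mono ?_ ?_ ?_ ?_ ?_ ?_ ?_ ?_ ?_ f
  · intro j; exact Nat.lt_succ_of_le (Nat.log_mono_right j.2)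
  · intro f
    refine (hC1 M (G × Fin K) _ P hν' hP hS b r hr hr1 f).trans ?_
    exact mul_le_mul_of_nonneg_right (by linarith) (nn _ _)
  · intro f
    refine (hC2 M (G × Fin K) _ _ hν' (Pst_sto hν' hP) (Pst_sect hν' hS) (-b) r hr hr1 f).trans ?_
    exact mul_le_mul_of_nonneg_right (by linarith) (nn _ _)
  · intro i hi; exact mass_pos ω a h0 i (ln i hi)
  · intro i; positivity
  · intro i k hik hk
    have := mass_ratio (K := K) ω a h0 h1 D0 i k hik (ln k hk) p p0
    have hx : (((i:ℤ) - k).natAbs : ℝ) = (k:ℝ) - i := by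
      rw [Nat.cast_natAbs, Int.cast_abs]; push_cast
      rw [abs_sub_comm, abs_of_nonneg (sub_nonneg.2 (by exact_mod_cast hik.le))]
    have kp : 0 ≤ (k:ℝ) - i := (sub_nonneg.2 (by exact_mod_cast hik.le))
    rw [thr i k _ hx]
    calc _ ≤ ((2:ℝ) ^ i) ^ e * (E ^ (1 / p) * 2 ^ (-((k:ℝ) - i) * (D / p))) := mul_le_mul_of_nonneg_left this (by positivity)
      _ = E ^ (1 / p) * (2 ^ (((i:ℝ) - k) * e) * 2 ^ (-((k:ℝ) - i) * (D / p))) * ((2:ℝ) ^ k) ^ e := by rw [lamr i k]; ring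
      _ ≤ A * 2 ^ (-η * ((k:ℝ) - i)) * ((2:ℝ) ^ k) ^ e := by
        apply mul_le_mul_of_nonneg_right _ (by positivity)
        apply mul_le_mul (by rw [hA]; have : 0 < E ^ (1/q) := by positivity
                             linarith) _ (by positivity) (by positivity)
        rw [← Real.rpow_add (by norm_num)]
        apply Real.rpow_le_rpow_of_exponent_le (by norm_num)
        have : η ≤ s := min_le_left _ _
        rw [he]
        nlinarith
  · intro i k hik hk
    have := mass_ratio (K := K) ω a h0 h1 D0 k i hik (ln i hk) q q0
    have kp : 0 ≤ (i:ℝ) - k := (sub_nonneg.2 (by exact_mod_cast hik.le))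
    have hx : (((i:ℤ) - k).natAbs : ℝ) = (i:ℝ) - k := by
      rw [Nat.cast_natAbs, Int.cast_abs]; push_cast
      rw [abs_of_nonneg kp]
    rw [thr i k _ hx]
    calc _ ≤ ((2:ℝ) ^ i) ^ e * (E ^ (1 / q) * 2 ^ (-((i:ℝ) - k) * (D / q))) := mul_le_mul_of_nonneg_left this (by positivity)
      _ = E ^ (1 / q) * (2 ^ (((i:ℝ) - k) * e) * 2 ^ (-((i:ℝ) - k) * (D / q))) * ((2:ℝ) ^ k) ^ e := by rw [lamr i k]; ring
      _ ≤ A * 2 ^ (-η * ((i:ℝ) - k)) * ((2:ℝ) ^ k) ^ e := by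
        apply mul_le_mul_of_nonneg_right _ (by positivity)
        apply mul_le_mul (by rw [hA]; have : 0 < E ^ (1/p) := by positivity
                             linarith) _ (by positivity) (by positivity)
        rw [← Real.rpow_add (by norm_num)]
        apply Real.rpow_le_rpow_of_exponent_le (by norm_num)
        have h3 : η ≤ D - s := min_le_right _ _
        have h4 : D / p + D / q = D := by
          calc _ = D * (1 / p + 1 / q) := by ring
            _ = D := by rw [hpq, mul_one]
        have : e - D / q ≤ -η := by rw [he]; linarith
        nlinarith
  · intro j
    have hz := z_bd (j := j) h0 h1 rfl
    have := (zb (p * e) _ _ (by positivity) hz.1 hz.2).1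
    have e1 : m = p * e + a := by rw [he, hsd, hDd]; field_simp; ring
    have e2 : ∀ T : ℝ, 0 < T → (T ^ e) ^ p = T ^ (p * e) := fun T hT => by rw [← Real.rpow_mul hT.le, mul_comm]
    rw [e2 _ (by positivity), pwt, e1, Real.rpow_add (by positivity), ← mul_assoc]
    exact mul_le_mul_of_nonneg_right this (hν j).le
  · intro j
    have hz := z_bd (j := j) h0 h1 rfl
    have := (zb (p * e) _ _ (by positivity) hz.1 hz.2).2
    have e1 : m = p * e + a := by rw [he, hsd, hDd]; field_simp; ring
    have e2 : ∀ T : ℝ, 0 < T → (T ^ e) ^ p = T ^ (p * e) := fun T hT => by rw [← Real.rpow_mul hT.le, mul_comm]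
    rw [e2 _ (by positivity), pwt, pwt, e1, Real.rpow_add (by positivity), ← mul_assoc]
    exact mul_le_mul_of_nonneg_right this (hν j).le

/-- upper conductance matrix -/
def ka {K : ℕ} (k : ℕ → ℝ) (j j' : Fin K) : ℝ := if (j : ℕ) + 1 = j' then k j' else 0
/-- conductance matrix -/
def kk {K : ℕ} (k : ℕ → ℝ) (j j' : Fin K) : ℝ := ka k j j' + ka k j' j

lemma kk_symm {K : ℕ} (k : ℕ → ℝ) (j j' : Fin K) : kk k j j' = kk k j' j := by unfold kk; ring

/-- total jump rate -/
def rate {N K : ℕ} (μ : Fin K → ℝ) (k : ℕ → ℝ) (l : Fin N → Fin K → ℝ) (j : Fin K) : ℝ := ∑ j', kk k j j' / μ j + 2 * ∑ i, l i j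

/-- lattice generator -/
def Lop {G : Type*} [AddCommGroup G] {N K : ℕ} (e : Fin N → G) (μ : Fin K → ℝ) (k : ℕ → ℝ) (l b : Fin N → Fin K → ℝ) (u : G × Fin K → ℂ) (x : G × Fin K) : ℂ :=
  ∑ j', ((kk k x.2 j' / μ x.2 : ℝ) : ℂ) * (u (x.1, j') - u x) + 
  ∑ i, (((l i x.2 + b i x.2 : ℝ) : ℂ) * (u (x.1 + e i, x.2) - u x) + ((l i x.2 - b i x.2 : ℝ) : ℂ) * (u (x.1 - e i, x.2) - u x))

/-- transition matrix -/
def Pmat {G : Type*} [AddCommGroup G] [DecidableEq G] {N K : ℕ} (e : Fin N → G) (μ : Fin K → ℝ) (k : ℕ → ℝ) (l b : Fin N → Fin K → ℝ) (τ : ℝ) (x y : G × Fin K) : ℝ :=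
  (if y.1 = x.1 then τ * (kk k x.2 y.2 / μ x.2) else 0) + (if y.2 = x.2 then (if y.1 = x.1 then 1 - τ * rate μ k l x.2 else 0) else 0) + 
  (if y.2 = x.2 then τ * ∑ i, ((l i x.2 + b i x.2) * (if y.1 = x.1 + e i then 1 else 0) + (l i x.2 - b i x.2) * (if y.1 = x.1 - e i then 1 else 0)) else 0)

lemma Pmat_apply {G : Type*} [AddCommGroup G] [Fintype G] [DecidableEq G] {N K : ℕ} (e : Fin N → G) (μ : Fin K → ℝ) (k : ℕ → ℝ) (l b : Fin N → Fin K → ℝ) (τ : ℝ) (u : G × Fin K → ℂ) (x : G × Fin K) :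
    ∑ y, (Pmat e μ k l b τ x y : ℂ) * u y = u x + τ * Lop e μ k l b u x := by
  have e1 : ∑ y : G × Fin K, (((if y.1 = x.1 then τ * (kk k x.2 y.2 / μ x.2) else 0 : ℝ)) : ℂ) * u y = τ * ∑ j', ((kk k x.2 j' / μ x.2 : ℝ) : ℂ) * u (x.1, j') := by
    rw [Fintype.sum_prod_type_right, Finset.mul_sum]
    apply Finset.sum_congr rfl; intro j' _
    rw [Finset.sum_eq_single x.1]
    · simp; ring
    · intro g _ hg; simp [hg]
    · simp
  have e2 : ∑ y : G × Fin K, (((if y.2 = x.2 then (if y.1 = x.1 then 1 - τ * rate μ k l x.2 else 0) else 0 : ℝ)) : ℂ) * u y = (1 - τ * (rate μ k l x.2 : ℂ)) * u x := by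
    rw [Finset.sum_eq_single x]
    · simp
    · intro y _ hy
      by_cases h2 : y.2 = x.2
      · have : y.1 ≠ x.1 := fun h => hy (Prod.ext h h2)
        simp [this]
      · simp [h2]
    · simp
  have sel : ∀ (g : G) , ∑ y : G × Fin K, (if y.2 = x.2 then (if y.1 = g then (1:ℂ) else 0) else 0) * u y = u (g, x.2) := by
    intro g
    rw [Finset.sum_eq_single (g, x.2)]
    · simp
    · intro y _ hy
      by_cases h2 : y.2 = x.2
      · have : y.1 ≠ g := fun h => hy (Prod.ext h h2)
        simp [this]
      · simp [h2]
    · simp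
  have e3 : ∑ y : G × Fin K, (((if y.2 = x.2 then τ * ∑ i, ((l i x.2 + b i x.2) * (if y.1 = x.1 + e i then 1 else 0) + (l i x.2 - b i x.2) * (if y.1 = x.1 - e i then 1 else 0)) else 0 : ℝ)) : ℂ) * u y = τ * ∑ i, (((l i x.2 + b i x.2 : ℝ) : ℂ) * u (x.1 + e i, x.2) + ((l i x.2 - b i x.2 : ℝ) : ℂ) * u (x.1 - e i, x.2)) := by
    have : ∀ y : G × Fin K, (((if y.2 = x.2 then τ * ∑ i, ((l i x.2 + b i x.2) * (if y.1 = x.1 + e i then 1 else 0) + (l i x.2 - b i x.2) * (if y.1 = x.1 - e i then 1 else 0)) else 0 : ℝ)) : ℂ) * u y = τ * ∑ i, (((l i x.2 + b i x.2 : ℝ) : ℂ) * ((if y.2 = x.2 then (if y.1 = x.1 + e i then (1:ℂ) else 0) else 0) * u y) + ((l i x.2 - b i x.2 : ℝ) : ℂ) * ((if y.2 = x.2 then (if y.1 = x.1 - e i then (1:ℂ) else 0) else 0) * u y)) := by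
      intro y
      split_ifs with h
      · push_cast
        rw [mul_assoc, Finset.sum_mul]
        congr 1
        apply Finset.sum_congr rfl; intro i _
        split_ifs <;> push_cast <;> ring
      · simp
    simp only [this]
    rw [← Finset.mul_sum, Finset.sum_comm]
    congr 1
    apply Finset.sum_congr rfl; intro i _
    rw [Finset.sum_add_distrib, ← Finset.mul_sum, ← Finset.mul_sum, sel, sel]
  have e4 := congrArg₂ (· + ·) (congrArg₂ (· + ·) e1 e2) e3
  rw [← Finset.sum_add_distrib, ← Finset.sum_add_distrib] at e4
  simp only [← add_mul, ← Complex.ofReal_add] at e4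
  replace e4 : ∑ y, (Pmat e μ k l b τ x y : ℂ) * u y = _ := e4
  rw [e4, Lop, rate]
  simp only [mul_sub, Finset.sum_sub_distrib, Finset.sum_add_distrib, add_mul, sub_mul, Complex.ofReal_add, Complex.ofReal_sub, ← Finset.sum_mul, Complex.ofReal_sum, Complex.ofReal_mul, Complex.ofReal_ofNat]
  ring

section
variable {G : Type*} [AddCommGroup G] [Fintype G] [DecidableEq G] {N K : ℕ} {e : Fin N → G} {μ : Fin K → ℝ} {k : ℕ → ℝ} {l b : Fin N → Fin K → ℝ} {τ : ℝ}

/-- projected transition matrix -/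
def ppm {N K : ℕ} (μ : Fin K → ℝ) (k : ℕ → ℝ) (l : Fin N → Fin K → ℝ) (τ : ℝ) (j j' : Fin K) : ℝ := 
  τ * (kk k j j' / μ j) + (if j' = j then 1 - τ * ∑ j', kk k j j' / μ j else 0)

lemma Pmat_rows (hμ : ∀ j, 0 < μ j) (hk : ∀ n, 0 < k n) (hτ : 0 < τ) : Rows μ (Pmat e μ k l b τ) (ppm μ k l τ) where
  col j x' j' := by
    simp only [Pmat]
    rw [Finset.sum_add_distrib, Finset.sum_add_distrib, Finset.sum_ite_eq]
    by_cases h : j' = j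
    · have h1 : ∀ i : Fin N, ∑ x : G, (if x' = x + e i then (1:ℝ) else 0) = 1 := by
        intro i; simp only [← sub_eq_iff_eq_add]; simp
      have h2 : ∀ i : Fin N, ∑ x : G, (if x' = x - e i then (1:ℝ) else 0) = 1 := by
        intro i; simp only [eq_sub_iff_add_eq]; simp
      simp only [h, if_true]
      rw [← Finset.mul_sum, Finset.sum_comm]
      simp only [Finset.sum_add_distrib, ← Finset.mul_sum, h1, h2]
      simp only [ppm, rate, mul_one, if_true, Finset.sum_ite_eq, Finset.mem_univ, Finset.sum_sub_distrib, Finset.sum_add_distrib]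
      ring
    · simp [h, ppm]
  col2 x j j' := by
    simp only [Pmat]
    rw [Finset.sum_add_distrib, Finset.sum_add_distrib, Finset.sum_ite_eq']
    by_cases h : j' = j
    · simp only [h, if_true]
      rw [← Finset.mul_sum, Finset.sum_comm]
      simp only [Finset.sum_add_distrib, ← Finset.mul_sum]
      simp only [ppm, rate, mul_one, if_true, Finset.sum_ite_eq', Finset.mem_univ, Finset.sum_sub_distrib, Finset.sum_add_distrib]
      ring
    · simp [h, ppm]
  rev j j' := by
    have h1 := (hμ j).ne'
    have h2 := (hμ j').ne'
    by_cases h : j' = j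
    · rw [h]
    · simp only [ppm, h, Ne.symm h, if_false, kk_symm k j' j]; field_simp; ring
  tri j j' h := by
    have h1 : j' ≠ j := by rintro rfl; omega
    have : kk k j j' = 0 := by unfold kk ka; rw [if_neg (by omega), if_neg (by omega), add_zero]
    simp [ppm, h1, this]
  pos j j' h := by
    have h1 : j' ≠ j := by rintro rfl; omega
    have : kk k j j' = k j' := by unfold kk ka; rw [if_pos h, if_neg (by omega), add_zero]
    have h2 := hμ j
    have h3 := hk j'
    simp only [ppm, h1, if_false, this]; positivity

lemma kk_nonneg (hk : ∀ n, 0 < k n) (j j' : Fin K) : 0 ≤ kk k j j' := by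
  unfold kk ka; split_ifs <;> linarith [hk j, hk j']

lemma Pmat_sto (hμ : ∀ j, 0 < μ j) (hk : ∀ n, 0 < k n) (hτ : 0 < τ) (hb : ∀ i j, |b i j| ≤ l i j) (hr : ∀ j, τ * rate μ k l j ≤ 1) : 
    Sto (fun x : G × Fin K => μ x.2) (Pmat e μ k l b τ) where
  mu x := (hμ _).le
  nn x y := by
    unfold Pmat
    have h1 : 0 ≤ kk k x.2 y.2 / μ x.2 := div_nonneg (kk_nonneg hk _ _) (hμ _).le
    apply add_nonneg (add_nonneg _ _)
    · split_ifs
      · apply mul_nonneg hτ.le; apply Finset.sum_nonneg; intro i _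
        have := abs_le.1 (hb i x.2)
        apply add_nonneg <;> apply mul_nonneg <;> (try linarith) <;> split_ifs <;> norm_num
      · exact le_rfl
    · split_ifs
      · exact mul_nonneg hτ.le h1
      · exact le_rfl
    · split_ifs
      · linarith [hr x.2]
      · exact le_rfl
      · exact le_rfl
  row x := by
    rw [Fintype.sum_prod_type_right]
    have := (Pmat_rows (e := e) (l := l) (b := b) hμ hk hτ).col2 x.1 x.2
    simp only [Prod.mk.eta] at this
    simp only [this, ppm, Finset.sum_add_distrib, ← Finset.mul_sum]
    simp
  inv y := by
    have R := (Pmat_rows (e := e) (l := l) (b := b) hμ hk hτ)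
    rw [Fintype.sum_prod_type_right]
    have := fun j => R.col j y.1 y.2
    simp only [Prod.mk.eta] at this
    simp only [← Finset.mul_sum, this, R.rev _ y.2]
    simp only [ppm, Finset.sum_add_distrib, ← Finset.mul_sum]
    simp
end

section
variable {G : Type*} [AddCommGroup G] [Fintype G]

lemma sum_shift {E : Type*} [AddCommMonoid E] (e : G) (F : G → E) : ∑ x, F (x + e) = ∑ x, F x := Equiv.sum_comp (Equiv.addRight e) F
lemma sum_shift_sub {E : Type*} [AddCommMonoid E] (e : G) (F : G → E) : ∑ x, F (x - e) = ∑ x, F x := Equiv.sum_comp (Equiv.subRight e) F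

/-- squared norm -/
def Nq (f : G → ℂ) : ℝ := ∑ x, ‖f x‖ ^ 2
/-- forward difference -/
def fd (e : G) (f : G → ℂ) (x : G) : ℂ := f (x + e) - f x
/-- skew form -/
def Bsk (e : G) (f g : G → ℂ) : ℂ := ∑ x, (starRingEnd ℂ) (f x) * (g (x + e) - g (x - e))

lemma Nq_nonneg (f : G → ℂ) : 0 ≤ Nq f := Finset.sum_nonneg fun _ _ => by positivity

lemma conj_mul_diff (a b : ℂ) : (starRingEnd ℂ) a * (b - a) + (starRingEnd ℂ) b * (a - b) = -((‖a - b‖ ^ 2 : ℝ) : ℂ) := by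
  have : ((‖a - b‖ ^ 2 : ℝ) : ℂ) = (starRingEnd ℂ) (a - b) * (a - b) := by
    rw [Complex.conj_mul']; push_cast; rfl
  rw [this, map_sub (starRingEnd ℂ)]; ring

lemma lap_form (e : G) (f : G → ℂ) : ∑ x, (starRingEnd ℂ) (f x) * ((f (x + e) - f x) + (f (x - e) - f x)) = -((Nq (fd e f) : ℝ) : ℂ) := by
  simp only [mul_add, Finset.sum_add_distrib]
  rw [← sum_shift e (fun x => (starRingEnd ℂ) (f x) * (f (x - e) - f x)), ← Finset.sum_add_distrib, Nq, Complex.ofReal_sum, ← Finset.sum_neg_distrib]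
  apply Finset.sum_congr rfl; intro x _
  rw [add_sub_cancel_right, conj_mul_diff, norm_sub_rev]; rfl

lemma Bsk_skew (e : G) (f g : G → ℂ) : (starRingEnd ℂ) (Bsk e g f) = - Bsk e f g := by
  unfold Bsk
  simp only [map_sum, map_mul (starRingEnd ℂ), map_sub (starRingEnd ℂ), Complex.conj_conj, mul_sub, Finset.sum_sub_distrib]
  rw [← sum_shift e (fun x => (starRingEnd ℂ) (f x) * g (x - e)), ← sum_shift_sub e (fun x => (starRingEnd ℂ) (f x) * g (x + e))]
  simp only [add_sub_cancel_right, sub_add_cancel, mul_comm]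
  ring

lemma Bsk_re (e : G) (f : G → ℂ) : (Bsk e f f).re = 0 := by
  have := congrArg Complex.re (Bsk_skew e f f)
  simp at this; linarith

lemma Bsk_sub (e : G) (f g : G → ℂ) : Bsk e f f - Bsk e g g = Bsk e (f - g) f - (starRingEnd ℂ) (Bsk e (f - g) g) := by
  rw [Bsk_skew]
  unfold Bsk
  rw [← Finset.sum_sub_distrib, sub_neg_eq_add, ← Finset.sum_add_distrib]
  apply Finset.sum_congr rfl; intro x _
  simp only [Pi.sub_apply, map_sub (starRingEnd ℂ)]; ring

lemma young_scal {κ C k m d p : ℝ} (hC : 0 ≤ C) (hk : 0 ≤ k) (hm : 0 ≤ m) (h : κ ^ 2 ≤ C ^ 2 * k * m) (hd : 0 ≤ d) (hp : 0 ≤ p) : 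
    |κ| * (d * p) ≤ C / 2 * (k * d ^ 2 + m * p ^ 2) := by
  have h1 : 0 ≤ C / 2 * (k * d ^ 2 + m * p ^ 2) := by positivity
  apply le_of_sq_le_sq _ h1
  rw [mul_pow, sq_abs]
  have : κ ^ 2 * (d * p) ^ 2 ≤ C ^ 2 * k * m * (d * p) ^ 2 := by gcongr
  refine this.trans ?_
  nlinarith [sq_nonneg (C * (k * d ^ 2 - m * p ^ 2))]

lemma Bsk_bound (e : G) (w f : G → ℂ) {κ C k m : ℝ} (hC : 0 ≤ C) (hk : 0 ≤ k) (hm : 0 ≤ m) (h : κ ^ 2 ≤ C ^ 2 * k * m) :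
    |κ| * ‖Bsk e w f‖ ≤ C * (k * Nq w + m * Nq (fd e f)) := by
  have h1 : ‖Bsk e w f‖ ≤ ∑ x, (‖w x‖ * ‖fd e f x‖ + ‖w x‖ * ‖fd e f (x - e)‖) := by
    refine (norm_sum_le _ _).trans (Finset.sum_le_sum fun x _ => ?_)
    rw [norm_mul, RCLike.norm_conj, ← mul_add]
    gcongr
    refine le_trans (le_of_eq ?_) (norm_add_le _ _)
    simp only [fd, sub_add_cancel]; congr 1; ring
  have h2 : ∑ x, ‖fd e f (x - e)‖ ^ 2 = Nq (fd e f) := sum_shift_sub e (fun x => ‖fd e f x‖ ^ 2)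
  calc |κ| * ‖Bsk e w f‖ ≤ |κ| * ∑ x, (‖w x‖ * ‖fd e f x‖ + ‖w x‖ * ‖fd e f (x - e)‖) := by gcongr
    _ = ∑ x, (|κ| * (‖w x‖ * ‖fd e f x‖) + |κ| * (‖w x‖ * ‖fd e f (x - e)‖)) := by rw [Finset.mul_sum]; simp only [mul_add]
    _ ≤ ∑ x, (C / 2 * (k * ‖w x‖ ^ 2 + m * ‖fd e f x‖ ^ 2) + C / 2 * (k * ‖w x‖ ^ 2 + m * ‖fd e f (x - e)‖ ^ 2)) := by
      apply Finset.sum_le_sum; intro x _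
      exact add_le_add (young_scal hC hk hm h (norm_nonneg _) (norm_nonneg _)) (young_scal hC hk hm h (norm_nonneg _) (norm_nonneg _))
    _ = _ := by
      simp only [Finset.sum_add_distrib, ← Finset.mul_sum, h2]
      simp only [Nq]; ring

lemma sk_diff (e : G) (f g : G → ℂ) {κ C k m m' : ℝ} (hC : 0 ≤ C) (hk : 0 ≤ k) (hm : 0 ≤ m) (hm' : 0 ≤ m') (h : κ ^ 2 ≤ C ^ 2 * k * m) (h' : κ ^ 2 ≤ C ^ 2 * k * m') :
    |κ * ((Bsk e f f).im - (Bsk e g g).im)| ≤ C * (2 * (k * Nq (f - g)) + m * Nq (fd e f) + m' * Nq (fd e g)) := by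
  rw [abs_mul, ← Complex.sub_im, Bsk_sub]
  have h1 := Bsk_bound e (f - g) f hC hk hm h
  have h2 := Bsk_bound e (f - g) g hC hk hm' h'
  have h3 : |(Bsk e (f - g) f - (starRingEnd ℂ) (Bsk e (f - g) g)).im| ≤ ‖Bsk e (f - g) f‖ + ‖Bsk e (f - g) g‖ := by
    refine (Complex.abs_im_le_norm _).trans ((norm_sub_le _ _).trans ?_)
    rw [RCLike.norm_conj]
  nlinarith [mul_le_mul_of_nonneg_left h3 (abs_nonneg κ)]

end

lemma sbp (K : ℕ) (kap : ℕ → ℝ) (h0 : kap 0 = 0) (hK : kap K = 0) (s : Fin K → ℝ) : 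
    ∑ j : Fin K, (kap (j + 1) - kap j) * s j = ∑ j : Fin K, ∑ j' : Fin K, ka kap j j' * (s j - s j') := by
  have h1 : ∀ j : Fin K, ∑ j' : Fin K, ka kap j j' = kap (j + 1) := by
    intro j
    unfold ka
    by_cases h : (j : ℕ) + 1 < K
    · rw [Finset.sum_eq_single ⟨j + 1, h⟩]
      · simp
      · intro b _ hb; rw [if_neg]; intro h2; exact hb (Fin.ext h2.symm)
      · simp
    · have : (j : ℕ) + 1 = K := by omega
      rw [this, hK]; apply Finset.sum_eq_zero; intro b _; rw [if_neg (by omega)]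
  have h2 : ∀ j' : Fin K, ∑ j : Fin K, ka kap j j' = kap j' := by
    intro j'
    unfold ka
    by_cases h : (j' : ℕ) = 0
    · rw [h, h0]; apply Finset.sum_eq_zero; intro b _; simp
    · rw [Finset.sum_eq_single ⟨(j' : ℕ) - 1, by omega⟩]
      · rw [if_pos]; simp; omega
      · intro b _ hb; rw [if_neg]; intro h2; apply hb; apply Fin.ext; simp; omega
      · simp
  simp only [mul_sub, sub_mul, Finset.sum_sub_distrib]
  rw [Finset.sum_comm (f := fun j j' => ka kap j j' * s j')]
  simp only [← Finset.sum_mul, h1, h2]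

lemma sbp_le (K : ℕ) (F : Fin K → ℝ) (hF : ∀ j, 0 ≤ F j) : 
    ∑ j : Fin K, ∑ j' : Fin K, ka (fun _ => 1) j j' * (F j + F j') ≤ 2 * ∑ j, F j := by
  have h1 : ∀ j : Fin K, ∑ j' : Fin K, ka (fun _ => 1) j j' ≤ 1 := by
    intro j
    unfold ka
    by_cases h : (j : ℕ) + 1 < K
    · rw [Finset.sum_eq_single ⟨j + 1, h⟩]
      · simp
      · intro b _ hb; rw [if_neg]; intro h2; exact hb (Fin.ext h2.symm)
      · simp
    · refine le_of_eq_of_le ?_ zero_le_one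
      apply Finset.sum_eq_zero; intro b _; rw [if_neg (by omega)]
  have h2 : ∀ j' : Fin K, ∑ j : Fin K, ka (fun _ => 1) j j' ≤ 1 := by
    intro j'
    unfold ka
    by_cases h : (j' : ℕ) = 0
    · refine le_of_eq_of_le ?_ zero_le_one
      apply Finset.sum_eq_zero; intro b _; rw [if_neg (by omega)]
    · rw [Finset.sum_eq_single ⟨(j' : ℕ) - 1, by omega⟩]
      · split_ifs <;> norm_num
      · intro b _ hb; rw [if_neg]; intro h2; apply hb; apply Fin.ext; simp; omega
      · simp
  simp only [mul_add, Finset.sum_add_distrib]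
  rw [Finset.sum_comm (f := fun j j' => ka (fun _ => 1) j j' * F j')]
  simp only [← Finset.sum_mul]
  have a1 : ∑ j : Fin K, (∑ j' : Fin K, ka (fun _ => 1) j j') * F j ≤ ∑ j, F j := 
    Finset.sum_le_sum fun j _ => mul_le_of_le_one_left (hF j) (h1 j)
  have a2 : ∑ j' : Fin K, (∑ j : Fin K, ka (fun _ => 1) j j') * F j' ≤ ∑ j, F j := 
    Finset.sum_le_sum fun j _ => mul_le_of_le_one_left (hF j) (h2 j)
  linarith

section
variable {G : Type*} [AddCommGroup G] [Fintype G] [DecidableEq G] {N K : ℕ} {e : Fin N → G} {μ : Fin K → ℝ} {k : ℕ → ℝ} {l b : Fin N → Fin K → ℝ} {τ : ℝ}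

/-- row of a lattice function -/
def rw_ {G : Type*} {K : ℕ} (u : G × Fin K → ℂ) (j : Fin K) (g : G) : ℂ := u (g, j)

lemma bond_form {G : Type*} [Fintype G] {K : ℕ} (k : ℕ → ℝ) (u : G × Fin K → ℂ) :
    ∑ x : G × Fin K, (starRingEnd ℂ) (u x) * ∑ j', ((kk k x.2 j' : ℝ) : ℂ) * (u (x.1, j') - u x) = -((∑ j, ∑ j', ka k j j' * Nq (rw_ u j - rw_ u j') : ℝ) : ℂ) := by
  rw [Fintype.sum_prod_type]
  have h1 : ∀ g : G, ∑ j, (starRingEnd ℂ) (u (g, j)) * ∑ j', ((kk k j j' : ℝ) : ℂ) * (u (g, j') - u (g, j)) = ∑ j, ∑ j', ((ka k j j' : ℝ) : ℂ) * (-((‖u (g, j) - u (g, j')‖ ^ 2 : ℝ) : ℂ)) := by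
    intro g
    simp only [kk, Complex.ofReal_add, add_mul, mul_add, Finset.sum_add_distrib, Finset.mul_sum]
    rw [Finset.sum_comm (f := fun j j' => (starRingEnd ℂ) (u (g, j)) * (((ka k j' j : ℝ) : ℂ) * (u (g, j') - u (g, j))))]
    rw [← Finset.sum_add_distrib]
    apply Finset.sum_congr rfl; intro j _
    rw [← Finset.sum_add_distrib]
    apply Finset.sum_congr rfl; intro j' _
    rw [← conj_mul_diff]; ring
  simp only [h1]
  rw [Finset.sum_comm]
  push_cast
  rw [← Finset.sum_neg_distrib]
  apply Finset.sum_congr rfl; intro j _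
  rw [Finset.sum_comm, ← Finset.sum_neg_distrib]
  apply Finset.sum_congr rfl; intro j' _
  rw [← Finset.mul_sum, Finset.sum_neg_distrib, mul_neg]
  simp [Nq, rw_]

lemma E_form (hμ : ∀ j, 0 < μ j) (u : G × Fin K → ℂ) : 
    ∑ x, (μ x.2 : ℂ) * ((starRingEnd ℂ) (u x) * Lop e μ k l b u x) = 
      -((∑ j, ∑ j', ka k j j' * Nq (rw_ u j - rw_ u j') + ∑ j, ∑ i, μ j * l i j * Nq (fd (e i) (rw_ u j)) : ℝ) : ℂ) + ∑ j, ∑ i, ((μ j * b i j : ℝ) : ℂ) * Bsk (e i) (rw_ u j) (rw_ u j) := by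
  have h0 : ∀ x : G × Fin K, (μ x.2 : ℂ) * ((starRingEnd ℂ) (u x) * Lop e μ k l b u x) = (starRingEnd ℂ) (u x) * ∑ j', ((kk k x.2 j' : ℝ) : ℂ) * (u (x.1, j') - u x)
     + ∑ i, (((μ x.2 * l i x.2 : ℝ) : ℂ) * ((starRingEnd ℂ) (u x) * ((u (x.1 + e i, x.2) - u x) + (u (x.1 - e i, x.2) - u x))) 
       + ((μ x.2 * b i x.2 : ℝ) : ℂ) * ((starRingEnd ℂ) (u x) * (u (x.1 + e i, x.2) - u (x.1 - e i, x.2)))) := by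
    intro x
    rw [Lop, mul_add, mul_add]
    congr 1
    · rw [mul_left_comm, Finset.mul_sum]
      congr 1
      apply Finset.sum_congr rfl; intro j' _
      rw [← mul_assoc, ← Complex.ofReal_mul, mul_div_cancel₀ _ (hμ _).ne']
    · rw [Finset.mul_sum, Finset.mul_sum]
      apply Finset.sum_congr rfl; intro i _
      push_cast; ring
  simp only [h0]
  rw [Finset.sum_add_distrib, bond_form, Complex.ofReal_add, neg_add, add_assoc]
  congr 1
  rw [Fintype.sum_prod_type_right, Complex.ofReal_sum, ← Finset.sum_neg_distrib, ← Finset.sum_add_distrib]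
  apply Finset.sum_congr rfl; intro j _
  rw [Finset.sum_comm, Complex.ofReal_sum, ← Finset.sum_neg_distrib, ← Finset.sum_add_distrib]
  apply Finset.sum_congr rfl; intro i _
  rw [Finset.sum_add_distrib]
  dsimp only
  rw [← Finset.mul_sum, ← Finset.mul_sum]
  congr 1
  · have := lap_form (e i) (rw_ u j)
    simp only [rw_] at this
    simp only [this]; push_cast; ring

lemma E_sect (i0 : Fin N) {C : ℝ} (hC : 0 ≤ C) (kap : ℕ → ℝ) (h0 : kap 0 = 0) (hK : kap K = 0) (hμ : ∀ j, 0 < μ j) (hk : ∀ n, 0 < k n) (hl : ∀ i j, 0 ≤ l i j)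
    (hb0 : ∀ i j, i ≠ i0 → b i j = 0) (hb : ∀ j : Fin K, μ j * b i0 j = kap (j + 1) - kap j)
    (hc1 : ∀ j j' : Fin K, (j : ℕ) + 1 = j' → kap j' ^ 2 ≤ C ^ 2 * k j' * (μ j * l i0 j)) 
    (hc2 : ∀ j j' : Fin K, (j : ℕ) + 1 = j' → kap j' ^ 2 ≤ C ^ 2 * k j' * (μ j' * l i0 j')) 
    (u : G × Fin K → ℂ) : 
    |(-∑ x, (μ x.2 : ℂ) * ((starRingEnd ℂ) (u x) * Lop e μ k l b u x)).im| ≤ 2 * C * (-∑ x, (μ x.2 : ℂ) * ((starRingEnd ℂ) (u x) * Lop e μ k l b u x)).re := by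
  rw [E_form hμ]
  have hB : ∑ j, ∑ i, ((μ j * b i j : ℝ) : ℂ) * Bsk (e i) (rw_ u j) (rw_ u j) = ∑ j : Fin K, ((kap (j + 1) - kap j : ℝ) : ℂ) * Bsk (e i0) (rw_ u j) (rw_ u j) := by
    apply Finset.sum_congr rfl; intro j _
    rw [Finset.sum_eq_single i0, hb]
    · intro i _ hi; rw [hb0 i j hi]; simp
    · simp
  rw [hB]
  have hre : (∑ j : Fin K, ((kap (j + 1) - kap j : ℝ) : ℂ) * Bsk (e i0) (rw_ u j) (rw_ u j)).re = 0 := by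
    rw [Complex.re_sum]; apply Finset.sum_eq_zero; intro j _
    rw [Complex.re_ofReal_mul, Bsk_re, mul_zero]
  have him : (∑ j : Fin K, ((kap (j + 1) - kap j : ℝ) : ℂ) * Bsk (e i0) (rw_ u j) (rw_ u j)).im = ∑ j : Fin K, ∑ j' : Fin K, ka kap j j' * ((Bsk (e i0) (rw_ u j) (rw_ u j)).im - (Bsk (e i0) (rw_ u j') (rw_ u j')).im) := by
    rw [← sbp K kap h0 hK, Complex.im_sum]; apply Finset.sum_congr rfl; intro j _
    rw [Complex.im_ofReal_mul]
  rw [Complex.neg_im, Complex.neg_re, Complex.add_im, Complex.add_re, hre, him, Complex.neg_im, Complex.neg_re, Complex.ofReal_im, Complex.ofReal_re, neg_zero, zero_add, add_zero, neg_neg, abs_neg]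
  set F : Fin K → ℝ := fun j => μ j * l i0 j * Nq (fd (e i0) (rw_ u j)) with hF
  have hF0 : ∀ j, 0 ≤ F j := fun j => mul_nonneg (mul_nonneg (hμ j).le (hl _ _)) (Nq_nonneg _)
  have hterm : ∀ j j' : Fin K, |ka kap j j' * ((Bsk (e i0) (rw_ u j) (rw_ u j)).im - (Bsk (e i0) (rw_ u j') (rw_ u j')).im)| ≤ C * (2 * (ka k j j' * Nq (rw_ u j - rw_ u j')) + ka (fun _ => 1) j j' * (F j + F j')) := by
    intro j j'
    by_cases h : (j : ℕ) + 1 = j'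
    · simp only [ka, if_pos h]
      refine (sk_diff (e i0) (rw_ u j) (rw_ u j') hC (hk j').le (mul_nonneg (hμ j).le (hl i0 j)) (mul_nonneg (hμ j').le (hl i0 j')) (hc1 j j' h) (hc2 j j' h)).trans (le_of_eq ?_)
      simp only [hF]; ring
    · simp [ka, if_neg h]
  have h1 : ∑ j, F j ≤ ∑ j, ∑ i, μ j * l i j * Nq (fd (e i) (rw_ u j)) := by
    apply Finset.sum_le_sum; intro j _
    exact Finset.single_le_sum (f := fun i => μ j * l i j * Nq (fd (e i) (rw_ u j))) (fun i _ => mul_nonneg (mul_nonneg (hμ j).le (hl _ _)) (Nq_nonneg _)) (Finset.mem_univ i0)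
  have h2 := sbp_le K F hF0
  calc _ ≤ ∑ j, ∑ j', C * (2 * (ka k j j' * Nq (rw_ u j - rw_ u j')) + ka (fun _ => 1) j j' * (F j + F j')) := by
        refine (Finset.abs_sum_le_sum_abs _ _).trans (Finset.sum_le_sum fun j _ => ?_)
        exact (Finset.abs_sum_le_sum_abs _ _).trans (Finset.sum_le_sum fun j' _ => hterm j j')
    _ = C * (2 * (∑ j, ∑ j', ka k j j' * Nq (rw_ u j - rw_ u j')) + ∑ j, ∑ j', ka (fun _ => 1) j j' * (F j + F j')) := by
        simp only [Finset.mul_sum, mul_add, Finset.sum_add_distrib]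
    _ ≤ C * (2 * (∑ j, ∑ j', ka k j j' * Nq (rw_ u j - rw_ u j')) + 2 * ∑ j, ∑ i, μ j * l i j * Nq (fd (e i) (rw_ u j))) := by gcongr; linarith
    _ = _ := by ring

lemma sto_small {Ω : Type*} [Fintype Ω] {ν : Ω → ℝ} {P : Ω → Ω → ℝ} (h : Sto ν P) (u : Ω → ℂ) : (Dform ν P u).re ≤ 2 * ∑ x, ν x * ‖u x‖ ^ 2 := by
  rw [Dform_eq, Complex.sub_re, Complex.ofReal_re]
  have h1 : -(∑ x, ∑ y, ((ν x * P x y : ℝ) : ℂ) * (starRingEnd ℂ (u x) * u y)).re ≤ ∑ x, ∑ y, (ν x * P x y) * (‖u x‖ ^ 2 / 2 + ‖u y‖ ^ 2 / 2) := by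
    simp only [Complex.re_sum, ← Finset.sum_neg_distrib, Complex.re_ofReal_mul]
    apply Finset.sum_le_sum; intro x _
    apply Finset.sum_le_sum; intro y _
    rw [← mul_neg]
    apply mul_le_mul_of_nonneg_left _ (mul_nonneg (h.mu x) (h.nn x y))
    have := Complex.abs_re_le_norm (starRingEnd ℂ (u x) * u y)
    rw [norm_mul, RCLike.norm_conj] at this
    nlinarith [neg_abs_le (starRingEnd ℂ (u x) * u y).re, sq_nonneg (‖u x‖ - ‖u y‖)]
  have h2 : ∑ x, ∑ y, (ν x * P x y) * (‖u x‖ ^ 2 / 2 + ‖u y‖ ^ 2 / 2) = ∑ x, ν x * ‖u x‖ ^ 2 := by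
    simp only [mul_add, Finset.sum_add_distrib]
    rw [Finset.sum_comm (f := fun x y => ν x * P x y * (‖u y‖ ^ 2 / 2))]
    simp only [← Finset.sum_mul, h.inv, ← Finset.mul_sum, h.row]
    rw [← Finset.sum_add_distrib]
    apply Finset.sum_congr rfl; intro x _; ring
  linarith

lemma Dform_Pmat (u : G × Fin K → ℂ) : Dform (fun x : G × Fin K => μ x.2) (Pmat e μ k l b τ) u = τ * (-∑ x, (μ x.2 : ℂ) * ((starRingEnd ℂ) (u x) * Lop e μ k l b u x)) := by
  rw [Dform, mul_neg, Finset.mul_sum, ← Finset.sum_neg_distrib]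
  apply Finset.sum_congr rfl; intro x _
  rw [mop_apply, Pmat_apply]; ring

lemma Pmat_sect (i0 : Fin N) {C : ℝ} (hC : 0 ≤ C) (kap : ℕ → ℝ) (h0 : kap 0 = 0) (hK : kap K = 0) (hμ : ∀ j, 0 < μ j) (hk : ∀ n, 0 < k n) (hbl : ∀ i j, |b i j| ≤ l i j)
    (hb0 : ∀ i j, i ≠ i0 → b i j = 0) (hb : ∀ j : Fin K, μ j * b i0 j = kap (j + 1) - kap j)
    (hc1 : ∀ j j' : Fin K, (j : ℕ) + 1 = j' → kap j' ^ 2 ≤ C ^ 2 * k j' * (μ j * l i0 j)) 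
    (hc2 : ∀ j j' : Fin K, (j : ℕ) + 1 = j' → kap j' ^ 2 ≤ C ^ 2 * k j' * (μ j' * l i0 j')) 
    (hτ : 0 < τ) (hr : ∀ j, 2 * (1 + (2 * C) ^ 2) * τ * rate μ k l j ≤ 1) : 
    Sect (fun x : G × Fin K => μ x.2) (Pmat e μ k l b τ) (2 * C) where
  sec u := by
    rw [Dform_Pmat, Complex.im_ofReal_mul, Complex.re_ofReal_mul, abs_mul, abs_of_pos hτ]
    have := E_sect (e := e) i0 hC kap h0 hK hμ hk (fun i j => (abs_nonneg _).trans (hbl i j)) hb0 hb hc1 hc2 u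
    calc _ ≤ τ * (2 * C * (-∑ x, (μ x.2 : ℂ) * ((starRingEnd ℂ) (u x) * Lop e μ k l b u x)).re) := by gcongr
      _ = _ := by ring
  small u := by
    have h2 := sto_small (Pmat_sto (e := e) (b := b) hμ hk (by positivity : 0 < 2 * (1 + (2 * C) ^ 2) * τ) hbl hr) u
    rw [Dform_Pmat, Complex.re_ofReal_mul] at h2
    rw [Dform_Pmat, Complex.re_ofReal_mul]
    linarith
end

lemma vma_eq {E : Type*} [Zero E] {R M : ℕ} (hM : 2 * R + 4 ≤ M) (F : ℤ → E) (hF : ∀ k, (R : ℤ) < |k| → F k = 0) (a : ℤ) (ha : 2 * |a| ≤ M + 2) :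
    F ((a : ZMod M).valMinAbs) = F a := by
  have : NeZero M := ⟨by omega⟩
  have h1 : ((((a : ZMod M).valMinAbs : ℤ)) : ZMod M) = (a : ZMod M) := ZMod.coe_valMinAbs _
  have h2 : (M : ℤ) ∣ (a : ZMod M).valMinAbs - a := (ZMod.intCast_eq_intCast_iff_dvd_sub _ _ _).1 h1.symm
  obtain ⟨c, hc⟩ := h2
  have h3 := ZMod.valMinAbs_mem_Ioc (a : ZMod M)
  generalize (a : ZMod M).valMinAbs = v at *
  rcases eq_or_ne c 0 with rfl | h0
  · have : v = a := by linarith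
    rw [this]
  · have hcM : (M : ℤ) ≤ |(M : ℤ) * c| := by
      rw [abs_mul, Nat.abs_cast]
      have := Int.one_le_abs h0
      nlinarith
    rw [← hc] at hcM
    have h4 := abs_sub v a
    have h5 : 2 * |v| ≤ M := by
      have := h3.1; have := h3.2
      rcases abs_cases v with h | h <;> linarith
    have h6 : |v - a| ≤ |v| + |a| := abs_sub v a
    rw [hF v (by omega), hF a (by omega)]

lemma vma_shift {E : Type*} [Zero E] {R M : ℕ} [NeZero M] (hM : 2 * R + 4 ≤ M) (F : ℤ → E) (hF : ∀ k, (R : ℤ) < |k| → F k = 0) (n : ZMod M) (s : ℤ) (hs : |s| ≤ 1) :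
    F ((n + (s : ZMod M)).valMinAbs) = F (n.valMinAbs + s) := by
  have h1 : n + (s : ZMod M) = ((n.valMinAbs + s : ℤ) : ZMod M) := by push_cast; simp
  rw [h1]
  apply vma_eq hM F hF
  have h3 := ZMod.valMinAbs_mem_Ioc n
  have := h3.1; have := h3.2
  have := abs_add_le n.valMinAbs s
  have : 2 * |n.valMinAbs| ≤ M := by rcases abs_cases n.valMinAbs with h | h <;> linarith
  linarith

/-- lattice -/
abbrev ZLat (N : ℕ) := ℤ × ((Fin N → ℤ) × ℕ)

/-- generator on the infinite lattice -/
def Lz {N : ℕ} (μ k : ℕ → ℝ) (l b : Fin N → ℕ → ℝ) (F : ZLat N → ℝ) (x : ZLat N) : ℝ :=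
  k (x.2.2 + 1) / μ x.2.2 * (F (x.1, (x.2.1, x.2.2 + 1)) - F x) + k x.2.2 / μ x.2.2 * (F (x.1, (x.2.1, x.2.2 - 1)) - F x) +
  ∑ i, ((l i x.2.2 + b i x.2.2) * (F (x.1, (x.2.1 + Pi.single i 1, x.2.2)) - F x) + (l i x.2.2 - b i x.2.2) * (F (x.1, (x.2.1 - Pi.single i 1, x.2.2)) - F x))

/-- embedding of the torus in the lattice -/
def emb {N : ℕ} (M K : ℕ) (x : ZMod M × ((Fin N → ZMod M) × Fin K)) : ZLat N := (x.1.valMinAbs, (fun i => (x.2.1 i).valMinAbs, (x.2.2 : ℕ)))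

lemma emb_inj {N M K : ℕ} [NeZero M] : Function.Injective (emb (N := N) M K) := by
  rintro ⟨n, g, j⟩ ⟨n', g', j'⟩ h
  simp only [emb, Prod.mk.injEq] at h
  obtain ⟨h1, h2, h3⟩ := h
  simp only [Prod.mk.injEq]
  refine ⟨ZMod.injective_valMinAbs h1, ?_, Fin.ext h3⟩
  funext i; exact ZMod.injective_valMinAbs (congrFun h2 i)

lemma emb_range {N M K R : ℕ} [NeZero M] (hM : 2 * R + 4 ≤ M) (x : ZLat N) (h1 : |x.1| ≤ R) (h2 : ∀ i, |x.2.1 i| ≤ R) (h3 : x.2.2 < K) : x ∈ Set.range (emb (N := N) M K) := by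
  refine ⟨((x.1 : ZMod M), (fun i => (x.2.1 i : ZMod M), ⟨x.2.2, h3⟩)), ?_⟩
  have key : ∀ a : ℤ, |a| ≤ R → (a : ZMod M).valMinAbs = a := by
    intro a ha
    rw [ZMod.valMinAbs_spec]
    refine ⟨rfl, ?_⟩
    have := abs_le.1 ha
    constructor <;> push_cast <;> omega
  unfold emb
  simp only [key _ h1, key _ (h2 _)]

/-- support condition -/
def Bdd {N : ℕ} (R J : ℕ) (F : ZLat N → ℝ) : Prop := ∀ x, F x ≠ 0 → |x.1| ≤ R ∧ (∀ i, |x.2.1 i| ≤ R) ∧ x.2.2 < J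

lemma emb_t {N M K R J : ℕ} [NeZero M] (hM : 2 * R + 4 ≤ M) {F : ZLat N → ℝ} (hF : Bdd R J F) (n : ZMod M) (g : Fin N → ZMod M) (j : Fin K) : 
    F (emb M K (n - 1, (g, j))) = F ((emb M K (n, (g, j))).1 - 1, (emb M K (n, (g, j))).2) := by
  have := vma_shift hM (fun k => F (k, (emb M K (n, (g, j))).2)) (fun k hk => by
    by_contra h; have := (hF _ h).1; simp only at this; omega) n (-1) (by norm_num)
  simpa [sub_eq_add_neg, emb] using this

lemma emb_x {N M K R J : ℕ} [NeZero M] (hM : 2 * R + 4 ≤ M) {F : ZLat N → ℝ} (hF : Bdd R J F) (n : ZMod M) (g : Fin N → ZMod M) (j : Fin K) (i : Fin N) (s : ℤ) (hs : |s| ≤ 1) : 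
    F (emb M K (n, (g + Pi.single i (s : ZMod M), j))) = F (n.valMinAbs, ((emb M K (n, (g, j))).2.1 + Pi.single i s, (j : ℕ))) := by
  have := vma_shift hM (fun k => F (n.valMinAbs, (Function.update (emb M K (n, (g, j))).2.1 i k, (j : ℕ)))) (fun k hk => by
    by_contra h; have := (hF _ h).2.1 i; simp only [Function.update_self] at this; omega) (g i) s hs
  have e1 : emb M K (n, (g + Pi.single i (s : ZMod M), j)) = (n.valMinAbs, (Function.update (emb M K (n, (g, j))).2.1 i (g i + (s : ZMod M)).valMinAbs, (j : ℕ))) := by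
    unfold emb
    simp only [Prod.mk.injEq, and_true, true_and]
    funext i'
    by_cases h : i' = i
    · subst h; simp
    · simp [h]
  have e2 : (emb M K (n, (g, j))).2.1 + Pi.single i s = Function.update (emb M K (n, (g, j))).2.1 i ((g i).valMinAbs + s) := by
    funext i'
    by_cases h : i' = i
    · subst h; simp [emb]
    · simp [h]
  rw [e1, e2]; exact this

lemma kk_sum {K : ℕ} (k : ℕ → ℝ) (μ : ℝ) (j : Fin K) (v : ℕ → ℝ) (hv : ∀ n, K ≤ n + 1 → v n = 0) :
    ∑ j' : Fin K, kk k j j' / μ * (v j' - v j) = k (j + 1) / μ * (v (j + 1) - v j) + k j / μ * (v (j - 1) - v j) := by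
  simp only [kk, add_div, add_mul, Finset.sum_add_distrib]
  congr 1
  · unfold ka
    by_cases h : (j : ℕ) + 1 < K
    · rw [Finset.sum_eq_single ⟨j + 1, h⟩]
      · simp
      · intro b _ hb; rw [if_neg]; · simp
        intro h2; exact hb (Fin.ext h2.symm)
      · simp
    · rw [hv (j + 1) (by omega), hv j (by omega), sub_zero, mul_zero]
      apply Finset.sum_eq_zero; intro b _; rw [if_neg (by omega)]; simp
  · unfold ka
    by_cases h : (j : ℕ) = 0
    · rw [h]; simp only [Nat.zero_sub, sub_self, mul_zero]
      apply Finset.sum_eq_zero; intro b _; simp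
    · rw [Finset.sum_eq_single ⟨(j : ℕ) - 1, by omega⟩]
      · rw [if_pos]; simp; omega
      · intro b _ hb; rw [if_neg]; · simp
        intro h2; apply hb; apply Fin.ext; simp; omega
      · simp

lemma Lop_emb {N M K R J : ℕ} [NeZero M] (hM : 2 * R + 4 ≤ M) (hK : J + 1 ≤ K) {F : ZLat N → ℝ} (hF : Bdd R J F) (μ k : ℕ → ℝ) (l b : Fin N → ℕ → ℝ) (n : ZMod M) (x : (Fin N → ZMod M) × Fin K) :
    Lop (fun i => (Pi.single i 1 : Fin N → ZMod M)) (fun j : Fin K => μ j) k (fun i j => l i j) (fun i j => b i j) (fun y => (F (emb M K (n, y)) : ℂ)) x = ((Lz μ k l b F (emb M K (n, x)) : ℝ) : ℂ) := by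
  obtain ⟨g, j⟩ := x
  rw [Lop, Lz]
  have h1 := kk_sum k (μ j) j (fun r => F (n.valMinAbs, (fun i => (g i).valMinAbs, r))) (by
    intro r hr; by_contra h; have := (hF _ h).2.2; simp only at this; omega)
  have h2 := fun i => emb_x hM hF n g j i 1 (by norm_num)
  have h3 := fun i => emb_x hM hF n g j i (-1) (by norm_num)
  push_cast at h2 h3
  simp only [Pi.single_neg, ← sub_eq_add_neg] at h3
  simp only [h2, h3]
  have h1c := congrArg (fun r : ℝ => (r : ℂ)) h1
  push_cast at h1c ⊢
  simp only [emb] at h1c ⊢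
  rw [h1c]

lemma Lz_bdd {N R J : ℕ} {F : ZLat N → ℝ} (hF : Bdd R J F) (μ k : ℕ → ℝ) (l b : Fin N → ℕ → ℝ) : Bdd (R + 1) (J + 1) (Lz μ k l b F) := by
  intro x hx
  by_contra hcon
  apply hx
  have far : ∀ y : ZLat N, |y.1 - x.1| ≤ 1 → (∀ i, |y.2.1 i - x.2.1 i| ≤ 1) → x.2.2 ≤ y.2.2 + 1 → F y = 0 := by
    intro y h1 h2 h3
    by_contra h
    obtain ⟨a1, a2, a3⟩ := hF y h
    apply hcon
    push_cast
    refine ⟨?_, ?_, by omega⟩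
    · have := abs_le.1 a1; have := abs_le.1 h1; rw [abs_le]; constructor <;> linarith
    · intro i; have := abs_le.1 (a2 i); have := abs_le.1 (h2 i); rw [abs_le]; constructor <;> linarith
  have one : ∀ i i' : Fin N, |(Pi.single i (1 : ℤ) : Fin N → ℤ) i'| ≤ 1 := by
    intro i i'; by_cases h : i' = i
    · subst h; simp
    · simp [h]
  rw [Lz, far x (by simp) (by simp) (by omega), far (x.1, (x.2.1, x.2.2 + 1)) (by simp) (by simp) (by simp; omega), far (x.1, (x.2.1, x.2.2 - 1)) (by simp) (by simp) (by simp only; omega)]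
  simp only [sub_self, mul_zero, add_zero, zero_add]
  apply Finset.sum_eq_zero; intro i _
  rw [far (x.1, (x.2.1 + Pi.single i 1, x.2.2)) (by simp) (by intro i'; simpa using one i i') (by simp),
    far (x.1, (x.2.1 - Pi.single i 1, x.2.2)) (by simp) (by intro i'; simpa using one i i') (by simp)]
  simp

lemma Bdd.mono {N R J R' J' : ℕ} {F : ZLat N → ℝ} (hF : Bdd R J F) (h : R ≤ R') (h' : J ≤ J') : Bdd R' J' F := by
  intro x hx
  obtain ⟨a1, a2, a3⟩ := hF x hx
  refine ⟨by omega, fun i => ?_, by omega⟩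
  have := a2 i; omega

lemma Aop_emb {N M K R J : ℕ} [NeZero M] (hM : 2 * R + 6 ≤ M) (hK : J + 1 ≤ K) {F : ZLat N → ℝ} (hF : Bdd R J F) (μ k : ℕ → ℝ) (l b : Fin N → ℕ → ℝ) (τ : ℝ) (x : ZMod M × ((Fin N → ZMod M) × Fin K)) :
    Aop (Pmat (fun i => (Pi.single i 1 : Fin N → ZMod M)) (fun j : Fin K => μ j) k (fun i j => l i j) (fun i j => b i j) τ) 1 1 (fun y => (F (emb M K y) : ℂ)) x = 
    ((F (emb M K x) - F ((emb M K x).1 - 1, (emb M K x).2) - τ * Lz μ k l b F ((emb M K x).1 - 1, (emb M K x).2) : ℝ) : ℂ) := by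
  obtain ⟨n, g, j⟩ := x
  rw [Aop, Pmat_apply, Lop_emb (by omega) hK hF, emb_t (by omega) hF, emb_t (by omega) (Lz_bdd hF μ k l b)]
  push_cast; ring

lemma Bop_emb {N M K R J : ℕ} [NeZero M] (hM : 2 * R + 6 ≤ M) {F : ZLat N → ℝ} (hF : Bdd R J F) (x : ZMod M × ((Fin N → ZMod M) × Fin K)) :
    Bop 1 1 (fun y => (F (emb M K y) : ℂ)) x = ((F (emb M K x) - F ((emb M K x).1 - 1, (emb M K x).2) : ℝ) : ℂ) := by
  obtain ⟨n, g, j⟩ := x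
  rw [Bop, emb_t (by omega) hF]
  push_cast; ring

/-- `r = 1` version -/
lemma limit_one {Ω : Type*} {M : ℕ} [NeZero M] [Fintype Ω] (P : Ω → Ω → ℝ) (a : ZMod M) (w : ZMod M × Ω → ℝ) (p C : ℝ) (hp : 0 < p) (f : ZMod M × Ω → ℂ) 
    (h : ∀ r : ℝ, 0 ≤ r → r < 1 → ∑ x, w x * ‖Bop a r f x‖ ^ p ≤ C * ∑ x, w x * ‖Aop P a r f x‖ ^ p) : 
    ∑ x, w x * ‖Bop a 1 f x‖ ^ p ≤ C * ∑ x, w x * ‖Aop P a 1 f x‖ ^ p := by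
  have hc1 : Continuous fun r : ℝ => ∑ x, w x * ‖Bop a r f x‖ ^ p := by
    unfold Bop
    refine continuous_finsetSum _ fun x _ => continuous_const.mul (Continuous.rpow_const (by fun_prop) fun _ => Or.inr hp.le)
  have hc2 : Continuous fun r : ℝ => C * ∑ x, w x * ‖Aop P a r f x‖ ^ p := by
    unfold Aop
    refine continuous_const.mul (continuous_finsetSum _ fun x _ => continuous_const.mul (Continuous.rpow_const (by fun_prop) fun _ => Or.inr hp.le))
  have h1 : (𝓝[<] (1 : ℝ)).NeBot := inferInstance
  have h2 : ∀ᶠ r : ℝ in 𝓝[<] 1, ∑ x, w x * ‖Bop a r f x‖ ^ p ≤ C * ∑ x, w x * ‖Aop P a r f x‖ ^ p := by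
    filter_upwards [Ico_mem_nhdsLT (zero_lt_one' ℝ)] with r hr
    exact h r hr.1 hr.2
  have := le_of_tendsto_of_tendsto (hc1.continuousWithinAt.tendsto (s := Set.Iio 1) (x := (1 : ℝ))) (hc2.continuousWithinAt.tendsto (s := Set.Iio 1) (x := (1 : ℝ))) h2
  simpa using this

/-- weights of rows -/
def muD (a ω : ℝ) (j : ℕ) : ℝ := ((j : ℝ) + 1 + ω) ^ a
/-- conductances -/
def kD (c γ H ω : ℝ) (n : ℕ) : ℝ := if n = 0 then 1 else H * γ * ((n : ℝ) + ω) ^ c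
/-- horizontal diffusion factor -/
def lamD {N : ℕ} (i0 : Fin N) (γ ρ : ℝ) (σ : ℝ → ℝ) (i : Fin N) (y : ℝ) : ℝ := 1 + if i = i0 then γ * ρ ^ 2 * (1 - σ y ^ 2) else 0
/-- horizontal drift factor -/
def bbD (c γ ρ h : ℝ) (σ : ℝ → ℝ) (y : ℝ) : ℝ := -(γ * ρ / 2) * (σ y - σ (y - h) * ((y - h) / y) ^ c)
/-- horizontal diffusion -/
def lD {N : ℕ} (i0 : Fin N) (α γ ρ h H ω : ℝ) (σ : ℝ → ℝ) (i : Fin N) (j : ℕ) : ℝ := H * ((j : ℝ) + 1 + ω) ^ α * lamD i0 γ ρ σ i (h * ((j : ℝ) + 1 + ω))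
/-- horizontal drift -/
def bD {N : ℕ} (i0 : Fin N) (α c γ ρ h H ω : ℝ) (σ : ℝ → ℝ) (i : Fin N) (j : ℕ) : ℝ := if i = i0 then H * ((j : ℝ) + 1 + ω) ^ α * bbD c γ ρ h σ (h * ((j : ℝ) + 1 + ω)) else 0
/-- stream function -/
def kapD (c γ ρ h H ω : ℝ) (σ : ℝ → ℝ) (n : ℕ) : ℝ := H * (-(γ * ρ / 2)) * σ (h * ((n : ℝ) + ω)) * ((n : ℝ) + ω) ^ c

lemma rpow_le_abs {z T s : ℝ} (h1 : 1 ≤ z) (h2 : z ≤ T) : z ^ s ≤ T ^ |s| :=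
  (Real.rpow_le_rpow_of_exponent_le h1 (le_abs_self s)).trans (Real.rpow_le_rpow (by linarith) h2 (abs_nonneg s))

lemma rpow_inv_le_abs {z T s : ℝ} (h1 : 1 ≤ z) (h2 : z ≤ T) : (z ^ s)⁻¹ ≤ T ^ |s| := by
  rw [← Real.rpow_neg (by linarith), ← abs_neg s]; exact rpow_le_abs h1 h2

lemma lam_ge {N : ℕ} (i0 : Fin N) {γ ρ : ℝ} (hγ : 0 < γ) {σ : ℝ → ℝ} (hσ : ∀ y, |σ y| ≤ 1) (i : Fin N) (y : ℝ) : 1 ≤ lamD i0 γ ρ σ i y ∧ lamD i0 γ ρ σ i y ≤ 1 + γ * ρ ^ 2 := by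
  have h1 : σ y ^ 2 ≤ 1 := by rw [← sq_abs]; exact pow_le_one₀ (abs_nonneg _) (hσ y)
  have h2 : 0 ≤ γ * ρ ^ 2 := by positivity
  have h3 := sq_nonneg (σ y)
  unfold lamD
  split_ifs
  · constructor <;> nlinarith
  · constructor <;> linarith

lemma rate_le {N K : ℕ} (i0 : Fin N) {α c γ ρ h H ω : ℝ} {σ : ℝ → ℝ} (hγ : 0 < γ) (hH : 0 < H) (hω : 0 ≤ ω) (hω1 : ω < 1) (hσ : ∀ y, |σ y| ≤ 1) (j : Fin K) :
    rate (fun j : Fin K => muD (c - α) ω j) (kD c γ H ω) (fun i j => lD i0 α γ ρ h H ω σ i j) j ≤ 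
      K * (2 * (H * γ * ((K : ℝ) + 1) ^ |c|) * ((K : ℝ) + 1) ^ |c - α|) + 2 * (N * (H * ((K : ℝ) + 1) ^ |α| * (1 + γ * ρ ^ 2))) := by
  have hj : ((j : ℕ) : ℝ) + 1 ≤ K := by exact_mod_cast j.2
  have hj0 : (0 : ℝ) ≤ ((j : ℕ) : ℝ) := by positivity
  have hka : ∀ j j' : Fin K, ka (kD c γ H ω) j j' ≤ H * γ * ((K : ℝ) + 1) ^ |c| := by
    intro j j'
    unfold ka
    split_ifs with h1
    · unfold kD
      rw [if_neg (by omega)]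
      have h2 : ((j' : ℕ) : ℝ) + 1 ≤ K := by exact_mod_cast j'.2
      have h3 : (1 : ℝ) ≤ ((j' : ℕ) : ℝ) := by exact_mod_cast (by omega : 1 ≤ (j' : ℕ))
      gcongr
      exact rpow_le_abs (by linarith) (by linarith)
    · positivity
  unfold rate
  apply add_le_add
  · calc _ ≤ ∑ j' : Fin K, (2 * (H * γ * ((K : ℝ) + 1) ^ |c|) * ((K : ℝ) + 1) ^ |c - α|) := by
          apply Finset.sum_le_sum; intro j' _
          rw [div_eq_mul_inv]
          have hm : 0 < muD (c - α) ω j := by unfold muD; positivity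
          apply mul_le_mul
          · unfold kk; linarith [hka j j', hka j' j]
          · exact rpow_inv_le_abs (by linarith) (by linarith)
          · positivity
          · positivity
      _ = _ := by simp
  · gcongr
    calc _ ≤ ∑ i : Fin N, (H * ((K : ℝ) + 1) ^ |α| * (1 + γ * ρ ^ 2)) := by
          apply Finset.sum_le_sum; intro i _
          unfold lD
          have := lam_ge i0 (ρ := ρ) hγ hσ i (h * (((j : ℕ) : ℝ) + 1 + ω))
          apply mul_le_mul _ this.2 (by linarith) (by positivity)
          gcongr
          exact rpow_le_abs (by linarith) (by linarith)
      _ = _ := by simp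

lemma mu_b {N : ℕ} (i0 : Fin N) {α c γ ρ h H ω : ℝ} {σ : ℝ → ℝ} (hh : 0 < h) (hω : 0 ≤ ω) (j : ℕ) : 
    muD (c - α) ω j * bD i0 α c γ ρ h H ω σ i0 j = kapD c γ ρ h H ω σ (j + 1) - kapD c γ ρ h H ω σ j := by
  unfold muD bD kapD bbD
  rw [if_pos rfl]
  set z : ℝ := (j : ℝ) + 1 + ω with hz
  have hz0 : 0 < z := by positivity
  have hz1 : (j : ℝ) + ω = z - 1 := by rw [hz]; ring
  have hz2 : ((j + 1 : ℕ) : ℝ) + ω = z := by rw [hz]; push_cast; ring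
  have hz3 : 0 ≤ z - 1 := by rw [← hz1]; positivity
  have e1 : (h * z - h) / (h * z) = (z - 1) / z := by field_simp
  have e2 : h * z - h = h * (z - 1) := by ring
  rw [hz1, hz2, e1, e2, Real.div_rpow hz3 hz0.le, Real.rpow_sub hz0]
  have h1 := (Real.rpow_pos_of_pos hz0 c).ne'
  have h2 := (Real.rpow_pos_of_pos hz0 α).ne'
  field_simp
  ring

theorem lat_ineq (p m α c γ ρ : ℝ) (hp : 1 < p) (hγ : 0 < γ) (hs : 0 < (m + 1) / p) (hD : (m + 1) / p < c - α + 1) (N : ℕ) (i0 : Fin N) : 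
    ∃ C' : ℝ, 0 < C' ∧ ∀ (h : ℝ), 0 < h → ∀ J : ℕ, ∃ τ0 : ℝ, 0 < τ0 ∧ ∀ (ω : ℝ), 0 ≤ ω → ω < 1 → ∀ σ : ℝ → ℝ, (∀ y, |σ y| ≤ 1) → σ (h * ω) = 0 → (∀ y, h * J ≤ y → σ y = 0) → 
      (∀ y, h ≤ y → |bbD c γ ρ h σ y| ≤ 1) → ∀ τ, 0 < τ → τ ≤ τ0 → ∀ R : ℕ, ∀ F : ZLat N → ℝ, Bdd R J F → 
      ∑' x : ZLat N, ENNReal.ofReal (muD m ω x.2.2 * |F x - F (x.1 - 1, x.2)| ^ p) ≤ 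
      ENNReal.ofReal C' * ∑' x : ZLat N, ENNReal.ofReal (muD m ω x.2.2 * |F x - F (x.1 - 1, x.2) - τ * 
        Lz (muD (c - α) ω) (kD c γ (h ^ (α - 2)) ω) (lD i0 α γ ρ h (h ^ (α - 2)) ω σ) (bD i0 α c γ ρ h (h ^ (α - 2)) ω σ) F (x.1 - 1, x.2)| ^ p) := by
  set C : ℝ := 1 + γ * ρ ^ 2 * 2 ^ |c| with hCdef
  have hC1 : 1 ≤ C := by have : 0 ≤ γ * ρ ^ 2 * 2 ^ |c| := by positivity
                         linarith
  have hC0 : 0 < C := by linarith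
  obtain ⟨C', hC', key⟩ := wt_pow p (c - α) m (2 * C) hp (by positivity) hs hD
  refine ⟨C', hC', ?_⟩
  intro h hh J
  set H := h ^ (α - 2) with hHd
  have hH : 0 < H := Real.rpow_pos_of_pos hh _
  set K := J + 1 with hK
  set Bd : ℝ := K * (2 * (H * γ * ((K : ℝ) + 1) ^ |c|) * ((K : ℝ) + 1) ^ |c - α|) + 2 * (N * (H * ((K : ℝ) + 1) ^ |α| * (1 + γ * ρ ^ 2))) with hBd
  have hBd0 : 0 ≤ Bd := by positivity
  refine ⟨1 / (2 * (1 + (2 * C) ^ 2) * (Bd + 1)), by positivity, ?_⟩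
  intro ω hω hω1 σ hσ hσ0 hσR hbb τ hτ hτ0 R F hF
  set M := 2 * R + 10 with hM
  have : NeZero M := ⟨by omega⟩
  rw [le_div_iff₀ (by positivity)] at hτ0
  have hrate : ∀ j : Fin K, 2 * (1 + (2 * C) ^ 2) * τ * rate (fun j : Fin K => muD (c - α) ω j) (kD c γ H ω) (fun i j => lD i0 α γ ρ h H ω σ i j) j ≤ 1 := by
    intro j
    have h1 := rate_le (c := c) (α := α) (ρ := ρ) (h := h) i0 hγ hH hω hω1 hσ j
    calc _ ≤ 2 * (1 + (2 * C) ^ 2) * τ * (Bd + 1) := by gcongr; linarith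
      _ ≤ 1 := by linarith
  have hμ : ∀ j : Fin K, 0 < (fun j : Fin K => muD (c - α) ω j) j := by intro j; simp only [muD]; positivity
  have hk : ∀ n, 0 < kD c γ H ω n := by
    intro n; unfold kD; split_ifs with h0
    · norm_num
    · have : (0 : ℝ) < n := by exact_mod_cast Nat.pos_of_ne_zero h0
      positivity
  have hzh : ∀ j : ℕ, h ≤ h * ((j : ℝ) + 1 + ω) := by
    intro j; have : (0 : ℝ) ≤ j := by positivity
    nlinarith
  have hbl : ∀ (i : Fin N) (j : Fin K), |(fun i (j : Fin K) => bD i0 α c γ ρ h H ω σ i j) i j| ≤ (fun i (j : Fin K) => lD i0 α γ ρ h H ω σ i j) i j := by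
    intro i j
    simp only [bD, lD]
    have h1 := (lam_ge i0 (ρ := ρ) hγ hσ i (h * (((j : ℕ) : ℝ) + 1 + ω))).1
    have h2 : 0 < H * (((j : ℕ) : ℝ) + 1 + ω) ^ α := by positivity
    split_ifs
    · rw [abs_mul, abs_of_pos h2]
      apply mul_le_mul_of_nonneg_left _ h2.le
      exact (hbb _ (hzh j)).trans h1
    · rw [abs_zero]; positivity
  have hml : ∀ j : ℕ, H * ((j : ℝ) + 1 + ω) ^ c ≤ muD (c - α) ω j * lD i0 α γ ρ h H ω σ i0 j := by
    intro j
    unfold muD lD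
    have h1 := (lam_ge i0 (ρ := ρ) hγ hσ i0 (h * ((j : ℝ) + 1 + ω))).1
    have h0 : 0 < (j : ℝ) + 1 + ω := by positivity
    have h2 : 0 < ((j : ℝ) + 1 + ω) ^ c := by positivity
    have e : ((j : ℝ) + 1 + ω) ^ (c - α) * ((j : ℝ) + 1 + ω) ^ α = ((j : ℝ) + 1 + ω) ^ c := by rw [← Real.rpow_add h0]; ring_nf
    calc H * ((j : ℝ) + 1 + ω) ^ c = H * ((j : ℝ) + 1 + ω) ^ c * 1 := by ring
      _ ≤ H * ((j : ℝ) + 1 + ω) ^ c * lamD i0 γ ρ σ i0 (h * ((j : ℝ) + 1 + ω)) := by gcongr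
      _ = _ := by rw [← e]; ring
  have hkap : ∀ n : ℕ, n ≠ 0 → ∀ Z : ℝ, ((n : ℝ) + ω) ^ c ≤ 2 ^ |c| * Z → kapD c γ ρ h H ω σ n ^ 2 ≤ C ^ 2 * kD c γ H ω n * (H * Z) := by
    intro n hn Z hZ
    unfold kapD kD
    rw [if_neg hn]
    set s := σ (h * ((n : ℝ) + ω))
    set ζ := ((n : ℝ) + ω) ^ c
    have hζ : 0 < ζ := by
      have : (0 : ℝ) < n := by exact_mod_cast Nat.pos_of_ne_zero hn
      positivity
    have hs1 : s ^ 2 ≤ 1 := by rw [← sq_abs]; exact pow_le_one₀ (abs_nonneg _) (hσ _)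
    have hZ0 : 0 ≤ Z := by
      by_contra hneg
      push Not at hneg
      have : (0 : ℝ) < 2 ^ |c| := by positivity
      nlinarith
    have hC2 : γ * ρ ^ 2 * 2 ^ |c| ≤ C ^ 2 := by nlinarith
    calc (H * -(γ * ρ / 2) * s * ζ) ^ 2 = (H ^ 2 * γ * ζ) * (γ * ρ ^ 2 / 4 * ζ) * s ^ 2 := by ring
      _ ≤ (H ^ 2 * γ * ζ) * (γ * ρ ^ 2 / 4 * ζ) * 1 := by gcongr
      _ ≤ (H ^ 2 * γ * ζ) * (γ * ρ ^ 2 * (2 ^ |c| * Z)) := by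
          rw [mul_one]; gcongr
          have : 0 ≤ γ * ρ ^ 2 := by positivity
          linarith
      _ = (H ^ 2 * γ * ζ) * Z * (γ * ρ ^ 2 * 2 ^ |c|) := by ring
      _ ≤ (H ^ 2 * γ * ζ) * Z * C ^ 2 := by gcongr
      _ = _ := by ring
  have hsto := Pmat_sto (G := Fin N → ZMod M) (e := fun i => Pi.single i 1) (τ := τ) hμ hk hτ hbl (by
    intro j
    have h1 := hrate j
    have h2 : 0 ≤ rate (fun j : Fin K => muD (c - α) ω j) (kD c γ H ω) (fun i j => lD i0 α γ ρ h H ω σ i j) j := by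
      unfold rate
      apply add_nonneg
      · exact Finset.sum_nonneg fun j' _ => div_nonneg (kk_nonneg hk _ _) (hμ _).le
      · exact mul_nonneg zero_le_two (Finset.sum_nonneg fun i _ => (abs_nonneg _).trans (hbl i j))
    have h3 : 0 ≤ τ * rate (fun j : Fin K => muD (c - α) ω j) (kD c γ H ω) (fun i j => lD i0 α γ ρ h H ω σ i j) j := mul_nonneg hτ.le h2
    nlinarith [sq_nonneg (2 * C)])
  have hsect := Pmat_sect (G := Fin N → ZMod M) (e := fun i => Pi.single i 1) (τ := τ) (C := C) i0 hC0.le (kapD c γ ρ h H ω σ) 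
    (by simp [kapD, hσ0]) (by 
      unfold kapD; rw [hσR]
      · simp
      · rw [hK]; push_cast; gcongr; linarith) hμ hk hbl
    (by intro i j hi; simp [bD, hi]) (fun j => mu_b i0 hh hω j)
    (by
      intro j j' hjj
      have e : (((j' : Fin K) : ℕ) : ℝ) = ((j : ℕ) : ℝ) + 1 := by rw [← hjj]; push_cast; ring
      have hZ : ((((j' : Fin K) : ℕ) : ℝ) + ω) ^ c ≤ 2 ^ |c| * (((j : ℕ) : ℝ) + 1 + ω) ^ c := by
        rw [e]
        have h3 : 0 ≤ (((j : ℕ) : ℝ) + 1 + ω) ^ c := by positivity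
        have h4 : (1 : ℝ) ≤ 2 ^ |c| := Real.one_le_rpow (by norm_num) (abs_nonneg c)
        nlinarith
      refine (hkap j' (by omega) _ hZ).trans ?_
      exact mul_le_mul_of_nonneg_left (hml j) (mul_nonneg (sq_nonneg _) (hk _).le))
    (by
      intro j j' hjj
      have e : (((j' : Fin K) : ℕ) : ℝ) = ((j : ℕ) : ℝ) + 1 := by rw [← hjj]; push_cast; ring
      have e2 : (0 : ℝ) ≤ ((j : ℕ) : ℝ) := by positivity
      have hZ := (zb c ((((j' : Fin K) : ℕ) : ℝ) + ω) ((((j' : Fin K) : ℕ) : ℝ) + 1 + ω) (by linarith) (by linarith) (by linarith)).2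
      refine (hkap j' (by omega) _ hZ).trans ?_
      exact mul_le_mul_of_nonneg_left (hml j') (mul_nonneg (sq_nonneg _) (hk _).le)) hτ hrate
  have hrows := Pmat_rows (G := Fin N → ZMod M) (e := fun i => Pi.single i 1) (τ := τ) (l := fun i (j : Fin K) => lD i0 α γ ρ h H ω σ i j) (b := fun i (j : Fin K) => bD i0 α c γ ρ h H ω σ i j) hμ hk hτ
  have main := limit_one _ _ _ p C' (by linarith) _ (fun r hr hr1 => key M (Fin N → ZMod M) K ω _ _ hω hω1 hsto hsect hrows 1 r hr hr1 (fun y => (F (emb M K y) : ℂ)))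
  simp only [Aop_emb (show 2 * R + 6 ≤ M by omega) (show J + 1 ≤ K by omega) hF (muD (c - α) ω) (kD c γ H ω) (lD i0 α γ ρ h H ω σ) (bD i0 α c γ ρ h H ω σ) τ, 
    Bop_emb (show 2 * R + 6 ≤ M by omega) hF, Complex.norm_real, Real.norm_eq_abs] at main
  have hmu : ∀ j, 0 ≤ muD m ω j := by intro j; unfold muD; positivity
  have conv : ∀ G : ZLat N → ℝ, (∀ x, G x ≠ 0 → |x.1| ≤ (R : ℤ) + 2 ∧ (∀ i, |x.2.1 i| ≤ (R : ℤ) + 2) ∧ x.2.2 < K) → 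
      ∑' x : ZLat N, ENNReal.ofReal (muD m ω x.2.2 * |G x| ^ p) = ENNReal.ofReal (∑ x : ZMod M × ((Fin N → ZMod M) × Fin K), pwt ω m x.2.2 * |G (emb M K x)| ^ p) := by
    intro G hG
    rw [← Function.Injective.tsum_eq (emb_inj (N := N) (M := M) (K := K)), tsum_fintype, ENNReal.ofReal_sum_of_nonneg]
    · rfl
    · intro x _; exact mul_nonneg (hmu _) (by positivity)
    · intro x hx
      have h0 : G x ≠ 0 := by
        intro h0; apply hx; simp only [h0, abs_zero]; rw [Real.zero_rpow (by linarith)]; simp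
      obtain ⟨h1, h2, h3⟩ := hG x h0
      exact emb_range (R := R + 2) (by omega) x (by push_cast; exact h1) (by push_cast; exact h2) h3
  have hLb := Lz_bdd hF (muD (c - α) ω) (kD c γ H ω) (lD i0 α γ ρ h H ω σ) (bD i0 α c γ ρ h H ω σ)
  have wk : ∀ (R' J' : ℕ) (G : ZLat N → ℝ), R' ≤ R + 1 → J' ≤ J + 1 → Bdd R' J' G → ∀ x : ZLat N, G x ≠ 0 → |x.1| ≤ (R : ℤ) + 2 ∧ (∀ i, |x.2.1 i| ≤ (R : ℤ) + 2) ∧ x.2.2 < K := by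
    intro R' J' G hR hJ hG x hx
    obtain ⟨h1, h2, h3⟩ := hG x hx
    exact ⟨by omega, fun i => by have := h2 i; omega, by omega⟩
  have wk2 : ∀ (R' J' : ℕ) (G : ZLat N → ℝ), R' ≤ R + 1 → J' ≤ J + 1 → Bdd R' J' G → ∀ x : ZLat N, G (x.1 - 1, x.2) ≠ 0 → |x.1| ≤ (R : ℤ) + 2 ∧ (∀ i, |x.2.1 i| ≤ (R : ℤ) + 2) ∧ x.2.2 < K := by
    intro R' J' G hR hJ hG x hx
    obtain ⟨h1, h2, h3⟩ := hG _ hx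
    simp only at h1 h2 h3
    refine ⟨?_, fun i => by have := h2 i; omega, by omega⟩
    rw [abs_le] at h1 ⊢; constructor <;> omega
  rw [conv (fun x => F x - F (x.1 - 1, x.2)), conv (fun x => F x - F (x.1 - 1, x.2) - τ * Lz (muD (c - α) ω) (kD c γ H ω) (lD i0 α γ ρ h H ω σ) (bD i0 α c γ ρ h H ω σ) F (x.1 - 1, x.2)), ← ENNReal.ofReal_mul hC'.le]
  · exact ENNReal.ofReal_le_ofReal main
  · intro x hx
    by_cases h0 : F x = 0
    · by_cases h1 : F (x.1 - 1, x.2) = 0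
      · refine wk2 _ _ _ le_rfl le_rfl hLb x ?_
        intro h2; apply hx; simp only [h0, h1, h2]; ring
      · exact wk2 _ _ _ (by omega) (by omega) hF x h1
    · exact wk _ _ _ (by omega) (by omega) hF x h0
  · intro x hx
    by_cases h0 : F x = 0
    · refine wk2 _ _ _ (by omega) (by omega) hF x ?_
      intro h2; apply hx; simp only [h0, h2]; ring
    · exact wk _ _ _ (by omega) (by omega) hF x h0

/-- tiling by translates of a cell -/
theorem tile {W K : Type*} [MeasurableSpace W] [AddGroup W] [MeasurableAdd W] (ν : Measure W) [ν.IsAddRightInvariant] [Countable K] [AddGroup K] [MeasurableSpace K] [MeasurableSingletonClass K] 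
    (φ : W → K) (hφ : Measurable φ) (v : K → W) (hv : ∀ w k, φ (w + v k) = φ w + k) (Φ : W → ENNReal) (hΦ : Measurable Φ) : 
    ∫⁻ w, Φ w ∂ν = ∫⁻ w in φ ⁻¹' {0}, ∑' k, Φ (w + v k) ∂ν := by
  have hm : ∀ k, MeasurableSet (φ ⁻¹' {k}) := fun k => hφ (measurableSet_singleton k)
  have hU : (⋃ k, φ ⁻¹' {k}) = Set.univ := by ext w; simp
  rw [lintegral_tsum (f := fun k w => Φ (w + v k)) (fun k => (hΦ.comp (measurable_add_const (v k))).aemeasurable), ← setLIntegral_univ, ← hU, lintegral_iUnion hm]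
  · congr 1; funext k
    rw [← lintegral_indicator (hm k), ← lintegral_indicator (hm 0), ← lintegral_add_right_eq_self _ (v k)]
    congr 1; funext w
    have e : w + v k ∈ φ ⁻¹' {k} ↔ w ∈ φ ⁻¹' {0} := by
      rw [Set.mem_preimage, Set.mem_preimage, Set.mem_singleton_iff, Set.mem_singleton_iff, hv, add_eq_right]
    by_cases h : w ∈ φ ⁻¹' {0}
    · rw [Set.indicator_of_mem h, Set.indicator_of_mem (e.2 h)]
    · rw [Set.indicator_of_notMem h, Set.indicator_of_notMem (fun h' => h (e.1 h'))]
  · intro a b hab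
    rw [Function.onFun, Set.disjoint_left]
    intro w h1 h2
    exact hab (h1.symm.trans h2)

/-- space-time points -/
abbrev WW (N : ℕ) := ℝ × ((Fin N → ℝ) × ℝ)

/-- finite difference generator -/
def Lh {N : ℕ} (i0 : Fin N) (α c γ ρ h : ℝ) (σ : ℝ → ℝ) (U : WW N → ℝ) (w : WW N) : ℝ :=
  w.2.2 ^ α * (h ^ 2)⁻¹ * (γ * ((U (w.1, (w.2.1, w.2.2 + h)) - U w) + ((w.2.2 - h) / w.2.2) ^ c * (U (w.1, (w.2.1, w.2.2 - h)) - U w)) + 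
    ∑ i, ((lamD i0 γ ρ σ i w.2.2 + if i = i0 then bbD c γ ρ h σ w.2.2 else 0) * (U (w.1, (w.2.1 + Pi.single i h, w.2.2)) - U w) + 
      (lamD i0 γ ρ σ i w.2.2 - if i = i0 then bbD c γ ρ h σ w.2.2 else 0) * (U (w.1, (w.2.1 - Pi.single i h, w.2.2)) - U w)))

/-- cell index -/
def cellI {N : ℕ} (τ h : ℝ) (w : WW N) : ℤ × ((Fin N → ℤ) × ℤ) := (⌊w.1 / τ⌋, (fun i => ⌊w.2.1 i / h⌋, ⌊w.2.2 / h⌋))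
/-- lattice vectors -/
def latV {N : ℕ} (τ h : ℝ) (k : ℤ × ((Fin N → ℤ) × ℤ)) : WW N := (τ * k.1, (fun i => h * k.2.1 i, h * k.2.2))

lemma cellI_add {N : ℕ} {τ h : ℝ} (hτ : 0 < τ) (hh : 0 < h) (w : WW N) (k : ℤ × ((Fin N → ℤ) × ℤ)) : cellI τ h (w + latV τ h k) = cellI τ h w + k := by
  unfold cellI latV
  refine Prod.ext ?_ (Prod.ext ?_ ?_)
  · simp [add_div, mul_div_cancel_left₀ _ hτ.ne', Int.floor_add_intCast]
  · funext i; simp [add_div, mul_div_cancel_left₀ _ hh.ne', Int.floor_add_intCast]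
  · simp [add_div, mul_div_cancel_left₀ _ hh.ne', Int.floor_add_intCast]

lemma cellI_meas {N : ℕ} {τ h : ℝ} : Measurable (cellI (N := N) τ h) := by
  unfold cellI
  refine Measurable.prodMk ?_ (Measurable.prodMk (measurable_pi_lambda _ fun i => ?_) ?_)
  · exact Int.measurable_floor.comp (by fun_prop)
  · exact Int.measurable_floor.comp (by fun_prop)
  · exact Int.measurable_floor.comp (by fun_prop)

instance invWW (N : ℕ) : (volume : Measure (WW N)).IsAddRightInvariant := by
  have h1 : (volume : Measure ((Fin N → ℝ) × ℝ)).IsAddLeftInvariant := Measure.prod.instIsAddLeftInvariant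
  have h2 : (volume : Measure (WW N)).IsAddLeftInvariant := Measure.prod.instIsAddLeftInvariant
  infer_instance

lemma tile_ws {N : ℕ} {τ h : ℝ} (hτ : 0 < τ) (hh : 0 < h) (Φ : WW N → ENNReal) (hΦ : Measurable Φ) : 
    ∫⁻ w in {w : WW N | h ≤ w.2.2}, Φ w = ∫⁻ w in cellI τ h ⁻¹' {0}, ∑' x : ZLat N, Φ (w.1 + τ * x.1, (w.2.1 + (fun i => h * (x.2.1 i : ℝ)), w.2.2 + h * ((x.2.2 : ℝ) + 1))) := by
  have hs : MeasurableSet {w : WW N | h ≤ w.2.2} := measurableSet_le (by fun_prop) (by fun_prop)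
  rw [← lintegral_indicator hs, tile volume (cellI τ h) cellI_meas (latV τ h) (cellI_add hτ hh) _ (hΦ.indicator hs)]
  apply setLIntegral_congr_fun (cellI_meas (measurableSet_singleton _))
  intro w hw
  have h0 : ⌊w.2.2 / h⌋ = 0 := congrArg (fun k : ℤ × ((Fin N → ℤ) × ℤ) => k.2.2) hw
  rw [Int.floor_eq_zero_iff] at h0
  have hy0 : 0 ≤ w.2.2 := by have := h0.1; rw [le_div_iff₀ hh] at this; linarith
  have hy1 : w.2.2 < h := by have := h0.2; rw [div_lt_iff₀ hh] at this; linarith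
  let e : ZLat N → ℤ × ((Fin N → ℤ) × ℤ) := fun x => (x.1, (x.2.1, (x.2.2 : ℤ) + 1))
  have he : Function.Injective e := by
    rintro ⟨n, g, j⟩ ⟨n', g', j'⟩ hx
    simp only [e, Prod.mk.injEq] at hx
    simp only [Prod.mk.injEq]
    refine ⟨hx.1, hx.2.1, by omega⟩
  simp only
  rw [← he.tsum_eq]
  · congr 1; funext x
    rw [Set.indicator_of_mem]
    · congr 1
      refine Prod.ext ?_ (Prod.ext ?_ ?_) <;> simp [latV, e]
    · simp only [latV, e, Set.mem_ofPred_eq, Prod.snd_add]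
      push_cast
      have : (0 : ℝ) ≤ x.2.2 := by positivity
      nlinarith
  · intro k hk
    have hk2 : h ≤ w.2.2 + h * k.2.2 := by
      by_contra hc
      apply hk
      refine Set.indicator_of_notMem ?_ _
      simpa [latV] using hc
    have hk3 : 0 < k.2.2 := by
      by_contra hc
      push Not at hc
      have : (k.2.2 : ℝ) ≤ 0 := by exact_mod_cast hc
      nlinarith
    refine ⟨(k.1, (k.2.1, (k.2.2 - 1).toNat)), ?_⟩
    simp only [e]
    refine Prod.ext rfl (Prod.ext rfl ?_)
    simp only; omega

lemma Lz_eq {N : ℕ} (i0 : Fin N) {α c γ ρ h τ : ℝ} {σ : ℝ → ℝ} {U : WW N → ℝ} (hh : 0 < h) (hU : ∀ t x y, 0 ≤ y → y ≤ 2 * h → U (t, (x, y)) = U (t, (x, 0))) 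
    (w : WW N) {ω : ℝ} (hω : 0 ≤ ω) (hω1 : ω < 1) (hw : w.2.2 = h * ω) (x : ZLat N) : 
    Lz (muD (c - α) ω) (kD c γ (h ^ (α - 2)) ω) (lD i0 α γ ρ h (h ^ (α - 2)) ω σ) (bD i0 α c γ ρ h (h ^ (α - 2)) ω σ) 
      (fun x => U (w.1 + τ * x.1, (w.2.1 + (fun i => h * (x.2.1 i : ℝ)), w.2.2 + h * ((x.2.2 : ℝ) + 1)))) x = 
    Lh i0 α c γ ρ h σ U (w.1 + τ * x.1, (w.2.1 + (fun i => h * (x.2.1 i : ℝ)), w.2.2 + h * ((x.2.2 : ℝ) + 1))) := by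
  obtain ⟨n, g, j⟩ := x
  set z : ℝ := (j : ℝ) + 1 + ω with hz
  have hj0 : (0 : ℝ) ≤ j := by positivity
  have hz0 : 0 < z := by positivity
  have hy : w.2.2 + h * ((j : ℝ) + 1) = h * z := by rw [hw, hz]; ring
  have hH : h ^ (α - 2) * z ^ α = (h * z) ^ α * (h ^ 2)⁻¹ := by
    rw [Real.mul_rpow hh.le hz0.le, Real.rpow_sub hh, Real.rpow_two]; field_simp
  have hzc := (Real.rpow_pos_of_pos hz0 c).ne'
  have hza := (Real.rpow_pos_of_pos hz0 α).ne'
  unfold Lz Lh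
  simp only [hy]
  have e1 : kD c γ (h ^ (α - 2)) ω (j + 1) / muD (c - α) ω j = (h * z) ^ α * (h ^ 2)⁻¹ * γ := by
    rw [← hH]
    unfold kD muD
    rw [if_neg (by omega)]
    have : (((j + 1 : ℕ) : ℝ) + ω) = z := by rw [hz]; push_cast; ring
    rw [this, ← hz, Real.rpow_sub hz0]; field_simp
  have e2 : kD c γ (h ^ (α - 2)) ω j / muD (c - α) ω j * (U (w.1 + τ * n, (w.2.1 + (fun i => h * (g i : ℝ)), w.2.2 + h * (((j - 1 : ℕ) : ℝ) + 1))) - U (w.1 + τ * n, (w.2.1 + (fun i => h * (g i : ℝ)), h * z))) = 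
      (h * z) ^ α * (h ^ 2)⁻¹ * γ * ((h * z - h) / (h * z)) ^ c * (U (w.1 + τ * n, (w.2.1 + (fun i => h * (g i : ℝ)), h * z - h)) - U (w.1 + τ * n, (w.2.1 + (fun i => h * (g i : ℝ)), h * z))) := by
    rcases Nat.eq_zero_or_pos j with rfl | hj
    · have hz1 : z = 1 + ω := by rw [hz]; simp
      rw [hU _ _ (h * z) (by positivity) (by rw [hz1]; nlinarith), hU _ _ (h * z - h) (by rw [hz1]; nlinarith) (by rw [hz1]; nlinarith), hU _ _ (w.2.2 + _) (by rw [hw]; simp; positivity) (by rw [hw]; simp; nlinarith)]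
      simp
    · have e3 : w.2.2 + h * (((j - 1 : ℕ) : ℝ) + 1) = h * z - h := by
        rw [Nat.cast_sub (by omega), hw, hz]; push_cast; ring
      rw [e3]
      congr 1
      rw [← hH]
      have e4 : (h * z - h) / (h * z) = (z - 1) / z := by field_simp
      have hz1 : 0 ≤ z - 1 := by rw [hz]; linarith
      rw [e4, Real.div_rpow hz1 hz0.le]
      unfold kD muD
      rw [if_neg (by omega)]
      have : ((j : ℝ) + ω) = z - 1 := by rw [hz]; push_cast; ring
      rw [this, ← hz, Real.rpow_sub hz0]; field_simp
  have e5 : w.2.2 + h * (((j + 1 : ℕ) : ℝ) + 1) = h * z + h := by rw [hw, hz]; push_cast; ring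
  have e6 : ∀ i, (w.2.1 + fun i' => h * ((g + Pi.single i 1 : Fin N → ℤ) i' : ℝ)) = (w.2.1 + fun i => h * (g i : ℝ)) + Pi.single i h := by
    intro i; funext i'
    by_cases hi : i' = i
    · subst hi; simp; ring
    · simp [hi]
  have e7 : ∀ i, (w.2.1 + fun i' => h * ((g - Pi.single i 1 : Fin N → ℤ) i' : ℝ)) = (w.2.1 + fun i => h * (g i : ℝ)) - Pi.single i h := by
    intro i; funext i'
    by_cases hi : i' = i
    · subst hi; simp; ring
    · simp [hi]
  simp only [e1, e2, e5, e6, e7]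
  rw [mul_add ((h * z) ^ α * (h ^ 2)⁻¹), Finset.mul_sum]
  congr 1
  · ring
  · apply Finset.sum_congr rfl; intro i _
    unfold lD bD
    rw [← hz, hH]
    split_ifs <;> ring

theorem tile_ineq (p m α c γ ρ : ℝ) (hp : 1 < p) (hγ : 0 < γ) (hs : 0 < (m + 1) / p) (hD : (m + 1) / p < c - α + 1) (N : ℕ) (i0 : Fin N) : 
    ∃ C' : ℝ, 0 < C' ∧ ∀ (h : ℝ), 0 < h → ∀ J : ℕ, ∃ τ0 : ℝ, 0 < τ0 ∧ ∀ σ : ℝ → ℝ, Measurable σ → (∀ y, |σ y| ≤ 1) → (∀ y ≤ h, σ y = 0) → (∀ y, h * J ≤ y → σ y = 0) → 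
      (∀ y, h ≤ y → |bbD c γ ρ h σ y| ≤ 1) → ∀ τ, 0 < τ → τ ≤ τ0 → ∀ U : WW N → ℝ, Measurable U → (∃ T : ℝ, ∀ w, U w ≠ 0 → |w.1| ≤ T ∧ ∀ i, |w.2.1 i| ≤ T) → 
      (∀ w : WW N, h * J ≤ w.2.2 → U w = 0) → (∀ t x y, 0 ≤ y → y ≤ 2 * h → U (t, (x, y)) = U (t, (x, 0))) → 
      ∫⁻ w in {w : WW N | h ≤ w.2.2}, ENNReal.ofReal (w.2.2 ^ m * |U w - U (w.1 - τ, w.2)| ^ p) ≤ 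
      ENNReal.ofReal C' * ∫⁻ w in {w : WW N | h ≤ w.2.2}, ENNReal.ofReal (w.2.2 ^ m * |U w - U (w.1 - τ, w.2) - τ * Lh i0 α c γ ρ h σ U (w.1 - τ, w.2)| ^ p) := by
  obtain ⟨C', hC', key⟩ := lat_ineq p m α c γ ρ hp hγ hs hD N i0
  refine ⟨C', hC', ?_⟩
  intro h hh J
  obtain ⟨τ0, hτ0, key⟩ := key h hh J
  refine ⟨τ0, hτ0, ?_⟩
  intro σ hσm hσ1 hσ0 hσJ hbb τ hτ hττ U hUm ⟨T, hT⟩ hUJ hUc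
  have hLm : Measurable (Lh i0 α c γ ρ h σ U) := by
    have hl : ∀ i, Measurable (lamD i0 γ ρ σ i) := by
      intro i; unfold lamD; split_ifs <;> fun_prop
    have hb : Measurable (bbD c γ ρ h σ) := by unfold bbD; fun_prop
    unfold Lh
    refine Measurable.mul (by fun_prop) (Measurable.add (by fun_prop) ?_)
    refine Finset.measurable_sum _ fun i _ => ?_
    have := hl i
    split_ifs <;> fun_prop
  rw [tile_ws hτ hh _ (by fun_prop), tile_ws hτ hh _ (by fun_prop), ← lintegral_const_mul']
  swap
  · exact ENNReal.ofReal_ne_top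
  apply setLIntegral_mono'  (cellI_meas (measurableSet_singleton _))
  intro w hw
  have h0 : ⌊w.2.2 / h⌋ = 0 := congrArg (fun k : ℤ × ((Fin N → ℤ) × ℤ) => k.2.2) hw
  rw [Int.floor_eq_zero_iff] at h0
  set ω := w.2.2 / h with hωd
  have hw2 : w.2.2 = h * ω := by rw [hωd]; field_simp
  obtain ⟨R, hR⟩ := exists_nat_ge ((T + |w.1|) / τ + (T + ‖w.2.1‖) / h)
  have hT0 : 0 ≤ |T| := abs_nonneg T
  set F : ZLat N → ℝ := fun x => U (w.1 + τ * x.1, (w.2.1 + (fun i => h * (x.2.1 i : ℝ)), w.2.2 + h * ((x.2.2 : ℝ) + 1))) with hFd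
  have hF : Bdd R J F := by
    intro x hx
    obtain ⟨h1, h2⟩ := hT _ hx
    simp only at h1 h2
    have hTn : 0 ≤ T := (abs_nonneg _).trans h1
    have hA : (T + |w.1|) / τ ≤ R := by
      have : 0 ≤ (T + ‖w.2.1‖) / h := by positivity
      linarith
    have hB : (T + ‖w.2.1‖) / h ≤ R := by
      have : 0 ≤ (T + |w.1|) / τ := by positivity
      linarith
    rw [div_le_iff₀ hτ] at hA
    rw [div_le_iff₀ hh] at hB
    have aux : ∀ (r a b Rr : ℝ) (n : ℤ), 0 < r → |a + r * n| ≤ T → |a| ≤ b → T + b ≤ R * r → |n| ≤ R := by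
      intro r a b Rr n hr h3 h4 h5
      have h6 : |r * n| ≤ T + b := by
        calc |r * n| = |(a + r * n) - a| := by ring_nf
          _ ≤ _ := abs_sub _ _
          _ ≤ _ := by linarith
      rw [abs_mul, abs_of_pos hr] at h6
      have h7 : |(n : ℝ)| ≤ R := by
        by_contra hc
        push Not at hc
        nlinarith
      exact_mod_cast h7
    refine ⟨aux τ w.1 |w.1| 0 x.1 hτ h1 le_rfl hA, fun i => aux h (w.2.1 i) ‖w.2.1‖ 0 _ hh (h2 i) (norm_le_pi_norm w.2.1 i) hB, ?_⟩
    by_contra hc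
    push Not at hc
    apply hx
    apply hUJ
    simp only
    have : (J : ℝ) ≤ x.2.2 := by exact_mod_cast hc
    have : 0 ≤ h * ω := mul_nonneg hh.le h0.1
    rw [hw2]
    nlinarith
  have := key ω h0.1 h0.2 σ hσ1 (hσ0 _ (by nlinarith [h0.2])) hσJ hbb τ hτ hττ R F hF
  have em : ∀ (x : ZLat N) (r : ℝ), ENNReal.ofReal ((w.2.2 + h * ((x.2.2 : ℝ) + 1)) ^ m * r) = ENNReal.ofReal (h ^ m) * ENNReal.ofReal (muD m ω x.2.2 * r) := by
    intro x r
    rw [← ENNReal.ofReal_mul (by positivity), ← mul_assoc]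
    have : w.2.2 + h * ((x.2.2 : ℝ) + 1) = h * ((x.2.2 : ℝ) + 1 + ω) := by rw [hw2]; ring
    rw [this, Real.mul_rpow hh.le (by have := h0.1; positivity)]; rfl
  have eF : ∀ x : ZLat N, U (w.1 + τ * x.1 - τ, (w.2.1 + (fun i => h * (x.2.1 i : ℝ)), w.2.2 + h * ((x.2.2 : ℝ) + 1))) = F (x.1 - 1, x.2) := by
    intro x
    simp only [hFd]; push_cast
    congr 2; ring
  have eL : ∀ x : ZLat N, Lh i0 α c γ ρ h σ U (w.1 + τ * x.1 - τ, (w.2.1 + (fun i => h * (x.2.1 i : ℝ)), w.2.2 + h * ((x.2.2 : ℝ) + 1))) = 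
      Lz (muD (c - α) ω) (kD c γ (h ^ (α - 2)) ω) (lD i0 α γ ρ h (h ^ (α - 2)) ω σ) (bD i0 α c γ ρ h (h ^ (α - 2)) ω σ) F (x.1 - 1, x.2) := by
    intro x
    rw [Lz_eq i0 hh hUc w h0.1 h0.2 hw2 (x.1 - 1, x.2)]
    congr 2; push_cast; ring
  simp only [em, eF, eL, ENNReal.tsum_mul_left]
  calc _ ≤ ENNReal.ofReal (h ^ m) * _ := mul_le_mul_right this _
    _ = _ := by rw [← mul_assoc, ← mul_assoc, mul_comm (ENNReal.ofReal C')]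

lemma mv_abs {f f' : ℝ → ℝ} {s M : ℝ} (hf : ∀ x, |x| ≤ |s| → HasDerivAt f (f' x) x) (hM : ∀ x, |x| ≤ |s| → |f' x| ≤ M) : |f s - f 0| ≤ M * |s| := by
  have := Convex.norm_image_sub_le_of_norm_hasDerivWithin_le (f := f) (f' := f') (s := Set.Icc (-|s|) |s|) (C := M) (x := 0) (y := s)
    (fun x hx => (hf x (abs_le.2 hx)).hasDerivWithinAt) (fun x hx => hM x (abs_le.2 hx)) (convex_Icc _ _) (by simp) (abs_le.1 le_rfl)
  simpa using this

lemma mv_one {f f' : ℝ → ℝ} {C : ℝ} (hC : 0 ≤ C) (hf : ∀ x, HasDerivAt f (f' x) x) (hM : ∀ x, |f' x - f' 0| ≤ C * |x|) (s : ℝ) : |f s - f 0 - s * f' 0| ≤ C * s ^ 2 := by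
  have := mv_abs (f := fun x => f x - x * f' 0) (f' := fun x => f' x - f' 0) (s := s) (M := C * |s|) 
    (fun x _ => ((hf x).sub ((hasDerivAt_id x).mul_const (f' 0))).congr_deriv (by simp)) (fun x hx => (hM x).trans (by gcongr))
  rw [mul_assoc, ← sq, sq_abs] at this
  convert this using 2; ring

lemma mv_two {f f' f'' : ℝ → ℝ} {C : ℝ} (hC : 0 ≤ C) (hf : ∀ x, HasDerivAt f (f' x) x) (hf' : ∀ x, HasDerivAt f' (f'' x) x) (hM : ∀ x, |f'' x - f'' 0| ≤ C * |x|) (s : ℝ) : 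
    |f s + f (-s) - 2 * f 0 - s ^ 2 * f'' 0| ≤ 2 * C * |s| ^ 3 := by
  have h1 := mv_one hC hf' hM
  have := mv_abs (f := fun x => f x + f (-x) - 2 * f 0 - x ^ 2 * f'' 0) (f' := fun x => f' x - f' (-x) - 2 * x * f'' 0) (s := s) (M := 2 * C * s ^ 2) 
    (fun x _ => by
      have a := (hf (-x)).comp x (hasDerivAt_neg x)
      have b := ((hf x).add a).sub_const (2 * f 0)
      have d := b.sub ((hasDerivAt_pow 2 x).mul_const (f'' 0))
      refine d.congr_deriv ?_
      simp; ring) (fun x hx => by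
      have a := h1 x
      have b := h1 (-x)
      have e : f' x - f' (-x) - 2 * x * f'' 0 = (f' x - f' 0 - x * f'' 0) - (f' (-x) - f' 0 - -x * f'' 0) := by ring
      rw [e]
      have : x ^ 2 ≤ s ^ 2 := sq_le_sq.2 hx
      calc _ ≤ _ := abs_sub _ _
        _ ≤ C * x ^ 2 + C * (-x) ^ 2 := add_le_add a b
        _ ≤ _ := by nlinarith)
  have e : 2 * C * s ^ 2 * |s| = 2 * C * |s| ^ 3 := by rw [← sq_abs s]; ring
  rw [e] at this
  convert this using 2
  simp; ring

section taylor
variable {E : Type*} [NormedAddCommGroup E] [NormedSpace ℝ E] 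

lemma cd_fd {G : E → ℝ} (hG : ContDiff ℝ (⊤ : ℕ∞) G) (v : E) : ContDiff ℝ (⊤ : ℕ∞) (fun w => fderiv ℝ G w v) :=
  (hG.fderiv_right (m := (⊤ : ℕ∞)) (by norm_cast)).clm_apply contDiff_const

lemma hcs_fd {G : E → ℝ} (hG : HasCompactSupport G) (v : E) : HasCompactSupport (fun w => fderiv ℝ G w v) := hG.fderiv_apply (𝕜 := ℝ) v

lemma line_deriv {G : E → ℝ} (hG : ContDiff ℝ (⊤ : ℕ∞) G) (w v : E) (s : ℝ) : HasDerivAt (fun s : ℝ => G (w + s • v)) (fderiv ℝ G (w + s • v) v) s := by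
  have h1 : HasFDerivAt G (fderiv ℝ G (w + s • v)) (w + s • v) := (hG.differentiable (by simp) _).hasFDerivAt
  have h2 : HasDerivAt (fun s : ℝ => w + s • v) v s := by simpa using ((hasDerivAt_id s).smul_const v).const_add w
  exact h1.comp_hasDerivAt s h2

lemma bd_zero {G : E → ℝ} (hG : ContDiff ℝ (⊤ : ℕ∞) G) (hc : HasCompactSupport G) : ∃ C, 0 ≤ C ∧ ∀ w, |G w| ≤ C := by
  obtain ⟨C, hC⟩ := hc.exists_bound_of_continuous hG.continuous
  exact ⟨|C|, abs_nonneg _, fun w => (hC w).trans (le_abs_self C)⟩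

lemma bd_one {G : E → ℝ} (hG : ContDiff ℝ (⊤ : ℕ∞) G) (hc : HasCompactSupport G) (v : E) : ∃ C, 0 ≤ C ∧ ∀ w (s : ℝ), |G (w + s • v) - G w| ≤ C * |s| := by
  obtain ⟨C, hC, h⟩ := bd_zero (cd_fd hG v) (hcs_fd hc v)
  refine ⟨C, hC, fun w s => ?_⟩
  have := mv_abs (s := s) (M := C) (fun x _ => line_deriv hG w v x) (fun x _ => h _)
  simpa using this

lemma bd_two {G : E → ℝ} (hG : ContDiff ℝ (⊤ : ℕ∞) G) (hc : HasCompactSupport G) (v : E) : ∃ C, 0 ≤ C ∧ ∀ w (s : ℝ), |G (w + s • v) - G w - s * fderiv ℝ G w v| ≤ C * s ^ 2 := by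
  obtain ⟨C, hC, h⟩ := bd_one (cd_fd hG v) (hcs_fd hc v) v
  refine ⟨C, hC, fun w s => ?_⟩
  have := mv_one hC (fun x => line_deriv hG w v x) (fun x => by simpa using h w x) s
  simpa using this

lemma bd_three {G : E → ℝ} (hG : ContDiff ℝ (⊤ : ℕ∞) G) (hc : HasCompactSupport G) (v : E) : ∃ C, 0 ≤ C ∧ ∀ w (s : ℝ), |G (w + s • v) + G (w - s • v) - 2 * G w - s ^ 2 * fderiv ℝ (fun w => fderiv ℝ G w v) w v| ≤ C * |s| ^ 3 := by
  obtain ⟨C, hC, h⟩ := bd_one (cd_fd (cd_fd hG v) v) (hcs_fd (hcs_fd hc v) v) v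
  refine ⟨2 * C, by positivity, fun w s => ?_⟩
  have := mv_two hC (fun x => line_deriv hG w v x) (fun x => line_deriv (cd_fd hG v) w v x) (fun x => by simpa using h w x) s
  simpa [sub_eq_add_neg] using this

end taylor

lemma rpow_lin (c : ℝ) : ∃ C, 0 ≤ C ∧ ∀ s, 0 ≤ s → s ≤ 1 / 2 → |1 - (1 - s) ^ c - c * s| ≤ C * s ^ 2 := by
  have hd : ∀ (a x : ℝ), |x| ≤ 1 / 2 → HasDerivAt (fun x : ℝ => (1 - x) ^ a) (-(a * (1 - x) ^ (a - 1))) x := by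
    intro a x hx
    have h1 : 1 - x ≠ 0 := by have := (abs_le.1 hx).2; linarith
    have := (Real.hasDerivAt_rpow_const (p := a) (Or.inl h1)).comp x ((hasDerivAt_id x).const_sub 1)
    refine this.congr_deriv ?_
    ring
  have hb : ∀ (a x : ℝ), |x| ≤ 1 / 2 → (1 - x) ^ a ≤ 2 ^ |a| := by
    intro a x hx
    obtain ⟨hx1, hx2⟩ := abs_le.1 hx
    rcases le_total 0 a with ha | ha
    · rw [abs_of_nonneg ha]; exact Real.rpow_le_rpow (by linarith) (by linarith) ha
    · rw [abs_of_nonpos ha, ← neg_neg a, Real.rpow_neg (by linarith), ← Real.inv_rpow (by linarith), neg_neg]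
      refine Real.rpow_le_rpow (inv_nonneg.2 (by linarith)) ?_ (by linarith)
      rw [inv_le_comm₀ (by linarith) (by norm_num)]; linarith
  refine ⟨|c| * (|c - 1| * 2 ^ |c - 2|), by positivity, fun s hs0 hs => ?_⟩
  have hsa : |s| ≤ 1 / 2 := by rwa [abs_of_nonneg hs0]
  have h1 : ∀ x, |x| ≤ |s| → |(1 - x) ^ (c - 1) - 1| ≤ |c - 1| * 2 ^ |c - 2| * |s| := by
    intro x hx
    have := mv_abs (f := fun x => (1 - x) ^ (c - 1)) (s := x) (M := |c - 1| * 2 ^ |c - 2|) (fun x' hx' => hd (c - 1) x' (hx'.trans (hx.trans hsa))) (fun x' hx' => by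
      have hx2 := hx'.trans (hx.trans hsa)
      have h3 := hb (c - 2) x' hx2
      have h4 : 0 ≤ (1 - x') ^ (c - 2) := Real.rpow_nonneg (by have := (abs_le.1 hx2).2; linarith) _
      have e : c - 1 - 1 = c - 2 := by ring
      rw [e, abs_neg, abs_mul, abs_of_nonneg h4]; gcongr)
    simp only [sub_zero, Real.one_rpow] at this
    exact this.trans (by gcongr)
  have := mv_abs (f := fun x => 1 - (1 - x) ^ c - c * x) (f' := fun x => c * ((1 - x) ^ (c - 1) - 1)) (s := s) (M := |c| * (|c - 1| * 2 ^ |c - 2| * |s|)) 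
    (fun x hx => by
      have := ((hd c x (hx.trans hsa)).const_sub 1).sub ((hasDerivAt_id x).const_mul c)
      refine this.congr_deriv ?_
      ring) (fun x hx => by rw [abs_mul]; exact mul_le_mul_of_nonneg_left (h1 x hx) (abs_nonneg c))
  simp only [sub_zero, Real.one_rpow, mul_zero, sub_self] at this
  refine this.trans (le_of_eq ?_)
  rw [abs_of_nonneg hs0]; ring

lemma ratio_est (c : ℝ) : ∃ C, 0 ≤ C ∧ ∀ h y, 0 < h → 2 * h ≤ y → |(1 - ((y - h) / y) ^ c) / h - c / y| ≤ C * h / y ^ 2 := by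
  obtain ⟨C, hC, H⟩ := rpow_lin c
  refine ⟨C, hC, fun h y hh hy => ?_⟩
  have hy0 : 0 < y := by linarith
  have := H (h / y) (by positivity) (by rw [div_le_div_iff₀ hy0 (by norm_num)]; linarith)
  have e : (y - h) / y = 1 - h / y := by field_simp
  have e2 : (1 - (1 - h / y) ^ c) / h - c / y = (1 - (1 - h / y) ^ c - c * (h / y)) / h := by field_simp
  rw [e, e2, abs_div, abs_of_pos hh, div_le_iff₀ hh]
  refine this.trans (le_of_eq ?_)
  field_simp

/-- drift coefficient -/
def bcoef (c : ℝ) (σ : ℝ → ℝ) (y : ℝ) : ℝ := deriv σ y + c * σ y / y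

lemma deriv_zero_of {σ : ℝ → ℝ} {δ : ℝ} (h : ∀ y ≤ 2 * δ, σ y = 0) (hδ : 0 < δ) {y : ℝ} (hy : y ≤ δ) : deriv σ y = 0 := by
  have : σ =ᶠ[𝓝 y] fun _ => 0 := by
    filter_upwards [Iio_mem_nhds (show y < 2 * δ by linarith)] with z hz
    exact h z (le_of_lt hz)
  rw [this.deriv_eq]; simp

lemma bcoef_bd (c : ℝ) {σ : ℝ → ℝ} {δ : ℝ} (hσ : ContDiff ℝ (⊤ : ℕ∞) σ) (hc : HasCompactSupport σ) (hδ : 0 < δ) (h : ∀ y ≤ 2 * δ, σ y = 0) : ∃ K, 0 ≤ K ∧ ∀ y, 0 < y → |bcoef c σ y| ≤ K := by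
  obtain ⟨C0, hC0, H0⟩ := bd_zero hσ hc
  obtain ⟨C1, hC1, H1⟩ := bd_zero (cd_fd hσ 1) (hcs_fd hc 1)
  refine ⟨C1 + |c| * C0 / δ, by positivity, fun y hy => ?_⟩
  unfold bcoef
  rcases le_total y δ with h1 | h1
  · rw [deriv_zero_of h hδ h1, h y (by linarith)]; simp; positivity
  · refine (abs_add_le _ _).trans (add_le_add ?_ ?_)
    · have := H1 y; rwa [fderiv_apply_one_eq_deriv] at this
    · rw [abs_div, abs_mul, abs_of_pos hy]
      have := H0 y
      gcongr

lemma bcoef_est (c : ℝ) {σ : ℝ → ℝ} {δ : ℝ} (hσ : ContDiff ℝ (⊤ : ℕ∞) σ) (hc : HasCompactSupport σ) (hδ : 0 < δ) (h : ∀ y ≤ 2 * δ, σ y = 0) : 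
    ∃ K, 0 ≤ K ∧ ∀ η, 0 < η → 2 * η ≤ δ → ∀ y, η ≤ y → |(σ y - σ (y - η) * ((y - η) / y) ^ c) / η - bcoef c σ y| ≤ K * η := by
  obtain ⟨C0, hC0, H0⟩ := bd_zero hσ hc
  obtain ⟨C1, hC1, H1⟩ := bd_one hσ hc 1
  obtain ⟨C2, hC2, H2⟩ := bd_two hσ hc 1
  obtain ⟨C3, hC3, H3⟩ := ratio_est c
  refine ⟨C2 + |c| / δ * C1 + C0 * (C3 / δ ^ 2), by positivity, fun η hη hηδ y hy => ?_⟩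
  rcases le_total y δ with h1 | h1
  · unfold bcoef
    rw [deriv_zero_of h hδ h1, h y (by linarith), h (y - η) (by linarith)]; simp; positivity
  · have hy0 : 0 < y := by linarith
    set r := ((y - η) / y) ^ c
    have a1 := H1 y (-η)
    have a2 := H2 y (-η)
    have a3 := H3 η y hη (by linarith)
    rw [fderiv_apply_one_eq_deriv] at a2
    simp only [smul_eq_mul, mul_one, ← sub_eq_add_neg, abs_neg, abs_of_pos hη, neg_sq] at a1 a2
    unfold bcoef
    have e : (σ y - σ (y - η) * r) / η - (deriv σ y + c * σ y / y) = -((σ (y - η) - σ y - -η * deriv σ y) / η) + c / y * (σ (y - η) - σ y) + σ (y - η) * ((1 - r) / η - c / y) := by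
      field_simp; ring
    rw [e]
    have b1 : |-((σ (y - η) - σ y - -η * deriv σ y) / η)| ≤ C2 * η := by
      rw [abs_neg, abs_div, abs_of_pos hη, div_le_iff₀ hη]; linarith
    have b2 : |c / y * (σ (y - η) - σ y)| ≤ |c| / δ * (C1 * η) := by
      rw [abs_mul, abs_div, abs_of_pos hy0]; gcongr
    have b3 : |σ (y - η) * ((1 - r) / η - c / y)| ≤ C0 * (C3 * η / δ ^ 2) := by
      rw [abs_mul]
      refine mul_le_mul (H0 _) (a3.trans ?_) (abs_nonneg _) hC0
      gcongr
    calc _ ≤ _ := abs_add_three _ _ _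
      _ ≤ C2 * η + |c| / δ * (C1 * η) + C0 * (C3 * η / δ ^ 2) := by linarith
      _ = _ := by ring

/-- the limit operator -/
def LL {N : ℕ} (i0 : Fin N) (α c γ ρ : ℝ) (σ : ℝ → ℝ) (U : WW N → ℝ) (w : WW N) : ℝ :=
  w.2.2 ^ α * (γ * (pdT (eyT N) (pdT (eyT N) U) w + c / w.2.2 * pdT (eyT N) U w) + 
    ∑ i, (lamD i0 γ ρ σ i w.2.2 * pdT (exT i) (pdT (exT i) U) w - if i = i0 then γ * ρ * bcoef c σ w.2.2 * pdT (exT i) U w else 0))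

lemma Uy_zero {N : ℕ} {U : WW N → ℝ} {δ : ℝ} (hU : ContDiff ℝ (⊤ : ℕ∞) U) (hδ : 0 < δ) (h : ∀ t x y, 0 ≤ y → y ≤ 2 * δ → U (t, (x, y)) = U (t, (x, 0))) (w : WW N) (h0 : 0 < w.2.2) (h1 : w.2.2 ≤ δ) : pdT (eyT N) U w = 0 := by
  have h2 := line_deriv hU w (eyT N) 0
  simp only [zero_smul, add_zero] at h2
  have h3 : (fun s : ℝ => U (w + s • eyT N)) =ᶠ[𝓝 0] fun _ => U (w.1, (w.2.1, 0)) := by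
    filter_upwards [Ioo_mem_nhds (show -w.2.2 < (0 : ℝ) by linarith) (show (0 : ℝ) < δ by linarith)] with s hs
    rw [← h w.1 w.2.1 (w.2.2 + s) (by linarith [hs.1]) (by linarith [hs.2])]
    congr 1
    refine Prod.ext ?_ (Prod.ext ?_ ?_) <;> simp [eyT]
  exact h2.unique ((hasDerivAt_const (0 : ℝ) (U (w.1, (w.2.1, 0)))).congr_of_eventuallyEq h3)

lemma LL_bd {N : ℕ} (i0 : Fin N) (α c : ℝ) {γ : ℝ} (ρ : ℝ) {σ : ℝ → ℝ} {δ : ℝ} {U : WW N → ℝ} (hγ : 0 < γ) (hδ : 0 < δ) (hσ : ContDiff ℝ (⊤ : ℕ∞) σ) (hc : HasCompactSupport σ) (hσ1 : ∀ y, |σ y| ≤ 1) (hσ0 : ∀ y ≤ 2 * δ, σ y = 0) 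
    (hU : ContDiff ℝ (⊤ : ℕ∞) U) (hUc : HasCompactSupport U) (hUy : ∀ t x y, 0 ≤ y → y ≤ 2 * δ → U (t, (x, y)) = U (t, (x, 0))) : 
    ∃ K, 0 ≤ K ∧ ∀ w : WW N, 0 < w.2.2 → |LL i0 α c γ ρ σ U w| ≤ K * w.2.2 ^ α := by
  obtain ⟨B, hB, HB⟩ := bcoef_bd c hσ hc hδ hσ0
  obtain ⟨Cy, hCy, Hy⟩ := bd_zero (cd_fd hU (eyT N)) (hcs_fd hUc (eyT N))
  obtain ⟨Cyy, hCyy, Hyy⟩ := bd_zero (cd_fd (cd_fd hU (eyT N)) (eyT N)) (hcs_fd (hcs_fd hUc (eyT N)) (eyT N))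
  have hx : ∀ i : Fin N, _ := fun i => bd_zero (cd_fd hU (exT i)) (hcs_fd hUc (exT i))
  have hxx : ∀ i : Fin N, _ := fun i => bd_zero (cd_fd (cd_fd hU (exT i)) (exT i)) (hcs_fd (hcs_fd hUc (exT i)) (exT i))
  choose Cx hCx Hx using hx
  choose Cxx hCxx Hxx using hxx
  refine ⟨γ * (Cyy + |c| / δ * Cy) + ∑ i, ((1 + γ * ρ ^ 2) * Cxx i + γ * |ρ| * B * Cx i), add_nonneg (by positivity) (Finset.sum_nonneg fun i _ => by have := hCx i; have := hCxx i; positivity), fun w hw => ?_⟩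
  unfold LL
  have hya : 0 ≤ w.2.2 ^ α := by positivity
  rw [abs_mul, abs_of_nonneg hya, mul_comm]
  apply mul_le_mul_of_nonneg_right _ hya
  refine (abs_add_le _ _).trans (add_le_add ?_ ((Finset.abs_sum_le_sum_abs _ _).trans (Finset.sum_le_sum fun i _ => ?_)))
  · rw [abs_mul, abs_of_pos hγ]
    apply mul_le_mul_of_nonneg_left _ hγ.le
    refine (abs_add_le _ _).trans (add_le_add (Hyy w) ?_)
    rcases le_total w.2.2 δ with h1 | h1
    · rw [Uy_zero hU hδ hUy w hw h1]; simp; positivity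
    · rw [abs_mul, abs_div, abs_of_pos hw]
      have : |pdT (eyT N) U w| ≤ Cy := Hy w
      gcongr
  · refine (abs_sub _ _).trans (add_le_add ?_ ?_)
    · have h1 := lam_ge i0 (ρ := ρ) hγ hσ1 i w.2.2
      rw [abs_mul, abs_of_nonneg (by linarith)]
      exact mul_le_mul h1.2 (Hxx i w) (abs_nonneg _) (by positivity)
    · have := hCx i
      split_ifs
      · rw [abs_mul, abs_mul, abs_mul, abs_of_pos hγ]
        have h2 := HB _ hw
        have : |pdT (exT i) U w| ≤ Cx i := Hx i w
        gcongr
      · rw [abs_zero]; positivity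

lemma Lh_est {N : ℕ} (i0 : Fin N) (α c : ℝ) {γ : ℝ} (ρ : ℝ) {σ : ℝ → ℝ} {δ : ℝ} {U : WW N → ℝ} (hγ : 0 < γ) (hδ : 0 < δ) (hσ : ContDiff ℝ (⊤ : ℕ∞) σ) (hc : HasCompactSupport σ) (hσ1 : ∀ y, |σ y| ≤ 1) (hσ0 : ∀ y ≤ 2 * δ, σ y = 0) 
    (hU : ContDiff ℝ (⊤ : ℕ∞) U) (hUc : HasCompactSupport U) (hUy : ∀ t x y, 0 ≤ y → y ≤ 2 * δ → U (t, (x, y)) = U (t, (x, 0))) : 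
    ∃ K, 0 ≤ K ∧ ∀ h, 0 < h → 2 * h ≤ δ → ∀ w : WW N, h ≤ w.2.2 → |Lh i0 α c γ ρ h σ U w - LL i0 α c γ ρ σ U w| ≤ K * h * w.2.2 ^ α := by
  obtain ⟨B, hB, HB⟩ := bcoef_bd c hσ hc hδ hσ0
  obtain ⟨B', hB', HB'⟩ := bcoef_est c hσ hc hδ hσ0
  obtain ⟨C3, hC3, H3⟩ := ratio_est c
  obtain ⟨Cy1, hCy1, Hy1⟩ := bd_one hU hUc (eyT N)
  obtain ⟨Cy2, hCy2, Hy2⟩ := bd_two hU hUc (eyT N)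
  obtain ⟨Cy3, hCy3, Hy3⟩ := bd_three hU hUc (eyT N)
  have hx1 : ∀ i : Fin N, _ := fun i => bd_one hU hUc (exT i)
  have hx2 : ∀ i : Fin N, _ := fun i => bd_two hU hUc (exT i)
  have hx3 : ∀ i : Fin N, _ := fun i => bd_three hU hUc (exT i)
  choose Cx1 hCx1 Hx1 using hx1
  choose Cx2 hCx2 Hx2 using hx2
  choose Cx3 hCx3 Hx3 using hx3
  refine ⟨γ * (Cy3 + (|c| / δ * Cy2 + C3 / δ ^ 2 * Cy1)) + ∑ i, ((1 + γ * ρ ^ 2) * Cx3 i + γ * |ρ| / 2 * (B' * (2 * Cx1 i) + B * (2 * Cx2 i))), 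
    add_nonneg (by positivity) (Finset.sum_nonneg fun i _ => by have := hCx1 i; have := hCx2 i; have := hCx3 i; positivity), fun h hh hhδ w hw => ?_⟩
  have hw0 : 0 < w.2.2 := by linarith
  set y := w.2.2 with hy
  have hya : 0 ≤ y ^ α := by positivity
  have ey1 : w + h • eyT N = (w.1, (w.2.1, y + h)) := by refine Prod.ext ?_ (Prod.ext ?_ ?_) <;> simp [eyT, hy]
  have ey2 : w - h • eyT N = (w.1, (w.2.1, y - h)) := by refine Prod.ext ?_ (Prod.ext ?_ ?_) <;> simp [eyT, hy]
  have ex1 : ∀ i, w + h • exT i = (w.1, (w.2.1 + Pi.single i h, y)) := by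
    intro i; refine Prod.ext ?_ (Prod.ext ?_ ?_)
    · simp [exT]
    · funext i'; by_cases hi : i' = i
      · subst hi; simp [exT]
      · simp [exT, hi]
    · simp [exT, hy]
  have ex2 : ∀ i, w - h • exT i = (w.1, (w.2.1 - Pi.single i h, y)) := by
    intro i; refine Prod.ext ?_ (Prod.ext ?_ ?_)
    · simp [exT]
    · funext i'; by_cases hi : i' = i
      · subst hi; simp [exT]
      · simp [exT, hi]
    · simp [exT, hy]
  have en : ∀ v : WW N, w + (-h) • v = w - h • v := by intro v; rw [neg_smul, sub_eq_add_neg]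
  unfold Lh LL
  rw [← hy]
  simp only [← ey1, ← ey2, ← ex1, ← ex2]
  rw [mul_assoc, ← mul_sub, abs_mul, abs_of_nonneg hya, mul_comm (y ^ α)]
  apply mul_le_mul_of_nonneg_right _ hya
  rw [mul_add, add_sub_add_comm, add_mul, Finset.mul_sum, ← Finset.sum_sub_distrib, Finset.sum_mul]
  refine (abs_add_le _ _).trans (add_le_add ?_ ((Finset.abs_sum_le_sum_abs _ _).trans (Finset.sum_le_sum fun i _ => ?_)))
  · set r := ((y - h) / y) ^ c
    have a1 := Hy1 w (-h)
    have a2 := Hy2 w (-h)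
    have a3 := Hy3 w h
    rw [en] at a1 a2
    simp only [abs_neg, abs_of_pos hh, neg_sq] at a1 a2 a3
    change |U (w - h • eyT N) - U w - -h * pdT (eyT N) U w| ≤ _ at a2
    change |U (w + h • eyT N) + U (w - h • eyT N) - 2 * U w - h ^ 2 * pdT (eyT N) (pdT (eyT N) U) w| ≤ _ at a3
    set U0 := U w
    set Um := U (w - h • eyT N) with hUm
    set Up := U (w + h • eyT N)
    set Uy := pdT (eyT N) U w with hUyd
    set Uyy := pdT (eyT N) (pdT (eyT N) U) w
    have e : (h ^ 2)⁻¹ * (γ * (Up - U0 + r * (Um - U0))) - γ * (Uyy + c / y * Uy) = γ * ((Up + Um - 2 * U0 - h ^ 2 * Uyy) / h ^ 2 + ((1 - r) / h * ((U0 - Um) / h) - c / y * Uy)) := by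
      field_simp; ring
    rw [e, abs_mul, abs_of_pos hγ, mul_assoc]
    apply mul_le_mul_of_nonneg_left _ hγ.le
    rw [add_mul]
    refine (abs_add_le _ _).trans (add_le_add ?_ ?_)
    · rw [abs_div, abs_of_pos (by positivity : 0 < h ^ 2), div_le_iff₀ (by positivity)]
      exact a3.trans (le_of_eq (by ring))
    · rcases le_total y δ with h1 | h1
      · have z1 : Uy = 0 := Uy_zero hU hδ hUy w hw0 h1
        have z2 : U0 = Um := by
          rw [hUm, ey2]
          have := hUy w.1 w.2.1 y hw0.le (by linarith)
          rw [hUy w.1 w.2.1 (y - h) (by linarith) (by linarith)]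
          exact this
        rw [z1, z2]; simp; positivity
      · have e2 : (1 - r) / h * ((U0 - Um) / h) - c / y * Uy = c / y * (-((Um - U0 - -h * Uy) / h)) + ((1 - r) / h - c / y) * (-((Um - U0) / h)) := by
          field_simp; ring
        rw [e2, add_mul]
        refine (abs_add_le _ _).trans (add_le_add ?_ ?_)
        · rw [abs_mul, abs_div, abs_of_pos hw0, abs_neg, abs_div, abs_of_pos hh, mul_assoc]
          have : |Um - U0 - -h * Uy| / h ≤ Cy2 * h := by rw [div_le_iff₀ hh]; linarith
          gcongr
        · rw [abs_mul, abs_neg, abs_div, abs_of_pos hh]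
          have b1 : |Um - U0| / h ≤ Cy1 := by rw [div_le_iff₀ hh]; exact a1
          have b2 := H3 h y hh (by linarith)
          calc _ ≤ (C3 * h / y ^ 2) * Cy1 := mul_le_mul b2 b1 (by positivity) (by positivity)
            _ ≤ (C3 * h / δ ^ 2) * Cy1 := by gcongr
            _ = _ := by ring
  · have a1 := Hx1 i w h
    have a1' := Hx1 i w (-h)
    have a2 := Hx2 i w h
    have a2' := Hx2 i w (-h)
    have a3 := Hx3 i w h
    rw [en] at a1' a2'
    simp only [abs_neg, abs_of_pos hh, neg_sq] at a1 a1' a2 a2' a3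
    change |U (w + h • exT i) - U w - h * pdT (exT i) U w| ≤ _ at a2
    change |U (w - h • exT i) - U w - -h * pdT (exT i) U w| ≤ _ at a2'
    change |U (w + h • exT i) + U (w - h • exT i) - 2 * U w - h ^ 2 * pdT (exT i) (pdT (exT i) U) w| ≤ _ at a3
    have hl := lam_ge i0 (ρ := ρ) hγ hσ1 i y
    set U0 := U w
    set Um := U (w - h • exT i) with hUm
    set Up := U (w + h • exT i)
    set Ux := pdT (exT i) U w with hUxd
    set Uxx := pdT (exT i) (pdT (exT i) U) w
    set lam := lamD i0 γ ρ σ i y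
    have hC1 := hCx1 i; have hC2 := hCx2 i; have hC3 := hCx3 i
    have d3 : |lam * ((Up + Um - 2 * U0 - h ^ 2 * Uxx) / h ^ 2)| ≤ (1 + γ * ρ ^ 2) * (Cx3 i * h) := by
      rw [abs_mul, abs_of_nonneg (by linarith)]
      refine mul_le_mul hl.2 ?_ (abs_nonneg _) (by positivity)
      rw [abs_div, abs_of_pos (by positivity : 0 < h ^ 2), div_le_iff₀ (by positivity)]
      exact a3.trans (le_of_eq (by ring))
    split_ifs with hi
    · set b := bcoef c σ y
      have hb := HB y hw0
      have hb' := HB' h hh hhδ y hw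
      have e : (h ^ 2)⁻¹ * ((lam + bbD c γ ρ h σ y) * (Up - U0) + (lam - bbD c γ ρ h σ y) * (Um - U0)) - (lam * Uxx - γ * ρ * b * Ux) = 
          lam * ((Up + Um - 2 * U0 - h ^ 2 * Uxx) / h ^ 2) + -(γ * ρ / 2) * ((((σ y - σ (y - h) * ((y - h) / y) ^ c) / h - b) * (((Up - U0) - (Um - U0)) / h)) + b * (((Up - U0 - h * Ux) - (Um - U0 - -h * Ux)) / h)) := by
        unfold bbD
        field_simp; ring
      rw [e]
      refine (abs_add_le _ _).trans ?_
      have g1 : |((Up - U0) - (Um - U0)) / h| ≤ 2 * Cx1 i := by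
        rw [abs_div, abs_of_pos hh, div_le_iff₀ hh]
        refine (abs_sub _ _).trans ?_
        linarith
      have g2 : |((Up - U0 - h * Ux) - (Um - U0 - -h * Ux)) / h| ≤ 2 * Cx2 i * h := by
        rw [abs_div, abs_of_pos hh, div_le_iff₀ hh]
        refine (abs_sub _ _).trans ?_
        linarith
      have g3 : |-(γ * ρ / 2) * ((((σ y - σ (y - h) * ((y - h) / y) ^ c) / h - b) * (((Up - U0) - (Um - U0)) / h)) + b * (((Up - U0 - h * Ux) - (Um - U0 - -h * Ux)) / h))| ≤ γ * |ρ| / 2 * (B' * h * (2 * Cx1 i) + B * (2 * Cx2 i * h)) := by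
        rw [abs_mul, abs_neg, abs_div, abs_mul, abs_of_pos hγ, abs_two]
        apply mul_le_mul_of_nonneg_left _ (by positivity)
        refine (abs_add_le _ _).trans (add_le_add ?_ ?_)
        · rw [abs_mul]; exact mul_le_mul hb' g1 (abs_nonneg _) (by positivity)
        · rw [abs_mul]; exact mul_le_mul hb g2 (abs_nonneg _) (by positivity)
      calc _ ≤ _ := add_le_add d3 g3
        _ = _ := by ring
    · have e : (h ^ 2)⁻¹ * ((lam + 0) * (Up - U0) + (lam - 0) * (Um - U0)) - (lam * Uxx - 0) = lam * ((Up + Um - 2 * U0 - h ^ 2 * Uxx) / h ^ 2) := by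
        field_simp; ring
      rw [e]
      refine d3.trans ?_
      rw [add_mul, mul_assoc]
      have : 0 ≤ γ * |ρ| / 2 * (B' * (2 * Cx1 i) + B * (2 * Cx2 i)) * h := by positivity
      linarith

lemma Lh_meas {N : ℕ} (i0 : Fin N) (α c γ ρ h : ℝ) {σ : ℝ → ℝ} {U : WW N → ℝ} (hσm : Measurable σ) (hUm : Measurable U) : Measurable (Lh i0 α c γ ρ h σ U) := by
  have hl : ∀ i, Measurable (lamD i0 γ ρ σ i) := by
    intro i; unfold lamD; split_ifs <;> fun_prop
  have hb : Measurable (bbD c γ ρ h σ) := by unfold bbD; fun_prop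
  unfold Lh
  refine Measurable.mul (by fun_prop) (Measurable.add (by fun_prop) ?_)
  refine Finset.measurable_sum _ fun i _ => ?_
  have := hl i
  split_ifs <;> fun_prop

lemma pt_bd {p m α A X y : ℝ} (hp : 1 < p) (hA : 0 ≤ A) (hy : 0 < y) (hX : |X| ≤ A * (1 + y ^ α)) : y ^ m * |X| ^ p ≤ A ^ p * 2 ^ p * (y ^ m + y ^ (m + α * p)) := by
  have hya : 0 < y ^ α := by positivity
  have hym : 0 < y ^ m := by positivity
  have h1 : |X| ^ p ≤ (A * (1 + y ^ α)) ^ p := Real.rpow_le_rpow (abs_nonneg _) hX (by linarith)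
  have h2 : (1 + y ^ α) ^ p ≤ 2 ^ p * (1 + (y ^ α) ^ p) := by
    have : 0 < (y ^ α) ^ p := by positivity
    rcases le_total 1 (y ^ α) with h | h
    · calc (1 + y ^ α) ^ p ≤ (2 * y ^ α) ^ p := Real.rpow_le_rpow (by positivity) (by linarith) (by linarith)
        _ = 2 ^ p * (y ^ α) ^ p := by rw [Real.mul_rpow (by norm_num) hya.le]
        _ ≤ _ := by gcongr; linarith
    · calc (1 + y ^ α) ^ p ≤ 2 ^ p := Real.rpow_le_rpow (by positivity) (by linarith) (by linarith)
        _ = 2 ^ p * 1 := by ring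
        _ ≤ _ := by gcongr; linarith
  calc y ^ m * |X| ^ p ≤ y ^ m * (A ^ p * (2 ^ p * (1 + (y ^ α) ^ p))) := by
        gcongr; refine h1.trans ?_
        rw [Real.mul_rpow hA (by positivity)]; gcongr
    _ = _ := by rw [Real.rpow_add hy, Real.rpow_mul hy.le]; ring

lemma fin_box {N : ℕ} {m a R K : ℝ} (hR : 0 ≤ R) (hm : -1 < m) (ha : -1 < a) : 
    ∫⁻ w in {w : WW N | 0 < w.2.2}, (Metric.closedBall (0 : WW N) R).indicator (fun w => ENNReal.ofReal (K * (w.2.2 ^ m + w.2.2 ^ a))) w ≠ ⊤ := by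
  rw [setLIntegral_indicator measurableSet_closedBall]
  have hsub : Metric.closedBall (0 : WW N) R ∩ {w : WW N | 0 < w.2.2} ⊆ Metric.closedBall (0 : ℝ) R ×ˢ (Metric.closedBall (0 : Fin N → ℝ) R ×ˢ Set.Ioc 0 R) := by
    rintro ⟨t, x, y⟩ ⟨h1, h2⟩
    simp only [mem_closedBall_zero_iff, Prod.norm_def, sup_le_iff] at h1
    simp only [Set.mem_prod, mem_closedBall_zero_iff, Set.mem_Ioc]
    exact ⟨h1.1, h1.2.1, h2, (le_abs_self y).trans h1.2.2⟩
  refine ((lintegral_mono_set hsub).trans_lt ?_).ne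
  have i1 : Integrable (fun y : ℝ => K * (y ^ m + y ^ a)) (volume.restrict (Set.Ioc 0 R)) := by
    refine Integrable.const_mul (Integrable.add ?_ ?_) K
    · exact (intervalIntegrable_iff_integrableOn_Ioc_of_le hR).1 (intervalIntegral.intervalIntegrable_rpow' hm)
    · exact (intervalIntegrable_iff_integrableOn_Ioc_of_le hR).1 (intervalIntegral.intervalIntegrable_rpow' ha)
  have i2 : Integrable (fun _ : Fin N → ℝ => (1 : ℝ)) (volume.restrict (Metric.closedBall 0 R)) := by
    have : IsFiniteMeasure ((volume : Measure (Fin N → ℝ)).restrict (Metric.closedBall 0 R)) := ⟨by rw [Measure.restrict_apply_univ]; exact measure_closedBall_lt_top⟩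
    exact integrable_const _
  have i3 : Integrable (fun _ : ℝ => (1 : ℝ)) (volume.restrict (Metric.closedBall 0 R)) := by
    have : IsFiniteMeasure ((volume : Measure ℝ).restrict (Metric.closedBall 0 R)) := ⟨by rw [Measure.restrict_apply_univ]; exact measure_closedBall_lt_top⟩
    exact integrable_const _
  have i4 := i3.mul_prod (i2.mul_prod i1)
  rw [Measure.prod_restrict, Measure.prod_restrict] at i4
  have := i4.lintegral_lt_top
  simp only [one_mul] at this
  exact this

theorem thmC (p m α c γ ρ : ℝ) (hp : 1 < p) (hγ : 0 < γ) (hs : 0 < (m + 1) / p) (hsα : -α < (m + 1) / p) (hD : (m + 1) / p < c - α + 1) (N : ℕ) (i0 : Fin N) : 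
    ∃ C : ℝ, 0 < C ∧ ∀ δ : ℝ, 0 < δ → ∀ σ : ℝ → ℝ, ContDiff ℝ (⊤ : ℕ∞) σ → HasCompactSupport σ → (∀ y, |σ y| ≤ 1) → (∀ y ≤ 2 * δ, σ y = 0) → 
      ∀ U : WW N → ℝ, ContDiff ℝ (⊤ : ℕ∞) U → HasCompactSupport U → (∀ t x y, 0 ≤ y → y ≤ 2 * δ → U (t, (x, y)) = U (t, (x, 0))) → 
      ∫⁻ w in {w : WW N | 0 < w.2.2}, ENNReal.ofReal (w.2.2 ^ m * |pdT (et N) U w| ^ p) ≤ 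
      ENNReal.ofReal C * ∫⁻ w in {w : WW N | 0 < w.2.2}, ENNReal.ofReal (w.2.2 ^ m * |pdT (et N) U w - LL i0 α c γ ρ σ U w| ^ p) := by
  obtain ⟨C, hC, key⟩ := tile_ineq p m α c γ ρ hp hγ hs hD N i0
  refine ⟨C, hC, ?_⟩
  intro δ hδ σ hσ hσc hσ1 hσ0 U hU hUc hUy
  have hp0 : 0 < p := by linarith
  have hm1 : -1 < m := by
    have := mul_pos hs hp0; rw [div_mul_cancel₀ _ hp0.ne'] at this; linarith
  have hm2 : -1 < m + α * p := by
    rw [lt_div_iff₀ hp0] at hsα; linarith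
  -- bounds
  obtain ⟨K1, hK1, HK1⟩ := Lh_est i0 α c ρ hγ hδ hσ hσc hσ1 hσ0 hU hUc hUy
  obtain ⟨K2, hK2, HK2⟩ := LL_bd i0 α c ρ hγ hδ hσ hσc hσ1 hσ0 hU hUc hUy
  obtain ⟨B, hB, HB⟩ := bcoef_bd c hσ hσc hδ hσ0
  obtain ⟨B', hB', HB'⟩ := bcoef_est c hσ hσc hδ hσ0
  obtain ⟨C1, hC1, H1⟩ := bd_one hU hUc (et N)
  obtain ⟨C2, hC2, H2⟩ := bd_two hU hUc (et N)
  -- supports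
  obtain ⟨T, hT⟩ : ∃ T : ℝ, 0 ≤ T ∧ (∀ w, U w ≠ 0 → ‖w‖ ≤ T) ∧ (∀ y, σ y ≠ 0 → |y| ≤ T) := by
    obtain ⟨T1, h1⟩ := hUc.isCompact.isBounded.exists_norm_le
    obtain ⟨T2, h2⟩ := hσc.isCompact.isBounded.exists_norm_le
    refine ⟨max 0 (max T1 T2), le_max_left _ _, fun w hw => (h1 w (subset_tsupport _ hw)).trans (by simp), fun y hy => (h2 y (subset_tsupport _ hy)).trans (by simp)⟩
  obtain ⟨hT0, hTU, hTσ⟩ := hT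
  -- step sizes
  set E : ℝ := γ * |ρ| / 2 * (B + B') + 1 with hE
  have hE0 : 0 < E := by positivity
  set h1 : ℝ := min (δ / 2) (min 1 (1 / E)) with hh1
  have hh1p : 0 < h1 := by positivity
  let h : ℕ → ℝ := fun n => h1 / (n + 1)
  have hpos : ∀ n, 0 < h n := fun n => by positivity
  have hle : ∀ n, h n ≤ h1 := fun n => by
    have : (0 : ℝ) ≤ n := by positivity
    exact div_le_self hh1p.le (by linarith)
  have hle1 : ∀ n, 2 * h n ≤ δ := fun n => by have := (hle n).trans (min_le_left _ _); linarith
  have hle2 : ∀ n, h n ≤ 1 := fun n => (hle n).trans ((min_le_right _ _).trans (min_le_left _ _))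
  have hle3 : ∀ n, h n ≤ 1 / E := fun n => (hle n).trans ((min_le_right _ _).trans (min_le_right _ _))
  have hlim : Filter.Tendsto h Filter.atTop (𝓝 0) := by
    have := (tendsto_one_div_add_atTop_nhds_zero_nat (𝕜 := ℝ)).const_mul h1
    simpa [h, div_eq_mul_inv] using this
  have hJ : ∀ n, ∃ J : ℕ, T + 1 ≤ h n * J := fun n => by
    obtain ⟨J, hJ⟩ := exists_nat_ge ((T + 1) / h n)
    exact ⟨J, by rw [div_le_iff₀ (hpos n)] at hJ; linarith⟩
  choose J hJ using hJ
  choose τ0 hτ0 key using fun n => key (h n) (hpos n) (J n)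
  let τ : ℕ → ℝ := fun n => min (τ0 n) (h n)
  have hτp : ∀ n, 0 < τ n := fun n => lt_min (hτ0 n) (hpos n)
  have hτ1 : ∀ n, τ n ≤ 1 := fun n => (min_le_right _ _).trans (hle2 n)
  have hτlim : Filter.Tendsto τ Filter.atTop (𝓝 0) := squeeze_zero (fun n => (hτp n).le) (fun n => min_le_right _ _) hlim
  have hbb : ∀ n, ∀ y, h n ≤ y → |bbD c γ ρ (h n) σ y| ≤ 1 := by
    intro n y hy
    have hy0 := (hpos n).trans_le hy
    have a1 := HB' (h n) (hpos n) (hle1 n) y hy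
    have a2 := HB y hy0
    have a3 : |(σ y - σ (y - h n) * ((y - h n) / y) ^ c) / h n| ≤ B + B' := by
      have := abs_sub_abs_le_abs_sub ((σ y - σ (y - h n) * ((y - h n) / y) ^ c) / h n) (bcoef c σ y)
      have : B' * h n ≤ B' := mul_le_of_le_one_right hB' (hle2 n)
      linarith
    rw [abs_div, abs_of_pos (hpos n), div_le_iff₀ (hpos n)] at a3
    unfold bbD
    rw [abs_mul, abs_neg, abs_div, abs_mul, abs_of_pos hγ, abs_two]
    calc _ ≤ γ * |ρ| / 2 * ((B + B') * h n) := by gcongr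
      _ = γ * |ρ| / 2 * (B + B') * h n := by ring
      _ ≤ E * h n := by gcongr; linarith
      _ ≤ E * (1 / E) := by gcongr; exact hle3 n
      _ = 1 := by field_simp
  have hσJ : ∀ n y, h n * J n ≤ y → σ y = 0 := by
    intro n y hy
    by_contra hc
    have := hTσ y hc
    have := le_abs_self y
    linarith [hJ n]
  have hUJ : ∀ n (w : WW N), h n * J n ≤ w.2.2 → U w = 0 := by
    intro n w hy
    by_contra hc
    have a1 := hTU w hc
    have a2 : |w.2.2| ≤ ‖w‖ := (norm_snd_le w.2).trans (norm_snd_le w)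
    have := le_abs_self w.2.2
    linarith [hJ n]
  have hUm : Measurable U := hU.continuous.measurable
  have hσm : Measurable σ := hσ.continuous.measurable
  have hUT : ∃ T : ℝ, ∀ w, U w ≠ 0 → |w.1| ≤ T ∧ ∀ i, |w.2.1 i| ≤ T := by
    refine ⟨T, fun w hw => ⟨(norm_fst_le w).trans (hTU w hw), fun i => ?_⟩⟩
    exact (norm_le_pi_norm w.2.1 i).trans ((norm_fst_le w.2).trans ((norm_snd_le w).trans (hTU w hw)))
  let D : ℕ → WW N → ℝ := fun n w => (U w - U (w.1 - τ n, w.2)) / τ n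
  let X : ℕ → WW N → ℝ := fun n w => D n w - Lh i0 α c γ ρ (h n) σ U (w.1 - τ n, w.2)
  have hDm : ∀ n, Measurable (D n) := fun n => by simp only [D]; fun_prop
  have hXm : ∀ n, Measurable (X n) := fun n => by
    have := Lh_meas i0 α c γ ρ (h n) hσm hUm
    have := hDm n
    simp only [X]; fun_prop
  let S : ℕ → Set (WW N) := fun n => {w | h n ≤ w.2.2}
  have hS : ∀ n, MeasurableSet (S n) := fun n => measurableSet_le (by fun_prop) (by fun_prop)
  have hinter : ∀ n, S n ∩ {w : WW N | 0 < w.2.2} = S n := fun n => Set.inter_eq_left.2 fun w hw => (hpos n).trans_le hw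
  have step : ∀ n, ∫⁻ w in {w : WW N | 0 < w.2.2}, (S n).indicator (fun w => ENNReal.ofReal (w.2.2 ^ m * |D n w| ^ p)) w ≤ 
      ENNReal.ofReal C * ∫⁻ w in {w : WW N | 0 < w.2.2}, (S n).indicator (fun w => ENNReal.ofReal (w.2.2 ^ m * |X n w| ^ p)) w := by
    intro n
    rw [setLIntegral_indicator (hS n), setLIntegral_indicator (hS n), hinter]
    have := key n σ hσm hσ1 (fun y hy => hσ0 y (by linarith [hle1 n])) (hσJ n) (hbb n) (τ n) (hτp n) (min_le_left _ _) U hUm hUT (hUJ n) 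
      (fun t x y h0 hy => hUy t x y h0 (by linarith [hle1 n]))
    have e : ∀ (Y : WW N → ℝ) (w : WW N), ENNReal.ofReal (w.2.2 ^ m * |τ n * Y w| ^ p) = ENNReal.ofReal (τ n ^ p) * ENNReal.ofReal (w.2.2 ^ m * |Y w| ^ p) := by
      intro Y w
      rw [← ENNReal.ofReal_mul (by have := hτp n; positivity), abs_mul, abs_of_pos (hτp n), Real.mul_rpow (hτp n).le (abs_nonneg _)]
      congr 1; ring
    have e1 : ∀ w : WW N, U w - U (w.1 - τ n, w.2) = τ n * D n w := fun w => by
      have := (hτp n).ne'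
      simp only [D]; field_simp
    have e2 : ∀ w : WW N, τ n * D n w - τ n * Lh i0 α c γ ρ (h n) σ U (w.1 - τ n, w.2) = τ n * X n w := fun w => by simp only [X]; ring
    simp only [e1, e2, e] at this
    have hne : ENNReal.ofReal (τ n ^ p) ≠ 0 := by
      rw [Ne, ENNReal.ofReal_eq_zero, not_le]; have := hτp n; positivity
    rw [lintegral_const_mul' _ _ ENNReal.ofReal_ne_top, lintegral_const_mul' _ _ ENNReal.ofReal_ne_top, mul_left_comm] at this
    exact (ENNReal.mul_le_mul_iff_right hne ENNReal.ofReal_ne_top).1 this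
  -- pointwise limits
  have hDlim : ∀ w, Filter.Tendsto (fun n => D n w) Filter.atTop (𝓝 (pdT (et N) U w)) := by
    intro w
    rw [tendsto_iff_norm_sub_tendsto_zero]
    refine squeeze_zero (fun n => norm_nonneg _) (fun n => ?_) (by simpa using hτlim.const_mul C2)
    have a := H2 w (-τ n)
    have e0 : w + (-τ n) • et N = (w.1 - τ n, w.2) := by refine Prod.ext ?_ ?_ <;> simp [et, sub_eq_add_neg]
    rw [e0, neg_sq] at a
    change |U (w.1 - τ n, w.2) - U w - -τ n * pdT (et N) U w| ≤ _ at a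
    have e1 : D n w - pdT (et N) U w = -((U (w.1 - τ n, w.2) - U w - -τ n * pdT (et N) U w) / τ n) := by
      have := (hτp n).ne'
      simp only [D]; field_simp; ring
    rw [Real.norm_eq_abs, e1, abs_neg, abs_div, abs_of_pos (hτp n), div_le_iff₀ (hτp n)]
    linarith
  have hLc : ∀ w : WW N, Continuous (fun t : ℝ => LL i0 α c γ ρ σ U (t, w.2)) := by
    intro w
    have c1 : ∀ v, Continuous (pdT v U) := fun v => (cd_fd hU v).continuous
    have c2 : ∀ v, Continuous (pdT v (pdT v U)) := fun v => (cd_fd (cd_fd hU v) v).continuous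
    have c3 : Continuous (fun t : ℝ => ((t, w.2) : WW N)) := by fun_prop
    unfold LL
    simp only
    refine continuous_const.mul ((continuous_const.mul (((c2 _).comp c3).add (continuous_const.mul ((c1 _).comp c3)))).add (continuous_finsetSum _ fun i _ => ?_))
    refine (continuous_const.mul ((c2 _).comp c3)).sub ?_
    split_ifs
    · exact continuous_const.mul ((c1 _).comp c3)
    · exact continuous_const
  have hXlim : ∀ w : WW N, 0 < w.2.2 → Filter.Tendsto (fun n => X n w) Filter.atTop (𝓝 (pdT (et N) U w - LL i0 α c γ ρ σ U w)) := by
    intro w hw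
    have a1 : Filter.Tendsto (fun n => LL i0 α c γ ρ σ U (w.1 - τ n, w.2)) Filter.atTop (𝓝 (LL i0 α c γ ρ σ U w)) := by
      have b1 : Filter.Tendsto (fun n => w.1 - τ n) Filter.atTop (𝓝 w.1) := by simpa using hτlim.const_sub w.1
      exact ((hLc w).tendsto w.1).comp b1
    have a2 : Filter.Tendsto (fun n => Lh i0 α c γ ρ (h n) σ U (w.1 - τ n, w.2) - LL i0 α c γ ρ σ U (w.1 - τ n, w.2)) Filter.atTop (𝓝 0) := by
      rw [tendsto_zero_iff_norm_tendsto_zero]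
      have b1 : Filter.Tendsto (fun n => K1 * h n * w.2.2 ^ α) Filter.atTop (𝓝 0) := by simpa using (hlim.const_mul K1).mul_const (w.2.2 ^ α)
      refine squeeze_zero' (Filter.Eventually.of_forall fun n => norm_nonneg _) ?_ b1
      filter_upwards [hlim.eventually (gt_mem_nhds hw)] with n hn
      exact HK1 (h n) (hpos n) (hle1 n) (w.1 - τ n, w.2) (le_of_lt hn)
    have a3 := (hDlim w).sub (a2.add a1)
    simp only [zero_add, sub_add_cancel] at a3
    exact a3
  have hcomb : ∀ (w : WW N), 0 < w.2.2 → ∀ (Y : ℕ → WW N → ℝ) (y : ℝ), Filter.Tendsto (fun n => Y n w) Filter.atTop (𝓝 y) → 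
      Filter.Tendsto (fun n => (S n).indicator (fun w => ENNReal.ofReal (w.2.2 ^ m * |Y n w| ^ p)) w) Filter.atTop (𝓝 (ENNReal.ofReal (w.2.2 ^ m * |y| ^ p))) := by
    intro w hw Y y hY
    have b1 : Filter.Tendsto (fun n => ENNReal.ofReal (w.2.2 ^ m * |Y n w| ^ p)) Filter.atTop (𝓝 (ENNReal.ofReal (w.2.2 ^ m * |y| ^ p))) := 
      (ENNReal.continuous_ofReal.tendsto _).comp ((hY.abs.rpow_const (Or.inr hp0.le)).const_mul (w.2.2 ^ m))
    refine b1.congr' ?_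
    filter_upwards [hlim.eventually (gt_mem_nhds hw)] with n hn
    rw [Set.indicator_of_mem]
    exact le_of_lt hn
  have hpm : MeasurableSet {w : WW N | 0 < w.2.2} := measurableSet_lt (by fun_prop) (by fun_prop)
  -- domination
  have hvan : ∀ (w : WW N), T + 1 < ‖w‖ → ∀ v : WW N, ‖w - v‖ ≤ 1 → U v = 0 := by
    intro w hw v hv
    by_contra hc
    have := hTU v hc
    have := norm_le_norm_add_norm_sub' w v
    linarith
  have hdom : ∀ n (w : WW N), h n ≤ w.2.2 → |X n w| ≤ (C1 + K1 + K2) * (1 + w.2.2 ^ α) := by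
    intro n w hw
    have hw0 := (hpos n).trans_le hw
    have hya : 0 < w.2.2 ^ α := by positivity
    have a1 : |D n w| ≤ C1 := by
      have a := H1 w (-τ n)
      have e0 : w + (-τ n) • et N = (w.1 - τ n, w.2) := by refine Prod.ext ?_ ?_ <;> simp [et, sub_eq_add_neg]
      rw [e0, abs_neg, abs_of_pos (hτp n)] at a
      simp only [D]
      rw [abs_div, abs_of_pos (hτp n), div_le_iff₀ (hτp n), abs_sub_comm]; exact a
    have a2 := HK1 (h n) (hpos n) (hle1 n) (w.1 - τ n, w.2) hw
    have a3 := HK2 (w.1 - τ n, w.2) hw0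
    simp only at a2 a3
    have a4 : |Lh i0 α c γ ρ (h n) σ U (w.1 - τ n, w.2)| ≤ K1 * w.2.2 ^ α + K2 * w.2.2 ^ α := by
      have b1 := abs_sub_abs_le_abs_sub (Lh i0 α c γ ρ (h n) σ U (w.1 - τ n, w.2)) (LL i0 α c γ ρ σ U (w.1 - τ n, w.2))
      have b2 : K1 * h n * w.2.2 ^ α ≤ K1 * w.2.2 ^ α := by
        gcongr; exact mul_le_of_le_one_right hK1 (hle2 n)
      linarith
    have a5 : |X n w| ≤ |D n w| + |Lh i0 α c γ ρ (h n) σ U (w.1 - τ n, w.2)| := abs_sub _ _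
    have : 0 ≤ C1 * w.2.2 ^ α := by positivity
    nlinarith
  have hXvan : ∀ n (w : WW N), T + 1 < ‖w‖ → X n w = 0 := by
    intro n w hw
    have n1 : ∀ a b d, |a| ≤ 1 → ‖b‖ ≤ 1 → |d| ≤ 1 → U (w.1 - a, (w.2.1 - b, w.2.2 - d)) = 0 := by
      intro a b d ha hb hd
      apply hvan w hw
      have e : w - (w.1 - a, (w.2.1 - b, w.2.2 - d)) = (a, (b, d)) := by refine Prod.ext ?_ (Prod.ext ?_ ?_) <;> simp
      rw [e]
      simp only [Prod.norm_def, sup_le_iff]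
      exact ⟨ha, hb, hd⟩
    have hτa : |τ n| ≤ 1 := by rw [abs_of_pos (hτp n)]; exact hτ1 n
    have hha : |h n| ≤ 1 := by rw [abs_of_pos (hpos n)]; exact hle2 n
    have u0 : U w = 0 := hvan w hw w (by simp)
    have u1 : U (w.1 - τ n, w.2) = 0 := by have := n1 (τ n) 0 0 hτa (by simp) (by simp); simpa using this
    have u2 : U (w.1 - τ n, (w.2.1, w.2.2 + h n)) = 0 := by have := n1 (τ n) 0 (-h n) hτa (by simp) (by simpa using hha); simpa using this
    have u3 : U (w.1 - τ n, (w.2.1, w.2.2 - h n)) = 0 := by have := n1 (τ n) 0 (h n) hτa (by simp) hha; simpa using this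
    have hsn : ∀ i : Fin N, ‖(Pi.single i (h n) : Fin N → ℝ)‖ ≤ 1 := fun i => by rw [Pi.norm_single]; exact hha
    have u4 : ∀ i, U (w.1 - τ n, (w.2.1 - Pi.single i (h n), w.2.2)) = 0 := fun i => by have := n1 (τ n) (Pi.single i (h n)) 0 hτa (hsn i) (by simp); simpa using this
    have u5 : ∀ i, U (w.1 - τ n, (w.2.1 + Pi.single i (h n), w.2.2)) = 0 := fun i => by have := n1 (τ n) (-Pi.single i (h n)) 0 hτa (by rw [norm_neg]; exact hsn i) (by simp); simpa using this
    simp only [X, D, Lh, u0, u1, u2, u3, u4, u5]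
    simp
  have hA : 0 ≤ C1 + K1 + K2 := by positivity
  have hlimX := tendsto_lintegral_of_dominated_convergence (μ := volume.restrict {w : WW N | 0 < w.2.2}) 
    (F := fun n w => (S n).indicator (fun w => ENNReal.ofReal (w.2.2 ^ m * |X n w| ^ p)) w) 
    (f := fun w => ENNReal.ofReal (w.2.2 ^ m * |pdT (et N) U w - LL i0 α c γ ρ σ U w| ^ p)) 
    ((Metric.closedBall (0 : WW N) (T + 1)).indicator (fun w => ENNReal.ofReal ((C1 + K1 + K2) ^ p * 2 ^ p * (w.2.2 ^ m + w.2.2 ^ (m + α * p))))) 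
    (fun n => by
      have := hXm n
      exact Measurable.indicator (by fun_prop) (hS n)) (fun n => by
      refine Filter.Eventually.of_forall fun w => ?_
      simp only
      by_cases hw : w ∈ S n
      · rw [Set.indicator_of_mem hw]
        by_cases hb : w ∈ Metric.closedBall (0 : WW N) (T + 1)
        · rw [Set.indicator_of_mem hb]
          exact ENNReal.ofReal_le_ofReal (pt_bd hp hA ((hpos n).trans_le hw) (hdom n w hw))
        · rw [hXvan n w (by simpa using hb)]
          simp [Real.zero_rpow hp0.ne']
      · rw [Set.indicator_of_notMem hw]; exact zero_le)
    (fin_box (by linarith) hm1 hm2)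
    (by
      filter_upwards [ae_restrict_mem hpm] with w hw
      exact hcomb w hw X _ (hXlim w hw))
  calc _ = ∫⁻ w in {w : WW N | 0 < w.2.2}, Filter.liminf (fun n => (S n).indicator (fun w => ENNReal.ofReal (w.2.2 ^ m * |D n w| ^ p)) w) Filter.atTop := by
        apply setLIntegral_congr_fun hpm
        intro w hw
        exact (hcomb w hw D _ (hDlim w)).liminf_eq.symm
    _ ≤ Filter.liminf (fun n => ∫⁻ w in {w : WW N | 0 < w.2.2}, (S n).indicator (fun w => ENNReal.ofReal (w.2.2 ^ m * |D n w| ^ p)) w) Filter.atTop := by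
        refine lintegral_liminf_le fun n => ?_
        have := hDm n
        exact Measurable.indicator (by fun_prop) (hS n)
    _ ≤ Filter.liminf (fun n => ENNReal.ofReal C * ∫⁻ w in {w : WW N | 0 < w.2.2}, (S n).indicator (fun w => ENNReal.ofReal (w.2.2 ^ m * |X n w| ^ p)) w) Filter.atTop := 
        Filter.liminf_le_liminf (Filter.Eventually.of_forall step)
    _ = _ := (ENNReal.Tendsto.const_mul hlimX (Or.inr ENNReal.ofReal_ne_top)).liminf_eq

/-- second derivative as a bilinear form -/
def HH {N : ℕ} (u : WW N → ℝ) (z : WW N) : WW N →L[ℝ] WW N →L[ℝ] ℝ := fderiv ℝ (fderiv ℝ u) z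

lemma pd2 {N : ℕ} {u : WW N → ℝ} (hu : ContDiff ℝ (⊤ : ℕ∞) u) (v v2 z : WW N) : pdT v (pdT v2 u) z = HH u z v v2 := by
  have h1 : DifferentiableAt ℝ (fderiv ℝ u) z := ((hu.fderiv_right (m := 1) (by norm_cast)).differentiable (by simp)) z
  have h2 := h1.hasFDerivAt.clm_apply (hasFDerivAt_const v2 z)
  unfold pdT HH
  rw [h2.fderiv]
  simp

lemma HH_symm {N : ℕ} {u : WW N → ℝ} (hu : ContDiff ℝ (⊤ : ℕ∞) u) (v v2 z : WW N) : HH u z v v2 = HH u z v2 v :=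
  (hu.contDiffAt.isSymmSndFDerivAt (by simp only [minSmoothness_of_isRCLikeNormedField]; exact WithTop.coe_le_coe.2 (le_top : (2 : ℕ∞) ≤ ⊤))).eq v v2

/-- embedding of an x-vector -/
def xe {N : ℕ} (v : Fin N → ℝ) : WW N := (0, (v, 0))

lemma xe_sum {N : ℕ} (v : Fin N → ℝ) : xe v = ∑ i, v i • exT i := by
  have : v = ∑ i, v i • (Pi.single i (1 : ℝ) : Fin N → ℝ) := by
    ext j; simp [Finset.sum_apply, Pi.single_apply]
  refine Prod.ext ?_ (Prod.ext ?_ ?_)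
  · simp [xe, exT, Prod.fst_sum, Prod.snd_sum]
  · simp only [xe, exT, Prod.fst_sum, Prod.snd_sum, Prod.smul_mk]
    exact this
  · simp [xe, exT, Prod.fst_sum, Prod.snd_sum]

lemma trHess_eq {N : ℕ} (Q : Matrix (Fin N) (Fin N) ℝ) (q : Fin N → ℝ) (γ : ℝ) {u : WW N → ℝ} (hu : ContDiff ℝ (⊤ : ℕ∞) u) (z : WW N) : 
    trHessT (blockA Q q γ) u z = (∑ i, ∑ j, Q i j * HH u z (exT i) (exT j)) + (∑ i, q i * HH u z (exT i) (eyT N)) + (∑ j, q j * HH u z (eyT N) (exT j)) + γ * HH u z (eyT N) (eyT N) := by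
  unfold trHessT
  simp only [pd2 hu]
  rw [Fin.sum_univ_castSucc]
  have b1 : ∀ i : Fin N, (bvecT (Fin.castSucc i) : PtT N) = exT i := fun i => by simp [bvecT]
  have b2 : (bvecT (Fin.last N) : PtT N) = eyT N := by simp [bvecT]
  have a1 : ∀ i j : Fin N, blockA Q q γ (Fin.castSucc i) (Fin.castSucc j) = Q i j := fun i j => by simp [blockA]
  have a2 : ∀ i : Fin N, blockA Q q γ (Fin.castSucc i) (Fin.last N) = q i := fun i => by simp [blockA]
  have a3 : ∀ i : Fin N, blockA Q q γ (Fin.last N) (Fin.castSucc i) = q i := fun i => by simp [blockA]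
  have a4 : blockA Q q γ (Fin.last N) (Fin.last N) = γ := by simp [blockA]
  have e : ∀ i, ∑ j, blockA Q q γ i j * HH u z (bvecT i) (bvecT j) = (∑ j : Fin N, blockA Q q γ i (Fin.castSucc j) * HH u z (bvecT i) (exT j)) + blockA Q q γ i (Fin.last N) * HH u z (bvecT i) (eyT N) := fun i => by
    rw [Fin.sum_univ_castSucc]; simp only [b1, b2]
  rw [e (Fin.last N), Finset.sum_congr rfl fun i _ => e (Fin.castSucc i)]
  simp only [b1, b2, a1, a2, a3, a4]
  rw [Finset.sum_add_distrib]
  ring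

lemma bil_sq {N : ℕ} {E : Type*} [NormedAddCommGroup E] [NormedSpace ℝ E] (H : E →L[ℝ] E →L[ℝ] ℝ) (a b : Fin N → ℝ) (e : Fin N → E) : 
    H (∑ i, a i • e i) (∑ j, b j • e j) = ∑ i, ∑ j, a i * b j * H (e i) (e j) := by
  simp only [map_sum, map_smul, _root_.sum_apply, _root_.smul_apply, smul_eq_mul, Finset.mul_sum]
  rw [Finset.sum_comm]
  refine Finset.sum_congr rfl fun i _ => Finset.sum_congr rfl fun j _ => by ring

lemma bil_id {N : ℕ} (Q M : Matrix (Fin N) (Fin N) ℝ) (q : Fin N → ℝ) {γ : ℝ} (hγ : 0 < γ) (hQ : ∀ i j, Q i j = (∑ k, M i k * M j k) + q i * q j / γ) {u : WW N → ℝ} (hu : ContDiff ℝ (⊤ : ℕ∞) u) (z : WW N) : 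
    trHessT (blockA Q q γ) u z = (∑ k, HH u z (xe fun i => M i k) (xe fun i => M i k)) + γ * HH u z (xe (fun i => q i / γ) + eyT N) (xe (fun i => q i / γ) + eyT N) := by
  rw [trHess_eq Q q γ hu]
  have e1 : ∀ k, HH u z (xe fun i => M i k) (xe fun i => M i k) = ∑ i, ∑ j, M i k * M j k * HH u z (exT i) (exT j) := fun k => by
    rw [xe_sum, bil_sq]
  have e2 : HH u z (xe fun i => q i / γ) (xe fun i => q i / γ) = ∑ i, ∑ j, q i / γ * (q j / γ) * HH u z (exT i) (exT j) := by
    rw [xe_sum, bil_sq]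
  have e3 : HH u z (xe fun i => q i / γ) (eyT N) = ∑ i, q i / γ * HH u z (exT i) (eyT N) := by
    rw [xe_sum]; simp [map_sum, _root_.sum_apply]
  have e4 : HH u z (eyT N) (xe fun i => q i / γ) = ∑ i, q i / γ * HH u z (eyT N) (exT i) := by
    rw [xe_sum]; simp [map_sum]
  simp only [e1]
  simp only [map_add, _root_.add_apply]
  rw [e2, e3, e4]
  have f1 : ∑ k, ∑ i, ∑ j, M i k * M j k * HH u z (exT i) (exT j) = ∑ i, ∑ j, (∑ k, M i k * M j k) * HH u z (exT i) (exT j) := by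
    rw [Finset.sum_comm]
    refine Finset.sum_congr rfl fun i _ => ?_
    rw [Finset.sum_comm]
    refine Finset.sum_congr rfl fun j _ => ?_
    rw [Finset.sum_mul]
  have f2 : ∑ i, ∑ j, Q i j * HH u z (exT i) (exT j) = (∑ i, ∑ j, (∑ k, M i k * M j k) * HH u z (exT i) (exT j)) + γ * ∑ i, ∑ j, q i / γ * (q j / γ) * HH u z (exT i) (exT j) := by
    rw [Finset.mul_sum, ← Finset.sum_add_distrib]
    refine Finset.sum_congr rfl fun i _ => ?_
    rw [Finset.mul_sum, ← Finset.sum_add_distrib]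
    refine Finset.sum_congr rfl fun j _ => ?_
    rw [hQ]; field_simp
  have f3 : ∀ X : Fin N → ℝ, ∑ i, q i * X i = γ * ∑ i, q i / γ * X i := fun X => by
    rw [Finset.mul_sum]; refine Finset.sum_congr rfl fun i _ => by field_simp
  rw [f1, f2, f3, f3]
  ring

section
open scoped MatrixOrder Matrix.Norms.L2Operator
lemma posdef_fact {N : ℕ} {P : Matrix (Fin N) (Fin N) ℝ} (hP : P.PosDef) : ∃ B : Matrix (Fin N) (Fin N) ℝ, P = B.conjTranspose * B :=
  CStarAlgebra.nonneg_iff_eq_star_mul_self.mp hP.posSemidef.nonneg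
end

/-- matrix factorisation adapted to a vector -/
lemma fact_adapt {N : ℕ} (i0 : Fin N) (P : Matrix (Fin N) (Fin N) ℝ) (hP : P.PosDef) (g : Fin N → ℝ) : 
    ∃ (M : Matrix (Fin N) (Fin N) ℝ) (ρ : ℝ), M.det ≠ 0 ∧ M * M.transpose = P ∧ ∀ i, ρ * M i i0 = g i := by
  obtain ⟨B0, hB0⟩ := posdef_fact hP
  set B := B0.transpose with hB
  have hBP : B * B.transpose = P := by
    rw [hB0, hB, Matrix.transpose_transpose]; rfl
  have hdet : B.det ≠ 0 := by
    intro h0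
    have := hP.det_pos
    rw [← hBP, Matrix.det_mul, h0] at this
    simp at this
  have hu : IsUnit B.det := isUnit_iff_ne_zero.2 hdet
  set v : Fin N → ℝ := B⁻¹.mulVec g with hv
  have hBv : B.mulVec v = g := by
    rw [hv, Matrix.mulVec_mulVec, Matrix.mul_nonsing_inv _ hu, Matrix.one_mulVec]
  by_cases hv0 : v = 0
  · refine ⟨B, 0, hdet, hBP, fun i => ?_⟩
    rw [← hBv, hv0]; simp
  · set V : EuclideanSpace ℝ (Fin N) := WithLp.toLp 2 v with hV
    have hV0 : V ≠ 0 := by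
      intro h; apply hv0
      ext i
      have := congrArg (fun z : EuclideanSpace ℝ (Fin N) => z i) h
      simpa [hV] using this
    have hn : ‖V‖ ≠ 0 := norm_ne_zero_iff.2 hV0
    have ho : Orthonormal ℝ (({i0} : Set (Fin N)).domRestrict (fun _ : Fin N => (‖V‖⁻¹ • V : EuclideanSpace ℝ (Fin N)))) := by
      constructor
      · intro i; simp [Set.domRestrict, norm_smul, hn]
      · intro i j hij
        exact absurd (Subsingleton.elim i j) hij
    obtain ⟨b, hb⟩ := ho.exists_orthonormalBasis_extension_of_card_eq (by simp)
    have hb0 : b i0 = ‖V‖⁻¹ • V := hb i0 rfl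
    let O : Matrix (Fin N) (Fin N) ℝ := Matrix.of fun i j => b j i
    have hO1 : O.transpose * O = 1 := by
      ext i j
      have := orthonormal_iff_ite.1 b.orthonormal i j
      rw [Matrix.mul_apply, Matrix.one_apply, ← this, PiLp.inner_apply]
      refine Finset.sum_congr rfl fun k _ => ?_
      simp [O, mul_comm]
    have hO2 : O * O.transpose = 1 := mul_eq_one_comm.1 hO1
    have hOd : O.det ≠ 0 := by
      intro h0
      have := congrArg Matrix.det hO2
      rw [Matrix.det_mul, h0] at this
      simp at this
    refine ⟨B * O, ‖V‖, ?_, ?_, fun i => ?_⟩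
    · rw [Matrix.det_mul]; exact mul_ne_zero hdet hOd
    · rw [Matrix.transpose_mul, ← Matrix.mul_assoc, Matrix.mul_assoc B, hO2, Matrix.mul_one, hBP]
    · rw [← hBv, Matrix.mul_apply, Matrix.mulVec, dotProduct, Finset.mul_sum]
      refine Finset.sum_congr rfl fun k _ => ?_
      have : O k i0 = ‖V‖⁻¹ * v k := by
        change b i0 k = _
        rw [hb0]; simp [hV]
      rw [this]; field_simp

lemma schur_pos {N : ℕ} (Q : Matrix (Fin N) (Fin N) ℝ) (q : Fin N → ℝ) {γ : ℝ} (hγ : 0 < γ) (hsym : (blockA Q q γ).IsSymm) (hpos : (blockA Q q γ).PosDef) : 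
    (Matrix.of fun i j => Q i j - q i * q j / γ : Matrix (Fin N) (Fin N) ℝ).PosDef := by
  refine Matrix.PosDef.of_dotProduct_mulVec_pos ?_ ?_
  · ext i j
    have := congrFun (congrFun hsym (Fin.castSucc i)) (Fin.castSucc j)
    simp [blockA] at this
    simp [this]; ring
  · intro x hx
    let z : Fin (N + 1) → ℝ := Fin.snoc x (-(∑ i, q i * x i) / γ)
    have hz : z ≠ 0 := by
      intro h; apply hx; ext i
      have := congrFun h (Fin.castSucc i)
      simpa [z] using this
    have h0 := hpos.dotProduct_mulVec_pos hz
    simp only [Matrix.mulVec, dotProduct, Pi.star_apply, star_trivial, Finset.mul_sum, Matrix.of_apply] at h0 ⊢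
    have z1 : ∀ i : Fin N, z (Fin.castSucc i) = x i := fun i => by simp [z]
    have z2 : z (Fin.last N) = -(∑ i, q i * x i) / γ := by simp [z]
    have a1 : ∀ i j : Fin N, blockA Q q γ (Fin.castSucc i) (Fin.castSucc j) = Q i j := fun i j => by simp [blockA]
    have a2 : ∀ i : Fin N, blockA Q q γ (Fin.castSucc i) (Fin.last N) = q i := fun i => by simp [blockA]
    have a3 : ∀ i : Fin N, blockA Q q γ (Fin.last N) (Fin.castSucc i) = q i := fun i => by simp [blockA]
    have a4 : blockA Q q γ (Fin.last N) (Fin.last N) = γ := by simp [blockA]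
    simp only [Fin.sum_univ_castSucc, z1, z2, a1, a2, a3, a4] at h0
    set s := ∑ i, q i * x i with hs
    have e1 : ∑ i, (∑ j, x i * (Q i j * x j) + x i * (q i * (-s / γ))) = (∑ i, ∑ j, x i * (Q i j * x j)) + s * (-s / γ) := by
      rw [Finset.sum_add_distrib]; congr 1
      rw [hs, Finset.sum_mul]; refine Finset.sum_congr rfl fun i _ => by ring
    have e2 : ∑ i, -s / γ * (q i * x i) = -s / γ * s := by rw [← Finset.mul_sum]
    have e3 : ∑ i, ∑ j, x i * ((Q i j - q i * q j / γ) * x j) = (∑ i, ∑ j, x i * (Q i j * x j)) - s * s / γ := by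
      have : s * s / γ = ∑ i, ∑ j, (q i * x i) * (q j * x j) / γ := by
        rw [hs, Finset.sum_mul_sum, Finset.sum_div]; refine Finset.sum_congr rfl fun i _ => by rw [Finset.sum_div]
      rw [this, ← Finset.sum_sub_distrib]
      refine Finset.sum_congr rfl fun i _ => ?_
      rw [← Finset.sum_sub_distrib]
      refine Finset.sum_congr rfl fun j _ => by ring
    rw [e1, e2] at h0
    rw [e3]
    have : s * (-s / γ) + (-s / γ * s + -s / γ * (γ * (-s / γ))) = - (s * s / γ) := by field_simp; ring
    linarith

/-- the change of coordinates -/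
def Phi {N : ℕ} (M : Matrix (Fin N) (Fin N) ℝ) (Θ : ℝ → Fin N → ℝ) (w : WW N) : WW N :=
  (w.1, (M.mulVec w.2.1 + Θ w.2.2, w.2.2))

/-- the inverse change of coordinates -/
def Psi {N : ℕ} (M : Matrix (Fin N) (Fin N) ℝ) (Θ : ℝ → Fin N → ℝ) (w : WW N) : WW N :=
  (w.1, (M⁻¹.mulVec (w.2.1 - Θ w.2.2), w.2.2))

lemma cont_Phi {N : ℕ} (M : Matrix (Fin N) (Fin N) ℝ) {Θ : ℝ → Fin N → ℝ} (hΘ : Continuous Θ) : Continuous (Phi M Θ) := by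
  unfold Phi
  refine Continuous.prodMk (by fun_prop) (Continuous.prodMk ?_ (by fun_prop))
  exact (Continuous.matrix_mulVec continuous_const (by fun_prop)).add (hΘ.comp (by fun_prop))

lemma cont_Psi {N : ℕ} (M : Matrix (Fin N) (Fin N) ℝ) {Θ : ℝ → Fin N → ℝ} (hΘ : Continuous Θ) : Continuous (Psi M Θ) := by
  unfold Psi
  refine Continuous.prodMk (by fun_prop) (Continuous.prodMk ?_ (by fun_prop))
  exact (Continuous.matrix_mulVec continuous_const (Continuous.sub (by fun_prop) (hΘ.comp (by fun_prop))))

/-- the coordinates as a homeomorphism -/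
def PhiH {N : ℕ} (M : Matrix (Fin N) (Fin N) ℝ) (Θ : ℝ → Fin N → ℝ) (hM : M.det ≠ 0) (hΘ : Continuous Θ) : WW N ≃ₜ WW N where
  toFun := Phi M Θ
  invFun := Psi M Θ
  left_inv := fun w => by
    refine Prod.ext rfl (Prod.ext ?_ rfl)
    simp [Phi, Psi, Matrix.mulVec_mulVec, Matrix.nonsing_inv_mul _ (isUnit_iff_ne_zero.2 hM)]
  right_inv := fun w => by
    refine Prod.ext rfl (Prod.ext ?_ rfl)
    simp [Phi, Psi, Matrix.mulVec_mulVec, Matrix.mul_nonsing_inv _ (isUnit_iff_ne_zero.2 hM)]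
  continuous_toFun := cont_Phi M hΘ
  continuous_invFun := cont_Psi M hΘ

/-- linear part of the derivative -/
def PhiL {N : ℕ} (M : Matrix (Fin N) (Fin N) ℝ) (θ : Fin N → ℝ) : WW N →L[ℝ] WW N :=
  LinearMap.toContinuousLinearMap
  { toFun := fun v => (v.1, (M.mulVec v.2.1 + v.2.2 • θ, v.2.2))
    map_add' := fun v w => by
      refine Prod.ext rfl (Prod.ext ?_ rfl)
      simp only [Prod.snd_add, Prod.fst_add, Matrix.mulVec_add, add_smul]
      abel
    map_smul' := fun r v => by
      refine Prod.ext rfl (Prod.ext ?_ rfl)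
      simp [Matrix.mulVec_smul, mul_smul] }

lemma PhiL_apply {N : ℕ} (M : Matrix (Fin N) (Fin N) ℝ) (θ : Fin N → ℝ) (v : WW N) : PhiL M θ v = (v.1, (M.mulVec v.2.1 + v.2.2 • θ, v.2.2)) := rfl

lemma mulVec_hasFDerivAt {N : ℕ} (M : Matrix (Fin N) (Fin N) ℝ) (x : Fin N → ℝ) : HasFDerivAt (fun x => M.mulVec x) (LinearMap.toContinuousLinearMap (Matrix.mulVecLin M)) x :=
  (LinearMap.toContinuousLinearMap (Matrix.mulVecLin M)).hasFDerivAt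

lemma Phi_hasFDerivAt {N : ℕ} (M : Matrix (Fin N) (Fin N) ℝ) {Θ θ : ℝ → Fin N → ℝ} (hΘ : ∀ y, HasDerivAt Θ (θ y) y) (w : WW N) : 
    HasFDerivAt (Phi M Θ) (PhiL M (θ w.2.2)) w := by
  have h1 : HasFDerivAt (fun w : WW N => w.2.1) ((ContinuousLinearMap.fst ℝ (Fin N → ℝ) ℝ).comp (ContinuousLinearMap.snd ℝ ℝ ((Fin N → ℝ) × ℝ))) w :=
    ((ContinuousLinearMap.fst ℝ (Fin N → ℝ) ℝ).comp (ContinuousLinearMap.snd ℝ ℝ ((Fin N → ℝ) × ℝ))).hasFDerivAt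
  have h2 : HasFDerivAt (fun w : WW N => w.2.2) ((ContinuousLinearMap.snd ℝ (Fin N → ℝ) ℝ).comp (ContinuousLinearMap.snd ℝ ℝ ((Fin N → ℝ) × ℝ))) w :=
    ((ContinuousLinearMap.snd ℝ (Fin N → ℝ) ℝ).comp (ContinuousLinearMap.snd ℝ ℝ ((Fin N → ℝ) × ℝ))).hasFDerivAt
  have h3 : HasFDerivAt (fun w : WW N => w.1) (ContinuousLinearMap.fst ℝ ℝ ((Fin N → ℝ) × ℝ)) w := (ContinuousLinearMap.fst ℝ ℝ ((Fin N → ℝ) × ℝ)).hasFDerivAt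
  have h4 := (mulVec_hasFDerivAt M w.2.1).comp w h1
  have h5 := (hΘ w.2.2).hasFDerivAt.comp w h2
  have h6 := h3.prodMk ((h4.add h5).prodMk h2)
  refine h6.congr_fderiv ?_
  ext v <;> simp [PhiL_apply, Matrix.mulVecLin_apply]

lemma cd_Phi {N : ℕ} (M : Matrix (Fin N) (Fin N) ℝ) {Θ : ℝ → Fin N → ℝ} (hΘ : ContDiff ℝ (⊤ : ℕ∞) Θ) : ContDiff ℝ (⊤ : ℕ∞) (Phi M Θ) := by
  unfold Phi
  refine ContDiff.prodMk (by fun_prop) (ContDiff.prodMk ?_ (by fun_prop))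
  refine ContDiff.add ?_ (hΘ.comp (by fun_prop))
  exact (LinearMap.toContinuousLinearMap (Matrix.mulVecLin M)).contDiff.comp (by fun_prop : ContDiff ℝ (⊤ : ℕ∞) (fun w : WW N => w.2.1))

lemma pd_comp {N : ℕ} (M : Matrix (Fin N) (Fin N) ℝ) {Θ θ : ℝ → Fin N → ℝ} (hΘ : ∀ y, HasDerivAt Θ (θ y) y) {F : WW N → ℝ} (hF : Differentiable ℝ F) (v w : WW N) : 
    pdT v (fun w => F (Phi M Θ w)) w = pdT (PhiL M (θ w.2.2) v) F (Phi M Θ w) := by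
  have := (hF (Phi M Θ w)).hasFDerivAt.comp w (Phi_hasFDerivAt M hΘ w)
  unfold pdT
  change fderiv ℝ (F ∘ Phi M Θ) w v = _
  rw [this.fderiv]; rfl

lemma pd_add {N : ℕ} (v v2 : WW N) (F : WW N → ℝ) (w : WW N) : pdT (v + v2) F w = pdT v F w + pdT v2 F w := by simp [pdT]
lemma pd_smul {N : ℕ} (r : ℝ) (v : WW N) (F : WW N → ℝ) (w : WW N) : pdT (r • v) F w = r * pdT v F w := by simp [pdT]

lemma PhiL_ex {N : ℕ} (M : Matrix (Fin N) (Fin N) ℝ) (θ : Fin N → ℝ) (i : Fin N) : PhiL M θ (exT i) = xe fun k => M k i := by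
  rw [PhiL_apply]; simp [exT, xe]; rfl
lemma PhiL_et {N : ℕ} (M : Matrix (Fin N) (Fin N) ℝ) (θ : Fin N → ℝ) : PhiL M θ (et N) = et N := by
  rw [PhiL_apply]; simp [et]
lemma PhiL_ey {N : ℕ} (M : Matrix (Fin N) (Fin N) ℝ) (θ0 g : Fin N → ℝ) (s : ℝ) : PhiL M (θ0 + s • g) (eyT N) = (xe θ0 + eyT N) + s • xe g := by
  rw [PhiL_apply]; simp [eyT, xe]

/-- first derivatives of the transformed function -/
lemma U_derivs {N : ℕ} (M : Matrix (Fin N) (Fin N) ℝ) {Θ : ℝ → Fin N → ℝ} {σ : ℝ → ℝ} (θ0 g : Fin N → ℝ) (hΘ : ∀ y, HasDerivAt Θ (θ0 + σ y • g) y) 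
    (hσ : Differentiable ℝ σ) {u : WW N → ℝ} (hu : ContDiff ℝ (⊤ : ℕ∞) u) (w : WW N) : 
    (pdT (et N) (fun w => u (Phi M Θ w)) w = pdT (et N) u (Phi M Θ w)) ∧ 
    (∀ i, pdT (exT i) (fun w => u (Phi M Θ w)) w = pdT (xe fun k => M k i) u (Phi M Θ w)) ∧ 
    (∀ i, pdT (exT i) (pdT (exT i) (fun w => u (Phi M Θ w))) w = HH u (Phi M Θ w) (xe fun k => M k i) (xe fun k => M k i)) ∧ 
    (pdT (eyT N) (fun w => u (Phi M Θ w)) w = pdT (xe θ0 + eyT N) u (Phi M Θ w) + σ w.2.2 * pdT (xe g) u (Phi M Θ w)) ∧ 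
    (pdT (eyT N) (pdT (eyT N) (fun w => u (Phi M Θ w))) w = HH u (Phi M Θ w) (xe θ0 + eyT N) (xe θ0 + eyT N) + 2 * σ w.2.2 * HH u (Phi M Θ w) (xe g) (xe θ0 + eyT N) 
       + σ w.2.2 ^ 2 * HH u (Phi M Θ w) (xe g) (xe g) + deriv σ w.2.2 * pdT (xe g) u (Phi M Θ w)) := by
  have hud : Differentiable ℝ u := hu.differentiable (by simp)
  have hpd : ∀ v, Differentiable ℝ (pdT v u) := fun v => (cd_fd hu v).differentiable (by simp)
  have ex : ∀ i w, pdT (exT i) (fun w => u (Phi M Θ w)) w = pdT (xe fun k => M k i) u (Phi M Θ w) := fun i w => by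
    rw [pd_comp M hΘ hud, PhiL_ex]
  have ey : ∀ w, pdT (eyT N) (fun w => u (Phi M Θ w)) w = pdT (xe θ0 + eyT N) u (Phi M Θ w) + σ w.2.2 * pdT (xe g) u (Phi M Θ w) := fun w => by
    rw [pd_comp M hΘ hud, PhiL_ey, pd_add, pd_smul]
  refine ⟨by rw [pd_comp M hΘ hud, PhiL_et], fun i => ex i w, fun i => ?_, ey w, ?_⟩
  · rw [funext (ex i), pd_comp M hΘ (hpd _), PhiL_ex, pd2 hu]
  · rw [funext ey]
    have d1 : DifferentiableAt ℝ (fun w => pdT (xe θ0 + eyT N) u (Phi M Θ w)) w := (hpd _ _).comp w (Phi_hasFDerivAt M hΘ w).differentiableAt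
    have d2 : DifferentiableAt ℝ (fun w => pdT (xe g) u (Phi M Θ w)) w := (hpd _ _).comp w (Phi_hasFDerivAt M hΘ w).differentiableAt
    have h2 : HasFDerivAt (fun w : WW N => w.2.2) ((ContinuousLinearMap.snd ℝ (Fin N → ℝ) ℝ).comp (ContinuousLinearMap.snd ℝ ℝ ((Fin N → ℝ) × ℝ))) w :=
      ((ContinuousLinearMap.snd ℝ (Fin N → ℝ) ℝ).comp (ContinuousLinearMap.snd ℝ ℝ ((Fin N → ℝ) × ℝ))).hasFDerivAt
    have d3 := (hσ w.2.2).hasDerivAt.hasFDerivAt.comp w h2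
    have d4 := d1.hasFDerivAt.add (d3.mul d2.hasFDerivAt)
    have e1 := pd_comp M hΘ (hpd (xe θ0 + eyT N)) (eyT N) w
    have e2 := pd_comp M hΘ (hpd (xe g)) (eyT N) w
    rw [PhiL_ey, pd2 hu] at e1 e2
    have e3 : pdT (eyT N) (fun w => pdT (xe θ0 + eyT N) u (Phi M Θ w) + σ w.2.2 * pdT (xe g) u (Phi M Θ w)) w = 
      pdT (eyT N) (fun w => pdT (xe θ0 + eyT N) u (Phi M Θ w)) w + (σ w.2.2 * pdT (eyT N) (fun w => pdT (xe g) u (Phi M Θ w)) w + pdT (xe g) u (Phi M Θ w) * deriv σ w.2.2) := by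
      have := d4.fderiv
      rw [pdT]
      refine (congrArg (fun L => L (eyT N)) this).trans ?_
      simp [pdT, eyT]
    rw [e3, e1, e2]
    generalize xe θ0 + eyT N = V at *
    have s := HH_symm hu V (xe g) (Phi M Θ w)
    simp only [map_add, map_smul, _root_.add_apply, _root_.smul_apply, smul_eq_mul, s]
    ring

/-- the original operator -/
def LopA {N : ℕ} (α : ℝ) (A : Matrix (Fin (N + 1)) (Fin (N + 1)) ℝ) (d : Fin N → ℝ) (c : ℝ) (u : WW N → ℝ) (w : WW N) : ℝ :=
  w.2.2 ^ α * trHessT A u w + w.2.2 ^ (α - 1) * ((∑ i, d i * pdT (exT i) u w) + c * pdT (eyT N) u w)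

lemma bdry_eq {N : ℕ} (d : Fin N → ℝ) {c : ℝ} (hc : c ≠ 0) (u : WW N → ℝ) (w : WW N) : 
    (∑ i, d i * pdT (exT i) u w) + c * pdT (eyT N) u w = c * pdT (xe (fun i => d i / c) + eyT N) u w := by
  rw [pd_add, xe_sum, mul_add]
  congr 1
  simp only [pdT, map_sum, map_smul, smul_eq_mul, Finset.mul_sum]
  refine Finset.sum_congr rfl fun i _ => by field_simp

lemma op_id {N : ℕ} (i0 : Fin N) (α : ℝ) (Q M : Matrix (Fin N) (Fin N) ℝ) (q : Fin N → ℝ) {γ : ℝ} (hγ : 0 < γ) (hQ : ∀ i j, Q i j = (∑ k, M i k * M j k) + q i * q j / γ) 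
    (d : Fin N → ℝ) {c : ℝ} (hc : c ≠ 0) (ρ : ℝ) (g : Fin N → ℝ) (hg : ∀ i, g i = q i / γ - d i / c) (hρ : ∀ i, ρ * M i i0 = g i) {Θ : ℝ → Fin N → ℝ} {σ : ℝ → ℝ} 
    (hΘ : ∀ y, HasDerivAt Θ ((fun i => d i / c) + σ y • g) y) (hσ : Differentiable ℝ σ) {u : WW N → ℝ} (hu : ContDiff ℝ (⊤ : ℕ∞) u) (w : WW N) (hw : 0 < w.2.2) 
    (hH : σ w.2.2 = 1 ∨ pdT (xe (fun i => d i / c) + eyT N) u =ᶠ[𝓝 (Phi M Θ w)] fun _ => 0) : 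
    LL i0 α (c / γ) γ ρ σ (fun w => u (Phi M Θ w)) w = LopA α (blockA Q q γ) d c u (Phi M Θ w) := by
  obtain ⟨-, ux, uxx, uy, uyy⟩ := U_derivs M (fun i => d i / c) g hΘ hσ hu w
  unfold LL LopA
  rw [bdry_eq d hc, bil_id Q M q hγ hQ hu]
  simp only [ux, uxx, uy, uyy]
  have hz : (Phi M Θ w).2.2 = w.2.2 := rfl
  rw [hz]
  set z := Phi M Θ w with hzdef
  set V := xe (fun i => d i / c) + eyT N with hV
  have hW : xe (fun i => q i / γ) + eyT N = V + xe g := by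
    rw [hV]
    refine Prod.ext ?_ (Prod.ext ?_ ?_)
    · simp [xe, eyT]
    · ext i; simp [xe, eyT, hg]
    · simp [xe, eyT]
  have hxg : xe g = ρ • xe (fun k => M k i0) := by
    refine Prod.ext ?_ (Prod.ext ?_ ?_)
    · simp [xe]
    · ext i; simp [xe, hρ]
    · simp [xe]
  have hcross : (1 - σ w.2.2) * HH u z (xe g) V = 0 := by
    rcases hH with h | h
    · rw [h]; ring
    · rw [← pd2 hu]
      unfold pdT at h ⊢
      rw [h.fderiv_eq]; simp
  have hsum : ∑ i, (lamD i0 γ ρ σ i w.2.2 * HH u z (xe fun k => M k i) (xe fun k => M k i) - if i = i0 then γ * ρ * bcoef (c / γ) σ w.2.2 * pdT (xe fun k => M k i) u z else 0) = 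
      (∑ i, HH u z (xe fun k => M k i) (xe fun k => M k i)) + γ * (1 - σ w.2.2 ^ 2) * HH u z (xe g) (xe g) - γ * bcoef (c / γ) σ w.2.2 * pdT (xe g) u z := by
    rw [hxg, pd_smul]
    simp only [map_smul, _root_.smul_apply, smul_eq_mul]
    rw [Finset.sum_sub_distrib, Finset.sum_ite_eq' Finset.univ i0]
    unfold lamD
    simp only [add_mul, one_mul, ite_mul, zero_mul]
    rw [Finset.sum_add_distrib, Finset.sum_ite_eq' Finset.univ i0]
    simp only [Finset.mem_univ, if_true]
    ring
  rw [hsum, hW]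
  have hs := HH_symm hu V (xe g) z
  have hya : w.2.2 ^ (α - 1) = w.2.2 ^ α / w.2.2 := by rw [Real.rpow_sub hw, Real.rpow_one]
  simp only [map_add, _root_.add_apply, hs, hya]
  unfold bcoef
  have : c / γ * γ = c := by field_simp
  have hcr : HH u z (xe g) V = σ w.2.2 * HH u z (xe g) V := by linarith
  generalize HH u z (xe g) V = X at *
  generalize σ w.2.2 = s at *
  have e : w.2.2 ^ α / w.2.2 * (c * pdT V u z) = w.2.2 ^ α * (γ * (c / γ / w.2.2 * pdT V u z)) := by field_simp
  rw [e]
  linear_combination (-(2 * γ * w.2.2 ^ α)) * hcross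

/-- change of variables -/
lemma cov_x {N : ℕ} {M : Matrix (Fin N) (Fin N) ℝ} (hM : M.det ≠ 0) (b : Fin N → ℝ) {F : (Fin N → ℝ) → ENNReal} (hF : Measurable F) : 
    ∫⁻ x, F (M.mulVec x + b) = ENNReal.ofReal |M.det⁻¹| * ∫⁻ x, F x := by
  have h := Real.map_matrix_volume_pi_eq_smul_volume_pi hM
  have hm : Measurable (Matrix.toLin' M) := (LinearMap.continuous_of_finiteDimensional _).measurable
  have h1 : ∫⁻ x, F (x + b) ∂(Measure.map (Matrix.toLin' M) volume) = ∫⁻ x, F (M.mulVec x + b) := by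
    rw [lintegral_map (by fun_prop) hm]; rfl
  rw [← h1, h, lintegral_smul_measure, lintegral_add_right_eq_self (μ := volume) F b, smul_eq_mul]

lemma cov {N : ℕ} {M : Matrix (Fin N) (Fin N) ℝ} (hM : M.det ≠ 0) {Θ : ℝ → Fin N → ℝ} (hΘ : Continuous Θ) {F : WW N → ENNReal} (hF : Measurable F) : 
    ∫⁻ w, F (Phi M Θ w) = ENNReal.ofReal |M.det⁻¹| * ∫⁻ w, F w := by
  have hP : Measurable (Phi M Θ) := (cont_Phi M hΘ).measurable
  have hFP : Measurable fun w => F (Phi M Θ w) := hF.comp hP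
  have gen : ∀ G : WW N → ENNReal, Measurable G → ∫⁻ w, G w = ∫⁻ t, ∫⁻ y, ∫⁻ x, G (t, (x, y)) := by
    intro G hG
    rw [show (volume : Measure (WW N)) = (volume : Measure ℝ).prod (volume : Measure ((Fin N → ℝ) × ℝ)) from rfl, lintegral_prod _ hG.aemeasurable]
    refine lintegral_congr fun t => ?_
    rw [show (volume : Measure ((Fin N → ℝ) × ℝ)) = (volume : Measure (Fin N → ℝ)).prod (volume : Measure ℝ) from rfl, lintegral_prod_symm _ (by fun_prop)]
  rw [gen _ hFP, gen _ hF, ← lintegral_const_mul' _ _ ENNReal.ofReal_ne_top]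
  refine lintegral_congr fun t => ?_
  rw [← lintegral_const_mul' _ _ ENNReal.ofReal_ne_top]
  refine lintegral_congr fun y => ?_
  exact cov_x hM (Θ y) (F := fun x => F (t, (x, y))) (by fun_prop)

lemma cov_half {N : ℕ} {M : Matrix (Fin N) (Fin N) ℝ} (hM : M.det ≠ 0) {Θ : ℝ → Fin N → ℝ} (hΘ : Continuous Θ) {F : WW N → ENNReal} (hF : Measurable F) : 
    ∫⁻ w in {w : WW N | 0 < w.2.2}, F (Phi M Θ w) = ENNReal.ofReal |M.det⁻¹| * ∫⁻ w in {w : WW N | 0 < w.2.2}, F w := by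
  have hpm : MeasurableSet {w : WW N | 0 < w.2.2} := measurableSet_lt (by fun_prop) (by fun_prop)
  rw [← lintegral_indicator hpm, ← lintegral_indicator hpm, ← cov hM hΘ (hF.indicator hpm)]
  rfl

/-- primitive of the cut-off -/
lemma prim_exists {N : ℕ} (θ0 g : Fin N → ℝ) {σ : ℝ → ℝ} (hσ : ContDiff ℝ (⊤ : ℕ∞) σ) : 
    ∃ Θ : ℝ → Fin N → ℝ, ContDiff ℝ (⊤ : ℕ∞) Θ ∧ ∀ y, HasDerivAt Θ (θ0 + σ y • g) y := by
  have hS : ∀ y, HasDerivAt (fun y => ∫ s in (0:ℝ)..y, σ s) (σ y) y := fun y =>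
    intervalIntegral.integral_hasDerivAt_right (hσ.continuous.intervalIntegrable _ _) (hσ.continuous.stronglyMeasurableAtFilter _ _) hσ.continuous.continuousAt
  have hΘ : ∀ y, HasDerivAt (fun y : ℝ => y • θ0 + (∫ s in (0:ℝ)..y, σ s) • g) (θ0 + σ y • g) y := fun y => by
    have := ((hasDerivAt_id y).smul_const θ0).add ((hS y).smul_const g)
    exact this.congr_deriv (by simp)
  refine ⟨_, ?_, hΘ⟩
  rw [contDiff_infty_iff_deriv]
  refine ⟨fun y => (hΘ y).differentiableAt, ?_⟩
  have : deriv (fun y : ℝ => y • θ0 + (∫ s in (0:ℝ)..y, σ s) • g) = fun y => θ0 + σ y • g := funext fun y => (hΘ y).deriv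
  rw [this]
  fun_prop

lemma cutoff_exists {δ Y : ℝ} (hδ : 0 < δ) (hY : δ < Y) : ∃ σ : ℝ → ℝ, ContDiff ℝ (⊤ : ℕ∞) σ ∧ HasCompactSupport σ ∧ (∀ y, |σ y| ≤ 1) ∧ (∀ y ≤ 2 * (δ / 4), σ y = 0) ∧ ∀ y, δ ≤ y → y ≤ Y → σ y = 1 := by
  let f : ContDiffBump ((δ + Y) / 2) := ⟨(Y - δ) / 2, (Y - δ) / 2 + δ / 2, by linarith, by linarith⟩
  refine ⟨f, f.contDiff, f.hasCompactSupport, fun y => ?_, fun y hy => ?_, fun y h1 h2 => ?_⟩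
  · rw [abs_of_nonneg f.nonneg]; exact f.le_one
  · apply f.zero_of_le_dist
    rw [Real.dist_eq]
    have := neg_abs_le (y - (δ + Y) / 2)
    change (Y - δ) / 2 + δ / 2 ≤ _
    linarith
  · apply f.one_of_mem_closedBall
    rw [Metric.mem_closedBall, Real.dist_eq, abs_le]
    change -((Y - δ) / 2) ≤ _ ∧ _ ≤ (Y - δ) / 2
    constructor <;> linarith

/-- weighted integral -/
def IW {N : ℕ} (p m : ℝ) (f : WW N → ℝ) : ENNReal := ∫⁻ w in {w : WW N | 0 < w.2.2}, ENNReal.ofReal (w.2.2 ^ m * |f w| ^ p)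

lemma norm_eq {N : ℕ} {p : ℝ} (m : ℝ) (hp : 1 < p) {f : WW N → ℝ} (hf : Measurable f) (h0 : ∀ w : WW N, w.1 ≤ 0 → f w = 0) : 
    LpmNormT N p m f = (IW p m f).toReal ^ (1 / p) := by
  unfold LpmNormT IW
  have hm1 : MeasurableSet {w : WW N | 0 < w.1} := measurableSet_lt (by fun_prop) (by fun_prop)
  have hm2 : MeasurableSet {w : WW N | 0 < w.2.2} := measurableSet_lt (by fun_prop) (by fun_prop)
  have hset : {w : PtT N | 0 < w.1 ∧ 0 < w.2.2} = {w : WW N | 0 < w.1} ∩ {w : WW N | 0 < w.2.2} := rfl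
  have hmeas : Measurable fun w : WW N => |f w| ^ p * w.2.2 ^ m := by fun_prop
  rw [hset, integral_eq_lintegral_of_nonneg_ae ?_ hmeas.aestronglyMeasurable, ← setLIntegral_indicator hm1]
  · congr 2
    refine lintegral_congr fun w => ?_
    by_cases hw : w ∈ {w : WW N | 0 < w.1}
    · rw [Set.indicator_of_mem hw, mul_comm]
    · rw [Set.indicator_of_notMem hw, h0 w (not_lt.1 hw)]
      simp [Real.zero_rpow (by linarith : p ≠ 0)]
  · filter_upwards [ae_restrict_mem (hm1.inter hm2)] with w hw
    have : 0 < w.2.2 := hw.2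
    simp only [Pi.zero_apply]
    positivity

lemma IW_sub {N : ℕ} {p : ℝ} (m : ℝ) (hp : 1 < p) {f g : WW N → ℝ} (hf : Measurable f) : 
    IW p m g ≤ ENNReal.ofReal (2 ^ p) * (IW p m f + IW p m (fun w => f w - g w)) := by
  unfold IW
  have hm2 : MeasurableSet {w : WW N | 0 < w.2.2} := measurableSet_lt (by fun_prop) (by fun_prop)
  rw [← lintegral_add_left (by fun_prop), ← lintegral_const_mul' _ _ ENNReal.ofReal_ne_top]
  refine setLIntegral_mono' hm2 fun w hw => ?_
  have hw0 : 0 < w.2.2 := hw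
  rw [← ENNReal.ofReal_add (by positivity) (by positivity), ← ENNReal.ofReal_mul (by positivity)]
  refine ENNReal.ofReal_le_ofReal ?_
  have h1 : |g w| ≤ |f w| + |f w - g w| := by
    have := abs_sub (f w) (f w - g w)
    simpa using this
  have h2 : |g w| ^ p ≤ 2 ^ p * (|f w| ^ p + |f w - g w| ^ p) := by
    have hp0 : 0 ≤ p := by linarith
    have a1 : 0 ≤ |f w| ^ p := by positivity
    have a2 : 0 ≤ |f w - g w| ^ p := by positivity
    rcases le_total (|f w|) (|f w - g w|) with h | h
    · calc |g w| ^ p ≤ (2 * |f w - g w|) ^ p := Real.rpow_le_rpow (abs_nonneg _) (by linarith) hp0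
        _ = 2 ^ p * |f w - g w| ^ p := by rw [Real.mul_rpow (by norm_num) (abs_nonneg _)]
        _ ≤ _ := by gcongr; linarith
    · calc |g w| ^ p ≤ (2 * |f w|) ^ p := Real.rpow_le_rpow (abs_nonneg _) (by linarith) hp0
        _ = 2 ^ p * |f w| ^ p := by rw [Real.mul_rpow (by norm_num) (abs_nonneg _)]
        _ ≤ _ := by gcongr; linarith
  calc w.2.2 ^ m * |g w| ^ p ≤ w.2.2 ^ m * (2 ^ p * (|f w| ^ p + |f w - g w| ^ p)) := by gcongr
    _ = _ := by ring

lemma pd_off {N : ℕ} {u : WW N → ℝ} {z : WW N} (hz : z ∉ tsupport u) (v : WW N) : pdT v u =ᶠ[𝓝 z] fun _ => 0 := by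
  have : (tsupport u)ᶜ ∈ 𝓝 z := (isClosed_tsupport u).isOpen_compl.mem_nhds hz
  filter_upwards [this] with x hx
  have h : u =ᶠ[𝓝 x] fun _ => 0 := notMem_tsupport_iff_eventuallyEq.1 hx
  unfold pdT
  rw [h.fderiv_eq]; simp

lemma LopA_off {N : ℕ} (α : ℝ) (A : Matrix (Fin (N + 1)) (Fin (N + 1)) ℝ) (d : Fin N → ℝ) (c : ℝ) {u : WW N → ℝ} {z : WW N} (hz : z ∉ tsupport u) : LopA α A d c u z = 0 := by
  have h1 : ∀ v, pdT v u z = 0 := fun v => (pd_off hz v).self_of_nhds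
  have h2 : ∀ v v2, pdT v (pdT v2 u) z = 0 := fun v v2 => by
    rw [pdT, (pd_off hz v2).fderiv_eq]; simp
  simp [LopA, trHessT, h1, h2]

lemma LopA_meas {N : ℕ} (α : ℝ) (A : Matrix (Fin (N + 1)) (Fin (N + 1)) ℝ) (d : Fin N → ℝ) (c : ℝ) {u : WW N → ℝ} (hu : ContDiff ℝ (⊤ : ℕ∞) u) : Measurable (LopA α A d c u) := by
  have c1 : ∀ v, Measurable (pdT v u) := fun v => (cd_fd hu v).continuous.measurable
  have c2 : ∀ v v2, Measurable (pdT v (pdT v2 u)) := fun v v2 => (cd_fd (cd_fd hu v2) v).continuous.measurable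
  unfold LopA trHessT
  refine Measurable.add (Measurable.mul (by fun_prop) ?_) (Measurable.mul (by fun_prop) (Measurable.add ?_ ((c1 _).const_mul _)))
  · exact Finset.measurable_sum _ fun i _ => Finset.measurable_sum _ fun j _ => (c2 _ _).const_mul _
  · exact Finset.measurable_sum _ fun i _ => (c1 _).const_mul _

theorem mainI {N : ℕ} (i0 : Fin N) (p m α : ℝ) (hp : 1 < p) 
    (Q : Matrix (Fin N) (Fin N) ℝ) (q : Fin N → ℝ) (γ : ℝ) (hγ : 0 < γ) (hsym : (blockA Q q γ).IsSymm) (hpd : (blockA Q q γ).PosDef) 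
    (d : Fin N → ℝ) (c : ℝ) (hc : c ≠ 0) (h1 : max (-α) 0 < (m + 1) / p) (h2 : (m + 1) / p < c / γ + 1 - α) : 
    ∃ C : ℝ, 0 < C ∧ ∀ u : WW N → ℝ, ContDiff ℝ (⊤ : ℕ∞) u → HasCompactSupport u → 
      (∃ δ > 0, ∀ w : WW N, 0 ≤ w.2.2 → w.2.2 ≤ δ → (∑ i, d i * pdT (exT i) u w) + c * pdT (eyT N) u w = 0) → 
      IW p m (pdT (et N) u) ≤ ENNReal.ofReal C * IW p m (fun w => pdT (et N) u w - LopA α (blockA Q q γ) d c u w) ∧ 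
      IW p m (fun w => pdT (et N) u w - LopA α (blockA Q q γ) d c u w) ≠ ⊤ := by
  obtain ⟨M, ρ, hM, hMM, hρ⟩ := fact_adapt i0 _ (schur_pos Q q hγ hsym hpd) (fun i => q i / γ - d i / c)
  have hQ : ∀ i j, Q i j = (∑ k, M i k * M j k) + q i * q j / γ := by
    intro i j
    have := congrFun (congrFun hMM i) j
    rw [Matrix.mul_apply] at this
    simp only [Matrix.transpose_apply, Matrix.of_apply] at this
    rw [this]; ring
  have hs : 0 < (m + 1) / p := (le_max_right _ _).trans_lt h1
  have hsα : -α < (m + 1) / p := (le_max_left _ _).trans_lt h1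
  obtain ⟨C, hC, key⟩ := thmC p m α (c / γ) γ ρ hp hγ hs hsα (by linarith) N i0
  refine ⟨C, hC, fun u hu huc ⟨δ, hδ, hbc⟩ => ?_⟩
  have hp0 : 0 < p := by linarith
  have hm1 : -1 < m := by
    have := mul_pos hs hp0; rw [div_mul_cancel₀ _ hp0.ne'] at this; linarith
  have hm2 : -1 < m + α * p := by
    rw [lt_div_iff₀ hp0] at hsα; linarith
  obtain ⟨T, hT0, hT⟩ : ∃ T : ℝ, 0 ≤ T ∧ ∀ w ∈ tsupport u, ‖w‖ ≤ T := by
    obtain ⟨T1, hT1⟩ := huc.isCompact.isBounded.exists_norm_le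
    exact ⟨max 0 T1, le_max_left _ _, fun w hw => (hT1 w hw).trans (le_max_right _ _)⟩
  obtain ⟨σ, hσ, hσc, hσ1, hσ0, hσY⟩ := cutoff_exists hδ (show δ < δ + T + 1 by linarith)
  obtain ⟨Θ, hΘ, hΘd⟩ := prim_exists (fun i => d i / c) (fun i => q i / γ - d i / c) hσ
  set V := xe (fun i => d i / c) + eyT N with hV
  have hVz : ∀ z : WW N, 0 ≤ z.2.2 → z.2.2 ≤ δ → pdT V u z = 0 := by
    intro z h0 hz
    have := hbc z h0 hz
    rw [bdry_eq d hc] at this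
    exact (mul_eq_zero.1 this).resolve_left hc
  let U : WW N → ℝ := fun w => u (Phi M Θ w)
  have hU : ContDiff ℝ (⊤ : ℕ∞) U := hu.comp (cd_Phi M hΘ)
  have hUc : HasCompactSupport U := huc.comp_homeomorph (PhiH M Θ hM hΘ.continuous)
  have hσd : Differentiable ℝ σ := hσ.differentiable (by simp)
  have hUd := fun w => U_derivs M (fun i => d i / c) (fun i => q i / γ - d i / c) hΘd hσd hu w
  have hUy : ∀ t x y, 0 ≤ y → y ≤ 2 * (δ / 4) → U (t, (x, y)) = U (t, (x, 0)) := by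
    intro t x y h0 hy
    have hd : ∀ s : ℝ, HasDerivAt (fun s : ℝ => U (t, (x, s))) (pdT (eyT N) U (t, (x, s))) s := by
      intro s
      have := line_deriv hU ((t, (x, 0)) : WW N) (eyT N) s
      have e : ∀ s : ℝ, ((t, (x, 0)) : WW N) + s • eyT N = (t, (x, s)) := fun s => by
        refine Prod.ext ?_ (Prod.ext ?_ ?_) <;> simp [eyT]
      simp only [e] at this
      exact this
    refine constant_of_has_deriv_right_zero (f := fun s : ℝ => U (t, (x, s))) (a := 0) (b := 2 * (δ / 4)) (fun s _ => (hd s).continuousAt.continuousWithinAt) (fun s hs => ?_) y ⟨h0, hy⟩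
    have h3 : pdT (eyT N) U (t, (x, s)) = 0 := by
      rw [(hUd (t, (x, s))).2.2.2.1, hσ0 s hs.2.le, ← hV, hVz _ hs.1 (by have := hs.2; change s ≤ δ; linarith)]
      ring
    have := (hd s).hasDerivWithinAt (s := Set.Ici s)
    rwa [h3] at this
  have hop : ∀ w : WW N, 0 < w.2.2 → LL i0 α (c / γ) γ ρ σ U w = LopA α (blockA Q q γ) d c u (Phi M Θ w) := by
    intro w hw
    refine op_id i0 α Q M q hγ hQ d hc ρ _ (fun i => rfl) hρ hΘd hσd hu w hw ?_
    have hy2 : (Phi M Θ w).2.2 = w.2.2 := rfl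
    rcases lt_or_ge w.2.2 δ with ha | ha
    · right
      have o1 : IsOpen {z : WW N | 0 < z.2.2} := isOpen_lt continuous_const (by fun_prop)
      have o2 : IsOpen {z : WW N | z.2.2 < δ} := isOpen_lt (by fun_prop) continuous_const
      filter_upwards [o1.mem_nhds (show Phi M Θ w ∈ {z : WW N | 0 < z.2.2} from hw), o2.mem_nhds (show Phi M Θ w ∈ {z : WW N | z.2.2 < δ} from ha)] with z hz1 hz2
      exact hVz z (le_of_lt hz1) (le_of_lt hz2)
    · rcases le_or_gt w.2.2 (δ + T + 1) with hb | hb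
      · left; exact hσY _ ha hb
      · right
        refine pd_off (fun hmem => ?_) _
        have a1 := hT _ hmem
        have a2 : |(Phi M Θ w).2.2| ≤ ‖Phi M Θ w‖ := (norm_snd_le _).trans (norm_snd_le (Phi M Θ w))
        rw [hy2] at a2
        have := le_abs_self w.2.2
        linarith
  have hLm := LopA_meas α (blockA Q q γ) d c hu
  have htm : Measurable (pdT (et N) u) := (cd_fd hu (et N)).continuous.measurable
  have hpm : MeasurableSet {w : WW N | 0 < w.2.2} := measurableSet_lt (by fun_prop) (by fun_prop)
  constructor
  · have k := key (δ / 4) (by linarith) σ hσ hσc hσ1 hσ0 U hU hUc hUy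
    have e1 : ∫⁻ w in {w : WW N | 0 < w.2.2}, ENNReal.ofReal (w.2.2 ^ m * |pdT (et N) U w| ^ p) = ENNReal.ofReal |M.det⁻¹| * IW p m (pdT (et N) u) := by
      unfold IW
      rw [← cov_half hM hΘ.continuous (by fun_prop)]
      refine lintegral_congr fun w => ?_
      rw [(hUd w).1]; rfl
    have e2 : ∫⁻ w in {w : WW N | 0 < w.2.2}, ENNReal.ofReal (w.2.2 ^ m * |pdT (et N) U w - LL i0 α (c / γ) γ ρ σ U w| ^ p) = 
        ENNReal.ofReal |M.det⁻¹| * IW p m (fun w => pdT (et N) u w - LopA α (blockA Q q γ) d c u w) := by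
      unfold IW
      rw [← cov_half hM hΘ.continuous (by fun_prop)]
      refine setLIntegral_congr_fun hpm fun w hw => ?_
      simp only
      rw [(hUd w).1, hop w hw]; rfl
    rw [e1, e2, mul_left_comm] at k
    refine (ENNReal.mul_le_mul_iff_right ?_ ENNReal.ofReal_ne_top).1 k
    rw [Ne, ENNReal.ofReal_eq_zero, not_le]
    positivity
  · obtain ⟨K, hK, HK⟩ := LL_bd i0 α (c / γ) ρ hγ (by linarith : 0 < δ / 4) hσ hσc hσ1 hσ0 hU hUc hUy
    obtain ⟨C1, hC1, H1⟩ := bd_zero (cd_fd hu (et N)) (hcs_fd huc (et N))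
    have hLb : ∀ z : WW N, 0 < z.2.2 → |LopA α (blockA Q q γ) d c u z| ≤ K * z.2.2 ^ α := by
      intro z hz
      have e : Phi M Θ (Psi M Θ z) = z := (PhiH M Θ hM hΘ.continuous).right_inv z
      have := HK (Psi M Θ z) hz
      rw [hop (Psi M Θ z) hz, e] at this
      exact this
    refine ((setLIntegral_mono' hpm fun w hw => ?_).trans_lt (fin_box (N := N) (K := (C1 + K) ^ p * 2 ^ p) hT0 hm1 hm2).lt_top).ne
    by_cases hb : w ∈ Metric.closedBall (0 : WW N) T
    · rw [Set.indicator_of_mem hb]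
      refine ENNReal.ofReal_le_ofReal (pt_bd hp (by positivity) hw ?_)
      have a1 := H1 w
      have a2 := hLb w hw
      have a3 := abs_sub (pdT (et N) u w) (LopA α (blockA Q q γ) d c u w)
      have hw0 : 0 < w.2.2 := hw
      have : 0 ≤ C1 * w.2.2 ^ α := by positivity
      change |pdT (et N) u w| ≤ C1 at a1
      nlinarith
    · have hz : w ∉ tsupport u := fun h => hb (by simpa using hT w h)
      simp only
      rw [LopA_off α _ d c hz, (pd_off hz (et N)).self_of_nhds]
      simp [Real.zero_rpow hp0.ne']

lemma toReal_est {a b : ENNReal} {C p : ℝ} (hp : 1 < p) (hC : 0 < C) (h : a ≤ ENNReal.ofReal C * b) (hb : b ≠ ⊤) : a.toReal ^ (1 / p) ≤ C ^ (1 / p) * b.toReal ^ (1 / p) := by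
  have h1 := ENNReal.toReal_mono (ENNReal.mul_ne_top ENNReal.ofReal_ne_top hb) h
  rw [ENNReal.toReal_mul, ENNReal.toReal_ofReal hC.le] at h1
  rw [← Real.mul_rpow hC.le ENNReal.toReal_nonneg]
  exact Real.rpow_le_rpow ENNReal.toReal_nonneg h1 (by positivity)

theorem statement1 (N : ℕ) (hN : 1 ≤ N) (p m α : ℝ) (hp : 1 < p) (hα : α < 2)
    (Q : Matrix (Fin N) (Fin N) ℝ) (q : Fin N → ℝ) (γ : ℝ) (hγ : 0 < γ)
    (hsym : (blockA Q q γ).IsSymm) (hposdef : (blockA Q q γ).PosDef)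
    (d : Fin N → ℝ) (c : ℝ) (hc : c ≠ 0)
    (h1 : max (-α) 0 < (m + 1) / p) (h2 : (m + 1) / p < c / γ + 1 - α) :
    ∃ C > 0, ∀ u : PtT N → ℝ, ContDiff ℝ (⊤ : ℕ∞) u → HasCompactSupport u →
      tsupport u ⊆ {w : PtT N | 0 < w.1} →
      (∃ δ > 0, ∀ w : PtT N, 0 ≤ w.2.2 → w.2.2 ≤ δ →
        (∑ i, d i * pdT (exT i) u w) + c * pdT (eyT N) u w = 0) →
      (LpmNormT N p m fun w => pdT (et N) u w)
        + (LpmNormT N p m fun w =>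
            w.2.2 ^ α * trHessT (blockA Q q γ) u w
              + w.2.2 ^ (α - 1) * ((∑ i, d i * pdT (exT i) u w) + c * pdT (eyT N) u w))
      ≤ C * LpmNormT N p m fun w =>
          pdT (et N) u w
            - (w.2.2 ^ α * trHessT (blockA Q q γ) u w
              + w.2.2 ^ (α - 1) * ((∑ i, d i * pdT (exT i) u w) + c * pdT (eyT N) u w)) := by
  obtain ⟨C, hC, key⟩ := mainI (⟨0, hN⟩ : Fin N) p m α hp Q q γ hγ hsym hposdef d c hc h1 h2
  refine ⟨C ^ (1 / p) + (2 ^ p * (C + 1)) ^ (1 / p), by positivity, fun u hu huc hut hbc => ?_⟩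
  obtain ⟨k1, k2⟩ := key u hu huc hbc
  have hLm := LopA_meas α (blockA Q q γ) d c hu
  have htm : Measurable (pdT (et N) u) := (cd_fd hu (et N)).continuous.measurable
  have hoff : ∀ w : WW N, w.1 ≤ 0 → w ∉ tsupport u := fun w hw h => absurd (hut h) (not_lt.2 hw)
  have ht0 : ∀ w : WW N, w.1 ≤ 0 → pdT (et N) u w = 0 := fun w hw => (pd_off (hoff w hw) (et N)).self_of_nhds
  have hL0 : ∀ w : WW N, w.1 ≤ 0 → LopA α (blockA Q q γ) d c u w = 0 := fun w hw => LopA_off α _ d c (hoff w hw)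
  have n1 := norm_eq m hp htm ht0
  have n2 := norm_eq m hp hLm hL0
  have n3 := norm_eq m hp (htm.sub hLm) (fun w hw => by simp [ht0 w hw, hL0 w hw])
  have k3 : IW p m (LopA α (blockA Q q γ) d c u) ≤ ENNReal.ofReal (2 ^ p * (C + 1)) * IW p m (fun w => pdT (et N) u w - LopA α (blockA Q q γ) d c u w) := by
    refine (IW_sub m hp htm).trans ?_
    rw [ENNReal.ofReal_mul (by positivity), mul_assoc]
    gcongr
    rw [ENNReal.ofReal_add hC.le (by norm_num), ENNReal.ofReal_one, add_mul, one_mul]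
    gcongr
  have r1 := toReal_est hp hC k1 k2
  have r2 := toReal_est hp (by positivity) k3 k2
  change LpmNormT N p m (pdT (et N) u) + LpmNormT N p m (LopA α (blockA Q q γ) d c u) ≤ _ * LpmNormT N p m (pdT (et N) u - LopA α (blockA Q q γ) d c u)
  rw [n1, n2, n3, add_mul]
  exact add_le_add r1 r2
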